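/- Let k > n ≥ 2 be integers and suppose s ≥ 4k(k−1)+1. (i) Consider a system of two degree-k equations Σ_{j=1}^s c_{ij} x_j^k = 0 (i = 1,2) and one degree-n equation Σ_{j=1}^s b_j x_j^n = 0 with nonzero integer coefficients such that every 2×2 minor of the matrix (c_{ij}) is nonzero. (ii) Alternatively, consider a system of two degree-k equations Σ_{j=1}^s c_{ij} x_j^k = 0 (i = 1,2) and two degree-n equations Σ_{j=1}^s b_{ij} x_j^n = 0 (i = 1,2) with nonzero integer coefficients such that every 2×2 minor of (c_{ij}) and every 2×2 minor of (b_{ij}) is nonzero. In either case, if the system possesses a non-singular real solution with all coordinates positive and, for every prime p, a non-singular solution in ℚ_p^s, then there is C > 0 such that the number N(P) of integer solutions x with 1 ≤ x_j ≤ P satisfies N(P) = (C + o(1)) P^{s−K} as P → ∞, where K = 2k+n in case (i) and K = 2k+2n in case (ii). -/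

import Mathlib

open Finset

namespace DiagonalSystems

open Polynomial in
/-- A tuple of `p`-adic polynomials congruent to the moment curve modulo `p`. -/
def IsMomentCurve (p : ℕ) [Fact p.Prime] (k : ℕ) (φ : Fin k → ℤ_[p][X]) : Prop :=
  ∀ j : Fin k, ∃ ψ : ℤ_[p][X], φ j = X ^ ((j : ℕ) + 1) + C (p : ℤ_[p]) * ψ

open Polynomial in
lemma taylor_matrix_injective {F : Type*} [Field F] (l n : ℕ) (ζ : F) (hζ : n = 0 ∨ ζ ≠ 0)
    (hF : ∀ m : ℕ, 1 ≤ m → m ≤ n + l → (m : F) ≠ 0) (c : Fin l → F)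
    (hc : ∀ i : Fin l, ∑ r : Fin l, c r *
      (taylor ζ (X ^ (n + (r : ℕ) + 1) : F[X])).coeff ((i : ℕ) + 1) = 0) : c = 0 := by
  set g : F[X] := ∑ r : Fin l, C (c r) * X ^ (n + (r : ℕ) + 1) with hg
  set h0 : F[X] := ∑ r : Fin l, C (c r * ((n + (r : ℕ) + 1 : ℕ) : F)) * X ^ (r : ℕ) with hh0
  have hder : derivative g = X ^ n * h0 := by
    simp only [hg, hh0, derivative_sum, mul_sum]
    refine sum_congr rfl fun r _ => ?_
    rw [derivative_C_mul_X_pow]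
    simp only [Nat.add_sub_cancel, pow_add]
    ring
  have hg1 : ∀ i : Fin l, (hasseDeriv ((i : ℕ) + 1) g).eval ζ = 0 := by
    intro i
    rw [← hc i, hg, map_sum, eval_finsetSum]
    refine sum_congr rfl fun r _ => ?_
    rw [taylor_coeff, ← smul_eq_C_mul, map_smul, eval_smul, smul_eq_mul]
  have hdvd : (X - C ζ) ^ l ∣ derivative g := by
    rw [X_sub_C_pow_dvd_iff, ← taylor_apply, X_pow_dvd_iff]
    intro d hd
    rw [taylor_coeff, ← hasseDeriv_one', ← LinearMap.comp_apply, hasseDeriv_comp]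
    simp [hg1 ⟨d, hd⟩]
  have hcop : IsCoprime ((X - C ζ) ^ l) (X ^ n : F[X]) := by
    rcases hζ with rfl | hζ
    · simp [isCoprime_one_right]
    · refine IsCoprime.pow ?_
      have := isCoprime_X_sub_C_of_isUnit_sub (R := F) (a := ζ) (b := 0) (by simpa using hζ)
      simpa using this
  have hd0 : (X - C ζ) ^ l ∣ h0 := by
    rw [hder] at hdvd
    exact hcop.dvd_of_dvd_mul_left hdvd
  have h00 : h0 = 0 := by
    by_contra hne
    have h1 := natDegree_le_of_dvd hd0 hne
    rw [natDegree_pow, natDegree_X_sub_C, mul_one] at h1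
    rcases Nat.eq_zero_or_pos l with rfl | hl
    · exact hne (by simp [hh0])
    have h2 : h0.natDegree ≤ l - 1 := by
      refine natDegree_sum_le_of_forall_le _ _ fun r _ => ?_
      exact (natDegree_C_mul_X_pow_le _ _).trans (by have := r.2; omega)
    omega
  funext r
  have h3 : h0.coeff r = c r * ((n + (r : ℕ) + 1 : ℕ) : F) := by
    rw [hh0, finsetSum_coeff, sum_eq_single r]
    · rw [coeff_C_mul_X_pow, if_pos rfl]
    · intro b _ hb
      rw [coeff_C_mul_X_pow, if_neg]
      intro h; exact hb (Fin.ext h.symm)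
    · simp
  rw [h00, coeff_zero] at h3
  rcases mul_eq_zero.1 h3.symm with h | h
  · simpa using h
  · exact absurd h (hF _ (by omega) (by have := r.2; omega))

section
variable {p : ℕ} [Fact p.Prime]

lemma isUnit_matrix_of_toZMod {l : ℕ} (Q : Matrix (Fin l) (Fin l) ℤ_[p])
    (h : ∀ c : Fin l → ZMod p, (∀ i, ∑ r, c r * PadicInt.toZMod (Q r i) = 0) → c = 0) :
    IsUnit Q := by
  rw [Matrix.isUnit_iff_isUnit_det]
  by_contra hd
  have h1 : Q.det ∈ IsLocalRing.maximalIdeal ℤ_[p] := by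
    rwa [IsLocalRing.mem_maximalIdeal, mem_nonunits_iff]
  rw [← PadicInt.ker_toZMod, RingHom.mem_ker, RingHom.map_det] at h1
  obtain ⟨v, hv, hv0⟩ := Matrix.exists_vecMul_eq_zero_iff.2 h1
  refine hv (h v fun i => ?_)
  have := congrFun hv0 i
  simpa [Matrix.vecMul, dotProduct] using this

open Polynomial

lemma normal_form {l : ℕ} (χ : Fin l → ℤ_[p][X]) (ξ : ℤ_[p])
    (hQ : IsUnit (Matrix.of fun r i : Fin l => (taylor ξ (χ r)).coeff ((i : ℕ) + 1))) :
    ∃ (B : Fin l → Fin l → ℤ_[p]) (ρ : Fin l → ℤ_[p][X]), ∀ i,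
      ∑ r, C (B i r) * (taylor ξ (χ r) - C ((χ r).eval ξ)) =
        X ^ ((i : ℕ) + 1) + X ^ (l + 1) * ρ i := by
  obtain ⟨u, hu⟩ := hQ
  set B : Matrix (Fin l) (Fin l) ℤ_[p] := ((u⁻¹ : (Matrix (Fin l) (Fin l) ℤ_[p])ˣ) :
    Matrix (Fin l) (Fin l) ℤ_[p])
  have hB : B * (Matrix.of fun r i : Fin l => (taylor ξ (χ r)).coeff ((i : ℕ) + 1)) = 1 := by
    rw [← hu]; exact u.inv_mul
  have key : ∀ i : Fin l, X ^ (l + 1) ∣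
      ∑ r, C (B i r) * (taylor ξ (χ r) - C ((χ r).eval ξ)) - X ^ ((i : ℕ) + 1) := by
    intro i
    rw [X_pow_dvd_iff]
    intro d hd
    rw [coeff_sub, finsetSum_coeff]
    simp only [coeff_C_mul, coeff_sub, coeff_X_pow]
    rcases d with _ | d
    · simp
    · have := congrFun (congrFun hB i) ⟨d, by omega⟩
      simp only [Matrix.mul_apply, Matrix.of_apply, Matrix.one_apply] at this
      simp only [coeff_C_succ, sub_zero, this, Fin.ext_iff, Nat.add_right_cancel_iff]
      split_ifs <;> first | omega | simp
  choose ρ hρ using key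
  exact ⟨fun i r => B i r, ρ, fun i => by rw [← hρ i]; ring⟩

lemma eval_taylor_sub {l : ℕ} {χ : Fin l → ℤ_[p][X]} {ξ : ℤ_[p]}
    {B : Fin l → Fin l → ℤ_[p]} {ρ : Fin l → ℤ_[p][X]}
    (h : ∀ i, ∑ r, C (B i r) * (taylor ξ (χ r) - C ((χ r).eval ξ)) =
        X ^ ((i : ℕ) + 1) + X ^ (l + 1) * ρ i) (i : Fin l) (y : ℤ_[p]) :
    ∑ r, B i r * ((χ r).eval (ξ + y) - (χ r).eval ξ) =
      y ^ ((i : ℕ) + 1) + y ^ (l + 1) * (ρ i).eval y := by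
  have := congrArg (eval y) (h i)
  simpa [eval_finsetSum, taylor_eval, add_comm y ξ] using this

lemma natCast_zmod_ne_zero {m : ℕ} (h1 : 1 ≤ m) (h2 : m < p) : (m : ZMod p) ≠ 0 := by
  rw [Ne, ZMod.natCast_eq_zero_iff]
  exact fun h => absurd (Nat.le_of_dvd h1 h) (by omega)

lemma toZMod_coeff_taylor (χ : ℤ_[p][X]) (ξ : ℤ_[p]) (i : ℕ) :
    PadicInt.toZMod ((taylor ξ χ).coeff i) =
      (taylor (PadicInt.toZMod ξ) (χ.map PadicInt.toZMod)).coeff i := by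
  rw [← coeff_map, taylor_apply, taylor_apply, Polynomial.map_comp]
  simp

/-- Rescaling of a curve on a residue class. -/
lemma IsMomentCurve.rescale {k : ℕ} (hp : k < p) {φ : Fin k → ℤ_[p][X]}
    (hφ : IsMomentCurve p k φ) (ξ : ℤ_[p]) {a : ℕ} (ha : 1 ≤ a) :
    ∃ (L : Fin k → Fin k → ℤ_[p]) (φ' : Fin k → ℤ_[p][X]), IsMomentCurve p k φ' ∧
      ∀ i z, ∑ j, L i j * ((φ j).eval (ξ + (p : ℤ_[p]) ^ a * z) - (φ j).eval ξ) =
        (p : ℤ_[p]) ^ (a * ((i : ℕ) + 1)) * (φ' i).eval z := by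
  have hQ : IsUnit (Matrix.of fun r i : Fin k => (taylor ξ (φ r)).coeff ((i : ℕ) + 1)) := by
    refine isUnit_matrix_of_toZMod _ fun c hc => ?_
    refine taylor_matrix_injective k 0 (PadicInt.toZMod ξ) (Or.inl rfl)
      (fun m h1 h2 => natCast_zmod_ne_zero h1 (by omega)) c fun i => ?_
    rw [← hc i]
    refine sum_congr rfl fun r _ => ?_
    obtain ⟨ψ, hψ⟩ := hφ r
    rw [Matrix.of_apply, toZMod_coeff_taylor, hψ]
    simp
  obtain ⟨B, ρ, hB⟩ := normal_form φ ξ hQ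
  refine ⟨B, fun i => X ^ ((i : ℕ) + 1) + C ((p : ℤ_[p]) ^ (a * (k - i))) *
    (X ^ (k + 1) * (ρ i).comp (C ((p : ℤ_[p]) ^ a) * X)), fun i => ?_, fun i z => ?_⟩
  · have hi : 1 ≤ a * (k - i) := Nat.mul_pos ha (by have := i.2; omega)
    obtain ⟨e, he⟩ := Nat.exists_eq_add_of_le hi
    refine ⟨C ((p : ℤ_[p]) ^ e) * (X ^ (k + 1) * (ρ i).comp (C ((p : ℤ_[p]) ^ a) * X)), ?_⟩
    beta_reduce
    simp only [he, C_pow, C_mul, pow_add, pow_one]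
    ring
  · rw [eval_taylor_sub hB]
    have hk : a * (k + 1) = a * ((i : ℕ) + 1) + a * (k - i) := by
      rw [← mul_add]; congr 1; have := i.2; omega
    simp only [eval_add, eval_mul, eval_pow, eval_X, eval_C, eval_comp, mul_pow, ← pow_mul]
    rw [hk, pow_add]
    ring

lemma IsMomentCurve.normal {k : ℕ} (hp : k < p) {φ : Fin k → ℤ_[p][X]}
    (hφ : IsMomentCurve p k φ) (η : ℤ_[p]) :
    ∃ (A : Fin k → Fin k → ℤ_[p]) (ρ : Fin k → ℤ_[p][X]), ∀ i y,
      ∑ j, A i j * ((φ j).eval (η + y) - (φ j).eval η) =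
        y ^ ((i : ℕ) + 1) + p * (y ^ (k + 1) * (ρ i).eval y) := by
  have hQ : IsUnit (Matrix.of fun r i : Fin k => (taylor η (φ r)).coeff ((i : ℕ) + 1)) := by
    refine isUnit_matrix_of_toZMod _ fun c hc => ?_
    refine taylor_matrix_injective k 0 (PadicInt.toZMod η) (Or.inl rfl)
      (fun m h1 h2 => natCast_zmod_ne_zero h1 (by omega)) c fun i => ?_
    rw [← hc i]
    refine sum_congr rfl fun r _ => ?_
    obtain ⟨ψ, hψ⟩ := hφ r
    rw [Matrix.of_apply, toZMod_coeff_taylor, hψ]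
    simp
  obtain ⟨B, ρ, hB⟩ := normal_form φ η hQ
  have hρ : ∀ i, C (p : ℤ_[p]) ∣ ρ i := by
    intro i
    rw [C_dvd_iff_dvd_coeff]
    intro m
    have h1 := congrArg (fun f => coeff f (m + (k + 1))) (hB i)
    simp only [coeff_add, coeff_X_pow_mul, finsetSum_coeff, coeff_C_mul, coeff_sub, coeff_X_pow,
      coeff_C] at h1
    rw [if_neg (by have := i.2; omega), zero_add] at h1
    rw [← h1]
    refine dvd_sum fun r _ => Dvd.dvd.mul_left ?_ _
    rw [if_neg (by omega), sub_zero]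
    obtain ⟨ψ, hψ⟩ := hφ r
    rw [hψ, map_add, coeff_add, coeff_eq_zero_of_natDegree_lt, zero_add]
    · rw [taylor_mul, taylor_C, coeff_C_mul]
      exact dvd_mul_right _ _
    · rw [natDegree_taylor, natDegree_X_pow]
      have := r.2; omega
  choose σ hσ using hρ
  refine ⟨B, σ, fun i y => ?_⟩
  rw [eval_taylor_sub hB, hσ i]
  simp only [eval_mul, eval_C]
  ring

/-- Near `η` suitable combinations of the coordinates of a curve vanish to order `k - l + 1`, and
away from `η` these combinations again form a curve of degree `l`. -/
lemma IsMomentCurve.lower {k l n : ℕ} (hkl : n + l = k) (hp : k < p) {φ : Fin k → ℤ_[p][X]}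
    (hφ : IsMomentCurve p k φ) (ξ η : ℤ_[p]) (hξη : ¬ (p : ℤ_[p]) ∣ ξ - η) {a : ℕ} (ha : 1 ≤ a) :
    ∃ (L : Fin l → Fin k → ℤ_[p]) (φ' : Fin l → ℤ_[p][X]), IsMomentCurve p l φ' ∧
      (∀ i b y, (p : ℤ_[p]) ^ ((n + 1) * b) ∣
        ∑ j, L i j * ((φ j).eval (η + (p : ℤ_[p]) ^ b * y) - (φ j).eval η)) ∧
      ∀ i z, ∑ j, L i j * ((φ j).eval (ξ + (p : ℤ_[p]) ^ a * z) - (φ j).eval ξ) =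
        (p : ℤ_[p]) ^ (a * ((i : ℕ) + 1)) * (φ' i).eval z := by
  obtain ⟨A, ρ, hA⟩ := hφ.normal hp η
  set e : Fin l → Fin k := fun r => ⟨n + r, by have := r.2; omega⟩ with he
  set χ : Fin l → ℤ_[p][X] := fun r =>
    X ^ (n + (r : ℕ) + 1) + C (p : ℤ_[p]) * (X ^ (k + 1) * ρ (e r)) with hχ
  have hχe : ∀ r y, (χ r).eval y = ∑ j, A (e r) j * ((φ j).eval (η + y) - (φ j).eval η) := by
    intro r y
    rw [hA]
    simp [hχ, he]
  have hζ : PadicInt.toZMod (ξ - η) ≠ 0 := by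
    intro h
    rw [← RingHom.mem_ker, PadicInt.ker_toZMod, PadicInt.maximalIdeal_eq_span_p,
      Ideal.mem_span_singleton] at h
    exact hξη h
  have hQ : IsUnit (Matrix.of fun r i : Fin l =>
      (taylor (ξ - η) (χ r)).coeff ((i : ℕ) + 1)) := by
    refine isUnit_matrix_of_toZMod _ fun c hc => ?_
    refine taylor_matrix_injective l n (PadicInt.toZMod (ξ - η)) (Or.inr hζ)
      (fun m h1 h2 => natCast_zmod_ne_zero h1 (by omega)) c fun i => ?_
    rw [← hc i]
    refine sum_congr rfl fun r _ => ?_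
    rw [Matrix.of_apply, toZMod_coeff_taylor, hχ]
    simp
  obtain ⟨B, σ, hB⟩ := normal_form χ (ξ - η) hQ
  refine ⟨fun i j => ∑ r, B i r * A (e r) j,
    fun i => X ^ ((i : ℕ) + 1) + C ((p : ℤ_[p]) ^ (a * (l - i))) *
    (X ^ (l + 1) * (σ i).comp (C ((p : ℤ_[p]) ^ a) * X)), fun i => ?_, fun i b y => ?_,
    fun i z => ?_⟩
  · have hi : 1 ≤ a * (l - i) := Nat.mul_pos ha (by have := i.2; omega)
    obtain ⟨f, hf⟩ := Nat.exists_eq_add_of_le hi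
    refine ⟨C ((p : ℤ_[p]) ^ f) * (X ^ (l + 1) * (σ i).comp (C ((p : ℤ_[p]) ^ a) * X)), ?_⟩
    beta_reduce
    simp only [hf, C_pow, C_mul, pow_add, pow_one]
    ring
  · simp_rw [sum_mul]
    rw [sum_comm]
    refine dvd_sum fun r _ => ?_
    simp_rw [mul_assoc]
    rw [← mul_sum, hA]
    refine Dvd.dvd.mul_left (dvd_add ?_ (Dvd.dvd.mul_left (Dvd.dvd.mul_right ?_ _) _)) _
    · rw [mul_pow, ← pow_mul]
      refine Dvd.dvd.mul_right (pow_dvd_pow _ ?_) _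
      rw [mul_comm b]
      exact Nat.mul_le_mul_right _ (by simp [he])
    · rw [mul_pow, ← pow_mul]
      refine Dvd.dvd.mul_right (pow_dvd_pow _ ?_) _
      rw [mul_comm b]
      exact Nat.mul_le_mul_right _ (by omega)
  · have h1 : ∀ z, ∑ j, (∑ r, B i r * A (e r) j) *
        ((φ j).eval (ξ + z) - (φ j).eval ξ) =
        ∑ r, B i r * ((χ r).eval (ξ - η + z) - (χ r).eval (ξ - η)) := by
      intro z
      simp_rw [hχe, ← sum_sub_distrib, mul_sum, sum_mul]
      rw [sum_comm]
      refine sum_congr rfl fun r _ => sum_congr rfl fun j _ => ?_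
      rw [show η + (ξ - η + z) = ξ + z by ring, show η + (ξ - η) = ξ by ring]
      ring
    rw [h1, eval_taylor_sub hB]
    have hk : a * (l + 1) = a * ((i : ℕ) + 1) + a * (l - i) := by
      rw [← mul_add]; congr 1; have := i.2; omega
    simp only [eval_add, eval_mul, eval_pow, eval_X, eval_C, eval_comp, mul_pow, ← pow_mul]
    rw [hk, pow_add]
    ring

end

end DiagonalSystems

namespace DiagonalSystems

noncomputable section
open Polynomial Classical

variable {p : ℕ} [Fact p.Prime]

/-- `χ` is trivial precisely on the ideal generated by `p ^ m`. -/
def HasConductor (χ : AddChar ℤ_[p] Circle) (m : ℕ) : Prop :=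
  ∀ y, (∀ u, χ (u * y) = 1) ↔ (p : ℤ_[p]) ^ m ∣ y

/-- The weighted `q`-th moment of `∑ i ∈ S, g i`. -/
def energy {Ω ι : Type} [Fintype Ω] (W : Ω → ℝ) (g : ι → Ω → ℂ) (q : ℕ) (S : Finset ι) : ℝ :=
  ∑ w, W w * ‖∑ i ∈ S, g i w‖ ^ q

/-- The partition of `S` into residue classes modulo `p ^ N`. -/
def parts {ι : Type} (x : ι → ℤ_[p]) (N : ℕ) (S : Finset ι) : Finset (Finset ι) :=
  S.image fun i => S.filter fun j => (p : ℤ_[p]) ^ N ∣ x j - x i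

/-- The square function norm of `∑ i ∈ S, g i` with respect to residue classes modulo `p ^ N`. -/
def sqEnergy {Ω ι : Type} [Fintype Ω] (W : Ω → ℝ) (g : ι → Ω → ℂ) (x : ι → ℤ_[p]) (q N : ℕ)
    (S : Finset ι) : ℝ :=
  ∑ B ∈ parts x N S, energy W g q B ^ (2 / q : ℝ)

/-- A family of functions `g i` with frequencies on the curve `φ` at the points `x i`. -/
structure IsSystem (χ : AddChar ℤ_[p] Circle) {k : ℕ} (φ : Fin k → ℤ_[p][X]) {Ω ι : Type}
    [Fintype Ω] (W : Ω → ℝ) (g : ι → Ω → ℂ) (x : ι → ℤ_[p]) (S : Finset ι) : Prop where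
  nonneg : ∀ w, 0 ≤ W w
  symm : ∀ u : Fin k → ℤ_[p], ∃ (T : Equiv.Perm Ω) (θ : Circle), (∀ w, W (T w) = W w) ∧
    ∀ i ∈ S, ∀ w, g i (T w) = θ * χ (∑ j, u j * (φ j).eval (x i)) * g i w

/-- The decoupling inequality in degree `k` down to scale `p ^ N` with constant `E`. -/
def Decoupling (p : ℕ) [Fact p.Prime] (k N : ℕ) (E : ℝ) : Prop :=
  ∀ (χ : AddChar ℤ_[p] Circle) (φ : Fin k → ℤ_[p][X]) (Ω ι : Type) [Fintype Ω] (W : Ω → ℝ)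
    (g : ι → Ω → ℂ) (x : ι → ℤ_[p]) (S : Finset ι), HasConductor χ (k * N) →
    IsMomentCurve p k φ → IsSystem χ φ W g x S →
    energy W g (k * (k + 1)) S ≤
      E * sqEnergy W g x (k * (k + 1)) N S ^ ((k * (k + 1) : ℕ) / 2 : ℝ)

/-- The bilinear variant of the decoupling inequality. -/
def BilDecoupling (p : ℕ) [Fact p.Prime] (k N l a b : ℕ) (E : ℝ) : Prop :=
  ∀ (χ : AddChar ℤ_[p] Circle) (φ : Fin k → ℤ_[p][X]) (Ω ι : Type) [Fintype Ω] (W : Ω → ℝ)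
    (g : ι → Ω → ℂ) (x : ι → ℤ_[p]) (S S₁ S₂ : Finset ι), HasConductor χ (k * N) →
    IsMomentCurve p k φ → IsSystem χ φ W g x S → S₁ ⊆ S → S₂ ⊆ S →
    (∀ i ∈ S₁, ∀ j ∈ S₁, (p : ℤ_[p]) ^ a ∣ x i - x j) →
    (∀ i ∈ S₂, ∀ j ∈ S₂, (p : ℤ_[p]) ^ b ∣ x i - x j) →
    (∀ i ∈ S₁, ∀ j ∈ S₂, ¬ (p : ℤ_[p]) ∣ x i - x j) →
    ∑ w, W w * (‖∑ i ∈ S₁, g i w‖ ^ (l * (l + 1)) *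
      ‖∑ i ∈ S₂, g i w‖ ^ (k * (k + 1) - l * (l + 1))) ≤
      E * (sqEnergy W g x (k * (k + 1)) N S₁ ^ ((l * (l + 1) : ℕ) / 2 : ℝ) *
        sqEnergy W g x (k * (k + 1)) N S₂ ^ ((k * (k + 1) - l * (l + 1) : ℕ) / 2 : ℝ))

lemma IsSystem.mono {χ : AddChar ℤ_[p] Circle} {k : ℕ} {φ : Fin k → ℤ_[p][X]} {Ω ι : Type}
    [Fintype Ω] {W : Ω → ℝ} {g : ι → Ω → ℂ} {x : ι → ℤ_[p]} {S T : Finset ι}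
    (h : IsSystem χ φ W g x S) (hT : T ⊆ S) : IsSystem χ φ W g x T where
  nonneg := h.nonneg
  symm u := by
    obtain ⟨τ, θ, h1, h2⟩ := h.symm u
    exact ⟨τ, θ, h1, fun i hi => h2 i (hT hi)⟩

lemma HasConductor.mulShift {χ : AddChar ℤ_[p] Circle} {m n : ℕ} (h : HasConductor χ (n + m)) :
    HasConductor (χ.mulShift ((p : ℤ_[p]) ^ n)) m := by
  intro y
  have hp : (p : ℤ_[p]) ^ n ≠ 0 := pow_ne_zero _ (by exact_mod_cast (Fact.out : p.Prime).ne_zero)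
  have := h ((p : ℤ_[p]) ^ n * y)
  rw [pow_add, mul_dvd_mul_iff_left hp] at this
  rw [← this]
  simp only [AddChar.mulShift_apply]
  refine forall_congr' fun u => ?_
  rw [mul_left_comm]

lemma HasConductor.eq_one {χ : AddChar ℤ_[p] Circle} {m : ℕ} (h : HasConductor χ m) {y : ℤ_[p]}
    (hy : (p : ℤ_[p]) ^ m ∣ y) : χ y = 1 := by
  simpa using (h y).2 hy 1

lemma coe_char_mul_congr {χ : AddChar ℤ_[p] Circle} {θ : Circle} {a b c : ℤ_[p]} {z : ℂ}
    (h : a = b + c) : (θ : ℂ) * χ a * z = (θ * χ b : Circle) * χ c * z := by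
  rw [h, AddChar.map_add_eq_mul, Circle.coe_mul, Circle.coe_mul]
  ring

section
variable {Ω ι : Type} [Fintype Ω] {W : Ω → ℝ} {g : ι → Ω → ℂ} {x : ι → ℤ_[p]}

lemma energy_nonneg (hW : ∀ w, 0 ≤ W w) (q : ℕ) (S : Finset ι) : 0 ≤ energy W g q S :=
  sum_nonneg fun w _ => mul_nonneg (hW w) (by positivity)

lemma sqEnergy_nonneg (hW : ∀ w, 0 ≤ W w) (q N : ℕ) (S : Finset ι) :
    0 ≤ sqEnergy W g x q N S :=
  sum_nonneg fun B _ => Real.rpow_nonneg (energy_nonneg hW q B) _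

lemma mem_parts {N : ℕ} {S B : Finset ι} : B ∈ parts x N S ↔
    ∃ i ∈ S, S.filter (fun j => (p : ℤ_[p]) ^ N ∣ x j - x i) = B := by
  simp [parts]

lemma subset_of_mem_parts {N : ℕ} {S B : Finset ι} (h : B ∈ parts x N S) : B ⊆ S := by
  obtain ⟨i, _, rfl⟩ := mem_parts.1 h
  exact filter_subset _ _

lemma dvd_of_mem_parts {N : ℕ} {S B : Finset ι} (h : B ∈ parts x N S) {i j : ι} (hi : i ∈ B)
    (hj : j ∈ B) : (p : ℤ_[p]) ^ N ∣ x i - x j := by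
  obtain ⟨c, _, rfl⟩ := mem_parts.1 h
  rw [mem_filter] at hi hj
  simpa using dvd_sub hi.2 hj.2

lemma nonempty_of_mem_parts {N : ℕ} {S B : Finset ι} (h : B ∈ parts x N S) : B.Nonempty := by
  obtain ⟨i, hi, rfl⟩ := mem_parts.1 h
  exact ⟨i, by simp [hi]⟩

lemma filter_congr_parts {N : ℕ} {i j : ι} (h : (p : ℤ_[p]) ^ N ∣ x i - x j) (S : Finset ι) :
    S.filter (fun c => (p : ℤ_[p]) ^ N ∣ x c - x i) =
      S.filter (fun c => (p : ℤ_[p]) ^ N ∣ x c - x j) := by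
  refine filter_congr fun c _ => ⟨fun h1 => ?_, fun h1 => ?_⟩
  · simpa using dvd_add h1 h
  · simpa using dvd_sub h1 h

/-- A residue class is determined by any of its members. -/
lemma eq_filter_of_mem_parts {N : ℕ} {S B : Finset ι} (h : B ∈ parts x N S) {i : ι} (hi : i ∈ B) :
    B = S.filter (fun j => (p : ℤ_[p]) ^ N ∣ x j - x i) := by
  obtain ⟨c, _, rfl⟩ := mem_parts.1 h
  exact (filter_congr_parts (mem_filter.1 hi).2 S).symm

lemma pairwiseDisjoint_parts (N : ℕ) (S : Finset ι) :
    ((parts x N S : Finset (Finset ι)) : Set (Finset ι)).PairwiseDisjoint id := by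
  intro B hB C hC hne
  rw [Function.onFun, disjoint_left]
  intro i hi hj
  exact hne ((eq_filter_of_mem_parts hB hi).trans (eq_filter_of_mem_parts hC hj).symm)

lemma biUnion_parts (N : ℕ) (S : Finset ι) : (parts x N S).biUnion id = S := by
  ext i
  rw [mem_biUnion]
  refine ⟨fun ⟨B, hB, hi⟩ => subset_of_mem_parts hB hi, fun hi => ?_⟩
  exact ⟨_, mem_parts.2 ⟨i, hi, rfl⟩, by simp [hi]⟩

lemma sum_parts {M : Type} [AddCommMonoid M] (N : ℕ) (S : Finset ι) (f : ι → M) :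
    ∑ B ∈ parts x N S, ∑ i ∈ B, f i = ∑ i ∈ S, f i := by
  conv_rhs => rw [← biUnion_parts (x := x) N S]
  rw [sum_biUnion (pairwiseDisjoint_parts N S)]
  rfl

lemma parts_eq_biUnion {a N : ℕ} (haN : a ≤ N) (S : Finset ι) :
    parts x N S = (parts x a S).biUnion (parts x N) := by
  ext C
  simp only [mem_biUnion]
  constructor
  · intro hC
    obtain ⟨i, hi, rfl⟩ := mem_parts.1 hC
    refine ⟨_, mem_parts.2 ⟨i, hi, rfl⟩, mem_parts.2 ⟨i, by simp [hi], ?_⟩⟩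
    rw [filter_filter]
    exact filter_congr fun c _ => ⟨fun h => h.2, fun h => ⟨(pow_dvd_pow _ haN).trans h, h⟩⟩
  · rintro ⟨B, hB, hC⟩
    obtain ⟨i, hi, rfl⟩ := mem_parts.1 hC
    refine mem_parts.2 ⟨i, subset_of_mem_parts hB hi, ?_⟩
    rw [eq_filter_of_mem_parts hB hi, filter_filter]
    exact filter_congr fun c _ => ⟨fun h => ⟨(pow_dvd_pow _ haN).trans h, h⟩, fun h => h.2⟩

lemma sum_parts_parts {a N : ℕ} (haN : a ≤ N) (S : Finset ι) (f : Finset ι → ℝ) :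
    ∑ B ∈ parts x a S, ∑ C ∈ parts x N B, f C = ∑ C ∈ parts x N S, f C := by
  rw [parts_eq_biUnion haN, sum_biUnion]
  intro B hB C hC hne
  rw [Function.onFun, disjoint_left]
  intro D hD hD'
  obtain ⟨i, hi⟩ := nonempty_of_mem_parts hD
  exact disjoint_left.1 (pairwiseDisjoint_parts a S hB hC hne) (subset_of_mem_parts hD hi)
    (subset_of_mem_parts hD' hi)

lemma sum_sqEnergy {a N : ℕ} (haN : a ≤ N) (q : ℕ) (S : Finset ι) :
    ∑ B ∈ parts x a S, sqEnergy W g x q N B = sqEnergy W g x q N S :=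
  sum_parts_parts haN S _

lemma card_parts_le (N : ℕ) (S : Finset ι) : #(parts x N S) ≤ p ^ N := by
  have hp : NeZero (p ^ N) := ⟨pow_ne_zero _ (Fact.out : p.Prime).ne_zero⟩
  have h1 : parts x N S = (S.image fun i => PadicInt.toZModPow N (x i)).image
      fun c => S.filter fun j => PadicInt.toZModPow N (x j) = c := by
    rw [image_image]
    refine image_congr fun i _ => filter_congr fun j _ => ?_
    rw [← sub_eq_zero (a := PadicInt.toZModPow N (x j)), ← map_sub, ← RingHom.mem_ker,
      PadicInt.ker_toZModPow, Ideal.mem_span_singleton]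
  rw [h1]
  refine card_image_le.trans ((card_le_univ _).trans ?_)
  rw [ZMod.card]

lemma sqEnergy_mono (hW : ∀ w, 0 ≤ W w) {a N : ℕ} (haN : a ≤ N) (q : ℕ) {S B : Finset ι}
    (hB : B ∈ parts x a S) : sqEnergy W g x q N B ≤ sqEnergy W g x q N S := by
  rw [← sum_sqEnergy haN q S]
  exact single_le_sum (f := fun B => sqEnergy W g x q N B)
    (fun C _ => sqEnergy_nonneg hW q N C) hB

lemma parts_congr {x' : ι → ℤ_[p]} {N N' : ℕ} {S : Finset ι}
    (h : ∀ i ∈ S, ∀ j ∈ S, ((p : ℤ_[p]) ^ N ∣ x i - x j ↔ (p : ℤ_[p]) ^ N' ∣ x' i - x' j)) :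
    parts x N S = parts x' N' S :=
  image_congr fun i hi => filter_congr fun j hj => h j hj i hi

lemma exists_scaled_points {a : ℕ} {S : Finset ι}
    (hS : ∀ i ∈ S, ∀ j ∈ S, (p : ℤ_[p]) ^ a ∣ x i - x j) (hne : S.Nonempty) :
    ∃ (i₀ : ι) (x' : ι → ℤ_[p]), i₀ ∈ S ∧ (∀ i ∈ S, x i = x i₀ + (p : ℤ_[p]) ^ a * x' i) ∧
      ∀ M, parts x' M S = parts x (a + M) S := by
  obtain ⟨i₀, hi₀⟩ := hne
  have : ∀ i, ∃ y, i ∈ S → x i = x i₀ + (p : ℤ_[p]) ^ a * y := by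
    intro i
    by_cases hi : i ∈ S
    · obtain ⟨y, hy⟩ := hS i hi i₀ hi₀
      exact ⟨y, fun _ => by rw [← hy]; ring⟩
    · exact ⟨0, fun h => absurd h hi⟩
  choose x' hx' using this
  refine ⟨i₀, x', hi₀, hx', fun M => (parts_congr fun i hi j hj => ?_).symm⟩
  have hp : (p : ℤ_[p]) ^ a ≠ 0 := pow_ne_zero _ (by exact_mod_cast (Fact.out : p.Prime).ne_zero)
  rw [hx' i hi, hx' j hj, add_sub_add_left_eq_sub, ← mul_sub, pow_add, mul_dvd_mul_iff_left hp]

lemma energy_empty {q : ℕ} (hq : q ≠ 0) : energy W g q ∅ = 0 := by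
  simp [energy, hq]

end

/-- Decoupling on a residue class follows from decoupling at a coarser scale. -/
lemma Decoupling.rescale {k N a : ℕ} (hk : 1 ≤ k) (hkp : k < p) (ha : 1 ≤ a) (haN : a ≤ N) {E : ℝ}
    (hE : 0 ≤ E) (hD : Decoupling p k (N - a) E) {χ : AddChar ℤ_[p] Circle}
    {φ : Fin k → ℤ_[p][X]} {Ω ι : Type} [Fintype Ω] {W : Ω → ℝ} {g : ι → Ω → ℂ} {x : ι → ℤ_[p]}
    {S : Finset ι} (hχ : HasConductor χ (k * N)) (hφ : IsMomentCurve p k φ)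
    (hsys : IsSystem χ φ W g x S) (hS : ∀ i ∈ S, ∀ j ∈ S, (p : ℤ_[p]) ^ a ∣ x i - x j) :
    energy W g (k * (k + 1)) S ≤
      E * sqEnergy W g x (k * (k + 1)) N S ^ ((k * (k + 1) : ℕ) / 2 : ℝ) := by
  have hq : k * (k + 1) ≠ 0 := by positivity
  rcases S.eq_empty_or_nonempty with rfl | hne
  · rw [energy_empty hq]
    exact mul_nonneg hE (Real.rpow_nonneg (sqEnergy_nonneg hsys.nonneg _ _ _) _)
  obtain ⟨i₀, x', hi₀, hx', hparts⟩ := exists_scaled_points hS hne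
  obtain ⟨L, φ', hφ', hL⟩ := hφ.rescale hkp (x i₀) ha
  have h1 : sqEnergy W g x (k * (k + 1)) N S = sqEnergy W g x' (k * (k + 1)) (N - a) S := by
    rw [sqEnergy, sqEnergy, hparts, Nat.add_sub_cancel' haN]
  rw [h1]
  refine hD (χ.mulShift ((p : ℤ_[p]) ^ (k * a))) φ' Ω ι W g x' S ?_ hφ' ⟨hsys.nonneg, fun v => ?_⟩
  · refine HasConductor.mulShift ?_
    rwa [← mul_add, Nat.add_sub_cancel' haN]
  · obtain ⟨T, θ, hT1, hT2⟩ := hsys.symm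
      fun j => ∑ i : Fin k, (p : ℤ_[p]) ^ (k * a - a * ((i : ℕ) + 1)) * v i * L i j
    refine ⟨T, θ * χ (∑ j, (∑ i : Fin k, (p : ℤ_[p]) ^ (k * a - a * ((i : ℕ) + 1)) * v i * L i j) *
      (φ j).eval (x i₀)), hT1, fun i hi w => ?_⟩
    rw [hT2 i hi w, AddChar.mulShift_apply]
    refine coe_char_mul_congr ?_
    rw [hx' i hi, ← sub_eq_iff_eq_add', ← sum_sub_distrib]
    simp_rw [← mul_sub, sum_mul]
    rw [sum_comm, mul_sum]
    refine sum_congr rfl fun r _ => ?_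
    simp_rw [mul_assoc]
    rw [← mul_sum, ← mul_sum, hL]
    have : k * a = (k * a - a * ((r : ℕ) + 1)) + a * ((r : ℕ) + 1) := by
      rw [Nat.sub_add_cancel]
      rw [mul_comm k]
      exact Nat.mul_le_mul_left _ r.2
    conv_rhs => rw [this, pow_add]
    ring

/-- Lower degree decoupling for the first factor. -/
lemma BilDecoupling.of_lower {k N l a a' b : ℕ} (hkp : k < p) (hl : 1 ≤ l) (hlk : l < k)
    (ha : 1 ≤ a) (haa : a ≤ a') (haN : a' ≤ N) (hab : l * a' ≤ (k - l + 1) * b) {El E : ℝ}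
    (hEl : 0 ≤ El) (hE : 0 ≤ E) (hD : Decoupling p l (a' - a) El)
    (hB : BilDecoupling p k N l a' b E) : BilDecoupling p k N l a b (El * E) := by
  intro χ φ Ω ι _ W g x S S₁ S₂ hχ hφ hsys hS₁ hS₂ hc₁ hc₂ hsep
  have hq : l * (l + 1) ≠ 0 := by positivity
  have hqk : l * (l + 1) < k * (k + 1) := by gcongr
  set R : ℕ := k * (k + 1) - l * (l + 1) with hR
  have hR0 : R ≠ 0 := by omega
  have hY := fun T => sqEnergy_nonneg (g := g) (x := x) hsys.nonneg (k * (k + 1)) N T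
  have hrhs : 0 ≤ El * E * (sqEnergy W g x (k * (k + 1)) N S₁ ^ ((l * (l + 1) : ℕ) / 2 : ℝ) *
        sqEnergy W g x (k * (k + 1)) N S₂ ^ (R / 2 : ℝ)) := by
    have := hY S₁; have := hY S₂; positivity
  rcases S₁.eq_empty_or_nonempty with rfl | hne
  · refine le_trans (le_of_eq ?_) hrhs
    simp [hq]
  rcases S₂.eq_empty_or_nonempty with rfl | hne₂
  · refine le_trans (le_of_eq ?_) hrhs
    simp [hR0]
  obtain ⟨i₀, x', hi₀, hx', hparts⟩ := exists_scaled_points hc₁ hne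
  obtain ⟨j₀, hj₀⟩ := hne₂
  obtain ⟨L, φ', hφ', hL1, hL2⟩ := hφ.lower (n := k - l) (l := l) (by omega) hkp (x i₀) (x j₀)
    (hsep i₀ hi₀ j₀ hj₀) ha
  set W' : Ω → ℝ := fun w => W w * ‖∑ i ∈ S₂, g i w‖ ^ R with hW'
  have hW'0 : ∀ w, 0 ≤ W' w := fun w => mul_nonneg (hsys.nonneg w) (by positivity)
  have hla : l * (a' - a) ≤ k * N :=
    Nat.mul_le_mul hlk.le ((Nat.sub_le _ _).trans haN)
  have hexp : ∀ i : Fin l, a * ((i : ℕ) + 1) ≤ k * N - l * (a' - a) ∧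
      k * N ≤ (k * N - l * (a' - a) - a * ((i : ℕ) + 1)) + (k - l + 1) * b := by
    intro i
    have h1 : a * ((i : ℕ) + 1) ≤ l * a := by
      rw [mul_comm l]; exact Nat.mul_le_mul_left _ i.2
    have h2 : l * (a' - a) + l * a = l * a' := by rw [← mul_add, Nat.sub_add_cancel haa]
    have h3 : l * a' ≤ k * N := Nat.mul_le_mul hlk.le haN
    omega
  have key := hD (χ.mulShift ((p : ℤ_[p]) ^ (k * N - l * (a' - a)))) φ' Ω ι W' g x' S₁
    (HasConductor.mulShift (by rwa [Nat.sub_add_cancel hla])) hφ' ⟨hW'0, fun v => ?_⟩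
  · rw [sqEnergy, hparts, Nat.add_sub_cancel' haa] at key
    have h1 : energy W' g (l * (l + 1)) S₁ = ∑ w, W w * (‖∑ i ∈ S₁, g i w‖ ^ (l * (l + 1)) *
        ‖∑ i ∈ S₂, g i w‖ ^ R) := sum_congr rfl fun w _ => by rw [hW']; ring
    rw [← h1]
    refine key.trans ?_
    rw [mul_assoc El]
    refine mul_le_mul_of_nonneg_left ?_ hEl
    set q : ℝ := ((l * (l + 1) : ℕ) : ℝ) with hqdef
    have hq0 : 0 < q := by positivity
    have h2 : ∀ B ∈ parts x a' S₁, energy W' g (l * (l + 1)) B ^ (2 / q) ≤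
        (E * sqEnergy W g x (k * (k + 1)) N S₂ ^ (R / 2 : ℝ)) ^ (2 / q) *
          sqEnergy W g x (k * (k + 1)) N B := by
      intro B hB'
      have h3 := hB χ φ Ω ι W g x S B S₂ hχ hφ hsys ((subset_of_mem_parts hB').trans hS₁) hS₂
        (fun i hi j hj => dvd_of_mem_parts hB' hi hj) hc₂
        (fun i hi j hj => hsep i (subset_of_mem_parts hB' hi) j hj)
      have h4 : energy W' g (l * (l + 1)) B ≤
          (E * sqEnergy W g x (k * (k + 1)) N S₂ ^ (R / 2 : ℝ)) *
          sqEnergy W g x (k * (k + 1)) N B ^ (q / 2) := by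
        refine le_trans (le_of_eq ?_) (h3.trans (le_of_eq ?_))
        · exact sum_congr rfl fun w _ => by rw [hW']; ring
        · rw [hqdef]; ring
      refine (Real.rpow_le_rpow (energy_nonneg hW'0 _ _) h4 (by positivity)).trans (le_of_eq ?_)
      have := hY S₂
      rw [Real.mul_rpow (by positivity) (Real.rpow_nonneg (hY B) _), ← Real.rpow_mul (hY B),
        show q / 2 * (2 / q) = 1 by field_simp, Real.rpow_one]
    have h5 := hY S₂
    have h6 := hY S₁
    calc _ ≤ ((E * sqEnergy W g x (k * (k + 1)) N S₂ ^ (R / 2 : ℝ)) ^ (2 / q) *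
          sqEnergy W g x (k * (k + 1)) N S₁) ^ (q / 2) := by
          refine Real.rpow_le_rpow (sum_nonneg fun B _ => Real.rpow_nonneg
            (energy_nonneg hW'0 _ _) _) ?_ (by positivity)
          rw [← sum_sqEnergy haN _ S₁, mul_sum]
          exact sum_le_sum h2
      _ = _ := by
          rw [Real.mul_rpow (by positivity) (hY _), ← Real.rpow_mul (by positivity),
            show 2 / q * (q / 2) = 1 by field_simp, Real.rpow_one]
          ring
  · set c : Fin l → ℤ_[p] := fun i =>
      (p : ℤ_[p]) ^ (k * N - l * (a' - a) - a * ((i : ℕ) + 1)) * v i with hc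
    obtain ⟨T, θ, hT1, hT2⟩ := hsys.symm fun j => ∑ i : Fin l, c i * L i j
    have hlin : ∀ y z : ℤ_[p], ∑ j, (∑ i : Fin l, c i * L i j) * (φ j).eval y =
        ∑ j, (∑ i : Fin l, c i * L i j) * (φ j).eval z +
          ∑ i, c i * ∑ j, L i j * ((φ j).eval y - (φ j).eval z) := by
      intro y z
      rw [← sub_eq_iff_eq_add', ← sum_sub_distrib]
      simp_rw [← mul_sub, sum_mul, mul_sum]
      rw [sum_comm]
      exact sum_congr rfl fun i _ => sum_congr rfl fun j _ => by ring
    have hn2 : ∀ w, ‖∑ i ∈ S₂, g i (T w)‖ = ‖∑ i ∈ S₂, g i w‖ := by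
      intro w
      have : ∀ i ∈ S₂, g i (T w) = (θ * χ (∑ j, (∑ i : Fin l, c i * L i j) *
          (φ j).eval (x j₀)) : ℂ) * g i w := by
        intro i hi
        obtain ⟨y, hy⟩ := hc₂ i hi j₀ hj₀
        rw [hT2 i (hS₂ hi), hlin (x i) (x j₀), AddChar.map_add_eq_mul,
          hχ.eq_one (y := ∑ i, c i * _), mul_one]
        refine dvd_sum fun r _ => ?_
        rw [show x i = x j₀ + (p : ℤ_[p]) ^ b * y by rw [← hy]; ring]
        refine (pow_dvd_pow _ (hexp r).2).trans ?_
        rw [pow_add, hc, mul_assoc]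
        exact mul_dvd_mul_left _ (Dvd.dvd.mul_left (hL1 r b y) _)
      rw [sum_congr rfl this, ← mul_sum, norm_mul, norm_mul, Circle.norm_coe, Circle.norm_coe]
      ring
    refine ⟨T, θ * χ (∑ j, (∑ i : Fin l, c i * L i j) * (φ j).eval (x i₀)),
      fun w => by rw [hW']; simp only [hT1, hn2], fun i hi w => ?_⟩
    rw [hT2 i (hS₁ hi) w, AddChar.mulShift_apply]
    refine coe_char_mul_congr ?_
    rw [hlin (x i) (x i₀), hx' i hi]
    congr 1
    rw [mul_sum]
    refine sum_congr rfl fun r _ => ?_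
    rw [hL2, hc]
    have : k * N - l * (a' - a) = (k * N - l * (a' - a) - a * ((r : ℕ) + 1)) +
        a * ((r : ℕ) + 1) := (Nat.sub_add_cancel (hexp r).1).symm
    conv_rhs => rw [this, pow_add]
    ring

end

end DiagonalSystems

namespace DiagonalSystems

noncomputable section
open Polynomial Classical

variable {p : ℕ} [Fact p.Prime]

lemma sum_rpow_mul_rpow_le {Ω : Type} (s : Finset Ω) {f g : Ω → ℝ} (hf : ∀ w, 0 ≤ f w)
    (hg : ∀ w, 0 ≤ g w) {θ : ℝ} (h0 : 0 < θ) (h1 : θ < 1) :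
    ∑ w ∈ s, f w ^ θ * g w ^ (1 - θ) ≤ (∑ w ∈ s, f w) ^ θ * (∑ w ∈ s, g w) ^ (1 - θ) := by
  have h1' : 0 < 1 - θ := by linarith
  have hpq : (θ⁻¹).HolderConjugate (1 - θ)⁻¹ := by
    rw [Real.holderConjugate_iff]
    exact ⟨(one_lt_inv₀ h0).2 h1, by simp⟩
  have := Real.inner_le_Lp_mul_Lq_of_nonneg s hpq (f := fun w => f w ^ θ)
    (g := fun w => g w ^ (1 - θ)) (fun w _ => Real.rpow_nonneg (hf w) _)
    (fun w _ => Real.rpow_nonneg (hg w) _)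
  simp only [← Real.rpow_mul (hf _), ← Real.rpow_mul (hg _), mul_inv_cancel₀ h0.ne',
    mul_inv_cancel₀ h1'.ne', Real.rpow_one, one_div, inv_inv] at this
  exact this

lemma mul_rpow_mul_rpow_eq {W x y a a' b b' c c' θ : ℝ} (hW : 0 ≤ W) (hx : 0 ≤ x) (hy : 0 ≤ y)
    (ha : 0 ≤ a) (ha' : 0 ≤ a') (hb : 0 ≤ b) (hb' : 0 ≤ b') (h0 : 0 < θ) (h1 : θ < 1)
    (hc : c = θ * a + (1 - θ) * b) (hc' : c' = θ * a' + (1 - θ) * b') :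
    W * (x ^ c * y ^ c') = (W * (x ^ a * y ^ a')) ^ θ * (W * (x ^ b * y ^ b')) ^ (1 - θ) := by
  have h1' : 0 < 1 - θ := by linarith
  rw [Real.mul_rpow hW (by positivity), Real.mul_rpow (by positivity) (by positivity),
    Real.mul_rpow hW (by positivity), Real.mul_rpow (by positivity) (by positivity),
    ← Real.rpow_mul hx, ← Real.rpow_mul hx, ← Real.rpow_mul hy, ← Real.rpow_mul hy, hc, hc',
    Real.rpow_add_of_nonneg hx (by positivity) (by positivity),
    Real.rpow_add_of_nonneg hy (by positivity) (by positivity), mul_comm θ a, mul_comm θ a',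
    mul_comm (1 - θ) b, mul_comm (1 - θ) b']
  have : W ^ θ * W ^ (1 - θ) = W := by
    rw [← Real.rpow_add_of_nonneg hW h0.le h1'.le]; simp
  conv_lhs => rw [← this]
  ring

/-- Interpolation between two bilinear inequalities. -/
lemma bilinear_interpolation {Ω : Type} [Fintype Ω] {W x y : Ω → ℝ} (hW : ∀ w, 0 ≤ W w)
    (hx : ∀ w, 0 ≤ x w) (hy : ∀ w, 0 ≤ y w) {a a' b b' c c' : ℕ} {E₁ E₂ X Y θ : ℝ} (hX : 0 ≤ X)
    (hY : 0 ≤ Y) (hE₁ : 0 ≤ E₁) (hE₂ : 0 ≤ E₂) (h0 : 0 < θ) (h1 : θ < 1)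
    (hc : (c : ℝ) = θ * a + (1 - θ) * b) (hc' : (c' : ℝ) = θ * a' + (1 - θ) * b')
    (hA : ∑ w, W w * (x w ^ a * y w ^ a') ≤ E₁ * (X ^ (a / 2 : ℝ) * Y ^ (a' / 2 : ℝ)))
    (hB : ∑ w, W w * (x w ^ b * y w ^ b') ≤ E₂ * (X ^ (b / 2 : ℝ) * Y ^ (b' / 2 : ℝ))) :
    ∑ w, W w * (x w ^ c * y w ^ c') ≤
      E₁ ^ θ * E₂ ^ (1 - θ) * (X ^ (c / 2 : ℝ) * Y ^ (c' / 2 : ℝ)) := by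
  have h1' : 0 < 1 - θ := by linarith
  have hA0 : ∀ w, 0 ≤ W w * (x w ^ a * y w ^ a') := fun w => by
    have := hW w; have := hx w; have := hy w; positivity
  have hB0 : ∀ w, 0 ≤ W w * (x w ^ b * y w ^ b') := fun w => by
    have := hW w; have := hx w; have := hy w; positivity
  have h2 : ∀ w, W w * (x w ^ c * y w ^ c') =
      (W w * (x w ^ a * y w ^ a')) ^ θ * (W w * (x w ^ b * y w ^ b')) ^ (1 - θ) := by
    intro w
    have := mul_rpow_mul_rpow_eq (hW w) (hx w) (hy w) (a := a) (a' := a') (b := b) (b' := b')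
      (by positivity) (by positivity) (by positivity) (by positivity) h0 h1 hc hc'
    simpa only [Real.rpow_natCast] using this
  simp_rw [h2]
  refine (sum_rpow_mul_rpow_le _ hA0 hB0 h0 h1).trans ?_
  refine (mul_le_mul (Real.rpow_le_rpow (sum_nonneg fun w _ => hA0 w) hA h0.le)
    (Real.rpow_le_rpow (sum_nonneg fun w _ => hB0 w) hB h1'.le)
    (Real.rpow_nonneg (sum_nonneg fun w _ => hB0 w) _) (by positivity)).trans (le_of_eq ?_)
  have := mul_rpow_mul_rpow_eq zero_le_one hX hY (a := a / 2) (a' := a' / 2) (b := b / 2)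
      (b' := b' / 2) (c := c / 2) (c' := c' / 2)
      (by positivity) (by positivity) (by positivity) (by positivity) h0 h1 (by rw [hc]; ring)
      (by rw [hc']; ring)
  simp only [one_mul] at this
  rw [Real.mul_rpow hE₁ (by positivity), Real.mul_rpow hE₂ (by positivity), this]
  ring

lemma BilDecoupling.holder {k N l a b : ℕ} (hl : 1 ≤ l) (hlk : l < k) {E₁ E₂ : ℝ} (hE₁ : 0 ≤ E₁)
    (hE₂ : 0 ≤ E₂) (h1 : BilDecoupling p k N (k - l) b a E₁)
    (h2 : BilDecoupling p k N (l - 1) a b E₂) :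
    BilDecoupling p k N l a b (E₁ ^ (1 / (k - l + 1) : ℝ) * E₂ ^ (1 - 1 / (k - l + 1) : ℝ)) := by
  intro χ φ Ω ι _ W g x S S₁ S₂ hχ hφ hsys hS₁ hS₂ hc₁ hc₂ hsep
  have e1 := h1 χ φ Ω ι W g x S S₂ S₁ hχ hφ hsys hS₂ hS₁ hc₂ hc₁
    (fun i hi j hj h => hsep j hj i hi ((dvd_sub_comm).1 h))
  have e2 := h2 χ φ Ω ι W g x S S₁ S₂ hχ hφ hsys hS₁ hS₂ hc₁ hc₂ hsep
  have hY := fun T => sqEnergy_nonneg (g := g) (x := x) hsys.nonneg (k * (k + 1)) N T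
  obtain ⟨m, rfl⟩ : ∃ m, k = l + m := ⟨k - l, by omega⟩
  obtain ⟨l, rfl⟩ : ∃ n, l = n + 1 := ⟨l - 1, by omega⟩
  have hm : 0 < m := by omega
  have hm' : (0 : ℝ) < m := by exact_mod_cast hm
  simp only [Nat.add_sub_cancel_left, Nat.add_sub_cancel] at e1 e2 h1
  have e1' : ∑ w, W w * (‖∑ i ∈ S₁, g i w‖ ^
      ((l + 1 + m) * (l + 1 + m + 1) - m * (m + 1)) * ‖∑ i ∈ S₂, g i w‖ ^ (m * (m + 1))) ≤ _ :=
    le_trans (le_of_eq (sum_congr rfl fun w _ => by ring)) (e1.trans (le_of_eq (by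
      rw [mul_comm (sqEnergy W g x _ N S₂ ^ _)])))
  refine bilinear_interpolation hsys.nonneg (fun w => norm_nonneg _) (fun w => norm_nonneg _)
    (hY _) (hY _) hE₁ hE₂ ?_ ?_ ?_ ?_ e1' e2
  · push_cast
    rw [show ((l : ℝ) + 1 + m - (l + 1) + 1) = m + 1 by ring]
    positivity
  · push_cast
    rw [show ((l : ℝ) + 1 + m - (l + 1) + 1) = m + 1 by ring, div_lt_one (by positivity)]
    linarith
  · rw [Nat.cast_sub (Nat.mul_le_mul (by omega) (by omega))]
    push_cast
    rw [show ((l : ℝ) + 1 + m - (l + 1) + 1) = m + 1 by ring]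
    field_simp
    ring
  · rw [Nat.cast_sub (Nat.mul_le_mul (by omega) (by omega)),
      Nat.cast_sub (Nat.mul_le_mul (by omega) (by omega))]
    push_cast
    rw [show ((l : ℝ) + 1 + m - (l + 1) + 1) = m + 1 by ring]
    field_simp
    ring

lemma BilDecoupling.of_decoupling {k N l a b : ℕ} (hkp : k < p) (hl : 1 ≤ l) (hlk : l < k)
    (ha : 1 ≤ a) (hb : 1 ≤ b) (haN : a ≤ N) (hbN : b ≤ N) {E : ℝ} (hE : 0 ≤ E)
    (h1 : Decoupling p k (N - a) E) (h2 : Decoupling p k (N - b) E) :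
    BilDecoupling p k N l a b E := by
  intro χ φ Ω ι _ W g x S S₁ S₂ hχ hφ hsys hS₁ hS₂ hc₁ hc₂ hsep
  have hY := fun T => sqEnergy_nonneg (g := g) (x := x) hsys.nonneg (k * (k + 1)) N T
  have e1 := h1.rescale (by omega) hkp ha haN hE hχ hφ (hsys.mono hS₁) hc₁
  have e2 := h2.rescale (by omega) hkp hb hbN hE hχ hφ (hsys.mono hS₂) hc₂
  have hq : l * (l + 1) < k * (k + 1) := by gcongr
  have hq' : ((l * (l + 1) : ℕ) : ℝ) < ((k * (k + 1) : ℕ) : ℝ) := by exact_mod_cast hq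
  have hk0 : 0 < ((k * (k + 1) : ℕ) : ℝ) := by
    exact_mod_cast (Nat.zero_le _).trans_lt hq
  have hl0 : 0 < ((l * (l + 1) : ℕ) : ℝ) := by
    exact_mod_cast (by positivity)
  have := bilinear_interpolation (W := W) (x := fun w => ‖∑ i ∈ S₁, g i w‖)
    (y := fun w => ‖∑ i ∈ S₂, g i w‖) (a := k * (k + 1)) (a' := 0) (b := 0) (b' := k * (k + 1))
    (c := l * (l + 1)) (c' := k * (k + 1) - l * (l + 1)) (E₁ := E) (E₂ := E)
    (θ := ((l * (l + 1) : ℕ) : ℝ) / ((k * (k + 1) : ℕ) : ℝ))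
    hsys.nonneg (fun w => norm_nonneg _) (fun w => norm_nonneg _)
    (hY S₁) (hY S₂) hE hE (by positivity) (by rwa [div_lt_one hk0]) (by field_simp; simp)
    (by rw [Nat.cast_sub hq.le]; field_simp; simp) (by simpa [energy] using e1)
    (by simpa [energy] using e2)
  rw [← Real.rpow_add_of_nonneg hE (by positivity) (by
    rw [sub_nonneg, div_le_one hk0]; exact hq'.le), add_sub_cancel, Real.rpow_one] at this
  exact this

lemma BilDecoupling.zero {k N a b : ℕ} (hk : 1 ≤ k) (hkp : k < p)
    (hb : 1 ≤ b) (hbN : b ≤ N) {E : ℝ} (hE : 0 ≤ E) (h2 : Decoupling p k (N - b) E) :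
    BilDecoupling p k N 0 a b E := by
  intro χ φ Ω ι _ W g x S S₁ S₂ hχ hφ hsys hS₁ hS₂ hc₁ hc₂ hsep
  have e2 := h2.rescale hk hkp hb hbN hE hχ hφ (hsys.mono hS₂) hc₂
  simpa [energy] using e2

lemma sum_rpow_le_rpow_sum {ι : Type} (s : Finset ι) {f : ι → ℝ} (hf : ∀ i, 0 ≤ f i) {r : ℝ}
    (hr : 1 ≤ r) : ∑ i ∈ s, f i ^ r ≤ (∑ i ∈ s, f i) ^ r := by
  have hr' : r = 1 + (r - 1) := by ring
  have h0 : 0 ≤ ∑ i ∈ s, f i := sum_nonneg fun i _ => hf i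
  calc ∑ i ∈ s, f i ^ r ≤ ∑ i ∈ s, f i * (∑ i ∈ s, f i) ^ (r - 1) := by
        refine sum_le_sum fun i hi => ?_
        rw [hr', Real.rpow_add_of_nonneg (hf i) zero_le_one (by linarith), Real.rpow_one,
          add_sub_cancel_left]
        exact mul_le_mul_of_nonneg_left (Real.rpow_le_rpow (hf i)
          (single_le_sum (fun i _ => hf i) hi) (by linarith)) (hf i)
    _ = _ := by
        rw [← sum_mul]
        conv_rhs => rw [hr', Real.rpow_add_of_nonneg h0 zero_le_one (by linarith), Real.rpow_one]

section
variable {Ω ι : Type} [Fintype Ω] {W : Ω → ℝ} {g : ι → Ω → ℂ} {x : ι → ℤ_[p]}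

lemma exists_part_norm_le (a : ℕ) {S : Finset ι} (hS : S.Nonempty) (f : ι → ℂ) :
    ∃ B ∈ parts x a S, ‖∑ i ∈ S, f i‖ ≤ (p : ℝ) ^ a * ‖∑ i ∈ B, f i‖ := by
  have hne : (parts x a S).Nonempty := hS.image _
  obtain ⟨B, hB, hmax⟩ := exists_max_image (parts x a S) (fun B => ‖∑ i ∈ B, f i‖) hne
  refine ⟨B, hB, ?_⟩
  rw [← sum_parts (x := x) a S f]
  refine (norm_sum_le _ _).trans ((sum_le_card_nsmul _ _ _ hmax).trans ?_)
  rw [nsmul_eq_mul]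
  exact mul_le_mul_of_nonneg_right (by exact_mod_cast card_parts_le a S) (norm_nonneg _)

lemma Decoupling.trivial (k N : ℕ) (hk : 1 ≤ k) :
    Decoupling p k N ((p : ℝ) ^ (N * (k * (k + 1)))) := by
  intro χ φ Ω ι _ W g x S hχ hφ hsys
  set q := k * (k + 1) with hq
  have hq2 : 2 ≤ q := by rw [hq]; nlinarith
  have hq0 : q ≠ 0 := by omega
  have h1 : ∀ w, ‖∑ i ∈ S, g i w‖ ^ q ≤
      (p : ℝ) ^ (N * q) * ∑ B ∈ parts x N S, ‖∑ i ∈ B, g i w‖ ^ q := by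
    intro w
    rcases S.eq_empty_or_nonempty with rfl | hne
    · simp [hq0, parts]
    obtain ⟨B, hB, h⟩ := exists_part_norm_le (x := x) N hne fun i => g i w
    refine (pow_le_pow_left₀ (norm_nonneg _) h q).trans ?_
    rw [mul_pow, ← pow_mul]
    exact mul_le_mul_of_nonneg_left (single_le_sum
      (f := fun B => ‖∑ i ∈ B, g i w‖ ^ q) (fun B _ => by positivity) hB) (by positivity)
  have hq' : (2 : ℝ) ≤ q := by exact_mod_cast hq2
  calc energy W g q S ≤ ∑ w, W w * ((p : ℝ) ^ (N * q) * ∑ B ∈ parts x N S, ‖∑ i ∈ B, g i w‖ ^ q) :=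
        sum_le_sum fun w _ => mul_le_mul_of_nonneg_left (h1 w) (hsys.nonneg w)
    _ = (p : ℝ) ^ (N * q) * ∑ B ∈ parts x N S, energy W g q B := by
        simp_rw [energy]
        rw [sum_comm, mul_sum]
        refine sum_congr rfl fun w _ => ?_
        rw [← mul_sum]; ring
    _ ≤ _ := by
        refine mul_le_mul_of_nonneg_left ?_ (by positivity)
        refine le_trans (le_of_eq ?_) (sum_rpow_le_rpow_sum (parts x N S)
          (f := fun B => energy W g q B ^ (2 / q : ℝ))
          (fun B => Real.rpow_nonneg (energy_nonneg hsys.nonneg _ _) _) (by linarith))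
        refine sum_congr rfl fun B _ => ?_
        rw [← Real.rpow_mul (energy_nonneg hsys.nonneg _ _),
          show (2 / q : ℝ) * (q / 2) = 1 by field_simp, Real.rpow_one]

lemma broad_narrow (a b : ℕ) (ha : 1 ≤ a) (hb : 1 ≤ b) (r t : ℕ) (hrt : 1 ≤ r + t) (S : Finset ι)
    (f : ι → ℂ) :
    ‖∑ i ∈ S, f i‖ ^ (r + t) ≤ 2 ^ (r + t) * ∑ B ∈ parts x 1 S, ‖∑ i ∈ B, f i‖ ^ (r + t) +
      (p : ℝ) ^ ((r + t) * (2 + a + b)) * ∑ B ∈ parts x a S, ∑ B' ∈ parts x b S,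
        if ∀ i ∈ B, ∀ j ∈ B', ¬ (p : ℤ_[p]) ∣ x i - x j then
          ‖∑ i ∈ B, f i‖ ^ r * ‖∑ i ∈ B', f i‖ ^ t else 0 := by
  have hp1 : (1 : ℝ) ≤ p := by exact_mod_cast (Fact.out : p.Prime).one_le
  have hnn : ∀ B ∈ parts x a S, 0 ≤ ∑ B' ∈ parts x b S,
      if ∀ i ∈ B, ∀ j ∈ B', ¬ (p : ℤ_[p]) ∣ x i - x j then
        ‖∑ i ∈ B, f i‖ ^ r * ‖∑ i ∈ B', f i‖ ^ t else 0 :=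
    fun B _ => sum_nonneg fun B' _ => by split_ifs <;> positivity
  rcases S.eq_empty_or_nonempty with rfl | hne
  · simp only [sum_empty, norm_zero, zero_pow (by omega : r + t ≠ 0)]
    have := sum_nonneg hnn
    positivity
  have hne' : (parts x 1 S).Nonempty := hne.image _
  obtain ⟨B, hB, hmax⟩ := exists_max_image (parts x 1 S) (fun B => ‖∑ i ∈ B, f i‖) hne'
  have hcard : (#(parts x 1 S) : ℝ) ≤ p := by
    have := card_parts_le (x := x) 1 S
    rw [pow_one] at this
    exact_mod_cast this
  by_cases hcase : ∀ B' ∈ parts x 1 S, B' ≠ B → p * ‖∑ i ∈ B', f i‖ ≤ ‖∑ i ∈ B, f i‖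
  · have h1 : ‖∑ i ∈ S, f i‖ ≤ 2 * ‖∑ i ∈ B, f i‖ := by
      rw [← sum_parts (x := x) 1 S f, ← add_sum_erase _ _ hB]
      refine (norm_add_le _ _).trans ?_
      have : ‖∑ B' ∈ (parts x 1 S).erase B, ∑ i ∈ B', f i‖ ≤ ‖∑ i ∈ B, f i‖ := by
        refine (norm_sum_le _ _).trans ((sum_le_card_nsmul _ _ (‖∑ i ∈ B, f i‖ / p) ?_).trans ?_)
        · intro B' hB'
          rw [mem_erase] at hB'
          rw [le_div_iff₀ (by positivity), mul_comm]
          exact hcase B' hB'.2 hB'.1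
        · rw [nsmul_eq_mul, mul_div_assoc', div_le_iff₀ (by positivity), mul_comm]
          refine mul_le_mul_of_nonneg_left ?_ (norm_nonneg _)
          refine le_trans ?_ hcard
          exact_mod_cast card_le_card (erase_subset _ _)
      linarith
    refine (pow_le_pow_left₀ (norm_nonneg _) h1 _).trans ?_
    rw [mul_pow]
    have h2 := single_le_sum (f := fun B => ‖∑ i ∈ B, f i‖ ^ (r + t))
      (fun B _ => by positivity) hB
    have := mul_nonneg (by positivity : (0 : ℝ) ≤ (p : ℝ) ^ ((r + t) * (2 + a + b)))
      (sum_nonneg hnn)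
    have := mul_le_mul_of_nonneg_left h2 (by positivity : (0 : ℝ) ≤ 2 ^ (r + t))
    linarith
  · push Not at hcase
    obtain ⟨B', hB', hne2, hlt⟩ := hcase
    obtain ⟨C, hC, h1⟩ := exists_part_norm_le (x := x) a (nonempty_of_mem_parts hB) f
    obtain ⟨C', hC', h2⟩ := exists_part_norm_le (x := x) b (nonempty_of_mem_parts hB') f
    have hCS : C ∈ parts x a S := by
      rw [parts_eq_biUnion ha, mem_biUnion]; exact ⟨B, hB, hC⟩
    have hCS' : C' ∈ parts x b S := by
      rw [parts_eq_biUnion hb, mem_biUnion]; exact ⟨B', hB', hC'⟩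
    have hfar : ∀ i ∈ C, ∀ j ∈ C', ¬ (p : ℤ_[p]) ∣ x i - x j := by
      intro i hi j hj hd
      refine hne2 ?_
      rw [eq_filter_of_mem_parts hB (subset_of_mem_parts hC hi),
        eq_filter_of_mem_parts hB' (subset_of_mem_parts hC' hj)]
      exact (filter_congr_parts (by simpa using hd) S).symm
    have h3 : ‖∑ i ∈ S, f i‖ ≤ p * ‖∑ i ∈ B, f i‖ := by
      rw [← sum_parts (x := x) 1 S f]
      refine (norm_sum_le _ _).trans ((sum_le_card_nsmul _ _ _ hmax).trans ?_)
      rw [nsmul_eq_mul]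
      exact mul_le_mul_of_nonneg_right hcard (norm_nonneg _)
    have hM : ∀ m ≤ 2 + a + b, (p : ℝ) ^ m ≤ (p : ℝ) ^ (2 + a + b) :=
      fun m hm => pow_le_pow_right₀ hp1 hm
    have h4 : ‖∑ i ∈ S, f i‖ ≤ (p : ℝ) ^ (2 + a + b) * ‖∑ i ∈ C, f i‖ := by
      refine h3.trans ((mul_le_mul_of_nonneg_left h1 (by positivity)).trans ?_)
      rw [← mul_assoc, ← pow_succ']
      exact mul_le_mul_of_nonneg_right (hM _ (by omega)) (norm_nonneg _)
    have h5 : ‖∑ i ∈ S, f i‖ ≤ (p : ℝ) ^ (2 + a + b) * ‖∑ i ∈ C', f i‖ := by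
      refine h3.trans ((mul_le_mul_of_nonneg_left (hlt.le.trans
        (mul_le_mul_of_nonneg_left h2 (by positivity))) (by positivity)).trans ?_)
      rw [← mul_assoc, ← mul_assoc, ← pow_two, ← pow_add]
      exact mul_le_mul_of_nonneg_right (hM _ (by omega)) (norm_nonneg _)
    have h6 : ‖∑ i ∈ S, f i‖ ^ (r + t) ≤ (p : ℝ) ^ ((r + t) * (2 + a + b)) *
        (‖∑ i ∈ C, f i‖ ^ r * ‖∑ i ∈ C', f i‖ ^ t) := by
      rw [pow_add]
      refine (mul_le_mul (pow_le_pow_left₀ (norm_nonneg _) h4 r)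
        (pow_le_pow_left₀ (norm_nonneg _) h5 t) (by positivity) (by positivity)).trans
        (le_of_eq ?_)
      rw [mul_comm (r + t), pow_mul, pow_add, mul_pow, mul_pow]
      ring
    refine h6.trans ?_
    have h7 : ‖∑ i ∈ C, f i‖ ^ r * ‖∑ i ∈ C', f i‖ ^ t ≤
        ∑ B ∈ parts x a S, ∑ B' ∈ parts x b S,
        if ∀ i ∈ B, ∀ j ∈ B', ¬ (p : ℤ_[p]) ∣ x i - x j then
          ‖∑ i ∈ B, f i‖ ^ r * ‖∑ i ∈ B', f i‖ ^ t else 0 := by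
      refine le_trans ?_ (single_le_sum hnn hCS)
      refine le_trans (le_of_eq ?_) (single_le_sum (fun B' _ => ?_) hCS')
      · rw [if_pos hfar]
      · split_ifs <;> positivity
    have := mul_le_mul_of_nonneg_left h7
      (by positivity : (0 : ℝ) ≤ (p : ℝ) ^ ((r + t) * (2 + a + b)))
    have h8 : (0 : ℝ) ≤ 2 ^ (r + t) * ∑ B ∈ parts x 1 S, ‖∑ i ∈ B, f i‖ ^ (r + t) := by positivity
    linarith

end

/-- The induction step in the scale parameter. -/
lemma Decoupling.of_bilinear {k N l a b : ℕ} (hkp : k < p) (hlk : l < k)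
    (ha : 1 ≤ a) (hb : 1 ≤ b) (haN : a ≤ N) (hbN : b ≤ N) {E' E : ℝ} (hE' : 0 ≤ E') (hE : 0 ≤ E)
    (hD : Decoupling p k (N - 1) E') (hB : BilDecoupling p k N l a b E) :
    Decoupling p k N (2 ^ (k * (k + 1)) * E' +
      (p : ℝ) ^ (k * (k + 1) * (2 + a + b) + (a + b)) * E) := by
  intro χ φ Ω ι _ W g x S hχ hφ hsys
  have hlq : l * (l + 1) ≤ k * (k + 1) := by gcongr
  set q := k * (k + 1) with hq
  have hq2 : 2 ≤ q := by rw [hq]; nlinarith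
  have hq' : (2 : ℝ) ≤ q := by exact_mod_cast hq2
  have hY := fun T => sqEnergy_nonneg (g := g) (x := x) hsys.nonneg q N T
  obtain ⟨t, ht⟩ := Nat.exists_eq_add_of_le hlq
  set r := l * (l + 1) with hr
  have hRt : q - r = t := by omega
  set Z := sqEnergy W g x q N S ^ (q / 2 : ℝ) with hZ
  have h1 : ∑ B ∈ parts x 1 S, energy W g q B ≤ E' * Z := by
    calc _ ≤ ∑ B ∈ parts x 1 S, E' * sqEnergy W g x q N B ^ (q / 2 : ℝ) := by
          refine sum_le_sum fun B hB' => ?_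
          exact hD.rescale (by omega) hkp le_rfl (by omega) hE' hχ hφ
            (hsys.mono (subset_of_mem_parts hB'))
            fun i hi j hj => dvd_of_mem_parts hB' hi hj
      _ ≤ _ := by
          rw [← mul_sum]
          refine mul_le_mul_of_nonneg_left ?_ hE'
          rw [hZ, ← sum_sqEnergy (show 1 ≤ N by omega) q S]
          exact sum_rpow_le_rpow_sum _ (fun B => hY B) (by linarith)
  have h2 : ∀ B ∈ parts x a S, ∀ B' ∈ parts x b S,
      ∑ w, W w * (if ∀ i ∈ B, ∀ j ∈ B', ¬ (p : ℤ_[p]) ∣ x i - x j then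
          ‖∑ i ∈ B, g i w‖ ^ r * ‖∑ i ∈ B', g i w‖ ^ t else 0) ≤ E * Z := by
    intro B hB1 B' hB2
    split_ifs with hfar
    · have := hB χ φ Ω ι W g x S B B' hχ hφ hsys (subset_of_mem_parts hB1)
        (subset_of_mem_parts hB2) (fun i hi j hj => dvd_of_mem_parts hB1 hi hj)
        (fun i hi j hj => dvd_of_mem_parts hB2 hi hj) hfar
      rw [← hq, ← hr, hRt] at this
      refine this.trans (mul_le_mul_of_nonneg_left ?_ hE)
      rw [hZ, ht, Nat.cast_add, add_div,
        Real.rpow_add_of_nonneg (ht ▸ hY S) (by positivity) (by positivity), ← ht]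
      exact mul_le_mul
        (Real.rpow_le_rpow (hY _) (sqEnergy_mono hsys.nonneg haN q hB1) (by positivity))
        (Real.rpow_le_rpow (hY _) (sqEnergy_mono hsys.nonneg hbN q hB2) (by positivity))
        (Real.rpow_nonneg (hY _) _) (Real.rpow_nonneg (hY _) _)
    · simp only [mul_zero, sum_const_zero]
      exact mul_nonneg hE (Real.rpow_nonneg (hY _) _)
  have h3 : ∑ B ∈ parts x a S, ∑ B' ∈ parts x b S,
      ∑ w, W w * (if ∀ i ∈ B, ∀ j ∈ B', ¬ (p : ℤ_[p]) ∣ x i - x j then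
          ‖∑ i ∈ B, g i w‖ ^ r * ‖∑ i ∈ B', g i w‖ ^ t else 0) ≤
        (p : ℝ) ^ (a + b) * (E * Z) := by
    have hEZ : 0 ≤ E * Z := mul_nonneg hE (Real.rpow_nonneg (hY _) _)
    refine (sum_le_card_nsmul _ _ _ fun B hB1 => sum_le_card_nsmul _ _ _ (h2 B hB1)).trans ?_
    rw [nsmul_eq_mul, nsmul_eq_mul, pow_add, mul_assoc]
    have ha' : (#(parts x a S) : ℝ) ≤ (p : ℝ) ^ a := by exact_mod_cast card_parts_le a S
    have hb' : (#(parts x b S) : ℝ) ≤ (p : ℝ) ^ b := by exact_mod_cast card_parts_le b S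
    exact mul_le_mul ha' (mul_le_mul_of_nonneg_right hb' hEZ)
      (mul_nonneg (Nat.cast_nonneg _) hEZ) (pow_nonneg (Nat.cast_nonneg _) _)
  have h4 : energy W g q S ≤ 2 ^ q * ∑ B ∈ parts x 1 S, energy W g q B +
      (p : ℝ) ^ (q * (2 + a + b)) * ∑ B ∈ parts x a S, ∑ B' ∈ parts x b S,
      ∑ w, W w * (if ∀ i ∈ B, ∀ j ∈ B', ¬ (p : ℤ_[p]) ∣ x i - x j then
          ‖∑ i ∈ B, g i w‖ ^ r * ‖∑ i ∈ B', g i w‖ ^ t else 0) := by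
    have : ∀ w, W w * ‖∑ i ∈ S, g i w‖ ^ q ≤ W w * _ := fun w =>
      mul_le_mul_of_nonneg_left (ht ▸ broad_narrow (x := x) a b ha hb r t (by omega) S
        fun i => g i w) (hsys.nonneg w)
    refine (sum_le_sum fun w _ => this w).trans (le_of_eq ?_)
    rw [sum_congr rfl fun w _ => mul_add (W w) _ _, sum_add_distrib]
    congr 1
    · simp_rw [energy]
      rw [sum_comm, mul_sum]
      refine sum_congr rfl fun w _ => ?_
      rw [← mul_sum]; ring
    · have : ∀ B ∈ parts x a S, ∑ B' ∈ parts x b S,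
        ∑ w, W w * (if ∀ i ∈ B, ∀ j ∈ B', ¬ (p : ℤ_[p]) ∣ x i - x j then
          ‖∑ i ∈ B, g i w‖ ^ r * ‖∑ i ∈ B', g i w‖ ^ t else 0) =
          ∑ w, ∑ B' ∈ parts x b S, W w * (if ∀ i ∈ B, ∀ j ∈ B', ¬ (p : ℤ_[p]) ∣ x i - x j then
          ‖∑ i ∈ B, g i w‖ ^ r * ‖∑ i ∈ B', g i w‖ ^ t else 0) := fun B _ => sum_comm
      rw [sum_congr rfl this, sum_comm, mul_sum]
      refine sum_congr rfl fun w _ => ?_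
      simp_rw [← mul_sum]
      rw [mul_left_comm]
  refine h4.trans ?_
  have h5 := mul_le_mul_of_nonneg_left h1 (by positivity : (0 : ℝ) ≤ 2 ^ q)
  have h6 := mul_le_mul_of_nonneg_left h3 (by positivity : (0 : ℝ) ≤ (p : ℝ) ^ (q * (2 + a + b)))
  rw [pow_add, add_mul]
  linarith

end

end DiagonalSystems

namespace DiagonalSystems

noncomputable section
open Polynomial Classical

section
variable {p : ℕ} [Fact p.Prime]

lemma Decoupling.mono {k N : ℕ} {E E' : ℝ} (h : Decoupling p k N E) (hE : E ≤ E') :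
    Decoupling p k N E' := by
  intro χ φ Ω ι _ W g x S hχ hφ hsys
  refine (h χ φ Ω ι W g x S hχ hφ hsys).trans (mul_le_mul_of_nonneg_right hE ?_)
  exact Real.rpow_nonneg (sqEnergy_nonneg hsys.nonneg _ _ _) _

lemma BilDecoupling.mono {k N l a b : ℕ} {E E' : ℝ} (h : BilDecoupling p k N l a b E)
    (hE : E ≤ E') : BilDecoupling p k N l a b E' := by
  intro χ φ Ω ι _ W g x S S₁ S₂ hχ hφ hsys h1 h2 h3 h4 h5
  refine (h χ φ Ω ι W g x S S₁ S₂ hχ hφ hsys h1 h2 h3 h4 h5).trans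
    (mul_le_mul_of_nonneg_right hE ?_)
  exact mul_nonneg (Real.rpow_nonneg (sqEnergy_nonneg hsys.nonneg _ _ _) _)
    (Real.rpow_nonneg (sqEnergy_nonneg hsys.nonneg _ _ _) _)

lemma inner_eq_zero_of_not_dvd {N : ℕ} {χ : AddChar ℤ_[p] Circle} {φ : Fin 1 → ℤ_[p][X]}
    {Ω ι : Type} [Fintype Ω] {W : Ω → ℝ} {g : ι → Ω → ℂ} {x : ι → ℤ_[p]} {S : Finset ι}
    (hχ : HasConductor χ N) (hφ : IsMomentCurve p 1 φ) (hsys : IsSystem χ φ W g x S) {i j : ι}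
    (hi : i ∈ S) (hj : j ∈ S) (hij : ¬ (p : ℤ_[p]) ^ N ∣ x j - x i) :
    ∑ w, (W w : ℂ) * (g i w * (starRingEnd ℂ) (g j w)) = 0 := by
  obtain ⟨ψ, hψ⟩ := hφ 0
  have hy : ¬ (p : ℤ_[p]) ^ N ∣ (φ 0).eval (x i) - (φ 0).eval (x j) := by
    intro h
    obtain ⟨t, ht⟩ := sub_dvd_eval_sub (x i) (x j) ψ
    have h1 : (φ 0).eval (x i) - (φ 0).eval (x j) = (x i - x j) * (1 - -(p * t)) := by
      rw [hψ]
      simp only [eval_add, eval_mul, eval_X, eval_C, Fin.val_zero, zero_add, pow_one]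
      linear_combination (p : ℤ_[p]) * ht
    have h2 : IsUnit (1 - -((p : ℤ_[p]) * t)) := by
      refine IsLocalRing.isUnit_one_sub_self_of_mem_nonunits _ ?_
      rw [← IsLocalRing.mem_maximalIdeal, PadicInt.maximalIdeal_eq_span_p,
        Ideal.mem_span_singleton]
      exact ⟨-t, by ring⟩
    rw [h1, h2.dvd_mul_right] at h
    exact hij ((dvd_sub_comm).1 h)
  rw [← hχ] at hy
  push Not at hy
  obtain ⟨u, hu⟩ := hy
  obtain ⟨T, θ, hT1, hT2⟩ := hsys.symm fun _ => u
  set G := ∑ w, (W w : ℂ) * (g i w * (starRingEnd ℂ) (g j w)) with hG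
  set z : Circle := χ (u * ((φ 0).eval (x i) - (φ 0).eval (x j))) with hz
  have h3 : G = z * G := by
    conv_lhs => rw [hG, ← Equiv.sum_comp T]
    rw [hG, mul_sum]
    refine sum_congr rfl fun w _ => ?_
    rw [hT1, hT2 i hi, hT2 j hj]
    have h4 : (θ : ℂ) * (starRingEnd ℂ) θ = 1 := by
      rw [Complex.mul_conj, Circle.normSq_coe]; simp
    have h5 : z = χ (u * (φ 0).eval (x i)) * (χ (u * (φ 0).eval (x j)))⁻¹ := by
      rw [hz, mul_sub, sub_eq_add_neg, AddChar.map_add_eq_mul, AddChar.map_neg_eq_inv]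
    simp only [univ_unique, Fin.default_eq_zero, sum_singleton, map_mul]
    rw [h5, Circle.coe_mul, Circle.coe_inv_eq_conj]
    linear_combination ((W w : ℂ) * χ (u * (φ 0).eval (x i)) * g i w *
      (starRingEnd ℂ) (χ (u * (φ 0).eval (x j))) * (starRingEnd ℂ) (g j w)) * h4
  have h6 : (1 - (z : ℂ)) * G = 0 := by linear_combination h3
  rcases mul_eq_zero.1 h6 with h | h
  · exact absurd (Circle.ext (by simpa using (sub_eq_zero.1 h).symm)) hu
  · exact h

lemma ofReal_energy_two {Ω ι : Type} [Fintype Ω] {W : Ω → ℝ} {g : ι → Ω → ℂ} (S : Finset ι) :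
    (energy W g 2 S : ℂ) =
      ∑ i ∈ S, ∑ j ∈ S, ∑ w, (W w : ℂ) * (g i w * (starRingEnd ℂ) (g j w)) := by
  rw [energy, Complex.ofReal_sum]
  have : ∀ w, ((W w * ‖∑ i ∈ S, g i w‖ ^ 2 : ℝ) : ℂ) =
      ∑ i ∈ S, ∑ j ∈ S, (W w : ℂ) * (g i w * (starRingEnd ℂ) (g j w)) := by
    intro w
    push_cast
    rw [← Complex.mul_conj', map_sum, sum_mul_sum]
    simp_rw [mul_sum]
  simp_rw [this]
  rw [sum_comm]
  exact sum_congr rfl fun i _ => sum_comm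

lemma decoupling_one (N : ℕ) : Decoupling p 1 N 1 := by
  intro χ φ Ω ι _ W g x S hχ hφ hsys
  rw [one_mul] at hχ
  have h1 : energy W g 2 S = ∑ B ∈ parts x N S, energy W g 2 B := by
    rw [← Complex.ofReal_inj, Complex.ofReal_sum, ofReal_energy_two, ← sum_parts (x := x) N S]
    refine sum_congr rfl fun B hB => ?_
    rw [ofReal_energy_two]
    refine sum_congr rfl fun i hi => ?_
    symm
    refine sum_subset (subset_of_mem_parts hB) fun j hj hjB => ?_
    refine inner_eq_zero_of_not_dvd hχ hφ hsys (subset_of_mem_parts hB hi) hj fun h => hjB ?_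
    rw [eq_filter_of_mem_parts hB hi, mem_filter]
    exact ⟨hj, h⟩
  have h2 : sqEnergy W g x 2 N S = ∑ B ∈ parts x N S, energy W g 2 B := by
    simp [sqEnergy]
  norm_num
  rw [h1, h2]

end

/-- The recursively defined gains in the bilinear iteration. -/
def gain (k : ℕ) (t ε : ℝ) : ℕ → ℕ → ℝ
  | 0, l => if l = 0 then t else 0
  | r + 1, l => if l = 0 then t else gain k t ε r (k - l) / l +
      (1 - 1 / (k - l + 1)) * gain k t ε r (l - 1) - ε

lemma gain_zero_right (k : ℕ) (t ε : ℝ) (r : ℕ) : gain k t ε r 0 = t := by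
  cases r <;> simp [gain]

lemma le_sum_gain (n : ℕ) (t ε : ℝ) (r : ℕ) :
    r * (n * (t / (n + 1) - ε)) ≤
      ∑ j ∈ range n, gain (n + 1) t ε r (j + 1) := by
  induction r with
  | zero => simp [gain]
  | succ r ih =>
    have h1 : ∑ j ∈ range n, gain (n + 1) t ε (r + 1) (j + 1) =
        ∑ j ∈ range n, gain (n + 1) t ε r (n - j) / (j + 1) +
        ∑ j ∈ range n, (1 - 1 / (n - j + 1 : ℝ)) * gain (n + 1) t ε r j - n * ε := by
      have : (n : ℝ) * ε = ∑ j ∈ range n, ε := by simp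
      rw [this, ← sum_add_distrib, ← sum_sub_distrib]
      refine sum_congr rfl fun j _ => ?_
      simp only [gain, if_neg (Nat.succ_ne_zero j), Nat.add_sub_add_right, Nat.add_sub_cancel]
      push_cast
      ring_nf
    have h2 : ∑ j ∈ range n, gain (n + 1) t ε r (n - j) / (j + 1) =
        ∑ j ∈ range n, gain (n + 1) t ε r (j + 1) / (n - j : ℝ) := by
      rw [← sum_range_reflect]
      refine sum_congr rfl fun j hj => ?_
      rw [mem_range] at hj
      have e1 : n - (n - 1 - j) = j + 1 := by omega
      have e2 : ((n - 1 - j : ℕ) : ℝ) + 1 = n - j := by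
        have : n - 1 - j + 1 + j = n := by omega
        have h := congrArg (Nat.cast (R := ℝ)) this
        push_cast at h
        linarith
      rw [e1, e2]
    have h3 : ∑ j ∈ range n, (1 - 1 / (n - j + 1 : ℝ)) * gain (n + 1) t ε r j =
        n / (n + 1) * t + ∑ j ∈ range n, (1 - 1 / (n - j : ℝ)) * gain (n + 1) t ε r (j + 1) := by
      have h4 := sum_range_succ (fun j : ℕ => (1 - 1 / ((n : ℝ) - j + 1)) * gain (n + 1) t ε r j) n
      rw [sum_range_succ'] at h4
      simp only [sub_self, zero_add, div_one, zero_mul, add_zero, Nat.cast_zero,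
        sub_zero, gain_zero_right, Nat.cast_add, Nat.cast_one] at h4
      rw [← h4, add_comm]
      congr 1
      · field_simp
        ring
      · refine sum_congr rfl fun j _ => ?_
        rw [show (n : ℝ) - (j + 1) + 1 = n - j by ring]
    rw [h1, h2, h3]
    have h5 : ∑ j ∈ range n, gain (n + 1) t ε r (j + 1) / (n - j : ℝ) +
        ∑ j ∈ range n, (1 - 1 / (n - j : ℝ)) * gain (n + 1) t ε r (j + 1) =
        ∑ j ∈ range n, gain (n + 1) t ε r (j + 1) := by
      rw [← sum_add_distrib]
      exact sum_congr rfl fun j _ => by ring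
    have h6 : (n : ℝ) / (n + 1) * t = n * (t / (n + 1)) := by ring
    push_cast
    linarith

section
variable {p : ℕ} [Fact p.Prime]

lemma BilDecoupling.level {k N : ℕ} (hk : 2 ≤ k) (hkp : k < p) {t ε δ B : ℝ} (ht : 0 ≤ t)
    (hε : 0 ≤ ε) (hδ : 0 ≤ δ) (hB : 0 ≤ B)
    (hlow : ∀ l, 1 ≤ l → l < k → ∀ M : ℕ, Decoupling p l M ((p : ℝ) ^ (ε * M + δ)))
    (hN : ∀ c : ℕ, 1 ≤ c → c ≤ N → Decoupling p k (N - c) (B * (p : ℝ) ^ (-(t * c)))) (r : ℕ) :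
    ∀ b : ℕ, 0 < b → (k.factorial) ^ (2 * r) ∣ b → b * k ^ (r + 1) ≤ N → ∀ l a : ℕ, 1 ≤ l → l < k →
      l * a = (k - l + 1) * b →
      BilDecoupling p k N l a b (B * (p : ℝ) ^ (-(gain k t (2 * k * ε) r l * b - r * δ))) := by
  have hp1 : (1 : ℝ) ≤ p := by exact_mod_cast (Fact.out : p.Prime).one_le
  have hp0 : (0 : ℝ) < p := by linarith
  have hab : ∀ l a b : ℕ, 1 ≤ l → l < k → l * a = (k - l + 1) * b → a ≤ k * b := by
    intro l a b h1 h2 h3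
    calc a ≤ l * a := Nat.le_mul_of_pos_left _ h1
      _ = (k - l + 1) * b := h3
      _ ≤ k * b := Nat.mul_le_mul_right _ (by omega)
  induction r with
  | zero =>
    intro b hb _ hbN l a hl hlk hlab
    have ha := hab l a b hl hlk hlab
    have ha1 : 1 ≤ a := by
      rcases Nat.eq_zero_or_pos a with rfl | h
      · have : 0 < (k - l + 1) * b := by positivity
        omega
      · exact h
    rw [zero_add, pow_one] at hbN
    have haN : a ≤ N := by rw [mul_comm] at hbN; omega
    have hbN' : b ≤ N := le_trans (Nat.le_mul_of_pos_right _ (by omega)) hbN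
    have hexp : ∀ c : ℕ, B * (p : ℝ) ^ (-(t * c)) ≤ B := fun c => by
      refine mul_le_of_le_one_right hB (Real.rpow_le_one_of_one_le_of_nonpos hp1 ?_)
      have : 0 ≤ t * c := by positivity
      linarith
    have := BilDecoupling.of_decoupling hkp hl hlk ha1 hb haN hbN' hB
      ((hN a ha1 haN).mono (hexp a)) ((hN b hb hbN').mono (hexp b))
    simpa [gain, show l ≠ 0 by omega] using this
  | succ r ih =>
    intro b hb hdvd hbN l a hl hlk hlab
    have ha := hab l a b hl hlk hlab
    have ha1 : 1 ≤ a := by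
      rcases Nat.eq_zero_or_pos a with rfl | h
      · have : 0 < (k - l + 1) * b := by positivity
        omega
      · exact h
    set m := k - l with hm
    have hm1 : 1 ≤ m := by omega
    have hmk : m < k := by omega
    have hkm : k - m = l := by omega
    have hklm : k = l + m := by omega
    have hb' : k.factorial ^ (2 * r) ∣ b := (pow_dvd_pow _ (by omega)).trans hdvd
    have hfa : k.factorial * k.factorial ^ (2 * r) ∣ a := by
      obtain ⟨c, hc⟩ := hdvd
      obtain ⟨d, hd⟩ := Nat.dvd_factorial (by omega : 0 < l) hlk.le
      refine ⟨(m + 1) * d * c, ?_⟩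
      have hl0 : 0 < l := hl
      refine Nat.eq_of_mul_eq_mul_left hl0 ?_
      rw [hlab, hc, show 2 * (r + 1) = 2 * r + 1 + 1 by ring, pow_succ, pow_succ]
      calc (m + 1) * (k.factorial ^ (2 * r) * k.factorial * k.factorial * c) =
          (m + 1) * (k.factorial ^ (2 * r) * k.factorial * (l * d) * c) := by rw [← hd]
        _ = _ := by ring
    have ha' : k.factorial ^ (2 * r) ∣ a := (dvd_mul_left _ _).trans hfa
    have hma : m ∣ a := (Nat.dvd_factorial hm1 hmk.le).trans ((dvd_mul_right _ _).trans hfa)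
    obtain ⟨a₂, ha₂⟩ : m ∣ (l + 1) * a := hma.mul_left _
    have hbN2 : b * k ^ (r + 2) ≤ N := hbN
    have hkpos : 0 < k := by omega
    have hbk : b * k * k ≤ N := by
      refine le_trans ?_ hbN2
      rw [pow_add, mul_assoc, ← pow_two, ← mul_assoc]
      exact Nat.mul_le_mul_right _ (Nat.le_mul_of_pos_right _ (by positivity))
    have haN2 : a * k ^ (r + 1) ≤ N := by
      refine le_trans (Nat.mul_le_mul_right _ ha) ?_
      calc k * b * k ^ (r + 1) = b * k ^ (r + 2) := by ring
        _ ≤ N := hbN2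
    have hbN1 : b * k ^ (r + 1) ≤ N :=
      le_trans (Nat.mul_le_mul_left _ (Nat.pow_le_pow_right hkpos (by omega))) hbN2
    have ha₂k : a₂ ≤ k * a := hab m a₂ a hm1 hmk (by rw [hkm]; exact ha₂.symm)
    have ha₂N : a₂ ≤ N := by nlinarith
    have hba₂ : b ≤ a₂ := by
      by_contra h
      push Not at h
      have h1 : l * (m * a₂) = (l + 1) * ((m + 1) * b) := by rw [← ha₂, ← hlab]; ring
      have h2 : l * (m * a₂) ≤ l * (m * b) := by gcongr
      nlinarith
    have hbN' : b ≤ N := by nlinarith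
    have E1 := BilDecoupling.of_lower hkp hm1 hmk hb hba₂ ha₂N
      (by rw [hkm]; exact ha₂.ge) (Real.rpow_nonneg hp0.le _)
      (mul_nonneg hB (Real.rpow_nonneg hp0.le _)) (hlow m hm1 hmk (a₂ - b))
      (ih a ha1 ha' haN2 m a₂ hm1 hmk (by rw [hkm]; exact ha₂.symm))
    have E2 : BilDecoupling p k N (l - 1) a b (B * (p : ℝ) ^
        (-(gain k t (2 * k * ε) r (l - 1) * b - r * δ - ε * (k * b) - δ))) := by
      rcases Nat.lt_or_ge 1 l with h1l | h1l
      · obtain ⟨a₃, ha₃⟩ : l - 1 ∣ (m + 2) * b := by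
          refine Dvd.dvd.mul_left ?_ _
          refine (Nat.dvd_factorial (by omega) (by omega : l - 1 ≤ k)).trans
            ((dvd_pow_self _ ?_).trans hdvd)
          omega
        have hkl1 : k - (l - 1) = m + 1 := by omega
        have ha₃k : a₃ ≤ k * b :=
          hab (l - 1) a₃ b (by omega) (by omega) (by rw [hkl1]; exact ha₃.symm)
        have haa₃ : a ≤ a₃ := by
          by_contra h
          push Not at h
          obtain ⟨l', rfl⟩ : ∃ n, l = n + 1 := ⟨l - 1, by omega⟩
          simp only [Nat.add_sub_cancel] at ha₃
          have h1 : l' * a₃ < l' * a := Nat.mul_lt_mul_of_pos_left h (by omega)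
          nlinarith
        have ha₃N : a₃ ≤ N := by nlinarith
        refine (BilDecoupling.of_lower hkp (by omega) (by omega) ha1 haa₃ ha₃N
          (by rw [hkl1]; exact ha₃.ge) (Real.rpow_nonneg hp0.le _)
          (mul_nonneg hB (Real.rpow_nonneg hp0.le _)) (hlow (l - 1) (by omega) (by omega) (a₃ - a))
          (ih b hb hb' hbN1 (l - 1) a₃ (by omega) (by omega)
            (by rw [hkl1]; exact ha₃.symm))).mono ?_
        rw [mul_left_comm, ← Real.rpow_add hp0]
        refine mul_le_mul_of_nonneg_left (Real.rpow_le_rpow_of_exponent_le hp1 ?_) hB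
        have h2 : ((a₃ - a : ℕ) : ℝ) ≤ k * b := by
          exact_mod_cast (Nat.sub_le _ _).trans ha₃k
        have := mul_le_mul_of_nonneg_left h2 hε
        linarith
      · obtain rfl : l = 1 := by omega
        refine (BilDecoupling.zero (by omega) hkp hb hbN' (by positivity) (hN b hb hbN')).mono ?_
        refine mul_le_mul_of_nonneg_left (Real.rpow_le_rpow_of_exponent_le hp1 ?_) hB
        rw [Nat.sub_self, gain_zero_right]
        have : 0 ≤ ε * (k * b) := by positivity
        have : 0 ≤ r * δ := by positivity
        linarith
    refine (BilDecoupling.holder hl hlk (by positivity) (by positivity) E1 E2).mono ?_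
    have hmR : (k : ℝ) - l = m := by rw [hklm]; push_cast; ring
    rw [hmR]
    have hmpos : (0 : ℝ) < m + 1 := by positivity
    set θ : ℝ := 1 / (m + 1) with hθ
    have hθ0 : 0 < θ := by positivity
    have hθ1 : 0 ≤ 1 - θ := by
      rw [hθ, sub_nonneg, div_le_one hmpos]; simp
    rw [mul_left_comm, ← Real.rpow_add hp0, Real.mul_rpow hB (Real.rpow_nonneg hp0.le _),
      Real.mul_rpow hB (Real.rpow_nonneg hp0.le _), ← Real.rpow_mul hp0.le, ← Real.rpow_mul hp0.le,
      mul_mul_mul_comm, ← Real.rpow_add_of_nonneg hB hθ0.le hθ1, add_sub_cancel, Real.rpow_one,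
      ← Real.rpow_add hp0]
    refine mul_le_mul_of_nonneg_left (Real.rpow_le_rpow_of_exponent_le hp1 ?_) hB
    have hlR : (0 : ℝ) < l := by exact_mod_cast hl
    have haR : θ * a = b / l := by
      rw [hθ, one_div, inv_mul_eq_div, div_eq_div_iff hmpos.ne' hlR.ne']
      have := congrArg (Nat.cast (R := ℝ)) hlab
      push_cast at this
      linarith
    have h1 : θ * ((a₂ - b : ℕ) : ℝ) ≤ k * b := by
      have h2 : ((a₂ - b : ℕ) : ℝ) ≤ k * a := by exact_mod_cast (Nat.sub_le _ _).trans ha₂k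
      calc θ * ((a₂ - b : ℕ) : ℝ) ≤ θ * (k * a) := mul_le_mul_of_nonneg_left h2 hθ0.le
        _ = k * (b / l) := by rw [← haR]; ring
        _ ≤ k * b := by
          refine mul_le_mul_of_nonneg_left (div_le_self (by positivity) ?_) (by positivity)
          exact_mod_cast hl
    have h3 : gain k t (2 * k * ε) (r + 1) l = gain k t (2 * k * ε) r m / l +
        (1 - θ) * gain k t (2 * k * ε) r (l - 1) - 2 * k * ε := by
      simp only [gain, if_neg (show l ≠ 0 by omega)]
      rw [hmR]
    have h4 : gain k t (2 * k * ε) r m * (θ * a) = gain k t (2 * k * ε) r m * (b / l) := by rw [haR]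
    have h5 := mul_le_mul_of_nonneg_left h1 hε
    have h6 : (1 - θ) * (ε * (k * b)) ≤ ε * (k * b) :=
      mul_le_of_le_one_left (by positivity) (by linarith)
    rw [h3]
    push_cast
    have h7 : (ε * ((a₂ - b : ℕ) : ℝ) + δ + -(gain k t (2 * k * ε) r m * a - r * δ)) * θ +
        -(gain k t (2 * k * ε) r (l - 1) * b - r * δ - ε * (k * b) - δ) * (1 - θ) =
        ε * (θ * ((a₂ - b : ℕ) : ℝ)) - gain k t (2 * k * ε) r m * (θ * a) + (r + 1) * δ -
        (1 - θ) * gain k t (2 * k * ε) r (l - 1) * b + (1 - θ) * (ε * (k * b)) := by ring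
    have h8 : (gain k t (2 * k * ε) r m / l + (1 - θ) * gain k t (2 * k * ε) r (l - 1) -
        2 * k * ε) * b = gain k t (2 * k * ε) r m * (b / l) +
        (1 - θ) * gain k t (2 * k * ε) r (l - 1) * b - 2 * (ε * (k * b)) := by ring
    rw [h7, h4, h8]
    linarith

end

end

end DiagonalSystems

namespace DiagonalSystems

section
variable {p : ℕ} [Fact p.Prime]

lemma Decoupling.of_lower {k : ℕ} (hk : 2 ≤ k) (hkp : k < p) {t δ : ℝ} (ht : 0 < t) (hδ : 0 ≤ δ)
    (hlow : ∀ l, 1 ≤ l → l < k → ∀ M : ℕ,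
      Decoupling p l M ((p : ℝ) ^ (t / (4 * k ^ 2) * M + δ)))
    (hp : 2 * 2 ^ (k * (k + 1)) ≤ (p : ℝ) ^ t) :
    ∃ C : ℝ, 0 < C ∧ ∀ N : ℕ, Decoupling p k N (C * (p : ℝ) ^ (t * N)) := by
  have hp2 : (2 : ℝ) ≤ p := by exact_mod_cast (Fact.out : p.Prime).two_le
  have hp0 : (0 : ℝ) < p := by linarith
  have hp1 : (1 : ℝ) ≤ p := by linarith
  have hk0 : (0 : ℝ) < k := by exact_mod_cast (by omega : 0 < k)
  set q := k * (k + 1) with hq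
  obtain ⟨R, hR⟩ := exists_nat_ge ((((q : ℝ) + 1) * (k + 1) + 2 * q + 2) * (2 * k / t))
  have hRt : ((q : ℝ) + 1) * (k + 1) + 2 * q + 2 ≤ R * (t / (2 * k)) := by
    have := mul_le_mul_of_nonneg_right hR (by positivity : 0 ≤ t / (2 * k))
    have h2 : 2 * (k : ℝ) / t * (t / (2 * k)) = 1 := by field_simp
    rwa [mul_assoc, h2, mul_one] at this
  obtain ⟨l, hl1, hlk, hG⟩ : ∃ l, 1 ≤ l ∧ l < k ∧
      R * (t / (2 * k)) ≤ gain k t (2 * k * (t / (4 * k ^ 2))) R l := by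
    obtain ⟨n, rfl⟩ : ∃ n, k = n + 1 := ⟨k - 1, by omega⟩
    have h1 := le_sum_gain n t (2 * (n + 1 : ℕ) * (t / (4 * (n + 1 : ℕ) ^ 2))) R
    have h2 : ∑ j ∈ range n, R * (t / (2 * (n + 1 : ℕ))) ≤ ∑ j ∈ range n,
        gain (n + 1) t (2 * (n + 1 : ℕ) * (t / (4 * (n + 1 : ℕ) ^ 2))) R (j + 1) := by
      refine le_trans (le_of_eq ?_) h1
      rw [sum_const, card_range, nsmul_eq_mul]
      push_cast
      field_simp
      ring
    obtain ⟨j, hj, hj2⟩ := exists_le_of_sum_le (by simpa using (by omega : n ≠ 0)) h2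
    rw [mem_range] at hj
    exact ⟨j + 1, by omega, by omega, hj2⟩
  set G := gain k t (2 * k * (t / (4 * k ^ 2))) R l
  obtain ⟨B₀, hB₀⟩ := exists_nat_ge (R * δ)
  set b := k.factorial ^ (2 * R + 1) * (B₀ + 1) with hb
  have hfac := Nat.factorial_pos k
  have hb1 : 1 ≤ b := Nat.mul_pos (pow_pos hfac _) (by omega)
  have hbδ : R * δ ≤ b := by
    refine hB₀.trans ?_
    have : B₀ + 1 ≤ b := Nat.le_mul_of_pos_left _ (pow_pos hfac _)
    exact_mod_cast (by omega : B₀ ≤ b)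
  have hdvd : k.factorial ^ (2 * R) ∣ b := dvd_mul_of_dvd_left (pow_dvd_pow _ (by omega)) _
  obtain ⟨c, hc⟩ : l ∣ b := dvd_mul_of_dvd_left
    (dvd_trans (Nat.dvd_factorial hl1 hlk.le) (dvd_pow_self _ (by omega))) _
  set a := (k - l + 1) * c with ha
  have hla : l * a = (k - l + 1) * b := by rw [ha, hc]; ring
  have hc1 : 1 ≤ c := by
    rcases Nat.eq_zero_or_pos c with rfl | h
    · omega
    · exact h
  have ha1 : 1 ≤ a := Nat.mul_pos (by omega) hc1
  have hak : a ≤ k * b := by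
    calc a ≤ l * a := Nat.le_mul_of_pos_left _ hl1
      _ = (k - l + 1) * b := hla
      _ ≤ k * b := Nat.mul_le_mul_right _ (by omega)
  set N₀ := b * k ^ (R + 1) with hN₀
  set C := (p : ℝ) ^ (N₀ * q) with hC
  have hC0 : 0 < C := by positivity
  refine ⟨C, hC0, fun N => ?_⟩
  induction N using Nat.strong_induction_on with
  | _ N ih =>
    rcases lt_or_ge N N₀ with hlt | hge
    · refine (Decoupling.trivial k N (by omega)).mono ?_
      have h1 : (1 : ℝ) ≤ (p : ℝ) ^ (t * N) := Real.one_le_rpow hp1 (by positivity)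
      calc (p : ℝ) ^ (N * q) ≤ C := pow_le_pow_right₀ hp1 (Nat.mul_le_mul_right _ hlt.le)
        _ ≤ C * (p : ℝ) ^ (t * N) := le_mul_of_one_le_right hC0.le h1
    · have hNb : k * b ≤ N := by
        refine le_trans ?_ hge
        rw [hN₀, mul_comm k, pow_succ]
        exact Nat.mul_le_mul_left _ (Nat.le_mul_of_pos_left _ (pow_pos (by omega) _))
      have hbb : b ≤ k * b := Nat.le_mul_of_pos_left _ (by omega)
      have hstep : ∀ c : ℕ, 1 ≤ c → c ≤ N →
          Decoupling p k (N - c) (C * (p : ℝ) ^ (t * N) * (p : ℝ) ^ (-(t * c))) := by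
        intro c hc1 hcN
        refine (ih (N - c) (by omega)).mono (le_of_eq ?_)
        rw [mul_assoc, ← Real.rpow_add hp0, Nat.cast_sub hcN]
        ring_nf
      have h1 := BilDecoupling.level hk hkp ht.le (by positivity) hδ (by positivity) hlow hstep R b
        hb1 hdvd hge l a hl1 hlk hla
      have h2 := Decoupling.of_bilinear hkp hlk ha1 hb1 (by omega) (by omega) (by positivity)
        (by positivity) (hstep 1 le_rfl (by omega)) h1
      refine h2.mono ?_
      have e1 : 2 ^ q * (C * (p : ℝ) ^ (t * N) * (p : ℝ) ^ (-(t * (1 : ℕ)))) ≤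
          C * (p : ℝ) ^ (t * N) / 2 := by
        rw [Nat.cast_one, mul_one, Real.rpow_neg hp0.le]
        have h3 : 0 < (p : ℝ) ^ t := by positivity
        rw [← mul_assoc, ← div_eq_mul_inv, div_le_div_iff₀ h3 two_pos]
        have : 0 ≤ C * (p : ℝ) ^ (t * N) := by positivity
        nlinarith
      have e2 : (p : ℝ) ^ (q * (2 + a + b) + (a + b)) * (C * (p : ℝ) ^ (t * N) *
          (p : ℝ) ^ (-(G * b - R * δ))) ≤ C * (p : ℝ) ^ (t * N) / 2 := by
        have h3 : (p : ℝ) ^ (q * (2 + a + b) + (a + b)) * (p : ℝ) ^ (-(G * b - R * δ)) ≤ 1 / 2 := by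
          rw [← Real.rpow_natCast, ← Real.rpow_add hp0]
          have h4 : ((q * (2 + a + b) + (a + b) : ℕ) : ℝ) + -(G * b - R * δ) ≤ -1 := by
            have hb1' : (1 : ℝ) ≤ b := by exact_mod_cast hb1
            have hak' : (a : ℝ) ≤ k * b := by exact_mod_cast hak
            have hGb := mul_le_mul_of_nonneg_right (hRt.trans hG) (by linarith : (0 : ℝ) ≤ b)
            have hq0 : (0 : ℝ) ≤ q := Nat.cast_nonneg _
            push_cast
            nlinarith
          calc _ ≤ (p : ℝ) ^ (-1 : ℝ) := Real.rpow_le_rpow_of_exponent_le hp1 h4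
            _ ≤ 1 / 2 := by
              rw [Real.rpow_neg_one, one_div]
              exact inv_anti₀ two_pos hp2
        have : 0 ≤ C * (p : ℝ) ^ (t * N) := by positivity
        nlinarith
      linarith

end

/-- Decoupling for moment curves over `ℤ_[p]`, for all large primes `p`. -/
theorem decoupling (k : ℕ) (hk : 1 ≤ k) : ∀ t : ℝ, 0 < t → ∃ p₀ : ℕ, ∀ p : ℕ, ∀ [Fact p.Prime],
    p₀ < p → ∃ C : ℝ, 0 < C ∧ ∀ N : ℕ, Decoupling p k N (C * (p : ℝ) ^ (t * N)) := by
  induction k using Nat.strong_induction_on with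
  | _ k ih =>
    intro t ht
    rcases hk.eq_or_lt with rfl | hk2
    · refine ⟨0, fun p _ _ => ⟨1, one_pos, fun N => (decoupling_one N).mono ?_⟩⟩
      rw [one_mul]
      exact Real.one_le_rpow (by exact_mod_cast (Fact.out : p.Prime).one_le) (by positivity)
    · have hε : 0 < t / (4 * (k : ℝ) ^ 2) := by positivity
      have ih' : ∀ l : Fin k, ∃ p₀ : ℕ, 1 ≤ (l : ℕ) → ∀ p : ℕ, ∀ [Fact p.Prime], p₀ < p →
          ∃ C : ℝ, 0 < C ∧ ∀ N : ℕ,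
            Decoupling p l N (C * (p : ℝ) ^ (t / (4 * (k : ℝ) ^ 2) * N)) := by
        intro l
        by_cases hl : 1 ≤ (l : ℕ)
        · obtain ⟨p₀, h⟩ := ih l l.2 hl _ hε
          exact ⟨p₀, fun _ => h⟩
        · exact ⟨0, fun h => absurd h hl⟩
      choose P₀ hP₀ using ih'
      obtain ⟨m, hm⟩ := exists_nat_ge ((2 * 2 ^ (k * (k + 1)) : ℝ) ^ (1 / t))
      refine ⟨max (univ.sup P₀) (max k m), fun p _ hp => ?_⟩
      rw [max_lt_iff, max_lt_iff] at hp
      obtain ⟨hp1, hp2, hp3⟩ := hp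
      have hpp : (1 : ℝ) < p := by exact_mod_cast (Fact.out : p.Prime).one_lt
      have hC : ∀ l : Fin k, ∃ C : ℝ, 0 < C ∧ (1 ≤ (l : ℕ) → ∀ N : ℕ,
          Decoupling p l N (C * (p : ℝ) ^ (t / (4 * (k : ℝ) ^ 2) * N))) := by
        intro l
        by_cases hl : 1 ≤ (l : ℕ)
        · obtain ⟨C, h0, h⟩ := hP₀ l hl p (lt_of_le_of_lt (le_sup (mem_univ l)) hp1)
          exact ⟨C, h0, fun _ => h⟩
        · exact ⟨1, one_pos, fun h => absurd h hl⟩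
      choose C hC0 hC using hC
      obtain ⟨δ, hδ⟩ := pow_unbounded_of_one_lt (∑ l, C l) hpp
      refine Decoupling.of_lower hk2 hp2 ht (Nat.cast_nonneg δ) (fun l hl hlk M => ?_) ?_
      · refine (hC ⟨l, hlk⟩ hl M).mono ?_
        rw [Real.rpow_add (by linarith), Real.rpow_natCast, mul_comm]
        gcongr
        exact (single_le_sum (fun i _ => (hC0 i).le) (mem_univ _)).trans hδ.le
      · have : (m : ℝ) ≤ p := by exact_mod_cast hp3.le
        calc (2 * 2 ^ (k * (k + 1)) : ℝ) = ((2 * 2 ^ (k * (k + 1)) : ℝ) ^ (1 / t)) ^ t := by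
              rw [← Real.rpow_mul (by positivity), one_div, inv_mul_cancel₀ ht.ne', Real.rpow_one]
          _ ≤ (p : ℝ) ^ t := Real.rpow_le_rpow (by positivity) (hm.trans this) ht.le

end DiagonalSystems

namespace DiagonalSystems

lemma addChar_sum {A M ι : Type} [AddCommMonoid A] [CommMonoid M] (χ : AddChar A M) (s : Finset ι)
    (f : ι → A) : χ (∑ i ∈ s, f i) = ∏ i ∈ s, χ (f i) := by
  classical
  induction s using Finset.induction with
  | empty => simp
  | insert a s ha ih => rw [sum_insert ha, prod_insert ha, AddChar.map_add_eq_mul, ih]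

/-- The number of coincidences of a map is a mean value of exponential sums. -/
lemma card_mul_card_eq_sum_norm_sq {m : ℕ} [NeZero m] {κ V : Type} [Fintype κ] [DecidableEq κ]
    (s : Finset V) (h : V → κ → ZMod m) :
    (#{v ∈ s ×ˢ s | h v.1 = h v.2} : ℝ) * Fintype.card (κ → ZMod m) =
      ∑ w : κ → ZMod m, ‖∑ v ∈ s, (ZMod.toCircle (∑ j, w j * h v j) : ℂ)‖ ^ 2 := by
  have key : ∀ d : κ → ZMod m, ∑ w : κ → ZMod m, (ZMod.toCircle (∑ j, w j * d j) : ℂ) =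
      if d = 0 then (Fintype.card (κ → ZMod m) : ℂ) else 0 := by
    intro d
    split_ifs with hd
    · simp [hd]
    · obtain ⟨j, hj⟩ := Function.ne_iff.1 hd
      have hne : (ZMod.toCircle (d j) : ℂ) ≠ 1 := by
        intro h1
        apply hj
        apply ZMod.injective_toCircle (N := m)
        rw [Pi.zero_apply, AddChar.map_zero_eq_one]
        exact Circle.ext h1
      have h2 : (ZMod.toCircle (d j) : ℂ) * ∑ w : κ → ZMod m, (ZMod.toCircle (∑ j, w j * d j) : ℂ) =
          ∑ w : κ → ZMod m, (ZMod.toCircle (∑ j, w j * d j) : ℂ) := by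
        rw [mul_sum]
        conv_rhs => rw [← Equiv.sum_comp (Equiv.addRight (Pi.single j 1 : κ → ZMod m))]
        refine sum_congr rfl fun w _ => ?_
        rw [← Circle.coe_mul, ← AddChar.map_add_eq_mul]
        congr 2
        simp only [Equiv.coe_addRight, Pi.add_apply, add_mul, sum_add_distrib]
        rw [add_comm]
        congr 1
        rw [sum_eq_single j] <;> simp +contextual
      by_contra h3
      exact hne (mul_right_cancel₀ h3 (by rw [h2, one_mul]))
  rw [← Complex.ofReal_inj]
  push_cast
  have h1 : ∀ w : κ → ZMod m, ((‖∑ v ∈ s, (ZMod.toCircle (∑ j, w j * h v j) : ℂ)‖ : ℂ)) ^ 2 =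
      ∑ v ∈ s ×ˢ s, (ZMod.toCircle (∑ j, w j * (h v.1 j - h v.2 j)) : ℂ) := by
    intro w
    rw [← Complex.mul_conj', map_sum, sum_mul_sum, sum_product]
    refine sum_congr rfl fun v _ => sum_congr rfl fun v' _ => ?_
    rw [← Circle.coe_inv_eq_conj, ← Circle.coe_mul, ← AddChar.map_neg_eq_inv,
      ← AddChar.map_add_eq_mul]
    congr 2
    rw [← sub_eq_add_neg, ← sum_sub_distrib]
    exact sum_congr rfl fun j _ => by ring
  simp_rw [h1]
  rw [sum_comm]
  have h2 : ∀ v ∈ s ×ˢ s, ∑ w : κ → ZMod m,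
      (ZMod.toCircle (∑ j, w j * (h v.1 j - h v.2 j)) : ℂ) =
      if h v.1 = h v.2 then (Fintype.card (κ → ZMod m) : ℂ) else 0 := by
    intro v _
    rw [key fun j => h v.1 j - h v.2 j]
    refine if_congr ?_ rfl rfl
    rw [funext_iff, funext_iff]
    simp [sub_eq_zero]
  rw [sum_congr rfl h2, ← sum_filter, sum_const, nsmul_eq_mul]

section
variable {p : ℕ} [Fact p.Prime]

open Classical in
lemma card_parts_le_card {ι : Type} (x : ι → ℤ_[p]) (N : ℕ) (S : Finset ι) : #(parts x N S) ≤ #S :=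
  card_image_le

lemma hasConductor_toCircle (m : ℕ) :
    HasConductor (p := p) ((ZMod.toCircle (N := p ^ m)).compAddMonoidHom
      (PadicInt.toZModPow m).toAddMonoidHom) m := by
  intro y
  have h0 : (p : ℤ_[p]) ^ m ∣ y ↔ PadicInt.toZModPow m y = 0 := by
    rw [← RingHom.mem_ker, PadicInt.ker_toZModPow, Ideal.mem_span_singleton]
  rw [h0]
  simp only [AddChar.compAddMonoidHom_apply, RingHom.toAddMonoidHom_eq_coe, AddMonoidHom.coe_coe,
    map_mul]
  constructor
  · intro h
    have := h 1
    rw [map_one, one_mul, ← AddChar.map_zero_eq_one (ZMod.toCircle (N := p ^ m))] at this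
    exact ZMod.injective_toCircle this
  · intro h u
    rw [h, mul_zero, AddChar.map_zero_eq_one]

lemma Decoupling.moment_le {k N P : ℕ} (hk : 1 ≤ k) (hP : P ≤ p ^ N) {E : ℝ} (hE : 0 ≤ E)
    (h : Decoupling p k N E) :
    ∑ w : Fin k → ZMod (p ^ (k * N)), ‖∑ i ∈ Icc 1 P,
      (ZMod.toCircle (∑ j, w j * (i : ZMod (p ^ (k * N))) ^ (j + 1 : ℕ)) : ℂ)‖ ^ (k * (k + 1)) ≤
    E * P ^ ((k * (k + 1) : ℕ) / 2 : ℝ) * Fintype.card (Fin k → ZMod (p ^ (k * N))) := by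
  classical
  set M := k * N
  set q := k * (k + 1) with hq
  have hq0 : 0 < q := by positivity
  have hq0' : (0 : ℝ) < q := by exact_mod_cast hq0
  set g : ℕ → (Fin k → ZMod (p ^ M)) → ℂ := fun i w =>
    (ZMod.toCircle (∑ j, w j * (i : ZMod (p ^ M)) ^ (j + 1 : ℕ)) : ℂ) with hg
  have hsys : IsSystem ((ZMod.toCircle (N := p ^ M)).compAddMonoidHom
      (PadicInt.toZModPow M).toAddMonoidHom) (fun j : Fin k => (Polynomial.X : Polynomial ℤ_[p]) ^ (j + 1 : ℕ))
      (fun _ => (1 : ℝ)) g (fun i => (i : ℤ_[p])) (Icc 1 P) := by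
    refine ⟨fun _ => zero_le_one, fun u => ⟨Equiv.addRight fun j => PadicInt.toZModPow M (u j), 1,
      fun _ => rfl, fun i _ w => ?_⟩⟩
    simp only [hg, Equiv.coe_addRight, Pi.add_apply, add_mul, sum_add_distrib, Polynomial.eval_pow,
      Polynomial.eval_X, AddChar.compAddMonoidHom_apply, RingHom.toAddMonoidHom_eq_coe,
      AddMonoidHom.coe_coe, map_sum, map_mul, map_pow, map_natCast, Circle.coe_one, one_mul]
    rw [AddChar.map_add_eq_mul, Circle.coe_mul, mul_comm]
  have h1 := h _ _ _ _ _ g _ (Icc 1 P) (hasConductor_toCircle M) (fun j => ⟨0, by simp⟩) hsys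
  simp only [energy, one_mul] at h1
  refine h1.trans ?_
  set D : ℝ := ((Fintype.card (Fin k → ZMod (p ^ M)) : ℕ) : ℝ) with hD
  have hY : sqEnergy (fun _ => (1 : ℝ)) g (fun i => (i : ℤ_[p])) q N (Icc 1 P) ≤
      P * D ^ (2 / q : ℝ) := by
    have h2 : ∀ B ∈ parts (fun i : ℕ => (i : ℤ_[p])) N (Icc 1 P),
        energy (fun _ => (1 : ℝ)) g q B ^ (2 / q : ℝ) = D ^ (2 / q : ℝ) := by
      intro B hB
      obtain ⟨i, hi⟩ := nonempty_of_mem_parts hB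
      have hBi : B = {i} := by
        refine eq_singleton_iff_unique_mem.2 ⟨hi, fun j hj => ?_⟩
        have h3 := dvd_of_mem_parts hB hj hi
        have h4 : (p : ℤ_[p]) ^ N ∣ (((j : ℤ) - i : ℤ) : ℤ_[p]) := by simpa using h3
        rw [PadicInt.pow_p_dvd_int_iff] at h4
        have hi' := mem_Icc.1 (subset_of_mem_parts hB hi)
        have hj' := mem_Icc.1 (subset_of_mem_parts hB hj)
        have hP' : (P : ℤ) ≤ (p : ℤ) ^ N := by exact_mod_cast hP
        have := Int.eq_zero_of_abs_lt_dvd h4 (by rw [abs_lt]; constructor <;> omega)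
        omega
      rw [hBi]
      simp only [energy, sum_singleton, hg, Circle.norm_coe, one_pow, mul_one, sum_const, card_univ,
        nsmul_eq_mul, hD]
    rw [sqEnergy, sum_congr rfl h2, sum_const, nsmul_eq_mul]
    refine mul_le_mul_of_nonneg_right ?_ (by positivity)
    have h5 : #(parts (fun i : ℕ => (i : ℤ_[p])) N (Icc 1 P)) ≤ P := by
      exact (card_parts_le_card _ _ _).trans (by simp)
    exact_mod_cast h5
  have hD0 : 0 ≤ D := by positivity
  rw [mul_assoc]
  refine mul_le_mul_of_nonneg_left ?_ hE
  calc _ ≤ (P * D ^ (2 / q : ℝ)) ^ (q / 2 : ℝ) :=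
        Real.rpow_le_rpow (sqEnergy_nonneg (fun _ => zero_le_one) _ _ _) hY (by positivity)
    _ = _ := by
      rw [Real.mul_rpow (by positivity) (by positivity), ← Real.rpow_mul hD0]
      congr 1
      rw [div_mul_div_cancel₀ hq0'.ne', div_self two_ne_zero, Real.rpow_one]

end

/-- Vinogradov's mean value theorem in the supercritical range. -/
theorem vinogradov (k σ : ℕ) (hk : 1 ≤ k) (hσ : k * (k + 1) ≤ 2 * σ) {ε : ℝ} (hε : 0 < ε) :
    ∃ C : ℝ, 0 < C ∧ ∀ P : ℕ, 1 ≤ P →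
      (#{v ∈ Fintype.piFinset (fun _ : Fin σ => Icc 1 P) ×ˢ
          Fintype.piFinset (fun _ : Fin σ => Icc 1 P) |
        ∀ j : Fin k, ∑ i, v.1 i ^ (j + 1 : ℕ) = ∑ i, v.2 i ^ (j + 1 : ℕ)} : ℝ) ≤
      C * (P : ℝ) ^ ((2 * σ : ℕ) - (k * (k + 1) : ℕ) / 2 + ε : ℝ) := by
  obtain ⟨p₀, hp₀⟩ := decoupling k hk ε hε
  obtain ⟨p, hp1, hp2⟩ := Nat.exists_infinite_primes (p₀ + 1)
  have : Fact p.Prime := ⟨hp2⟩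
  obtain ⟨C, hC0, hC⟩ := hp₀ p (by omega)
  have hp0 : (0 : ℝ) < p := by exact_mod_cast hp2.pos
  refine ⟨C * (p : ℝ) ^ ε, by positivity, fun P hP => ?_⟩
  have hP0 : (0 : ℝ) < P := by exact_mod_cast hP
  set N := Nat.clog p P with hN
  have hPN : P ≤ p ^ N := Nat.le_pow_clog hp2.one_lt P
  have hpN : (p : ℝ) ^ N ≤ p * P := by
    rcases Nat.eq_zero_or_pos N with h0 | h0
    · rw [h0, pow_zero]
      have : (1 : ℝ) ≤ p := by exact_mod_cast hp2.one_le
      have : (1 : ℝ) ≤ P := by exact_mod_cast hP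
      nlinarith
    · have h1 : p ^ (N - 1) < P := Nat.pow_pred_clog_lt_self hp2.one_lt (by
        by_contra hcon
        rw [hN, Nat.clog_of_right_le_one (by omega)] at h0
        omega)
      have h2 : (p : ℝ) ^ (N - 1) ≤ P := by exact_mod_cast h1.le
      obtain ⟨n, hn⟩ : ∃ n, N = n + 1 := ⟨N - 1, by omega⟩
      rw [hn, Nat.add_sub_cancel] at h2
      rw [hn, pow_succ, mul_comm]
      exact mul_le_mul_of_nonneg_left h2 hp0.le
  set M := k * N with hM
  set D : ℝ := ((Fintype.card (Fin k → ZMod (p ^ M)) : ℕ) : ℝ) with hD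
  have hD0 : 0 < D := by
    rw [hD]
    exact_mod_cast Fintype.card_pos
  set q := k * (k + 1) with hq
  set f : (Fin k → ZMod (p ^ M)) → ℂ := fun w => ∑ i ∈ Icc 1 P,
      (ZMod.toCircle (∑ j, w j * (i : ZMod (p ^ M)) ^ (j + 1 : ℕ)) : ℂ) with hf
  have hmom := (hC N).moment_le hk hPN (by positivity)
  have hcount := card_mul_card_eq_sum_norm_sq (Fintype.piFinset (fun _ : Fin σ => Icc 1 P))
    (fun v (j : Fin k) => ∑ i, (v i : ZMod (p ^ M)) ^ (j + 1 : ℕ))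
  have hfσ : ∀ w : Fin k → ZMod (p ^ M), ∑ v ∈ Fintype.piFinset (fun _ : Fin σ => Icc 1 P),
      (ZMod.toCircle (∑ j, w j * ∑ i, (v i : ZMod (p ^ M)) ^ (j + 1 : ℕ)) : ℂ) = f w ^ σ := by
    intro w
    rw [show f w ^ σ = ∏ _i : Fin σ, f w by simp, hf]
    simp only
    rw [prod_univ_sum]
    refine sum_congr rfl fun v _ => ?_
    simp_rw [mul_sum]
    rw [sum_comm, addChar_sum]
    exact map_prod Circle.coeHom _ _
  simp_rw [hfσ] at hcount
  have hf1 : ∀ w, ‖f w‖ ≤ P := by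
    intro w
    refine (norm_sum_le _ _).trans (le_of_eq ?_)
    simp only [Circle.norm_coe, sum_const, Nat.card_Icc, nsmul_eq_mul]
    simp
  have hsum : ∑ w, ‖f w ^ σ‖ ^ 2 ≤ (P : ℝ) ^ (2 * σ - q) * ∑ w, ‖f w‖ ^ q := by
    rw [mul_sum]
    refine sum_le_sum fun w _ => ?_
    rw [norm_pow, ← pow_mul, mul_comm σ 2]
    calc ‖f w‖ ^ (2 * σ) = ‖f w‖ ^ (2 * σ - q) * ‖f w‖ ^ q := by
          rw [← pow_add, Nat.sub_add_cancel hσ]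
      _ ≤ _ := by gcongr; exact hf1 w
  have hle : (#{v ∈ Fintype.piFinset (fun _ : Fin σ => Icc 1 P) ×ˢ
          Fintype.piFinset (fun _ : Fin σ => Icc 1 P) |
        ∀ j : Fin k, ∑ i, v.1 i ^ (j + 1 : ℕ) = ∑ i, v.2 i ^ (j + 1 : ℕ)} : ℝ) * D ≤
      (P : ℝ) ^ (2 * σ - q) * (C * p ^ (ε * N) * P ^ (q / 2 : ℝ) * D) := by
    refine le_trans (mul_le_mul_of_nonneg_right ?_ hD0.le) (hcount.le.trans (hsum.trans
      (mul_le_mul_of_nonneg_left hmom (by positivity))))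
    norm_cast
    refine card_le_card (monotone_filter_right _ ?_)
    intro v _ hv
    funext j
    exact_mod_cast congrArg (Nat.cast : ℕ → ZMod (p ^ M)) (hv j)
  have hle2 : (#{v ∈ Fintype.piFinset (fun _ : Fin σ => Icc 1 P) ×ˢ
          Fintype.piFinset (fun _ : Fin σ => Icc 1 P) |
        ∀ j : Fin k, ∑ i, v.1 i ^ (j + 1 : ℕ) = ∑ i, v.2 i ^ (j + 1 : ℕ)} : ℝ) ≤
      (P : ℝ) ^ (2 * σ - q) * (C * p ^ (ε * N) * P ^ (q / 2 : ℝ)) := by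
    refine le_of_mul_le_mul_right ?_ hD0
    linarith
  refine hle2.trans ?_
  have hpε : (p : ℝ) ^ (ε * N) ≤ (p : ℝ) ^ ε * (P : ℝ) ^ ε := by
    rw [mul_comm ε, Real.rpow_mul hp0.le, Real.rpow_natCast, ← Real.mul_rpow hp0.le hP0.le]
    exact Real.rpow_le_rpow (by positivity) hpN hε.le
  calc (P : ℝ) ^ (2 * σ - q) * (C * p ^ (ε * N) * P ^ (q / 2 : ℝ))
      ≤ (P : ℝ) ^ (2 * σ - q) * (C * ((p : ℝ) ^ ε * (P : ℝ) ^ ε) * P ^ (q / 2 : ℝ)) := by gcongr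
    _ = C * (p : ℝ) ^ ε * ((P : ℝ) ^ (2 * σ - q) * (P : ℝ) ^ ε * P ^ (q / 2 : ℝ)) := by ring
    _ = _ := by
      rw [← Real.rpow_natCast, ← Real.rpow_add hP0, ← Real.rpow_add hP0, Nat.cast_sub hσ]
      congr 2
      ring

end DiagonalSystems

namespace DiagonalSystems

noncomputable section
open MeasureTheory

/-- The additive character `x ↦ exp (2πix)`. -/
def e (x : ℝ) : ℂ := (Real.fourierChar x : ℂ)

lemma e_eq_exp (x : ℝ) : e x = Complex.exp (2 * Real.pi * x * Complex.I) := by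
  rw [e, Real.fourierChar_apply]
  push_cast
  rfl

@[simp] lemma e_zero : e 0 = 1 := by simp [e]

lemma e_add (x y : ℝ) : e (x + y) = e x * e y := by simp [e, AddChar.map_add_eq_mul]

@[simp] lemma norm_e (x : ℝ) : ‖e x‖ = 1 := Circle.norm_coe _

lemma e_neg (x : ℝ) : e (-x) = (starRingEnd ℂ) (e x) := by
  rw [e, e, AddChar.map_neg_eq_inv, Circle.coe_inv_eq_conj]

@[simp] lemma e_intCast (n : ℤ) : e n = 1 := by
  rw [e_eq_exp, Complex.exp_eq_one_iff]
  exact ⟨n, by push_cast; ring⟩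

@[simp] lemma e_natCast (n : ℕ) : e n = 1 := by exact_mod_cast e_intCast n

lemma e_add_intCast (x : ℝ) (n : ℤ) : e (x + n) = e x := by rw [e_add, e_intCast, mul_one]

lemma e_sum {ι : Type} (s : Finset ι) (f : ι → ℝ) : e (∑ i ∈ s, f i) = ∏ i ∈ s, e (f i) := by
  classical
  induction s using Finset.induction with
  | empty => simp
  | insert a s ha ih => rw [sum_insert ha, prod_insert ha, e_add, ih]

@[fun_prop] lemma continuous_e : Continuous e := by
  unfold e
  fun_prop

lemma norm_e_sub_one_le (x : ℝ) : ‖e x - 1‖ ≤ 2 * Real.pi * |x| := by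
  have h := Real.norm_exp_I_mul_ofReal_sub_one_le (x := 2 * Real.pi * x)
  rw [e_eq_exp]
  rw [Real.norm_eq_abs, abs_mul, abs_of_pos Real.two_pi_pos] at h
  convert h using 4
  push_cast
  ring

lemma norm_e_sub_e_le (x y : ℝ) : ‖e x - e y‖ ≤ 2 * Real.pi * |x - y| := by
  have h : e x - e y = e y * (e (x - y) - 1) := by
    rw [mul_sub, ← e_add]
    ring_nf
  rw [h, norm_mul, norm_e, one_mul]
  exact norm_e_sub_one_le _

lemma setIntegral_e_mul_int (n : ℤ) :
    ∫ x in Set.Icc (0 : ℝ) 1, e (x * n) = if n = 0 then 1 else 0 := by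
  split_ifs with h
  · simp [h]
  · rw [integral_Icc_eq_integral_Ioc, ← intervalIntegral.integral_of_le zero_le_one]
    have hc : (2 * Real.pi * Complex.I * n : ℂ) ≠ 0 := by
      have : (n : ℂ) ≠ 0 := by exact_mod_cast h
      have := Real.pi_ne_zero
      simp [*]
    have h1 : ∀ x : ℝ, e (x * n) = Complex.exp ((2 * Real.pi * Complex.I * n) * x) := by
      intro x
      rw [e_eq_exp]
      push_cast
      ring_nf
    simp_rw [h1]
    rw [integral_exp_mul_complex hc, ← h1, ← h1]
    simp

section
variable {I : Type} [Fintype I]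

lemma volume_restrict_unitCube :
    (volume : Measure (I → ℝ)).restrict (Set.Icc 0 1) =
      Measure.pi fun _ => (volume : Measure ℝ).restrict (Set.Icc 0 1) := by
  rw [volume_pi, ← Set.pi_univ_Icc, Measure.restrict_pi_pi]
  rfl

lemma setIntegral_e_sum_mul_int (c : I → ℤ) :
    ∫ x in Set.Icc (0 : I → ℝ) 1, e (∑ i, x i * c i) = if c = 0 then 1 else 0 := by
  simp_rw [e_sum]
  rw [volume_restrict_unitCube, integral_fintype_prod_eq_prod (𝕜 := ℂ) (f := fun i t => e (t * c i))]
  simp_rw [setIntegral_e_mul_int]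
  rw [Fintype.prod_ite_zero]
  simp only [prod_const_one]
  exact if_congr (by simp [funext_iff]) rfl rfl

instance : IsProbabilityMeasure ((volume : Measure (I → ℝ)).restrict (Set.Icc 0 1)) := by
  rw [volume_restrict_unitCube]
  have : IsProbabilityMeasure ((volume : Measure ℝ).restrict (Set.Icc 0 1)) := ⟨by simp⟩
  infer_instance

lemma setIntegral_norm_sq_sum_e {V : Type} (s : Finset V) (H : V → I → ℤ) :
    ∫ x in Set.Icc (0 : I → ℝ) 1, ‖∑ v ∈ s, e (∑ i, x i * H v i)‖ ^ 2 =
      #{v ∈ s ×ˢ s | H v.1 = H v.2} := by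
  rw [← Complex.ofReal_inj, ← integral_complex_ofReal]
  push_cast
  have h1 : ∀ x : I → ℝ, (‖∑ v ∈ s, e (∑ i, x i * H v i)‖ : ℂ) ^ 2 =
      ∑ v ∈ s ×ˢ s, e (∑ i, x i * (H v.1 i - H v.2 i : ℤ)) := by
    intro x
    rw [← Complex.mul_conj', map_sum, sum_mul_sum, sum_product]
    refine sum_congr rfl fun v _ => sum_congr rfl fun v' _ => ?_
    rw [← e_neg, ← e_add, ← sub_eq_add_neg, ← sum_sub_distrib]
    congr 1
    exact sum_congr rfl fun j _ => by push_cast; ring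
  simp_rw [h1]
  rw [integral_finsetSum]
  · have h2 : ∀ v : V × V, (fun i => H v.1 i - H v.2 i) = 0 ↔ H v.1 = H v.2 := by
      intro v
      simp [funext_iff, sub_eq_zero]
    simp_rw [setIntegral_e_sum_mul_int (I := I) fun i => _ - _, h2]
    rw [← sum_filter, sum_const, nsmul_eq_mul, mul_one]
  · intro v _
    exact (Continuous.integrableOn_Icc (by fun_prop))

end

end

end DiagonalSystems

namespace DiagonalSystems

lemma card_sub_eq_le {V G : Type} [AddCommGroup G] [DecidableEq G] (s : Finset V) (H : V → G)
    (h : G) :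
    #{v ∈ s ×ˢ s | H v.1 - H v.2 = h} ≤ #{v ∈ s ×ˢ s | H v.1 = H v.2} := by
  set r : G → ℕ := fun w => #{v ∈ s | H v = w} with hr
  have hcount : ∀ h : G, #{v ∈ s ×ˢ s | H v.1 - H v.2 = h} = ∑ w ∈ s.image H, r (w + h) * r w := by
    intro h
    rw [card_eq_sum_card_fiberwise (f := fun v : V × V => H v.2) (t := s.image H)]
    · refine sum_congr rfl fun w _ => ?_
      rw [hr, ← card_product]
      congr 1
      ext v
      simp only [mem_filter, mem_product]
      constructor
      · rintro ⟨⟨⟨h1, h2⟩, h3⟩, h4⟩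
        exact ⟨⟨h1, by rw [← h4, ← h3]; abel⟩, h2, h4⟩
      · rintro ⟨⟨h1, h3⟩, h2, h4⟩
        exact ⟨⟨⟨h1, h2⟩, by rw [h3, h4]; abel⟩, h4⟩
    · intro v hv
      simp only [coe_filter, mem_product, Set.mem_ofPred_eq] at hv
      exact mem_coe.2 (mem_image_of_mem _ hv.1.2)
  have h0 : #{v ∈ s ×ˢ s | H v.1 = H v.2} = ∑ w ∈ s.image H, r w * r w := by
    have := hcount 0
    simpa [sub_eq_zero] using this
  rw [hcount, h0]
  have h1 : ∑ w ∈ s.image H, r (w + h) * r (w + h) ≤ ∑ w ∈ s.image H, r w * r w := by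
    have h2 : ∑ w ∈ s.image H, r (w + h) * r (w + h) =
        ∑ w ∈ (s.image H).image (· + h), r w * r w := by
      rw [sum_image fun a _ b _ hab => add_right_cancel hab]
    rw [h2]
    refine sum_le_sum_of_ne_zero fun w _ hw => ?_
    have : r w ≠ 0 := fun h => hw (by rw [h, zero_mul])
    rw [hr, Ne, card_eq_zero, ← Ne, ← nonempty_iff_ne_empty] at this
    obtain ⟨v, hv⟩ := this
    rw [mem_filter] at hv
    exact mem_image.2 ⟨v, hv.1, hv.2⟩
  have h3 : 2 * ∑ w ∈ s.image H, r (w + h) * r w ≤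
      ∑ w ∈ s.image H, r (w + h) * r (w + h) + ∑ w ∈ s.image H, r w * r w := by
    rw [mul_sum, ← sum_add_distrib]
    refine sum_le_sum fun w _ => ?_
    zify
    nlinarith [sq_nonneg ((r (w + h) : ℤ) - r w)]
  omega

/-- Pairs of `σ`-tuples of positive integers up to `P` whose power sums of degree `j ∈ T`
differ by `h j`. -/
def powerSumPairs (σ P : ℕ) (T : Finset ℕ) (h : ℕ → ℤ) : Finset ((Fin σ → ℕ) × (Fin σ → ℕ)) :=
  {v ∈ Fintype.piFinset (fun _ : Fin σ => Icc 1 P) ×ˢ Fintype.piFinset (fun _ : Fin σ => Icc 1 P) |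
    ∀ j ∈ T, ∑ i, (v.1 i : ℤ) ^ j - ∑ i, (v.2 i : ℤ) ^ j = h j}

lemma sum_icc_eq_sum_fin {M : Type} [AddCommMonoid M] (k : ℕ) (f : ℕ → M) :
    ∑ j ∈ Icc 1 k, f j = ∑ j : Fin k, f (j + 1) := by
  rw [Fin.sum_univ_eq_sum_range (fun j => f (j + 1)), range_eq_Ico, sum_Ico_add' f 0 k 1,
    zero_add]
  rfl

theorem card_powerSumPairs_le (k σ : ℕ) (hk : 1 ≤ k) (hσ : k * (k + 1) ≤ 2 * σ) {T : Finset ℕ}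
    (hT : T ⊆ Icc 1 k) {ε : ℝ} (hε : 0 < ε) : ∃ C : ℝ, 0 < C ∧ ∀ P : ℕ, 1 ≤ P → ∀ h : ℕ → ℤ,
      (#(powerSumPairs σ P T h) : ℝ) ≤ C * (P : ℝ) ^ ((2 * σ : ℕ) - (∑ j ∈ T, j : ℕ) + ε : ℝ) := by
  obtain ⟨C, hC0, hC⟩ := vinogradov k σ hk hσ hε
  refine ⟨(2 * σ + 1) ^ k * C, by positivity, fun P hP h => ?_⟩
  have hP0 : (0 : ℝ) < P := by exact_mod_cast hP
  have hP1 : (1 : ℝ) ≤ P := by exact_mod_cast hP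
  set s := Fintype.piFinset (fun _ : Fin σ => Icc 1 P) with hs
  set H : (Fin σ → ℕ) → Fin k → ℤ := fun v j => ∑ i, (v i : ℤ) ^ (j + 1 : ℕ) with hH
  set box : Finset (Fin k → ℤ) := Fintype.piFinset fun j : Fin k =>
    if (j + 1 : ℕ) ∈ T then {h (j + 1)} else Icc (-(σ * P ^ (j + 1 : ℕ)) : ℤ) (σ * P ^ (j + 1 : ℕ))
    with hbox
  have hHb : ∀ v ∈ s, ∀ j, 0 ≤ H v j ∧ H v j ≤ σ * P ^ (j + 1 : ℕ) := by
    intro v hv j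
    refine ⟨sum_nonneg fun i _ => by positivity, ?_⟩
    calc H v j ≤ ∑ i : Fin σ, (P : ℤ) ^ (j + 1 : ℕ) := by
          refine sum_le_sum fun i _ => ?_
          have := (mem_Icc.1 (Fintype.mem_piFinset.1 hv i)).2
          gcongr
      _ = _ := by simp
  have h1 : #(powerSumPairs σ P T h) ≤ #box * #{v ∈ s ×ˢ s | H v.1 = H v.2} := by
    rw [← smul_eq_mul]
    rw [card_eq_sum_card_fiberwise (f := fun v => H v.1 - H v.2) (t := box)]
    · refine sum_le_card_nsmul _ _ _ fun g _ => ?_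
      refine le_trans (card_le_card ?_) (card_sub_eq_le s H g)
      intro v hv
      rw [mem_filter, powerSumPairs, mem_filter] at hv
      rw [mem_filter]
      exact ⟨hv.1.1, hv.2⟩
    · intro v hv
      rw [mem_coe, powerSumPairs, mem_filter, mem_product] at hv
      refine mem_coe.2 (Fintype.mem_piFinset.2 fun j => ?_)
      split_ifs with hj
      · rw [mem_singleton]
        exact hv.2 _ hj
      · have h1 := hHb _ hv.1.1 j
        have h2 := hHb _ hv.1.2 j
        simp only [mem_Icc, Pi.sub_apply]
        constructor <;> linarith
  have h2 : (#box : ℝ) ≤ (2 * σ + 1) ^ k * (P : ℝ) ^ ((k * (k + 1) : ℕ) / 2 - (∑ j ∈ T, j : ℕ) : ℝ) := by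
    have h3 : (#box : ℝ) ≤ ∏ j : Fin k, (2 * σ + 1) * (P : ℝ) ^ (if (j + 1 : ℕ) ∈ T then 0 else (j + 1 : ℕ)) := by
      rw [hbox, Fintype.card_piFinset]
      push_cast
      refine prod_le_prod (fun _ _ => by positivity) fun j _ => ?_
      split_ifs with hj
      · simp
      · rw [Int.card_Icc]
        have h4 : ((σ * P ^ (j + 1 : ℕ) + 1 - -(σ * P ^ (j + 1 : ℕ)) : ℤ).toNat : ℤ) =
            2 * (σ * P ^ (j + 1 : ℕ)) + 1 := by
          have h9 : (0 : ℤ) ≤ σ * P ^ (j + 1 : ℕ) := by positivity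
          rw [Int.toNat_of_nonneg (by linarith)]
          ring
        have h5 : ((σ * P ^ (j + 1 : ℕ) + 1 - -(σ * P ^ (j + 1 : ℕ)) : ℤ).toNat : ℝ) =
            2 * (σ * P ^ (j + 1 : ℕ)) + 1 := by exact_mod_cast h4
        rw [h5]
        have : (1 : ℝ) ≤ P ^ (j + 1 : ℕ) := one_le_pow₀ hP1
        nlinarith
    refine h3.trans (le_of_eq ?_)
    rw [prod_mul_distrib, prod_const, card_univ, Fintype.card_fin, prod_pow_eq_pow_sum]
    congr 1
    rw [← Real.rpow_natCast]
    congr 1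
    rw [← sum_icc_eq_sum_fin k (fun j => if j ∈ T then 0 else j), sum_ite, sum_const_zero, zero_add]
    have h6 : ∑ j ∈ Icc 1 k, (j : ℝ) = (k * (k + 1) : ℕ) / 2 := by
      have := Finset.sum_range_id_mul_two (k + 1)
      rw [sum_icc_eq_sum_fin k (fun j => (j : ℝ)), Fin.sum_univ_eq_sum_range (fun j => ((j + 1 : ℕ) : ℝ))]
      rw [sum_range_succ'] at this
      have h7 : ((∑ j ∈ range k, (j + 1) : ℕ) : ℝ) * 2 = (k * (k + 1) : ℕ) := by
        norm_cast
        simpa [mul_comm] using this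
      push_cast at h7 ⊢
      linarith
    have h8 : ∑ j ∈ (Icc 1 k).filter (· ∉ T), (j : ℝ) + ∑ j ∈ T, (j : ℝ) = ∑ j ∈ Icc 1 k, (j : ℝ) := by
      rw [← sum_filter_add_sum_filter_not (Icc 1 k) (· ∈ T), filter_mem_eq_inter,
        inter_eq_right.2 hT, add_comm]
    rw [h6] at h8
    push_cast at h8 ⊢
    linarith
  have h3 : (#{v ∈ s ×ˢ s | H v.1 = H v.2} : ℝ) ≤
      C * (P : ℝ) ^ ((2 * σ : ℕ) - (k * (k + 1) : ℕ) / 2 + ε : ℝ) := by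
    refine le_trans (le_of_eq ?_) (hC P hP)
    congr 2
    refine filter_congr fun v _ => ?_
    rw [funext_iff]
    refine forall_congr' fun j => ?_
    simp only [hH]
    norm_cast
  calc (#(powerSumPairs σ P T h) : ℝ) ≤ #box * #{v ∈ s ×ˢ s | H v.1 = H v.2} := by exact_mod_cast h1
    _ ≤ ((2 * σ + 1) ^ k * (P : ℝ) ^ ((k * (k + 1) : ℕ) / 2 - (∑ j ∈ T, j : ℕ) : ℝ)) *
        (C * (P : ℝ) ^ ((2 * σ : ℕ) - (k * (k + 1) : ℕ) / 2 + ε : ℝ)) := by gcongr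
    _ = (2 * σ + 1) ^ k * C * ((P : ℝ) ^ ((k * (k + 1) : ℕ) / 2 - (∑ j ∈ T, j : ℕ) : ℝ) *
        (P : ℝ) ^ ((2 * σ : ℕ) - (k * (k + 1) : ℕ) / 2 + ε : ℝ)) := by ring
    _ = _ := by
      rw [← Real.rpow_add hP0]
      congr 2
      ring

end DiagonalSystems

namespace DiagonalSystems

noncomputable section
open MeasureTheory

section
variable {I : Type} [Fintype I]

/-- The exponential sum `∑_{x ≤ P} e(∑ᵢ βᵢ x ^ dᵢ)`. -/
def expSum (d : I → ℕ) (P : ℕ) (β : I → ℝ) : ℂ :=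
  ∑ x ∈ Icc 1 P, e (∑ i, β i * (x : ℝ) ^ d i)

lemma norm_expSum_le (d : I → ℕ) (P : ℕ) (β : I → ℝ) : ‖expSum d P β‖ ≤ P := by
  refine (norm_sum_le _ _).trans (le_of_eq ?_)
  simp only [norm_e, sum_const, nsmul_eq_mul, mul_one, Nat.card_Icc, Nat.add_sub_cancel]

@[fun_prop] lemma continuous_expSum (d : I → ℕ) (P : ℕ) : Continuous (expSum d P) := by
  unfold expSum
  fun_prop

lemma setIntegral_expSum_pair (d : I → ℕ) (σ P : ℕ) (a b : I → ℤ) :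
    ∫ α in Set.Icc (0 : I → ℝ) 1, (‖expSum d P fun i => α i * a i‖ *
      ‖expSum d P fun i => α i * b i‖) ^ (2 * σ) =
    #{v ∈ (Fintype.piFinset (fun _ : Fin σ => Icc 1 P) ×ˢ
          Fintype.piFinset (fun _ : Fin σ => Icc 1 P)) ×ˢ
        (Fintype.piFinset (fun _ : Fin σ => Icc 1 P) ×ˢ
          Fintype.piFinset (fun _ : Fin σ => Icc 1 P)) |
      (fun i => a i * ∑ l, (v.1.1 l : ℤ) ^ d i + b i * ∑ l, (v.1.2 l : ℤ) ^ d i) =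
      fun i => a i * ∑ l, (v.2.1 l : ℤ) ^ d i + b i * ∑ l, (v.2.2 l : ℤ) ^ d i} := by
  set s := Fintype.piFinset (fun _ : Fin σ => Icc 1 P)
  rw [← setIntegral_norm_sq_sum_e (s ×ˢ s)
    fun v i => a i * ∑ l, (v.1 l : ℤ) ^ d i + b i * ∑ l, (v.2 l : ℤ) ^ d i]
  refine setIntegral_congr_fun measurableSet_Icc fun α _ => ?_
  have h1 : ∀ c : I → ℤ, (expSum d P fun i => α i * c i) ^ σ =
      ∑ v ∈ s, e (∑ i, α i * c i * ∑ l, (v l : ℝ) ^ d i) := by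
    intro c
    rw [show (expSum d P fun i => α i * c i) ^ σ =
      ∏ _l : Fin σ, expSum d P fun i => α i * c i by simp]
    simp only [expSum]
    rw [prod_univ_sum]
    refine sum_congr rfl fun v _ => ?_
    rw [← e_sum, sum_comm]
    simp_rw [mul_sum]
  rw [mul_comm 2 σ, pow_mul, mul_pow, ← norm_pow, ← norm_pow, h1, h1, ← norm_mul, sum_mul_sum,
    sum_product]
  congr 2
  refine sum_congr rfl fun v _ => sum_congr rfl fun v' _ => ?_
  rw [← e_add, ← sum_add_distrib]
  congr 1
  refine sum_congr rfl fun i _ => ?_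
  push_cast
  ring

/-- The pair of columns `a`, `b` separates the power sums with degrees in `T` and `T'`. -/
def Separates (d : I → ℕ) (a b : I → ℤ) (T T' : Finset ℕ) : Prop :=
  ∃ h : (ℕ → ℤ) → ℕ → ℤ, ∀ u w : ℕ → ℤ, (∀ i, a i * u (d i) + b i * w (d i) = 0) →
    (∀ j ∈ T', w j = 0) ∧ ∀ j ∈ T, u j = h w j

lemma setIntegral_expSum_pair_le (d : I → ℕ) {k σ : ℕ} (hk : 1 ≤ k) (hσ : k * (k + 1) ≤ 2 * σ)
    {T T' : Finset ℕ} (hT : T ⊆ Icc 1 k) (hT' : T' ⊆ Icc 1 k) {ε : ℝ} (hε : 0 < ε) :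
    ∃ C : ℝ, 0 < C ∧ ∀ a b : I → ℤ, Separates d a b T T' → ∀ P : ℕ, 1 ≤ P →
    ∫ α in Set.Icc (0 : I → ℝ) 1, (‖expSum d P fun i => α i * a i‖ *
      ‖expSum d P fun i => α i * b i‖) ^ (2 * σ) ≤
      C * (P : ℝ) ^ ((4 * σ : ℕ) - (∑ j ∈ T, j + ∑ j ∈ T', j : ℕ) + ε : ℝ) := by
  obtain ⟨C, hC0, hC⟩ := card_powerSumPairs_le k σ hk hσ hT (half_pos hε)
  obtain ⟨C', hC0', hC'⟩ := card_powerSumPairs_le k σ hk hσ hT' (half_pos hε)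
  refine ⟨C' * C, by positivity, fun a b ⟨h, hh⟩ P hP => ?_⟩
  have hP0 : (0 : ℝ) < P := by exact_mod_cast hP
  rw [setIntegral_expSum_pair]
  set s := Fintype.piFinset (fun _ : Fin σ => Icc 1 P) with hs
  set S := {v ∈ (s ×ˢ s) ×ˢ (s ×ˢ s) |
      (fun i => a i * ∑ l, (v.1.1 l : ℤ) ^ d i + b i * ∑ l, (v.1.2 l : ℤ) ^ d i) =
      fun i => a i * ∑ l, (v.2.1 l : ℤ) ^ d i + b i * ∑ l, (v.2.2 l : ℤ) ^ d i} with hS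
  have hkey : ∀ v ∈ S, (∀ j ∈ T', ∑ l, (v.1.2 l : ℤ) ^ j - ∑ l, (v.2.2 l : ℤ) ^ j = 0) ∧
      ∀ j ∈ T, ∑ l, (v.1.1 l : ℤ) ^ j - ∑ l, (v.2.1 l : ℤ) ^ j =
        h (fun j => ∑ l, (v.1.2 l : ℤ) ^ j - ∑ l, (v.2.2 l : ℤ) ^ j) j := by
    intro v hv
    refine hh (fun j => ∑ l, (v.1.1 l : ℤ) ^ j - ∑ l, (v.2.1 l : ℤ) ^ j) _ fun i => ?_
    have := congrFun (mem_filter.1 hv).2 i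
    linear_combination this
  have h1 : (#S : ℝ) ≤ #(powerSumPairs σ P T' 0) *
      (C * (P : ℝ) ^ ((2 * σ : ℕ) - (∑ j ∈ T, j : ℕ) + ε / 2 : ℝ)) := by
    rw [card_eq_sum_card_fiberwise (f := fun v => (v.1.2, v.2.2)) (t := powerSumPairs σ P T' 0)]
    · rw [Nat.cast_sum, ← nsmul_eq_mul]
      refine sum_le_card_nsmul _ _ _ fun y _ => ?_
      refine le_trans ?_ (hC P hP (h fun j => ∑ l, (y.1 l : ℤ) ^ j - ∑ l, (y.2 l : ℤ) ^ j))
      rw [Nat.cast_le]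
      refine card_le_card_of_injOn (fun v => (v.1.1, v.2.1)) ?_ ?_
      · intro v hv
        rw [mem_coe, mem_filter] at hv
        have h2 := (hkey v hv.1).2
        have h3 := (mem_filter.1 hv.1).1
        simp only [mem_product] at h3
        rw [mem_coe, powerSumPairs, mem_filter, mem_product]
        refine ⟨⟨h3.1.1, h3.2.1⟩, fun j hj => ?_⟩
        rw [← hv.2]
        exact h2 j hj
      · rintro ⟨⟨x, y⟩, x', y'⟩ hv ⟨⟨z, w⟩, z', w'⟩ hv' hvv
        have h2 := (mem_filter.1 (mem_coe.1 hv)).2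
        have h3 := (mem_filter.1 (mem_coe.1 hv')).2
        rw [← h3] at h2
        simp only [Prod.mk.injEq] at h2 hvv ⊢
        tauto
    · intro v hv
      have h2 := (hkey v hv).1
      have h3 := (mem_filter.1 (mem_coe.1 hv)).1
      simp only [mem_product] at h3
      rw [mem_coe, powerSumPairs, mem_filter, mem_product]
      exact ⟨⟨h3.1.2, h3.2.2⟩, h2⟩
  calc (#S : ℝ) ≤ _ := h1
    _ ≤ (C' * (P : ℝ) ^ ((2 * σ : ℕ) - (∑ j ∈ T', j : ℕ) + ε / 2 : ℝ)) *
      (C * (P : ℝ) ^ ((2 * σ : ℕ) - (∑ j ∈ T, j : ℕ) + ε / 2 : ℝ)) := by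
        gcongr
        exact hC' P hP 0
    _ = C' * C * ((P : ℝ) ^ ((2 * σ : ℕ) - (∑ j ∈ T', j : ℕ) + ε / 2 : ℝ) *
      (P : ℝ) ^ ((2 * σ : ℕ) - (∑ j ∈ T, j : ℕ) + ε / 2 : ℝ)) := by ring
    _ = _ := by
      rw [← Real.rpow_add hP0]
      congr 2
      push_cast
      ring

lemma prod_le_sum_pow_card {ι : Type} [Fintype ι] [Nonempty ι] {g : ι → ℝ} (hg : ∀ i, 0 ≤ g i) :
    ∏ i, g i ≤ ∑ i, g i ^ Fintype.card ι := by
  obtain ⟨i, -, hi⟩ := exists_max_image univ g univ_nonempty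
  calc ∏ j, g j ≤ ∏ _j : ι, g i := prod_le_prod (fun j _ => hg j) fun j _ => hi j (mem_univ j)
    _ = g i ^ Fintype.card ι := by simp
    _ ≤ _ := single_le_sum (f := fun i => g i ^ Fintype.card ι)
      (fun j _ => pow_nonneg (hg j) _) (mem_univ i)

theorem setIntegral_prod_expSum_le (d : I → ℕ) {s : ℕ} (A : I → Fin s → ℤ) (j₀ : Fin s) {k σ : ℕ}
    (hk : 1 ≤ k) (hσ : k * (k + 1) ≤ 2 * σ) (hs : 4 * σ + 1 ≤ s) {T T' : Finset ℕ}
    (hT : T ⊆ Icc 1 k) (hT' : T' ⊆ Icc 1 k)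
    (hsep : ∀ j j', j ≠ j' → Separates d (fun i => A i j) (fun i => A i j') T T')
    {ε : ℝ} (hε : 0 < ε) : ∃ C : ℝ, 0 < C ∧ ∀ P : ℕ, 1 ≤ P →
    ∫ α in Set.Icc (0 : I → ℝ) 1, ∏ j ∈ univ.erase j₀, ‖expSum d P fun i => α i * A i j‖ ≤
      C * (P : ℝ) ^ ((s : ℝ) - 1 - (∑ j ∈ T, j + ∑ j ∈ T', j : ℕ) + ε) := by
  classical
  obtain ⟨C, hC0, hC⟩ := setIntegral_expSum_pair_le d hk hσ hT hT' hε
  have hσ0 : 0 < σ := by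
    have : 0 < k * (k + 1) := by positivity
    omega
  have : NeZero (2 * σ) := ⟨by omega⟩
  obtain ⟨φ⟩ : Nonempty (Fin (2 * σ) × Fin 2 ↪ {j : Fin s // j ≠ j₀}) := by
    refine Function.Embedding.nonempty_of_card_le ?_
    rw [Fintype.card_prod, Fintype.card_fin, Fintype.card_fin, Fintype.card_subtype_compl,
      Fintype.card_fin, Fintype.card_subtype_eq]
    omega
  refine ⟨(2 * σ : ℕ) * C, by positivity, fun P hP => ?_⟩
  have hP0 : (0 : ℝ) < P := by exact_mod_cast hP
  have hpt : ∀ α : I → ℝ, ∏ j ∈ univ.erase j₀, ‖expSum d P fun i => α i * A i j‖ ≤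
      (P : ℝ) ^ (s - 1 - 4 * σ) * ∑ l : Fin (2 * σ), (‖expSum d P fun i => α i * A i (φ (l, 0))‖ *
        ‖expSum d P fun i => α i * A i (φ (l, 1))‖) ^ (2 * σ) := by
    intro α
    set F : Fin s → ℝ := fun j => ‖expSum d P fun i => α i * A i j‖ with hF
    have hF0 : ∀ j, 0 ≤ F j := fun j => norm_nonneg _
    set U := univ.map (φ.trans (Function.Embedding.subtype _)) with hU
    have hUs : U ⊆ univ.erase j₀ := by
      intro j hj
      rw [hU, mem_map] at hj
      obtain ⟨l, _, rfl⟩ := hj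
      simpa using (φ l).2
    have hUc : #U = 4 * σ := by
      rw [hU, card_map, card_univ, Fintype.card_prod, Fintype.card_fin, Fintype.card_fin]
      ring
    change ∏ j ∈ univ.erase j₀, F j ≤ _
    rw [← prod_sdiff hUs]
    refine mul_le_mul ?_ ?_ (prod_nonneg fun j _ => hF0 j) (by positivity)
    · refine (prod_le_prod (fun j _ => hF0 j) fun j _ => norm_expSum_le d P _).trans (le_of_eq ?_)
      rw [prod_const, card_sdiff_of_subset hUs, hUc, card_erase_of_mem (mem_univ _), card_univ,
        Fintype.card_fin]
    · rw [hU, prod_map, Fintype.prod_prod_type]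
      have := prod_le_sum_pow_card (g := fun l : Fin (2 * σ) => F (φ (l, 0)) * F (φ (l, 1)))
        fun l => mul_nonneg (hF0 _) (hF0 _)
      simpa using this
  have hint : ∀ l : Fin (2 * σ), IntegrableOn (fun α : I → ℝ =>
      (‖expSum d P fun i => α i * A i (φ (l, 0))‖ *
        ‖expSum d P fun i => α i * A i (φ (l, 1))‖) ^ (2 * σ)) (Set.Icc 0 1) := fun l =>
    Continuous.integrableOn_Icc (by fun_prop)
  calc _ ≤ ∫ α in Set.Icc (0 : I → ℝ) 1, (P : ℝ) ^ (s - 1 - 4 * σ) * ∑ l : Fin (2 * σ),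
        (‖expSum d P fun i => α i * A i (φ (l, 0))‖ *
        ‖expSum d P fun i => α i * A i (φ (l, 1))‖) ^ (2 * σ) := by
        refine setIntegral_mono (Continuous.integrableOn_Icc (by fun_prop))
          ((integrable_finsetSum _ fun l _ => hint l).const_mul _) hpt
    _ = (P : ℝ) ^ (s - 1 - 4 * σ) * ∑ l : Fin (2 * σ), ∫ α in Set.Icc (0 : I → ℝ) 1,
        (‖expSum d P fun i => α i * A i (φ (l, 0))‖ *
        ‖expSum d P fun i => α i * A i (φ (l, 1))‖) ^ (2 * σ) := by
        rw [integral_const_mul, integral_finsetSum _ fun l _ => hint l]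
    _ ≤ (P : ℝ) ^ (s - 1 - 4 * σ) * ∑ l : Fin (2 * σ),
        C * (P : ℝ) ^ ((4 * σ : ℕ) - (∑ j ∈ T, j + ∑ j ∈ T', j : ℕ) + ε : ℝ) := by
        gcongr with l
        refine hC _ _ (hsep _ _ fun h => ?_) P hP
        have := φ.injective (Subtype.ext h)
        simp at this
    _ = (2 * σ : ℕ) * C * ((P : ℝ) ^ (s - 1 - 4 * σ) *
        (P : ℝ) ^ ((4 * σ : ℕ) - (∑ j ∈ T, j + ∑ j ∈ T', j : ℕ) + ε : ℝ)) := by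
        rw [sum_const, card_univ, Fintype.card_fin, nsmul_eq_mul]
        ring
    _ = _ := by
        rw [← Real.rpow_natCast, ← Real.rpow_add hP0, Nat.cast_sub (by omega),
          Nat.cast_sub (by omega)]
        congr 2
        push_cast
        ring

end

end

end DiagonalSystems

namespace DiagonalSystems

noncomputable section
open Polynomial

lemma four_mul_abs_le_norm_e_sub_one {t : ℝ} (ht : |t| ≤ 1 / 2) : 4 * |t| ≤ ‖e t - 1‖ := by
  have h1 : e t - 1 = Complex.exp (Complex.I * (2 * Real.pi * t : ℝ)) - 1 := by
    rw [e_eq_exp]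
    push_cast
    ring_nf
  have h2 : 2 * Real.pi * t / 2 = Real.pi * t := by ring
  rw [h1, Complex.norm_exp_I_mul_ofReal_sub_one, norm_mul, Real.norm_eq_abs, Real.norm_eq_abs,
    abs_two, h2]
  have hpi := Real.pi_pos
  have h3 := Real.mul_abs_le_abs_sin (x := Real.pi * t) (by
    rw [abs_mul, abs_of_pos hpi]
    nlinarith)
  rw [abs_mul, abs_of_pos hpi] at h3
  have h4 : 2 / Real.pi * (Real.pi * |t|) = 2 * |t| := by
    field_simp
  linarith

lemma abs_sub_round_mul_norm_sum_le (θ c : ℝ) (L : ℕ) :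
    |θ - round θ| * ‖∑ x ∈ range L, e (θ * x + c)‖ ≤ 1 / 2 := by
  set t := θ - round θ with ht
  have h1 : ∀ x : ℕ, e (θ * x + c) = e c * e t ^ x := by
    intro x
    induction x with
    | zero => simp
    | succ x ih =>
      rw [pow_succ, ← mul_assoc, ← ih, ← e_add, ← e_add_intCast (θ * x + c + t) (round θ)]
      congr 1
      rw [ht]
      push_cast
      ring
  simp_rw [h1, ← mul_sum]
  rw [norm_mul, norm_e, one_mul]
  have h2 : ‖e t - 1‖ * ‖∑ x ∈ range L, e t ^ x‖ ≤ 2 := by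
    rw [← norm_mul, mul_geom_sum]
    refine (norm_sub_le _ _).trans ?_
    rw [norm_pow, norm_e, one_pow, norm_one]
    norm_num
  have h3 := four_mul_abs_le_norm_e_sub_one (abs_sub_round θ)
  have h4 := mul_le_mul_of_nonneg_right h3 (norm_nonneg (∑ x ∈ range L, e t ^ x))
  linarith

lemma norm_sum_sq_le_differences (z : ℕ → ℂ) (L : ℕ) :
    ‖∑ x ∈ range L, z x‖ ^ 2 ≤ ∑ x ∈ range L, ‖z x‖ ^ 2 +
      2 * ∑ h ∈ range L, ‖∑ y ∈ range (L - 1 - h), z (y + (h + 1)) * (starRingEnd ℂ) (z y)‖ := by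
  have h1 : ∀ L : ℕ, ‖∑ x ∈ range L, z x‖ ^ 2 = ∑ x ∈ range L, ‖z x‖ ^ 2 +
      2 * (∑ x ∈ range L, ∑ y ∈ range x, z x * (starRingEnd ℂ) (z y)).re := by
    intro L
    induction L with
    | zero => simp
    | succ L ih =>
      rw [sum_range_succ, sum_range_succ, sum_range_succ, ← mul_sum, ← map_sum, Complex.sq_norm,
        add_comm (∑ x ∈ range L, z x), Complex.normSq_add, ← Complex.sq_norm, ← Complex.sq_norm, ih,
        Complex.add_re]
      ring
  have h2 : ∑ x ∈ range L, ∑ y ∈ range x, z x * (starRingEnd ℂ) (z y) =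
      ∑ h ∈ range L, ∑ y ∈ range (L - 1 - h), z (y + (h + 1)) * (starRingEnd ℂ) (z y) := by
    rw [sum_sigma', sum_sigma']
    refine sum_nbij' (fun v => ⟨v.1 - v.2 - 1, v.2⟩) (fun v => ⟨v.2 + (v.1 + 1), v.2⟩) ?_ ?_ ?_ ?_ ?_
    · rintro ⟨x, y⟩ h
      simp only [mem_sigma, mem_range] at h ⊢
      omega
    · rintro ⟨x, y⟩ h
      simp only [mem_sigma, mem_range] at h ⊢
      omega
    · rintro ⟨x, y⟩ h
      simp only [mem_sigma, mem_range] at h ⊢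
      rw [Sigma.mk.injEq]
      exact ⟨by omega, HEq.rfl⟩
    · rintro ⟨x, y⟩ h
      simp only [mem_sigma, mem_range] at h ⊢
      rw [Sigma.mk.injEq]
      exact ⟨by omega, HEq.rfl⟩
    · rintro ⟨x, y⟩ h
      simp only [mem_sigma, mem_range] at h ⊢
      rw [show y + (x - y - 1 + 1) = x by omega]
  rw [h1, h2]
  gcongr
  exact (Complex.re_le_norm _).trans (norm_sum_le _ _)

lemma natDegree_taylor_sub_le {f : ℝ[X]} {d : ℕ} (hf : f.natDegree ≤ d + 1) (h : ℝ) :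
    (taylor h f - f).natDegree ≤ d ∧ (taylor h f - f).coeff d = (d + 1) * h * f.coeff (d + 1) := by
  have hd := natDegree_hasseDeriv_le f
  constructor
  · rw [natDegree_le_iff_coeff_eq_zero]
    intro N hN
    rw [coeff_sub, taylor_coeff, eq_C_of_natDegree_le_zero (p := hasseDeriv N f)
      ((hd N).trans (by omega)), eval_C, hasseDeriv_coeff]
    simp
  · rw [coeff_sub, taylor_coeff, eq_X_add_C_of_natDegree_le_one (p := hasseDeriv d f)
      ((hd d).trans (by omega))]
    simp only [eval_add, eval_mul, eval_C, eval_X, hasseDeriv_coeff]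
    rw [add_comm 1 d, Nat.choose_succ_self_right]
    simp
    ring

/-- Points of an arithmetic progression near the integers. -/
lemma card_near_int_le {Y : ℕ} {S : Finset ℕ} (hS : S ⊆ range Y) {c ε δ : ℝ} (hε : ε ≠ 0)
    (hδ₀ : 0 ≤ δ) (hδ : δ ≤ 1) (h : ∀ y ∈ S, ∃ m : ℤ, |c + ε * y - m| ≤ δ) :
    (#S : ℝ) ≤ (2 * δ / |ε| + 1) * (2 * |ε| * Y + 3) := by
  have hε' : 0 < |ε| := abs_pos.2 hε
  choose! m hm using h
  have hfib : ∀ a ∈ S.image m, #{y ∈ S | m y = a} ≤ ⌊2 * δ / |ε|⌋₊ + 1 := by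
    intro a ha
    obtain ⟨y₀, hy₀, hmin⟩ := exists_min_image {y ∈ S | m y = a} id (by
      obtain ⟨y, hy, rfl⟩ := mem_image.1 ha
      exact ⟨y, by simp [hy]⟩)
    rw [mem_filter] at hy₀
    refine (card_le_card (t := Icc y₀ (y₀ + ⌊2 * δ / |ε|⌋₊)) ?_).trans (by
      rw [Nat.card_Icc]
      omega)
    intro y hy
    have hle : y₀ ≤ y := hmin y hy
    rw [mem_filter] at hy
    obtain ⟨t, rfl⟩ := Nat.exists_eq_add_of_le hle
    rw [mem_Icc]
    refine ⟨hle, Nat.add_le_add_left (Nat.le_floor ?_) _⟩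
    rw [le_div_iff₀ hε']
    have h1 := hm _ hy.1
    have h2 := hm _ hy₀.1
    rw [hy.2] at h1
    rw [hy₀.2] at h2
    have h3 : (t : ℝ) * |ε| = |(c + ε * ((y₀ + t : ℕ) : ℝ) - a) - (c + ε * y₀ - a)| := by
      conv_lhs => rw [← abs_of_nonneg (Nat.cast_nonneg t : (0 : ℝ) ≤ t), ← abs_mul]
      congr 1
      push_cast
      ring
    rw [h3]
    refine (abs_sub _ _).trans ?_
    linarith
  have himg : #(S.image m) ≤ (⌊c + |ε| * Y + 1⌋ + 1 - ⌈c - |ε| * Y - 1⌉).toNat := by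
    rw [← Int.card_Icc]
    refine card_le_card fun a ha => ?_
    obtain ⟨y, hy, rfl⟩ := mem_image.1 ha
    have h1 := abs_le.1 (hm y hy)
    have h2 : |ε * y| ≤ |ε| * Y := by
      rw [abs_mul, abs_of_nonneg (Nat.cast_nonneg y : (0 : ℝ) ≤ y)]
      gcongr
      exact (mem_range.1 (hS hy)).le
    rw [abs_le] at h2
    rw [mem_Icc, Int.le_floor, Int.ceil_le]
    constructor <;> linarith
  have himg' : (#(S.image m) : ℝ) ≤ 2 * |ε| * Y + 3 := by
    have h1 : (0 : ℤ) ≤ ⌊c + |ε| * Y + 1⌋ + 1 - ⌈c - |ε| * Y - 1⌉ := by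
      have h2 : ((⌈c - |ε| * Y - 1⌉ : ℤ) : ℝ) < ((⌊c + |ε| * Y + 1⌋ + 1 : ℤ) : ℝ) := by
        have h3 := Int.ceil_lt_add_one (c - |ε| * Y - 1)
        have h4 := Int.lt_floor_add_one (c + |ε| * Y + 1)
        have h5 : 0 ≤ |ε| * Y := by positivity
        push_cast
        linarith
      have := Int.cast_lt.1 h2
      omega
    have h2 : ((#(S.image m) : ℤ) : ℝ) ≤ ((⌊c + |ε| * Y + 1⌋ + 1 - ⌈c - |ε| * Y - 1⌉ : ℤ) : ℝ) := by
      rw [Int.cast_le, ← Int.toNat_of_nonneg h1, Int.ofNat_le]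
      exact himg
    push_cast at h2
    have h3 := Int.le_ceil (c - |ε| * Y - 1)
    have h4 := Int.floor_le (c + |ε| * Y + 1)
    linarith
  have h1 := card_le_mul_card_image (f := m) S _ hfib
  calc (#S : ℝ) ≤ ((⌊2 * δ / |ε|⌋₊ + 1) * #(S.image m) : ℕ) := by exact_mod_cast h1
    _ ≤ _ := by
      push_cast
      gcongr
      exact Nat.floor_le (by positivity)

/-- If many multiples of `ϑ` are near the integers, then `ϑ` is near a rational number with small
denominator. -/
lemma exists_approx_of_many_near_int {N m : ℕ} (hm : 1 ≤ m) {H : Finset ℕ} (hH : H ⊆ range (N + 1))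
    (hcard : N ≤ m * #H) {ϑ δ : ℝ} (hδ₀ : 0 ≤ δ) (hδ : δ * (64 * m) ≤ 1)
    (hN : 24 * m ^ 2 ≤ N) (h : ∀ y ∈ H, ∃ a : ℤ, |ϑ * y - a| ≤ δ) :
    ∃ q : ℕ, 1 ≤ q ∧ q ≤ 2 * m ∧ ∃ a : ℤ, |q * ϑ - a| * N ≤ 24 * m ^ 2 * δ := by
  have hmR : (1 : ℝ) ≤ m := by exact_mod_cast hm
  have hδ1 : δ ≤ 1 := by nlinarith
  obtain ⟨h₁, hh₁, h₂, hh₂, hlt, hle⟩ : ∃ h₁ ∈ H, ∃ h₂ ∈ H, h₁ < h₂ ∧ h₂ ≤ h₁ + 2 * m := by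
    obtain ⟨x, hx, y, hy, hxy, heq⟩ := exists_ne_map_eq_of_card_lt_of_maps_to
      (s := H) (t := range (N / (2 * m) + 1)) (f := fun h => h / (2 * m)) (by
        rw [card_range]
        have h1 : N / (2 * m) * (2 * m) ≤ N := Nat.div_mul_le_self _ _
        by_contra hcon
        push Not at hcon
        have h3 : 24 * m ≤ #H := by nlinarith
        nlinarith) (by
        intro h hh
        rw [coe_range, Set.mem_Iio, Nat.lt_succ_iff]
        exact Nat.div_le_div_right (Nat.lt_succ_iff.1 (mem_range.1 (hH hh))))
    have hx1 := Nat.div_add_mod x (2 * m)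
    have hy1 := Nat.div_add_mod y (2 * m)
    have hx2 := Nat.mod_lt x (show 0 < 2 * m by omega)
    have hy2 := Nat.mod_lt y (show 0 < 2 * m by omega)
    rw [heq] at hx1
    rcases lt_or_gt_of_ne hxy with hxy | hxy
    · exact ⟨x, hx, y, hy, hxy, by omega⟩
    · exact ⟨y, hy, x, hx, hxy, by omega⟩
  obtain ⟨a₁, ha₁⟩ := h _ hh₁
  obtain ⟨a₂, ha₂⟩ := h _ hh₂
  obtain ⟨q, rfl⟩ := Nat.exists_eq_add_of_lt hlt
  refine ⟨q + 1, by omega, by omega, a₂ - a₁, ?_⟩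
  set ε : ℝ := (q + 1 : ℕ) * ϑ - (a₂ - a₁ : ℤ) with hε
  have hε2 : |ε| ≤ 2 * δ := by
    have h1 : ε = (ϑ * (h₁ + q + 1 : ℕ) - a₂) - (ϑ * h₁ - a₁) := by
      rw [hε]
      push_cast
      ring
    rw [h1]
    refine (abs_sub _ _).trans ?_
    linarith
  by_cases hε0 : ε = 0
  · rw [hε0, abs_zero, zero_mul]
    positivity
  have hε' : 0 < |ε| := abs_pos.2 hε0
  set Y := N / (q + 1) + 1 with hY
  have hclass : ∀ r ∈ range (q + 1), (#{x ∈ H | x % (q + 1) = r} : ℝ) ≤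
      (2 * δ / |ε| + 1) * (2 * |ε| * Y + 3) := by
    intro r hr
    have hinj : Set.InjOn (fun x => x / (q + 1)) ({x ∈ H | x % (q + 1) = r} : Finset ℕ) := by
      intro x hx y hy hxy
      rw [mem_coe, mem_filter] at hx hy
      simp only at hxy
      rw [← Nat.div_add_mod x (q + 1), ← Nat.div_add_mod y (q + 1), hxy, hx.2, hy.2]
    rw [← card_image_of_injOn hinj]
    refine card_near_int_le (c := ϑ * r) ?_ hε0 hδ₀ hδ1 ?_
    · intro y hy
      obtain ⟨x, hx, rfl⟩ := mem_image.1 hy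
      rw [mem_range, hY, Nat.lt_succ_iff]
      exact Nat.div_le_div_right (Nat.lt_succ_iff.1 (mem_range.1 (hH (mem_filter.1 hx).1)))
    · intro y hy
      obtain ⟨x, hx, rfl⟩ := mem_image.1 hy
      rw [mem_filter] at hx
      obtain ⟨a, ha⟩ := h x hx.1
      refine ⟨a - ((x / (q + 1) : ℕ) : ℤ) * (a₂ - a₁), ?_⟩
      convert ha using 2
      have h1 : (x : ℝ) = (q + 1 : ℕ) * (x / (q + 1) : ℕ) + r := by
        rw [← hx.2]
        exact_mod_cast (Nat.div_add_mod x (q + 1)).symm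
      rw [h1, hε]
      generalize x / (q + 1) = w
      push_cast
      ring
  have hsum : (#H : ℝ) ≤ (q + 1 : ℕ) * ((2 * δ / |ε| + 1) * (2 * |ε| * Y + 3)) := by
    rw [card_eq_sum_card_fiberwise (f := fun x => x % (q + 1)) (t := range (q + 1)) (fun x _ => by
      simpa using Nat.mod_lt x (Nat.succ_pos q))]
    push_cast
    refine (sum_le_sum hclass).trans ?_
    rw [sum_const, card_range, nsmul_eq_mul]
    push_cast
    exact le_rfl
  have hqm : ((q + 1 : ℕ) : ℝ) ≤ 2 * m := by exact_mod_cast (by omega : q + 1 ≤ 2 * m)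
  have hqY : ((q + 1 : ℕ) : ℝ) * Y ≤ N + 2 * m := by
    have h1 : (q + 1) * (N / (q + 1)) ≤ N := Nat.mul_div_le _ _
    rw [hY]
    have h2 : (((q + 1) * (N / (q + 1)) : ℕ) : ℝ) ≤ N := by exact_mod_cast h1
    push_cast at h2 hqm ⊢
    linarith
  set Q : ℝ := ((q + 1 : ℕ) : ℝ) with hQ
  have hQ0 : 0 ≤ Q := Nat.cast_nonneg _
  have hNR : 24 * (m : ℝ) ^ 2 ≤ N := by exact_mod_cast hN
  have hcR : (N : ℝ) ≤ m * #H := by exact_mod_cast hcard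
  have h1 : |ε| * (#H : ℝ) ≤ (2 * δ + |ε|) * (2 * |ε| * (Q * Y) + 3 * Q) := by
    calc |ε| * (#H : ℝ) ≤ |ε| * (Q * ((2 * δ / |ε| + 1) * (2 * |ε| * Y + 3))) := by gcongr
      _ = (2 * δ + |ε|) * (2 * |ε| * (Q * Y) + 3 * Q) := by
        field_simp
  have h2 : |ε| * (#H : ℝ) ≤ (4 * δ) * (2 * |ε| * (N + 2 * m)) + 6 * δ * (2 * m) + |ε| * (6 * m) := by
    have h3 : (2 * δ + |ε|) * (2 * |ε| * (Q * Y)) ≤ (4 * δ) * (2 * |ε| * (N + 2 * m)) := by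
      gcongr
      linarith
    have h4 : (2 * δ + |ε|) * (3 * Q) ≤ 6 * δ * (2 * m) + |ε| * (6 * m) := by
      calc (2 * δ + |ε|) * (3 * Q) ≤ (2 * δ + |ε|) * (3 * (2 * m)) := by gcongr
        _ = _ := by ring
    linarith
  have h5 : |ε| * N ≤ m * (|ε| * #H) := by
    calc |ε| * N ≤ |ε| * (m * #H) := by gcongr
      _ = _ := by ring
  have h6 : m * (|ε| * (#H : ℝ)) ≤
      m * ((4 * δ) * (2 * |ε| * (N + 2 * m)) + 6 * δ * (2 * m) + |ε| * (6 * m)) := by gcongr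
  have h7 : δ * (64 * m) * (|ε| * (N + 2 * m)) ≤ 1 * (|ε| * (N + 2 * m)) := by gcongr
  have h8 : |ε| * (24 * (m : ℝ) ^ 2) ≤ |ε| * N := by gcongr
  have h9 : |ε| * m ≤ |ε| * m ^ 2 := by
    gcongr
    nlinarith
  have h10 : 0 ≤ (m : ℝ) ^ 2 * δ := by positivity
  linarith

end

end DiagonalSystems

namespace DiagonalSystems

noncomputable section
open Polynomial

lemma mul_pow_le_mul_pow_of_le {R A B K : ℕ} (hR : 1 ≤ R) (hA : A ≤ K) (hB : B ≤ K) :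
    A * R ^ B ≤ K * R ^ K :=
  Nat.mul_le_mul hA (Nat.pow_le_pow_right hR hB)

/-- The Weyl differencing step: many of the differenced sums are large. -/
lemma card_le_of_le_norm_weylSum {N R L : ℕ} (hL : L ≤ N) (hRN : 2 * R ^ 2 ≤ N)
    {z : ℕ → ℂ} (hz : ∀ x, ‖z x‖ = 1) (h : N ≤ R * ‖∑ x ∈ range L, z x‖) :
    N ≤ 8 * R ^ 2 * #{h ∈ range L | (N : ℝ) ≤ (8 * R ^ 2 : ℕ) *
      ‖∑ y ∈ range (L - 1 - h), z (y + (h + 1)) * (starRingEnd ℂ) (z y)‖} := by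
  set T : ℕ → ℝ := fun h => ‖∑ y ∈ range (L - 1 - h), z (y + (h + 1)) * (starRingEnd ℂ) (z y)‖
    with hT
  set G := {h ∈ range L | (N : ℝ) ≤ (8 * R ^ 2 : ℕ) * T h} with hG
  change N ≤ 8 * R ^ 2 * #G
  have hLR : (L : ℝ) ≤ N := by exact_mod_cast hL
  have hRNR : 2 * (R : ℝ) ^ 2 ≤ N := by exact_mod_cast hRN
  have h1 := norm_sum_sq_le_differences z L
  simp only [hz, one_pow, sum_const, card_range, nsmul_eq_mul, mul_one] at h1
  change _ ≤ _ + 2 * ∑ h ∈ range L, T h at h1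
  have hTN : ∀ h, T h ≤ N := by
    intro h
    refine (norm_sum_le _ _).trans ?_
    simp only [norm_mul, RCLike.norm_conj, hz, mul_one, sum_const, card_range, nsmul_eq_mul]
    exact_mod_cast (by omega : L - 1 - h ≤ N)
  have h2 : 8 * (R : ℝ) ^ 2 * ∑ h ∈ range L, T h ≤ 8 * R ^ 2 * (N * #G) + N * N := by
    rw [← sum_filter_add_sum_filter_not (range L) (fun h => (N : ℝ) ≤ (8 * R ^ 2 : ℕ) * T h),
      mul_add]
    refine add_le_add ?_ ?_
    · refine mul_le_mul_of_nonneg_left ?_ (by positivity)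
      refine (sum_le_card_nsmul _ _ (N : ℝ) fun h _ => hTN h).trans ?_
      rw [nsmul_eq_mul, mul_comm]
    · rw [mul_sum]
      refine (sum_le_card_nsmul _ _ (N : ℝ) fun h hh => ?_).trans ?_
      · have := (mem_filter.1 hh).2
        push_cast at this
        linarith
      · rw [nsmul_eq_mul]
        gcongr
        exact ((card_filter_le _ _).trans (card_range L).le).trans hL
  have h3 : (N : ℝ) ^ 2 ≤ R ^ 2 * ‖∑ x ∈ range L, z x‖ ^ 2 := by
    rw [← mul_pow]
    gcongr
  have h4 : (R : ℝ) ^ 2 * ‖∑ x ∈ range L, z x‖ ^ 2 ≤ R ^ 2 * (N + 2 * ∑ h ∈ range L, T h) := by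
    gcongr
    linarith
  have h5 : 2 * (R : ℝ) ^ 2 * N ≤ N * N := by gcongr
  have h6 : (N : ℝ) * N ≤ N * (8 * R ^ 2 * #G) := by nlinarith
  rcases Nat.eq_zero_or_pos N with hN | hN
  · omega
  · have h7 := le_of_mul_le_mul_left h6 (by exact_mod_cast hN)
    exact_mod_cast h7

/-- **Weyl's inequality**, in its inverse form. -/
theorem weyl (d : ℕ) : ∃ K : ℕ, 1 ≤ K ∧ ∀ N R L : ℕ, 1 ≤ N → 1 ≤ R → L ≤ N →
    ∀ f : ℝ[X], f.natDegree ≤ d + 1 → N ≤ R * ‖∑ x ∈ range L, e (f.eval (x : ℝ))‖ →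
    ∃ q : ℕ, 1 ≤ q ∧ q ≤ K * R ^ K ∧
      ∃ a : ℤ, |q * f.coeff (d + 1) - a| * N ^ (d + 1) ≤ (K * R ^ K : ℕ) := by
  induction d with
  | zero =>
    refine ⟨1, le_rfl, fun N R L _ hR _ f hf hN => ⟨1, le_rfl, by simpa using hR, round (f.coeff 1), ?_⟩⟩
    have h1 : ∀ x : ℕ, f.eval (x : ℝ) = f.coeff 1 * x + f.coeff 0 := by
      intro x
      rw [eq_X_add_C_of_natDegree_le_one hf]
      simp
    simp_rw [h1] at hN
    have h2 := abs_sub_round_mul_norm_sum_le (f.coeff 1) (f.coeff 0) L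
    simp only [zero_add, pow_one, Nat.cast_one, one_mul]
    calc |f.coeff 1 - round (f.coeff 1)| * N
        ≤ |f.coeff 1 - round (f.coeff 1)| *
          (R * ‖∑ x ∈ range L, e (f.coeff 1 * x + f.coeff 0)‖) := by gcongr
      _ = R * (|f.coeff 1 - round (f.coeff 1)| *
          ‖∑ x ∈ range L, e (f.coeff 1 * x + f.coeff 0)‖) := by ring
      _ ≤ R * (1 / 2) := by gcongr
      _ ≤ R := by
        have : (0 : ℝ) ≤ R := Nat.cast_nonneg _
        linarith
  | succ d ih =>
    obtain ⟨K, hK, ih⟩ := ih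
    set c₁ := (4096 * K ^ 2 * 64 ^ K) ^ (d + 2) with hc₁
    set c₂ := K * 8 ^ K * (d + 2) * (2 * (8 * (K * 8 ^ K))) with hc₂
    set c₃ := 24 * (8 * (K * 8 ^ K)) ^ 2 * (K * 8 ^ K) with hc₃
    set K' := c₁ + c₂ + c₃ + (4 * K + 4) * (d + 2) + (6 * K + 4) with hK'
    refine ⟨K', by omega, fun N R L hN hR hL f hf hS => ?_⟩
    set M := K * (8 * R ^ 2) ^ K with hM
    have hM' : M = K * 8 ^ K * R ^ (2 * K) := by
      rw [hM, mul_pow, ← pow_mul, mul_assoc]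
    have hM1 : 1 ≤ M := by
      have : 0 < K * (8 * R ^ 2) ^ K := by positivity
      omega
    have hNR : (1 : ℝ) ≤ N := by exact_mod_cast hN
    by_cases hsmall : N < 4096 * R ^ 4 * M ^ 2
    · refine ⟨1, le_rfl, Nat.mul_pos (by omega) (by positivity), round (f.coeff (d + 1 + 1)), ?_⟩
      have h1 : N ^ (d + 2) ≤ K' * R ^ K' := by
        calc N ^ (d + 2) ≤ (4096 * R ^ 4 * M ^ 2) ^ (d + 2) := Nat.pow_le_pow_left hsmall.le _
          _ = c₁ * R ^ ((4 * K + 4) * (d + 2)) := by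
            rw [hM', hc₁, pow_mul R (4 * K + 4), ← mul_pow]
            congr 1
            rw [show 64 = 8 ^ 2 by norm_num, ← pow_mul]
            ring
          _ ≤ _ := mul_pow_le_mul_pow_of_le hR (by omega) (by omega)
      calc |((1 : ℕ) : ℝ) * f.coeff (d + 1 + 1) - round (f.coeff (d + 1 + 1))| * N ^ (d + 1 + 1)
          ≤ 1 * N ^ (d + 2) := by
            gcongr
            rw [Nat.cast_one, one_mul]
            exact (abs_sub_round _).trans (by norm_num)
        _ ≤ _ := by
            rw [one_mul]
            exact_mod_cast h1
    push Not at hsmall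
    have hRpos : 1 ≤ R ^ 2 := Nat.one_le_pow _ _ hR
    have hR4 : R ^ 4 = R ^ 2 * R ^ 2 := by ring
    have hM2 : 1 ≤ M ^ 2 := Nat.one_le_pow _ _ hM1
    have hRN : 2 * R ^ 2 ≤ N := by
      refine le_trans ?_ hsmall
      rw [hR4]
      nlinarith [Nat.mul_le_mul hRpos hM2]
    have hcard := card_le_of_le_norm_weylSum (z := fun x => e (f.eval (x : ℝ))) hL hRN
      (fun x => norm_e _) hS
    set G := {h ∈ range L | (N : ℝ) ≤ (8 * R ^ 2 : ℕ) * ‖∑ y ∈ range (L - 1 - h),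
      e (f.eval ((y + (h + 1) : ℕ) : ℝ)) * (starRingEnd ℂ) (e (f.eval (y : ℝ)))‖} with hG
    have hgood : ∀ h ∈ G, ∃ q : ℕ, 1 ≤ q ∧ q ≤ M ∧
        ∃ a : ℤ, |q * ((d + 2) * (h + 1) * f.coeff (d + 2)) - a| * N ^ (d + 1) ≤ M := by
      intro h hh
      have h1 := (mem_filter.1 hh).2
      have h2 : ∀ y : ℕ, e (f.eval ((y + (h + 1) : ℕ) : ℝ)) * (starRingEnd ℂ) (e (f.eval (y : ℝ))) =
          e ((taylor ((h + 1 : ℕ) : ℝ) f - f).eval (y : ℝ)) := by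
        intro y
        rw [← e_neg, ← e_add, eval_sub, taylor_eval, Nat.cast_add y]
        rfl
      simp_rw [h2] at h1
      obtain ⟨h3, h4⟩ := natDegree_taylor_sub_le (d := d + 1) hf ((h + 1 : ℕ) : ℝ)
      obtain ⟨q, hq1, hq2, a, ha⟩ := ih N (8 * R ^ 2) (L - 1 - h) hN (by omega) (by omega) _ h3 h1
      refine ⟨q, hq1, hq2, a, ?_⟩
      rw [h4] at ha
      convert ha using 5
      push_cast
      ring
    choose! q hq1 hq2 a ha using hgood
    have hGne : G.Nonempty := by
      rw [nonempty_iff_ne_empty]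
      intro h0
      rw [h0] at hcard
      simp at hcard
      omega
    obtain ⟨q₀, hq₀, hq₀'⟩ := exists_le_card_fiber_of_nsmul_le_card_of_maps_to
      (s := G) (t := Icc 1 M) (f := q) (b := (#G : ℝ) / M)
      (fun h hh => mem_Icc.2 ⟨hq1 h hh, hq2 h hh⟩) ⟨1, mem_Icc.2 ⟨le_rfl, hM1⟩⟩ (by
        have : (0 : ℝ) < M := by exact_mod_cast hM1
        rw [Nat.card_Icc, nsmul_eq_mul, Nat.add_sub_cancel]
        field_simp
        exact le_rfl)
    have hMpos : (0 : ℝ) < M := by exact_mod_cast hM1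
    rw [div_le_iff₀ hMpos] at hq₀'
    replace hq₀' : #G ≤ #{x ∈ G | q x = q₀} * M := by exact_mod_cast hq₀'
    rw [mem_Icc] at hq₀
    set H := {x ∈ G | q x = q₀}.image (· + 1) with hH
    have hHcard : #H = #{x ∈ G | q x = q₀} := card_image_of_injective _ (add_left_injective 1)
    have hNd : (N : ℝ) ≤ N ^ (d + 1) := le_self_pow₀ hNR (by omega)
    have hNdpos : (0 : ℝ) < (N : ℝ) ^ (d + 1) := by positivity
    have hsmallR : 4096 * (R : ℝ) ^ 4 * M ^ 2 ≤ N := by exact_mod_cast hsmall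
    have hRR : (1 : ℝ) ≤ R := by exact_mod_cast hR
    obtain ⟨q', hq'1, hq'2, b, hb⟩ := exists_approx_of_many_near_int (N := N)
      (m := 8 * R ^ 2 * M) (Nat.mul_pos (by omega) hM1) (H := H)
      (ϑ := q₀ * (d + 2) * f.coeff (d + 2)) (δ := M / N ^ (d + 1)) (by
        intro x hx
        obtain ⟨h, hh, rfl⟩ := mem_image.1 hx
        have := mem_range.1 (mem_filter.1 (mem_filter.1 hh).1).1
        rw [mem_range]
        omega) (by
        rw [hHcard]
        calc N ≤ 8 * R ^ 2 * #G := hcard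
          _ ≤ 8 * R ^ 2 * (#{x ∈ G | q x = q₀} * M) := Nat.mul_le_mul_left _ hq₀'
          _ = _ := by ring) (by positivity) (by
        rw [div_mul_eq_mul_div, div_le_one hNdpos]
        refine le_trans ?_ (hsmallR.trans hNd)
        push_cast
        have h1 : (R : ℝ) ^ 2 ≤ R ^ 4 := pow_le_pow_right₀ hRR (by norm_num)
        have h2 : (R : ℝ) ^ 2 * M ^ 2 ≤ R ^ 4 * M ^ 2 := by gcongr
        nlinarith [h2, sq_nonneg ((R : ℝ) * M)]) (by
        refine le_trans ?_ hsmall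
        have : 24 * (8 * R ^ 2 * M) ^ 2 = 1536 * (R ^ 4 * M ^ 2) := by ring
        rw [this, mul_assoc]
        exact Nat.mul_le_mul_right _ (by norm_num)) (by
        intro x hx
        obtain ⟨h, hh, rfl⟩ := mem_image.1 hx
        rw [mem_filter] at hh
        refine ⟨a h, ?_⟩
        rw [le_div_iff₀ hNdpos]
        have h1 := ha h hh.1
        rw [hh.2] at h1
        refine le_trans (le_of_eq ?_) h1
        congr 3
        push_cast
        ring)
    have hq'' : 0 < q' * (q₀ * (d + 2)) := Nat.mul_pos hq'1 (Nat.mul_pos hq₀.1 (by omega))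
    refine ⟨q' * (q₀ * (d + 2)), by omega, ?_, b, ?_⟩
    · calc q' * (q₀ * (d + 2)) ≤ 2 * (8 * R ^ 2 * M) * (M * (d + 2)) :=
          Nat.mul_le_mul hq'2 (Nat.mul_le_mul_right _ hq₀.2)
        _ = c₂ * R ^ (4 * K + 2) := by
          rw [hc₂, hM']
          ring
        _ ≤ _ := mul_pow_le_mul_pow_of_le hR (by omega) (by omega)
    · have h1 : 24 * (8 * R ^ 2 * M) ^ 2 * M ≤ K' * R ^ K' := by
        calc 24 * (8 * R ^ 2 * M) ^ 2 * M = c₃ * R ^ (6 * K + 4) := by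
              rw [hc₃, hM']
              ring
          _ ≤ _ := mul_pow_le_mul_pow_of_le hR (by omega) (by omega)
      rw [← mul_div_assoc, le_div_iff₀ hNdpos] at hb
      refine le_trans ?_ (hb.trans ?_)
      · rw [pow_succ', ← mul_assoc]
        push_cast
        rw [mul_assoc (q' : ℝ), mul_assoc (q₀ : ℝ)]
      · exact_mod_cast h1

end

end DiagonalSystems

namespace DiagonalSystems

noncomputable section
open Polynomial

lemma norm_sum_sub_sum_shift_le {g : ℕ → ℂ} (hg : ∀ x, ‖g x‖ ≤ 1) (P t : ℕ) :
    ‖∑ x ∈ range P, g x - ∑ x ∈ range P, g (x + t)‖ ≤ 2 * t := by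
  induction t with
  | zero => simp
  | succ t ih =>
    have h1 : ∑ x ∈ range P, g (x + t) - ∑ x ∈ range P, g (x + (t + 1)) = g t - g (P + t) := by
      rw [← sum_sub_distrib]
      have := sum_range_sub' (fun x => g (x + t)) P
      simp only [zero_add] at this
      rw [← this]
      exact sum_congr rfl fun x _ => by rw [show x + (t + 1) = x + 1 + t by ring]
    calc _ = ‖(∑ x ∈ range P, g x - ∑ x ∈ range P, g (x + t)) + (g t - g (P + t))‖ := by
          rw [← h1]
          congr 1
          ring
      _ ≤ 2 * t + (1 + 1) :=
        (norm_add_le _ _).trans (add_le_add ih ((norm_sub_le _ _).trans (add_le_add (hg _) (hg _))))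
      _ = _ := by
        push_cast
        ring

lemma exists_norm_sum_progression_ge {g : ℕ → ℂ} (hg : ∀ x, ‖g x‖ ≤ 1) {P R q L : ℕ} (hP : 1 ≤ P)
    (hL : 4 * (q * L * R) ≤ P) (h : P ≤ R * ‖∑ x ∈ range P, g x‖) :
    ∃ x < P, (L : ℝ) ≤ 2 * R * ‖∑ y ∈ range L, g (x + q * y)‖ := by
  by_contra! hcon
  have h1 : L * ‖∑ x ∈ range P, g x‖ ≤
      ∑ x ∈ range P, ‖∑ y ∈ range L, g (x + q * y)‖ + L * (2 * (q * L)) := by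
    have h2 : (L : ℂ) * ∑ x ∈ range P, g x = ∑ x ∈ range P, ∑ y ∈ range L, g (x + q * y) +
        ∑ y ∈ range L, (∑ x ∈ range P, g x - ∑ x ∈ range P, g (x + q * y)) := by
      rw [sum_comm, ← sum_add_distrib]
      simp
    calc L * ‖∑ x ∈ range P, g x‖ = ‖(L : ℂ) * ∑ x ∈ range P, g x‖ := by simp
      _ ≤ _ := by
        rw [h2]
        refine (norm_add_le _ _).trans (add_le_add (norm_sum_le _ _) ((norm_sum_le _ _).trans ?_))
        refine (sum_le_card_nsmul _ _ (2 * (q * L : ℝ)) fun y hy => ?_).trans (by simp)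
        refine (norm_sum_sub_sum_shift_le hg P (q * y)).trans ?_
        push_cast
        have := (mem_range.1 hy).le
        gcongr
  have h2 : 2 * R * ∑ x ∈ range P, ‖∑ y ∈ range L, g (x + q * y)‖ < P * L := by
    have h3 := sum_lt_sum_of_nonempty (s := range P) ⟨0, mem_range.2 hP⟩ fun x hx =>
      hcon x (mem_range.1 hx)
    rwa [← mul_sum, sum_const, card_range, nsmul_eq_mul] at h3
  have h3 : (4 * (q * L * R) : ℝ) ≤ P := by exact_mod_cast hL
  have h4 : (L : ℝ) * P ≤ L * (R * ‖∑ x ∈ range P, g x‖) := by gcongr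
  have h5 : R * (L * ‖∑ x ∈ range P, g x‖) ≤
      R * (∑ x ∈ range P, ‖∑ y ∈ range L, g (x + q * y)‖ + L * (2 * (q * L))) := by gcongr
  have h6 : (L : ℝ) * (4 * (q * L * R)) ≤ L * P := by gcongr
  linarith

lemma exists_add_mul_pow_eq (u q y k : ℕ) :
    ∃ m : ℕ, (u + q * y) ^ k = u ^ k + q * m ∧ m * (u + q * y) ≤ y * k * (u + q * y) ^ k := by
  induction k with
  | zero => exact ⟨0, by simp⟩
  | succ k ih =>
    obtain ⟨m, h1, h2⟩ := ih
    refine ⟨y * u ^ k + m * (u + q * y), ?_, ?_⟩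
    · rw [pow_succ, h1]
      ring
    · have h3 : u ^ k ≤ (u + q * y) ^ k := Nat.pow_le_pow_left (by omega) k
      set V := u + q * y
      calc (y * u ^ k + m * V) * V ≤ (y * V ^ k + y * k * V ^ k) * V := by gcongr
        _ = _ := by ring

lemma coeff_comp_linear {n : ℕ} (φ u q : ℝ) :
    (C φ * (C q * X + C u) ^ n).natDegree ≤ n ∧ (C φ * (C q * X + C u) ^ n).coeff n = φ * q ^ n := by
  have h1 : (C q * X + C u).natDegree ≤ 1 := natDegree_linear_le
  have h2 : ((C q * X + C u) ^ n).natDegree ≤ n := by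
    simpa using natDegree_pow_le_of_le n h1
  refine ⟨(natDegree_C_mul_le _ _).trans h2, ?_⟩
  rw [coeff_C_mul]
  have := coeff_pow_of_natDegree_le (m := n) h1
  rw [mul_one] at this
  rw [this]
  simp

theorem weyl_two {k n : ℕ} (hn : 1 ≤ n) (hkn : n < k) : ∃ K : ℕ, 1 ≤ K ∧ ∀ P R : ℕ, 1 ≤ P → 1 ≤ R →
    ∀ θ φ : ℝ, P ≤ R * ‖∑ x ∈ range P, e (θ * (x + 1 : ℕ) ^ k + φ * (x + 1 : ℕ) ^ n)‖ →
    ∃ q : ℕ, 1 ≤ q ∧ q ≤ K * R ^ K ∧ (∃ a : ℤ, |q * θ - a| * P ^ k ≤ (K * R ^ K : ℕ)) ∧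
      ∃ b : ℤ, |q * φ - b| * P ^ n ≤ (K * R ^ K : ℕ) := by
  obtain ⟨K₁, hK₁, weyl₁⟩ := weyl (k - 1)
  obtain ⟨K₂, hK₂, weyl₂⟩ := weyl (n - 1)
  rw [Nat.sub_add_cancel (by omega)] at weyl₁
  rw [Nat.sub_add_cancel hn] at weyl₂
  set D := 32 * k * 2 ^ k with hD
  set c₁ := (D * K₁) ^ k with hc₁
  set c₂ := K₂ * 4 ^ K₂ * K₁ ^ n with hc₂
  set c₃ := K₂ * 4 ^ K₂ * (2 * D * K₁) ^ n with hc₃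
  set K := c₁ + c₂ + c₃ + (K₁ + 1) * k + (K₂ + K₁ * n) + (K₂ + (K₁ + 1) * n) with hK
  have hDpos : 1 ≤ D := by
    have : 0 < 32 * k * 2 ^ k := Nat.mul_pos (by omega) (by positivity)
    omega
  refine ⟨K, ?_, fun P R hP hR θ φ hS => ?_⟩
  · have : 0 < (K₁ + 1) * k := Nat.mul_pos (by omega) (by omega)
    omega
  set M := K₁ * R ^ K₁ with hM
  have hM1 : 1 ≤ M := Nat.mul_pos (by omega) (by positivity)
  by_cases hsmall : P < D * R * M
  · have hpow : P ^ k ≤ K * R ^ K := by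
      calc P ^ k ≤ (D * R * M) ^ k := Nat.pow_le_pow_left hsmall.le _
        _ = c₁ * R ^ ((K₁ + 1) * k) := by
          rw [hc₁, pow_mul, ← mul_pow, hM]
          ring
        _ ≤ _ := mul_pow_le_mul_pow_of_le hR (by omega) (by omega)
    have hround : ∀ x : ℝ, ∀ d ≤ k, ∃ a : ℤ, |((1 : ℕ) : ℝ) * x - a| * P ^ d ≤ (K * R ^ K : ℕ) := by
      intro x d hd
      refine ⟨round x, ?_⟩
      rw [Nat.cast_one, one_mul]
      calc |x - round x| * P ^ d ≤ 1 * P ^ k := by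
            have : (1 : ℝ) ≤ P := by exact_mod_cast hP
            gcongr
            exact (abs_sub_round _).trans (by norm_num)
        _ ≤ _ := by
          rw [one_mul]
          exact_mod_cast hpow
    exact ⟨1, le_rfl, (Nat.one_le_pow _ _ hP).trans hpow, hround θ k le_rfl, hround φ n hkn.le⟩
  push Not at hsmall
  obtain ⟨q, hq1, hq2, a, ha⟩ := weyl₁ P R P hP hR le_rfl
    (C θ * (C 1 * X + C 1) ^ k + C φ * (C 1 * X + C 1) ^ n)
    (natDegree_add_le_of_degree_le (coeff_comp_linear _ _ _).1 ((coeff_comp_linear _ _ _).1.trans hkn.le))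
    (by simpa using hS)
  rw [coeff_add, (coeff_comp_linear _ _ _).2, coeff_eq_zero_of_natDegree_lt
    ((coeff_comp_linear (n := n) φ 1 1).1.trans_lt hkn), one_pow, mul_one, add_zero] at ha
  change q ≤ M at hq2
  change _ ≤ ((M : ℕ) : ℝ) at ha
  set L := P / (D * R * M) with hL
  have hDRM : 0 < D * R * M := Nat.mul_pos (Nat.mul_pos hDpos hR) hM1
  have hL1 : 1 ≤ L := Nat.div_pos hsmall hDRM
  have hLP : L * (D * R * M) ≤ P := Nat.div_mul_le_self _ _
  have hPL : P ≤ 2 * (D * R * M) * L := by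
    have h1 := Nat.lt_div_mul_add (a := P) hDRM
    rw [← hL] at h1
    nlinarith
  have hD4 : 4 ≤ D := by
    have h1 : 0 < 8 * k * 2 ^ k := Nat.mul_pos (by omega) (by positivity)
    have h2 : D = 4 * (8 * k * 2 ^ k) := by
      rw [hD]
      ring
    omega
  have hqL : 4 * (q * L * R) ≤ P := by
    calc 4 * (q * L * R) ≤ D * (M * L * R) := by gcongr
      _ = L * (D * R * M) := by ring
      _ ≤ P := hLP
  obtain ⟨x, hx, hsum⟩ := exists_norm_sum_progression_ge
    (g := fun x => e (θ * (x + 1 : ℕ) ^ k + φ * (x + 1 : ℕ) ^ n)) (fun x => (norm_e _).le) hP hqL hS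
  have hRR : (1 : ℝ) ≤ R := by exact_mod_cast hR
  have hMR : (1 : ℝ) ≤ M := by exact_mod_cast hM1
  have hPR : (1 : ℝ) ≤ P := by exact_mod_cast hP
  have hcmp : ∀ y ∈ range L, ‖e (θ * (x + q * y + 1 : ℕ) ^ k + φ * (x + q * y + 1 : ℕ) ^ n) -
      e (θ * (x + 1 : ℕ) ^ k) * e (φ * (q * y + (x + 1 : ℕ)) ^ n)‖ ≤ 1 / (4 * R) := by
    intro y hy
    have hy' := (mem_range.1 hy).le
    obtain ⟨m, hm1, hm2⟩ := exists_add_mul_pow_eq (x + 1) q y k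
    have h1 : ((x + q * y + 1 : ℕ) : ℝ) ^ k = (x + 1 : ℕ) ^ k + q * m := by
      rw [show x + q * y + 1 = x + 1 + q * y by ring]
      exact_mod_cast hm1
    have h2 : ((x + q * y + 1 : ℕ) : ℝ) = q * y + (x + 1 : ℕ) := by
      push_cast
      ring
    rw [h1, ← e_add, h2]
    have h3 : θ * ((x + 1 : ℕ) ^ k + q * m) + φ * (q * y + (x + 1 : ℕ)) ^ n =
        (θ * (x + 1 : ℕ) ^ k + φ * (q * y + (x + 1 : ℕ)) ^ n + (q * θ - a) * m) + (a * m : ℤ) := by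
      push_cast
      ring
    rw [h3, e_add_intCast]
    refine (norm_e_sub_e_le _ _).trans ?_
    rw [add_sub_cancel_left, abs_mul, abs_of_nonneg (Nat.cast_nonneg m : (0 : ℝ) ≤ m)]
    have hV : x + 1 + q * y ≤ 2 * P := by
      have : q * y ≤ P := by
        calc q * y ≤ q * L := Nat.mul_le_mul_left _ hy'
          _ ≤ q * L * R := Nat.le_mul_of_pos_right _ hR
          _ ≤ P := by omega
      omega
    have hmP : m * P ≤ L * k * (2 ^ k * P ^ k) := by
      obtain ⟨k', rfl⟩ := Nat.exists_eq_add_of_lt hkn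
      rw [pow_succ, ← mul_assoc] at hm2
      have h5 := Nat.le_of_mul_le_mul_right hm2 (by omega)
      calc m * P ≤ y * (n + k' + 1) * (x + 1 + q * y) ^ (n + k') * P := Nat.mul_le_mul_right _ h5
        _ ≤ L * (n + k' + 1) * (2 * P) ^ (n + k') * (2 * P) := by
          gcongr
          omega
        _ = _ := by ring
    have hmPR : (m * P : ℝ) ≤ L * k * (2 ^ k * P ^ k) := by exact_mod_cast hmP
    have hLPR : (L : ℝ) * (32 * k * 2 ^ k * R * M) ≤ P := by
      rw [hD] at hLP
      exact_mod_cast hLP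
    have h6 : |q * θ - a| * m * P ≤ L * k * 2 ^ k * M := by
      calc |q * θ - a| * m * P = |q * θ - a| * (m * P) := by ring
        _ ≤ |q * θ - a| * (L * k * (2 ^ k * P ^ k)) := by gcongr
        _ = L * k * 2 ^ k * (|q * θ - a| * P ^ k) := by ring
        _ ≤ _ := by gcongr
    have h7 : (|q * θ - a| * m * (32 * R)) * P ≤ 1 * P := by
      calc (|q * θ - a| * m * (32 * R)) * P = (|q * θ - a| * m * P) * (32 * R) := by ring
        _ ≤ (L * k * 2 ^ k * M) * (32 * R) := by gcongr
        _ = L * (32 * k * 2 ^ k * R * M) := by ring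
        _ ≤ 1 * P := by rwa [one_mul]
    have h8 := le_of_mul_le_mul_right h7 (by positivity)
    rw [le_div_iff₀ (by positivity)]
    have h9 : 0 ≤ |q * θ - a| * m * R := by positivity
    have := Real.pi_lt_four
    nlinarith
  have hlow : (L : ℝ) ≤ (4 * R : ℕ) *
      ‖∑ y ∈ range L, e ((C φ * (C (q : ℝ) * X + C ((x + 1 : ℕ) : ℝ)) ^ n).eval (y : ℝ))‖ := by
    have h1 : ∀ y : ℕ, (C φ * (C (q : ℝ) * X + C ((x + 1 : ℕ) : ℝ)) ^ n).eval (y : ℝ) =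
        φ * (q * y + (x + 1 : ℕ)) ^ n := by
      intro y
      simp
    simp_rw [h1]
    set A := ∑ y ∈ range L, e (θ * (x + q * y + 1 : ℕ) ^ k + φ * (x + q * y + 1 : ℕ) ^ n) with hA
    set B := ∑ y ∈ range L, e (φ * (q * y + (x + 1 : ℕ)) ^ n) with hB
    have h2 : ‖A - e (θ * (x + 1 : ℕ) ^ k) * B‖ ≤ L * (1 / (4 * R)) := by
      rw [hA, hB, mul_sum, ← sum_sub_distrib]
      refine (norm_sum_le _ _).trans ((sum_le_card_nsmul _ _ _ hcmp).trans ?_)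
      rw [card_range, nsmul_eq_mul]
    have h3 : ‖A‖ ≤ ‖B‖ + L * (1 / (4 * R)) := by
      calc ‖A‖ = ‖e (θ * (x + 1 : ℕ) ^ k) * B + (A - e (θ * (x + 1 : ℕ) ^ k) * B)‖ := by
            congr 1
            ring
        _ ≤ ‖B‖ + L * (1 / (4 * R)) := by
          refine (norm_add_le _ _).trans (add_le_add ?_ h2)
          rw [norm_mul, norm_e, one_mul]
    have h4 : (L : ℝ) ≤ 2 * R * (‖B‖ + L * (1 / (4 * R))) :=
      hsum.trans (by gcongr)
    have h5 : 2 * R * (L * (1 / (4 * R)) : ℝ) = L / 2 := by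
      field_simp
      ring
    rw [mul_add, h5] at h4
    push_cast
    linarith
  obtain ⟨q', hq'1, hq'2, b, hb⟩ := weyl₂ L (4 * R) L hL1 (by omega) le_rfl _
    (coeff_comp_linear _ _ _).1 hlow
  rw [(coeff_comp_linear _ _ _).2] at hb
  have hqn : q' * q ^ n ≤ K * R ^ K := by
    calc q' * q ^ n ≤ K₂ * (4 * R) ^ K₂ * M ^ n := by gcongr
      _ = c₂ * R ^ (K₂ + K₁ * n) := by
        rw [hc₂, hM, mul_pow, mul_pow, pow_add, pow_mul]
        ring
      _ ≤ _ := mul_pow_le_mul_pow_of_le hR (by omega) (by omega)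
  refine ⟨q' * q ^ n, Nat.mul_pos hq'1 (by positivity), hqn, ⟨q' * q ^ (n - 1) * a, ?_⟩, ⟨b, ?_⟩⟩
  · have h1 : ((q' * q ^ n : ℕ) : ℝ) * θ - ((q' * q ^ (n - 1) * a : ℤ) : ℝ) =
        (q' * q ^ (n - 1) : ℕ) * (q * θ - a) := by
      obtain ⟨n', rfl⟩ := Nat.exists_eq_add_of_le' hn
      rw [Nat.add_sub_cancel]
      push_cast
      ring
    rw [h1, abs_mul, Nat.abs_cast, mul_assoc]
    have h2 : q' * q ^ (n - 1) * M ≤ K * R ^ K := by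
      calc q' * q ^ (n - 1) * M ≤ K₂ * (4 * R) ^ K₂ * M ^ (n - 1) * M := by gcongr
        _ = K₂ * (4 * R) ^ K₂ * M ^ n := by
          rw [mul_assoc, ← pow_succ, Nat.sub_add_cancel hn]
        _ = c₂ * R ^ (K₂ + K₁ * n) := by
          rw [hc₂, hM, mul_pow, mul_pow, pow_add, pow_mul]
          ring
        _ ≤ _ := mul_pow_le_mul_pow_of_le hR (by omega) (by omega)
    calc ((q' * q ^ (n - 1) : ℕ) : ℝ) * (|q * θ - a| * P ^ k) ≤ (q' * q ^ (n - 1) : ℕ) * M := by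
          gcongr
      _ ≤ _ := by exact_mod_cast h2
  · have h1 : ((q' * q ^ n : ℕ) : ℝ) * φ - b = q' * (φ * q ^ n) - b := by
      push_cast
      ring
    rw [h1]
    have h2 : (P : ℝ) ^ n ≤ (2 * (D * R * M) : ℕ) ^ n * L ^ n := by
      rw [← mul_pow]
      gcongr
      exact_mod_cast hPL
    calc |q' * (φ * q ^ n) - b| * P ^ n
        ≤ |q' * (φ * q ^ n) - b| * ((2 * (D * R * M) : ℕ) ^ n * L ^ n) := by gcongr
      _ = (2 * (D * R * M) : ℕ) ^ n * (|q' * (φ * q ^ n) - b| * L ^ n) := by ring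
      _ ≤ (2 * (D * R * M) : ℕ) ^ n * (K₂ * (4 * R) ^ K₂ : ℕ) := by gcongr
      _ = (c₃ * R ^ (K₂ + (K₁ + 1) * n) : ℕ) := by
        rw [← Nat.cast_pow, ← Nat.cast_mul, hc₃, hM]
        congr 1
        rw [pow_add, pow_mul R, mul_pow 4]
        rw [show 2 * (D * R * (K₁ * R ^ K₁)) = 2 * D * K₁ * R ^ (K₁ + 1) by ring, mul_pow]
        ring
      _ ≤ _ := by
        exact_mod_cast mul_pow_le_mul_pow_of_le hR (by omega) (by omega)

end

end DiagonalSystems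

namespace DiagonalSystems

noncomputable section

variable {I : Type} [Fintype I]

/-- The major arcs: points with a simultaneous rational approximation of height at most `Q`. -/
def majorArcs (d : I → ℕ) (P Q : ℕ) : Set (I → ℝ) :=
  {α | ∃ q : ℕ, 1 ≤ q ∧ q ≤ Q ∧ ∀ i, ∃ a : ℤ, |α i - a / q| * (P : ℝ) ^ d i ≤ Q}

/-- Each coefficient can be recovered, up to a fixed denominator, from the column forms. -/
def Recoverable (d : I → ℕ) {s : ℕ} (A : I → Fin s → ℤ) : Prop :=
  ∃ D : ℕ, 1 ≤ D ∧ ∃ u : I → Fin s → ℤ, ∀ (α : I → ℝ) i,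
    D * α i = ∑ j, u i j * ∑ i' with d i' = d i, α i' * A i' j

lemma mem_majorArcs_of_le_norm_expSum {k n : ℕ} (hn : 1 ≤ n) (hkn : n < k) {d : I → ℕ}
    (hd : ∀ i, d i = k ∨ d i = n) {s : ℕ} {A : I → Fin s → ℤ} (hA : Recoverable d A) :
    ∃ K : ℕ, 1 ≤ K ∧ ∀ P R : ℕ, 1 ≤ P → 1 ≤ R → ∀ α : I → ℝ,
      (∀ j, (P : ℝ) ≤ R * ‖expSum d P fun i => α i * A i j‖) → α ∈ majorArcs d P (K * R ^ K) := by
  classical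
  obtain ⟨K, hK, hweyl⟩ := weyl_two hn hkn
  obtain ⟨D, hD, u, hu⟩ := hA
  set U := ∑ i, ∑ j, (u i j).natAbs with hU
  refine ⟨(U + D) * K ^ s + K * s, ?_, fun P R hP hR α hα => ?_⟩
  · have : 0 < (U + D) * K ^ s := Nat.mul_pos (by omega) (by positivity)
    omega
  have hcol : ∀ j, ∃ q : ℕ, 1 ≤ q ∧ q ≤ K * R ^ K ∧ ∀ i, ∃ a : ℤ,
      |q * (∑ i' with d i' = d i, α i' * A i' j) - a| * P ^ d i ≤ (K * R ^ K : ℕ) := by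
    intro j
    have h1 : ∀ x : ℕ, ∑ i, α i * A i j * (x : ℝ) ^ d i =
        (∑ i' with d i' = k, α i' * A i' j) * x ^ k + (∑ i' with d i' = n, α i' * A i' j) * x ^ n := by
      intro x
      rw [← sum_filter_add_sum_filter_not univ (fun i => d i = k), sum_mul, sum_mul]
      congr 1
      · exact sum_congr rfl fun i hi => by rw [(mem_filter.1 hi).2]
      · have h2 : univ.filter (fun i => ¬ d i = k) = univ.filter fun i => d i = n := by
          refine filter_congr fun i _ => ?_
          have := hd i
          omega
        rw [h2]
        exact sum_congr rfl fun i hi => by rw [(mem_filter.1 hi).2]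
    have h2 := hα j
    rw [expSum, ← Ico_add_one_right_eq_Icc, sum_Ico_eq_sum_range, Nat.add_sub_cancel] at h2
    simp_rw [h1, add_comm 1] at h2
    obtain ⟨q, hq1, hq2, ha, hb⟩ := hweyl P R hP hR _ _ h2
    refine ⟨q, hq1, hq2, fun i => ?_⟩
    rcases hd i with h | h <;> rw [h]
    · exact ha
    · exact hb
  choose q hq1 hq2 a ha using hcol
  set B := K * R ^ K with hB
  have hB1 : 1 ≤ B := Nat.mul_pos (by omega) (by positivity)
  have hprod : 1 ≤ ∏ j, q j := Finset.one_le_prod' fun j _ => hq1 j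
  have hbound : (U + D) * B ^ s ≤ ((U + D) * K ^ s + K * s) *
      R ^ ((U + D) * K ^ s + K * s) := by
    calc (U + D) * B ^ s = (U + D) * K ^ s * R ^ (K * s) := by
          rw [hB, mul_pow, pow_mul]
          ring
      _ ≤ _ := mul_pow_le_mul_pow_of_le hR (by omega) (by omega)
  refine ⟨D * ∏ j, q j, Nat.mul_pos hD hprod, le_trans ?_ hbound, fun i =>
    ⟨∑ j, u i j * ((∏ j' ∈ univ.erase j, q j' : ℕ) * a j i), ?_⟩⟩
  · gcongr
    · omega
    · simpa using prod_le_pow_card univ q B fun j _ => hq2 j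
  have hq0 : (1 : ℝ) ≤ (D * ∏ j, q j : ℕ) := by
    exact_mod_cast (Nat.mul_pos hD hprod : 0 < D * ∏ j, q j)
  have h1 : α i - ((∑ j, u i j * ((∏ j' ∈ univ.erase j, q j' : ℕ) * a j i) : ℤ) : ℝ) /
      (D * ∏ j, q j : ℕ) = (∑ j, u i j * ((∏ j' ∈ univ.erase j, q j' : ℕ) *
        (q j * (∑ i' with d i' = d i, α i' * A i' j) - a j i))) / (D * ∏ j, q j : ℕ) := by
    rw [eq_div_iff (by positivity), sub_mul, div_mul_cancel₀ _ (by positivity)]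
    have h2 : α i * (D * ∏ j, q j : ℕ) = (∏ j, q j : ℕ) * (D * α i) := by
      push_cast
      ring
    rw [h2, hu, mul_sum]
    push_cast
    rw [← sum_sub_distrib]
    refine sum_congr rfl fun j _ => ?_
    rw [← mul_prod_erase univ (fun j => (q j : ℝ)) (mem_univ j)]
    ring
  rw [h1, abs_div, abs_of_pos (by positivity : (0 : ℝ) < (D * ∏ j, q j : ℕ))]
  refine (mul_le_mul_of_nonneg_right (div_le_self (abs_nonneg _) hq0) (by positivity)).trans ?_
  refine le_trans ?_ (by exact_mod_cast hbound : (((U + D) * B ^ s : ℕ) : ℝ) ≤ _)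
  calc |∑ j, u i j * ((∏ j' ∈ univ.erase j, q j' : ℕ) *
        (q j * (∑ i' with d i' = d i, α i' * A i' j) - a j i))| * (P : ℝ) ^ d i
      ≤ (∑ j, ((u i j).natAbs : ℝ) * (B ^ (s - 1) *
        |q j * (∑ i' with d i' = d i, α i' * A i' j) - a j i|)) * (P : ℝ) ^ d i := by
        gcongr
        refine (abs_sum_le_sum_abs _ _).trans (sum_le_sum fun j _ => ?_)
        rw [abs_mul, abs_mul, Nat.cast_natAbs, Int.cast_abs, Nat.abs_cast]
        gcongr
        have := prod_le_pow_card (univ.erase j) q B fun j _ => hq2 j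
        rw [card_erase_of_mem (mem_univ j), card_univ, Fintype.card_fin] at this
        exact_mod_cast this
    _ = ∑ j, ((u i j).natAbs : ℝ) * (B ^ (s - 1) *
        (|q j * (∑ i' with d i' = d i, α i' * A i' j) - a j i| * (P : ℝ) ^ d i)) := by
        rw [sum_mul]
        exact sum_congr rfl fun j _ => by ring
    _ ≤ ∑ j, ((u i j).natAbs : ℝ) * B ^ s := by
        refine sum_le_sum fun j _ => ?_
        have hs : s - 1 + 1 = s := Nat.sub_add_cancel (by have := j.2; omega)
        calc ((u i j).natAbs : ℝ) * (B ^ (s - 1) *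
              (|q j * (∑ i' with d i' = d i, α i' * A i' j) - a j i| * (P : ℝ) ^ d i))
            ≤ ((u i j).natAbs : ℝ) * (B ^ (s - 1) * B) := by
              gcongr
              exact ha j i
          _ = _ := by rw [← pow_succ, hs]
    _ ≤ ((U + D) * B ^ s : ℕ) := by
        rw [← sum_mul]
        push_cast
        gcongr
        have h3 : ∑ j, (u i j).natAbs ≤ U + D :=
          (single_le_sum (f := fun i => ∑ j, (u i j).natAbs) (fun _ _ => Nat.zero_le _)
            (mem_univ i)).trans (Nat.le_add_right _ _)
        exact_mod_cast h3

end

end DiagonalSystems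

namespace DiagonalSystems

noncomputable section

variable {I : Type} [Fintype I]

lemma sum_range_mul_eq {M : Type*} [AddCommMonoid M] (f : ℕ → M) (q n : ℕ) :
    ∑ x ∈ range (n * q), f x = ∑ b ∈ range n, ∑ r ∈ range q, f (b * q + r) := by
  induction n with
  | zero => simp
  | succ n ih => rw [Nat.succ_mul, sum_range_add, ih, sum_range_succ]

/-- A sum of a periodic function against a Lipschitz function is close to the product of the
averages. -/
lemma norm_sum_periodic_mul_sub_le {c : ℕ → ℂ} (hc : ∀ x, ‖c x‖ ≤ 1) {q : ℕ} (hq : 1 ≤ q)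
    (hper : ∀ b x, c (b * q + x) = c x) {g : ℝ → ℂ} (hg : Continuous g) (hg1 : ∀ t, ‖g t‖ ≤ 1)
    {Λ : ℝ} (hΛ : 0 ≤ Λ) (hlip : ∀ t ∈ Set.Icc (0 : ℝ) 1, ∀ t' ∈ Set.Icc (0 : ℝ) 1,
      ‖g t - g t'‖ ≤ Λ * |t - t'|) {P : ℕ} (hP : 1 ≤ P) :
    ‖(∑ x ∈ range P, c x * g ((x + 1 : ℕ) / P)) / P -
      (∑ x ∈ range q, c x) / q * ∫ t in (0 : ℝ)..1, g t‖ ≤ (Λ + 2) * q / P := by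
  have hPR : (0 : ℝ) < P := by exact_mod_cast hP
  have hqR : (0 : ℝ) < q := by exact_mod_cast hq
  have hPC : (P : ℂ) ≠ 0 := by exact_mod_cast hPR.ne'
  have hqC : (q : ℂ) ≠ 0 := by exact_mod_cast hqR.ne'
  set n := P / q with hn
  have hnq : n * q ≤ P := Nat.div_mul_le_self _ _
  have hnq' : P < n * q + q := Nat.lt_div_mul_add hq
  have hnqR : (n * q : ℝ) ≤ P := by exact_mod_cast hnq
  have hnqR' : (P : ℝ) < n * q + q := by exact_mod_cast hnq'
  have hint : ∀ a b : ℝ, IntervalIntegrable g MeasureTheory.volume a b :=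
    fun a b => hg.intervalIntegrable a b
  set p : ℕ → ℝ := fun b => (b * q : ℝ) / P with hp
  have hp0 : p 0 = 0 := by simp [hp]
  have hpmono : ∀ b, p b ≤ p (b + 1) := by
    intro b
    simp only [hp]
    push_cast
    gcongr
    linarith
  have hpdiff : ∀ b, p (b + 1) - p b = q / P := by
    intro b
    simp only [hp]
    push_cast
    ring
  have hpn : p n ≤ 1 := (div_le_one hPR).2 hnqR
  have hpble : ∀ b ≤ n, p b ≤ p n := fun b hb => monotone_nat_of_le_succ hpmono hb
  have hpb0 : ∀ b, 0 ≤ p b := fun b => by positivity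
  have hblock : ∀ b < n, ∀ r < q, ‖g ((b * q + r + 1 : ℕ) / P) -
      P / q * ∫ t in p b..p (b + 1), g t‖ ≤ Λ * (q / P) := by
    intro b hb r hr
    set u : ℝ := ((b * q + r + 1 : ℕ) : ℝ) / P with hu
    have hu1 : p b ≤ u := by
      simp only [hu, hp]
      gcongr
      push_cast
      linarith [(Nat.cast_nonneg r : (0 : ℝ) ≤ r)]
    have hu2 : u ≤ p (b + 1) := by
      simp only [hu, hp]
      gcongr
      have : b * q + r + 1 ≤ (b + 1) * q := by nlinarith
      exact_mod_cast this
    have h1 : g u - P / q * ∫ t in p b..p (b + 1), g t =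
        P / q * ∫ t in p b..p (b + 1), (g u - g t) := by
      rw [intervalIntegral.integral_sub (by simp) (hint _ _), intervalIntegral.integral_const,
        hpdiff, mul_sub, Complex.real_smul]
      push_cast
      field_simp
    have h2 : ‖∫ t in p b..p (b + 1), (g u - g t)‖ ≤ Λ * (q / P) * |p (b + 1) - p b| := by
      refine intervalIntegral.norm_integral_le_of_norm_le_const fun t ht => ?_
      rw [Set.uIoc_of_le (hpmono b)] at ht
      have h1 := (hpble (b + 1) hb).trans hpn
      have h0 := hpb0 b
      refine (hlip u ⟨h0.trans hu1, hu2.trans h1⟩ t ⟨h0.trans ht.1.le, ht.2.trans h1⟩).trans ?_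
      gcongr
      rw [← hpdiff b, abs_le]
      constructor <;> linarith [ht.1, ht.2]
    rw [h1, norm_mul, norm_div, Complex.norm_natCast, Complex.norm_natCast]
    calc (P : ℝ) / q * ‖∫ t in p b..p (b + 1), (g u - g t)‖
        ≤ P / q * (Λ * (q / P) * |p (b + 1) - p b|) := by gcongr
      _ = Λ * (q / P) := by
        rw [hpdiff, abs_of_pos (by positivity)]
        field_simp
  have hmain : ‖∑ x ∈ range (n * q), c x * g ((x + 1 : ℕ) / P) -
      P / q * (∑ x ∈ range q, c x) * ∫ t in (0 : ℝ)..p n, g t‖ ≤ Λ * q := by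
    have h1 : ∫ t in (0 : ℝ)..p n, g t = ∑ b ∈ range n, ∫ t in p b..p (b + 1), g t := by
      rw [intervalIntegral.sum_integral_adjacent_intervals fun _ _ => hint _ _, hp0]
    have h2 : ∑ x ∈ range (n * q), c x * g ((x + 1 : ℕ) / P) -
        P / q * (∑ x ∈ range q, c x) * ∫ t in (0 : ℝ)..p n, g t = ∑ b ∈ range n, ∑ r ∈ range q,
          c r * (g ((b * q + r + 1 : ℕ) / P) - P / q * ∫ t in p b..p (b + 1), g t) := by
      rw [sum_range_mul_eq, h1, mul_sum, ← sum_sub_distrib]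
      refine sum_congr rfl fun b _ => ?_
      simp_rw [mul_sub, sum_sub_distrib, hper, ← sum_mul]
      ring
    rw [h2]
    calc _ ≤ ∑ b ∈ range n, ∑ r ∈ range q, Λ * (q / P) := by
          refine (norm_sum_le _ _).trans (sum_le_sum fun b hb => (norm_sum_le _ _).trans
            (sum_le_sum fun r hr => ?_))
          rw [norm_mul]
          refine (mul_le_of_le_one_left (norm_nonneg _) (hc r)).trans
            (hblock b (mem_range.1 hb) r (mem_range.1 hr))
      _ = Λ * q * (n * q / P) := by
          rw [sum_const, sum_const, card_range, card_range, nsmul_eq_mul, nsmul_eq_mul]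
          ring
      _ ≤ Λ * q := mul_le_of_le_one_right (by positivity) ((div_le_one hPR).2 hnqR)
  have htail1 : ‖∑ x ∈ range (P - n * q), c (n * q + x) * g ((n * q + x + 1 : ℕ) / P)‖ ≤ q := by
    refine (norm_sum_le _ _).trans ?_
    calc _ ≤ ∑ x ∈ range (P - n * q), (1 : ℝ) := by
          refine sum_le_sum fun x _ => ?_
          rw [norm_mul]
          exact mul_le_one₀ (hc _) (norm_nonneg _) (hg1 _)
      _ ≤ q := by
          rw [sum_const, card_range, nsmul_one]
          exact_mod_cast (by omega : P - n * q ≤ q)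
  have htail2 : ‖P / q * (∑ x ∈ range q, c x) * ∫ t in p n..(1 : ℝ), g t‖ ≤ q := by
    have h1 : ‖∫ t in p n..(1 : ℝ), g t‖ ≤ 1 * |1 - p n| :=
      intervalIntegral.norm_integral_le_of_norm_le_const fun t _ => hg1 t
    have h2 : ‖∑ x ∈ range q, c x‖ ≤ q := by
      refine (norm_sum_le _ _).trans ((sum_le_sum fun x _ => hc x).trans ?_)
      simp
    have h3 : |1 - p n| ≤ q / P := by
      rw [abs_of_nonneg (by linarith), le_div_iff₀ hPR, sub_mul]
      simp only [hp]
      rw [div_mul_cancel₀ _ hPR.ne']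
      linarith
    rw [norm_mul, norm_mul, norm_div, Complex.norm_natCast, Complex.norm_natCast]
    calc (P : ℝ) / q * ‖∑ x ∈ range q, c x‖ * ‖∫ t in p n..(1 : ℝ), g t‖
        ≤ P / q * q * (1 * (q / P)) := by
          gcongr
          exact h1.trans (by gcongr)
      _ = q := by field_simp
  have hsplit : (∑ x ∈ range P, c x * g ((x + 1 : ℕ) / P)) / P -
      (∑ x ∈ range q, c x) / q * ∫ t in (0 : ℝ)..1, g t =
      ((∑ x ∈ range (n * q), c x * g ((x + 1 : ℕ) / P) -
      P / q * (∑ x ∈ range q, c x) * ∫ t in (0 : ℝ)..p n, g t) +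
      (∑ x ∈ range (P - n * q), c (n * q + x) * g ((n * q + x + 1 : ℕ) / P) -
      P / q * (∑ x ∈ range q, c x) * ∫ t in p n..(1 : ℝ), g t)) / P := by
    rw [← intervalIntegral.integral_add_adjacent_intervals (hint 0 (p n)) (hint (p n) 1)]
    conv_lhs => rw [← Nat.add_sub_of_le hnq, sum_range_add, Nat.add_sub_of_le hnq]
    field_simp
    ring
  rw [hsplit, norm_div, Complex.norm_natCast]
  gcongr
  refine (norm_add_le _ _).trans ?_
  have := norm_sub_le (∑ x ∈ range (P - n * q), c (n * q + x) * g ((n * q + x + 1 : ℕ) / P))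
    (P / q * (∑ x ∈ range q, c x) * ∫ t in p n..(1 : ℝ), g t)
  linarith

end

end DiagonalSystems

namespace DiagonalSystems

noncomputable section

variable {I : Type} [Fintype I]

lemma abs_pow_sub_pow_le (n : ℕ) {t t' : ℝ} (ht : t ∈ Set.Icc (0 : ℝ) 1)
    (ht' : t' ∈ Set.Icc (0 : ℝ) 1) : |t ^ n - t' ^ n| ≤ n * |t - t'| := by
  induction n with
  | zero => simp
  | succ n ih =>
    have h1 : t ^ (n + 1) - t' ^ (n + 1) = (t ^ n - t' ^ n) * t + t' ^ n * (t - t') := by ring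
    rw [h1]
    refine (abs_add_le _ _).trans ?_
    rw [abs_mul, abs_mul, abs_of_nonneg ht.1, abs_of_nonneg (pow_nonneg ht'.1 n)]
    have h2 := mul_le_of_le_one_right (abs_nonneg (t ^ n - t' ^ n)) ht.2
    have h3 := mul_le_of_le_one_left (abs_nonneg (t - t')) (pow_le_one₀ ht'.1 ht'.2 (n := n))
    push_cast
    linarith

lemma abs_prod_sub_prod_le {ι : Type*} (J : Finset ι) {a b : ι → ℝ}
    (ha : ∀ j, a j ∈ Set.Icc (0 : ℝ) 1) (hb : ∀ j, b j ∈ Set.Icc (0 : ℝ) 1) :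
    |∏ j ∈ J, a j - ∏ j ∈ J, b j| ≤ ∑ j ∈ J, |a j - b j| := by
  classical
  induction J using Finset.induction_on with
  | empty => simp
  | insert j J hj ih =>
    rw [prod_insert hj, prod_insert hj, sum_insert hj]
    have h1 : a j * ∏ j ∈ J, a j - b j * ∏ j ∈ J, b j =
      (a j - b j) * ∏ j ∈ J, a j + b j * (∏ j ∈ J, a j - ∏ j ∈ J, b j) := by ring
    rw [h1]
    refine (abs_add_le _ _).trans ?_
    rw [abs_mul, abs_mul, abs_of_nonneg (hb j).1,
      abs_of_nonneg (prod_nonneg fun j _ => (ha j).1)]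
    have h2 := mul_le_of_le_one_right (abs_nonneg (a j - b j))
      (prod_le_one (fun j _ => (ha j).1) fun j _ => (ha j).2 : ∏ j ∈ J, a j ≤ 1)
    have h3 := mul_le_of_le_one_left (abs_nonneg (∏ j ∈ J, a j - ∏ j ∈ J, b j)) (hb j).2
    linarith

/-- Near a rational point the normalised exponential sum is independent of its length. -/
lemma exists_norm_expSum_sub_le (d : I → ℕ) (b : I → ℤ) {q : ℕ} (hq : 1 ≤ q) (γ : I → ℝ) :
    ∃ M : ℂ, ∀ P : ℕ, 1 ≤ P →
      ‖expSum d P (fun i => b i / q + γ i / (P : ℝ) ^ d i) / P - M‖ ≤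
        (2 * Real.pi * ∑ i, |γ i| * d i + 2) * q / P := by
  have hqR : (q : ℝ) ≠ 0 := by positivity
  obtain ⟨c, hc⟩ : ∃ c : ℕ → ℂ, c = fun x =>
    e (∑ i, (b i : ℝ) / q * ((x + 1 : ℕ) : ℝ) ^ d i) := ⟨_, rfl⟩
  obtain ⟨g, hg⟩ : ∃ g : ℝ → ℂ, g = fun t => e (∑ i, γ i * t ^ d i) := ⟨_, rfl⟩
  have hc1 : ∀ x, ‖c x‖ ≤ 1 := fun x => by rw [hc]; exact (norm_e _).le
  have hg1 : ∀ t, ‖g t‖ ≤ 1 := fun x => by rw [hg]; exact (norm_e _).le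
  have hgc : Continuous g := by
    rw [hg]
    fun_prop
  have hper : ∀ m x, c (m * q + x) = c x := by
    intro m x
    have h1 : ∀ i, ∃ z : ℤ, (b i : ℝ) / q * ((m * q + x + 1 : ℕ) : ℝ) ^ d i =
        (b i : ℝ) / q * ((x + 1 : ℕ) : ℝ) ^ d i + z := by
      intro i
      obtain ⟨z, hz⟩ := sub_dvd_pow_sub_pow ((m * q + x + 1 : ℕ) : ℤ) ((x + 1 : ℕ) : ℤ) (d i)
      refine ⟨b i * m * z, ?_⟩
      have hz' : ((m * q + x + 1 : ℕ) : ℝ) ^ d i - ((x + 1 : ℕ) : ℝ) ^ d i = m * q * z := by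
        have := congrArg (fun y : ℤ => (y : ℝ)) hz
        push_cast at this ⊢
        rw [this]
        ring
      rw [eq_add_of_sub_eq' hz']
      push_cast
      field_simp
    choose z hz using h1
    simp only [hc]
    simp_rw [hz]
    rw [sum_add_distrib, ← Int.cast_sum, e_add_intCast]
  refine ⟨(∑ x ∈ range q, c x) / q * ∫ t in (0 : ℝ)..1, g t, fun P hP => ?_⟩
  have hPR : (P : ℝ) ≠ 0 := by positivity
  have h1 : expSum d P (fun i => b i / q + γ i / (P : ℝ) ^ d i) =
      ∑ x ∈ range P, c x * g ((x + 1 : ℕ) / P) := by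
    have hI : Icc 1 P = Ico (0 + 1) (P + 1) := by
      ext x
      simp only [mem_Icc, mem_Ico]
      omega
    rw [expSum, hI, range_eq_Ico, ← Finset.sum_Ico_add' (fun x : ℕ =>
      e (∑ i, ((b i : ℝ) / q + γ i / (P : ℝ) ^ d i) * (x : ℝ) ^ d i)) 0 P 1]
    · refine sum_congr rfl fun x _ => ?_
      simp only [hc, hg]
      rw [← e_add, ← sum_add_distrib]
      congr 1
      refine sum_congr rfl fun i _ => ?_
      rw [div_pow]
      field_simp
  rw [h1]
  refine norm_sum_periodic_mul_sub_le hc1 hq hper hgc hg1 (by positivity)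
    (fun t ht t' ht' => ?_) hP
  rw [hg]
  refine (norm_e_sub_e_le _ _).trans ?_
  rw [mul_assoc (2 * Real.pi)]
  gcongr
  rw [← sum_sub_distrib, sum_mul]
  refine (abs_sum_le_sum_abs _ _).trans (sum_le_sum fun i _ => ?_)
  rw [← mul_sub, abs_mul, mul_assoc]
  gcongr
  exact abs_pow_sub_pow_le _ ht ht'

/-- The normalised product of the absolute values of the exponential sums of the columns. -/
def normProd (d : I → ℕ) {s : ℕ} (A : I → Fin s → ℤ) (J : Finset (Fin s)) (P : ℕ)
    (α : I → ℝ) : ℝ :=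
  ∏ j ∈ J, (‖expSum d P fun i => α i * A i j‖ / P)

section normProd

variable {d : I → ℕ} {s : ℕ} {A : I → Fin s → ℤ} {J : Finset (Fin s)} {P : ℕ}

lemma norm_expSum_div_mem (d : I → ℕ) (P : ℕ) (β : I → ℝ) :
    ‖expSum d P β‖ / P ∈ Set.Icc (0 : ℝ) 1 :=
  ⟨by positivity, div_le_one_of_le₀ (norm_expSum_le d P β) (Nat.cast_nonneg _)⟩

lemma normProd_nonneg (α : I → ℝ) : 0 ≤ normProd d A J P α :=
  prod_nonneg fun _ _ => (norm_expSum_div_mem _ _ _).1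

@[fun_prop] lemma continuous_normProd : Continuous (normProd d A J P) := by
  unfold normProd
  fun_prop

lemma expSum_add_intCast (β : I → ℝ) (v : I → ℤ) :
    expSum d P (fun i => β i + v i) = expSum d P β := by
  refine sum_congr rfl fun x _ => ?_
  simp_rw [add_mul, sum_add_distrib]
  have : ∑ i, (v i : ℝ) * (x : ℝ) ^ d i = ((∑ i, v i * (x : ℤ) ^ d i : ℤ) : ℝ) := by push_cast; rfl
  rw [this, e_add_intCast]

lemma normProd_add_intCast (α : I → ℝ) (v : I → ℤ) :
    normProd d A J P (fun i => α i + v i) = normProd d A J P α := by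
  refine prod_congr rfl fun j _ => ?_
  have : (fun i => (α i + v i) * (A i j : ℝ)) = fun i => α i * A i j + (v i * A i j : ℤ) := by
    funext i
    push_cast
    ring
  rw [this, expSum_add_intCast]

lemma abs_normProd_sub_le (d : I → ℕ) {s : ℕ} (A : I → Fin s → ℤ) :
    ∃ C : ℝ, 0 < C ∧ ∀ (J : Finset (Fin s)) (Q P P' : ℕ), 1 ≤ Q → 1 ≤ P' → P' ≤ P →
      ∀ (q : ℕ), 1 ≤ q → q ≤ Q → ∀ (b : I → ℤ) (β : I → ℝ), (∀ i, |β i| ≤ Q) →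
        |normProd d A J P (fun i => b i / q + β i / (P : ℝ) ^ d i) -
          normProd d A J P' (fun i => b i / q + β i / (P' : ℝ) ^ d i)| ≤ C * Q ^ 2 / P' := by
  refine ⟨∑ j : Fin s, 2 * (2 * Real.pi * ∑ i, |(A i j : ℝ)| * d i + 2) + 1, by positivity, ?_⟩
  intro J Q P P' hQ hP' hPP q hq hqQ b β hβ
  have hQR : (1 : ℝ) ≤ Q := by exact_mod_cast hQ
  have hP'R : (1 : ℝ) ≤ P' := by exact_mod_cast hP'
  have hPPR : (P' : ℝ) ≤ P := by exact_mod_cast hPP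
  have hqR : (q : ℝ) ≤ Q := by exact_mod_cast hqQ
  refine (abs_prod_sub_prod_le J (fun j => norm_expSum_div_mem _ _ _)
    fun j => norm_expSum_div_mem _ _ _).trans ?_
  have key : ∀ j : Fin s, |‖expSum d P fun i => (b i / q + β i / (P : ℝ) ^ d i) * A i j‖ / P -
      ‖expSum d P' fun i => (b i / q + β i / (P' : ℝ) ^ d i) * A i j‖ / P'| ≤
      2 * (2 * Real.pi * ∑ i, |(A i j : ℝ)| * d i + 2) * (Q ^ 2 / P') := by
    intro j
    obtain ⟨M, hM⟩ := exists_norm_expSum_sub_le d (fun i => b i * A i j) hq (fun i => β i * A i j)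
    have hrew : ∀ P : ℕ, (fun i => (b i / q + β i / (P : ℝ) ^ d i) * A i j) =
        fun i => ((b i * A i j : ℤ) : ℝ) / q + β i * A i j / (P : ℝ) ^ d i := by
      intro P
      funext i
      push_cast
      ring
    have hb : ∀ R : ℕ, P' ≤ R → (2 * Real.pi * ∑ i, |β i * (A i j : ℝ)| * d i + 2) * q / R ≤
        (2 * Real.pi * ∑ i, |(A i j : ℝ)| * d i + 2) * (Q ^ 2 / P') := by
      intro R hR
      have hRR : (P' : ℝ) ≤ R := by exact_mod_cast hR
      have h1 : ∑ i, |β i * (A i j : ℝ)| * d i ≤ Q * ∑ i, |(A i j : ℝ)| * d i := by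
        rw [mul_sum]
        refine sum_le_sum fun i _ => ?_
        rw [abs_mul, mul_assoc]
        have := hβ i
        gcongr
      calc (2 * Real.pi * ∑ i, |β i * (A i j : ℝ)| * d i + 2) * q / R
          ≤ (2 * Real.pi * (Q * ∑ i, |(A i j : ℝ)| * d i) + 2 * Q) * Q / P' := by
            gcongr
            linarith
        _ = _ := by ring
    rw [hrew, hrew]
    have e1 := (hM P (hP'.trans hPP)).trans (hb P hPP)
    have e2 := (hM P' hP').trans (hb P' le_rfl)
    have hn : ∀ (z : ℂ) (R : ℕ), ‖z‖ / R = ‖z / R‖ := fun z R => by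
      rw [norm_div, Complex.norm_natCast]
    rw [hn, hn]
    refine (abs_norm_sub_norm_le _ _).trans ?_
    refine (norm_sub_le_norm_sub_add_norm_sub _ M _).trans ?_
    rw [norm_sub_rev M]
    linarith
  refine (sum_le_sum fun j _ => key j).trans ?_
  refine (sum_le_univ_sum_of_nonneg fun j => by positivity).trans ?_
  rw [← sum_mul, ← mul_div_assoc]
  gcongr
  linarith

end normProd

end

end DiagonalSystems

namespace DiagonalSystems

noncomputable section

open MeasureTheory

variable {I : Type} [Fintype I]

/-- The set of points whose `i`-th coordinate is within `Q / P ^ d i` of that of `x`. -/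
def arcBox (d : I → ℕ) (P Q : ℕ) (x : I → ℝ) : Set (I → ℝ) :=
  {α | ∀ i, |α i - x i| * (P : ℝ) ^ d i ≤ Q}

lemma measurableSet_arcBox (d : I → ℕ) (P Q : ℕ) (x : I → ℝ) :
    MeasurableSet (arcBox d P Q x) := by
  have : arcBox d P Q x = ⋂ i, {α : I → ℝ | |α i - x i| * (P : ℝ) ^ d i ≤ Q} := by
    ext α
    simp [arcBox]
  rw [this]
  exact MeasurableSet.iInter fun i => (isClosed_le (by fun_prop) (by fun_prop)).measurableSet

lemma lintegral_comp_scale (d : I → ℕ) {P : ℕ} (hP : 1 ≤ P) {f : (I → ℝ) → ENNReal}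
    (hf : Measurable f) (x : I → ℝ) :
    ∫⁻ β : I → ℝ, f (fun i => x i + β i / (P : ℝ) ^ d i) = ENNReal.ofReal ((P : ℝ) ^ ∑ i, d i) *
      ∫⁻ α, f α := by
  classical
  have hPR : (0 : ℝ) < P := by exact_mod_cast hP
  have hdet : (Matrix.diagonal fun i : I => ((P : ℝ) ^ d i)⁻¹).det = ((P : ℝ) ^ ∑ i, d i)⁻¹ := by
    rw [Matrix.det_diagonal, prod_inv_distrib, prod_pow_eq_pow_sum]
  have hdet0 : (Matrix.diagonal fun i : I => ((P : ℝ) ^ d i)⁻¹).det ≠ 0 := by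
    rw [hdet]
    positivity
  have h1 : ∫⁻ α, f α = ENNReal.ofReal (((P : ℝ) ^ ∑ i, d i)⁻¹) *
      ∫⁻ β : I → ℝ, f (fun i => x i + β i / (P : ℝ) ^ d i) := by
    rw [← lintegral_add_left_eq_self _ x]
    conv_lhs => rw [← Real.smul_map_diagonal_volume_pi hdet0, lintegral_smul_measure, hdet,
      abs_of_pos (by positivity)]
    rw [lintegral_map (by fun_prop) (by fun_prop), smul_eq_mul]
    congr 1
    refine lintegral_congr fun β => ?_
    congr 1
    funext i
    simp [Matrix.mulVec_diagonal, div_eq_inv_mul]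
  rw [h1, ← mul_assoc, ← ENNReal.ofReal_mul (by positivity), mul_inv_cancel₀ (by positivity),
    ENNReal.ofReal_one, one_mul]

lemma lintegral_arcBox (d : I → ℕ) {P : ℕ} (hP : 1 ≤ P) (Q : ℕ) {f : (I → ℝ) → ENNReal}
    (hf : Measurable f) (x : I → ℝ) :
    ∫⁻ β in {β : I → ℝ | ∀ i, |β i| ≤ Q}, f (fun i => x i + β i / (P : ℝ) ^ d i) =
      ENNReal.ofReal ((P : ℝ) ^ ∑ i, d i) * ∫⁻ α in arcBox d P Q x, f α := by
  have hPR : (0 : ℝ) < P := by exact_mod_cast hP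
  have hm : MeasurableSet {β : I → ℝ | ∀ i, |β i| ≤ (Q : ℝ)} := by
    have := measurableSet_arcBox (fun _ : I => 0) 1 Q 0
    simpa [arcBox] using this
  rw [← lintegral_indicator (measurableSet_arcBox d P Q x), ← lintegral_comp_scale d hP
    (hf.indicator (measurableSet_arcBox d P Q x)) x, ← lintegral_indicator hm]
  refine lintegral_congr fun β => ?_
  have : (β ∈ {β : I → ℝ | ∀ i, |β i| ≤ (Q : ℝ)}) ↔
      (fun i => x i + β i / (P : ℝ) ^ d i) ∈ arcBox d P Q x := by
    simp only [arcBox, Set.mem_ofPred_eq]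
    refine forall_congr' fun i => ?_
    have h0 : (0 : ℝ) < (P : ℝ) ^ d i := by positivity
    rw [add_sub_cancel_left, abs_div, abs_of_pos h0, div_mul_cancel₀ _ h0.ne']
  by_cases h : β ∈ {β : I → ℝ | ∀ i, |β i| ≤ (Q : ℝ)}
  · rw [Set.indicator_of_mem h, Set.indicator_of_mem (this.1 h)]
  · rw [Set.indicator_of_notMem h, Set.indicator_of_notMem (fun h' => h (this.2 h'))]

lemma lintegral_biUnion_finset_le {X ι : Type*} [MeasurableSpace X] {μ : Measure X}
    (V : Finset ι) (B : ι → Set X) (f : X → ENNReal) :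
    ∫⁻ x in ⋃ v ∈ V, B v, f x ∂μ ≤ ∑ v ∈ V, ∫⁻ x in B v, f x ∂μ := by
  classical
  induction V using Finset.induction_on with
  | empty => simp
  | insert v V hv ih =>
    rw [Finset.set_biUnion_insert, sum_insert hv]
    exact (lintegral_union_le _ _ _).trans (by gcongr)

lemma lintegral_le_of_periodic {f : (I → ℝ) → ENNReal}
    (hper : ∀ (α : I → ℝ) (v : I → ℤ), f (fun i => α i + v i) = f α) :
    ∫⁻ α in Set.Icc (fun _ => -3) fun _ => 3, f α ≤
      7 ^ Fintype.card I * ∫⁻ α in Set.Icc 0 1, f α := by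
  classical
  set V := Fintype.piFinset fun _ : I => Icc (-3 : ℤ) 3 with hV
  set B : (I → ℤ) → Set (I → ℝ) := fun v => {α | (fun i => α i - v i) ∈ Set.Icc (0 : I → ℝ) 1}
    with hB
  have hBm : ∀ v, MeasurableSet (B v) := fun v =>
    (isClosed_Icc.preimage (by fun_prop : Continuous fun (α : I → ℝ) i => α i - (v i : ℝ))).measurableSet
  have hsub : Set.Icc (fun _ : I => (-3 : ℝ)) (fun _ => 3) ⊆ ⋃ v ∈ V, B v := by
    intro α hα
    simp only [Set.mem_iUnion]
    refine ⟨fun i => ⌊α i⌋, Fintype.mem_piFinset.2 fun i => mem_Icc.2 ⟨?_, ?_⟩, ?_, ?_⟩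
    · rw [Int.le_floor]
      exact_mod_cast hα.1 i
    · have : (⌊α i⌋ : ℝ) ≤ 3 := (Int.floor_le (α i)).trans (hα.2 i)
      exact_mod_cast this
    · exact fun i => sub_nonneg.2 (Int.floor_le _)
    · exact fun i => by
        have := Int.lt_floor_add_one (α i)
        simp only [Pi.one_apply]
        linarith
  have hint : ∀ v, ∫⁻ α in B v, f α = ∫⁻ α in Set.Icc 0 1, f α := by
    intro v
    rw [← lintegral_indicator (hBm v), ← lintegral_indicator measurableSet_Icc,
      ← lintegral_add_left_eq_self _ (fun i => (v i : ℝ))]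
    refine lintegral_congr fun α => ?_
    have h1 : ((fun i => (v i : ℝ)) + α ∈ B v) ↔ α ∈ Set.Icc (0 : I → ℝ) 1 := by
      simp [hB]
    by_cases h : α ∈ Set.Icc (0 : I → ℝ) 1
    · rw [Set.indicator_of_mem h, Set.indicator_of_mem (h1.2 h), ← hper α v]
      congr 1
      funext i
      simp [add_comm]
    · rw [Set.indicator_of_notMem h, Set.indicator_of_notMem fun h' => h (h1.1 h')]
  calc ∫⁻ α in Set.Icc (fun _ => -3) fun _ => 3, f α ≤ ∫⁻ α in ⋃ v ∈ V, B v, f α :=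
        lintegral_mono_set hsub
    _ ≤ ∑ v ∈ V, ∫⁻ α in B v, f α := lintegral_biUnion_finset_le V B f
    _ = 7 ^ Fintype.card I * ∫⁻ α in Set.Icc 0 1, f α := by
        simp_rw [hint]
        rw [sum_const, hV, Fintype.card_piFinset]
        simp

end

end DiagonalSystems

namespace DiagonalSystems

noncomputable section

open MeasureTheory

variable {I : Type} [Fintype I]

/-- The rational points of height at most `Q` that are relevant to the unit cube. -/
def centers (I : Type) [Fintype I] (Q : ℕ) : Finset (I → ℝ) := by
  classical
  exact {p ∈ Icc 1 Q ×ˢ Fintype.piFinset fun _ : I => Icc (-(2 * Q) : ℤ) (2 * Q) |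
    ∀ i, |p.2 i| ≤ 2 * (p.1 : ℤ)}.image fun p i => (p.2 i : ℝ) / (p.1 : ℝ)

lemma mem_centers {Q : ℕ} {x : I → ℝ} : x ∈ centers I Q ↔ ∃ q : ℕ, 1 ≤ q ∧ q ≤ Q ∧
    ∃ a : I → ℤ, (∀ i, |a i| ≤ 2 * q) ∧ x = fun i => (a i : ℝ) / q := by
  classical
  simp only [centers, mem_image, mem_filter, mem_product, Fintype.mem_piFinset, mem_Icc,
    Prod.exists]
  constructor
  · rintro ⟨q, a, ⟨⟨h1, -⟩, h2⟩, h3⟩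
    exact ⟨q, h1.1, h1.2, a, h2, h3.symm⟩
  · rintro ⟨q, h1, h2, a, h3, h4⟩
    refine ⟨q, a, ⟨⟨⟨h1, h2⟩, fun i => ?_⟩, h3⟩, h4.symm⟩
    have := abs_le.1 (h3 i)
    omega

lemma card_centers_le {Q : ℕ} (hQ : 1 ≤ Q) : #(centers I Q) ≤ Q * (5 * Q) ^ Fintype.card I := by
  classical
  refine card_image_le.trans ((card_filter_le _ _).trans ?_)
  rw [card_product, Fintype.card_piFinset, Nat.card_Icc, prod_const, Int.card_Icc, card_univ]
  gcongr
  · omega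
  · omega

lemma abs_le_one_of_mul_pow_le {y P Q : ℝ} {n : ℕ} (hn : 1 ≤ n) (hP : 1 ≤ P) (hQP : Q ≤ P)
    (h : |y| * P ^ n ≤ Q) : |y| ≤ 1 := by
  have h2 : |y| * P ≤ P := by
    refine le_trans ?_ (h.trans hQP)
    gcongr
    exact le_self_pow₀ hP (by omega)
  nlinarith [abs_nonneg y]

lemma majorArcs_inter_subset {d : I → ℕ} (hd : ∀ i, 1 ≤ d i) {P Q : ℕ} (hQP : Q ≤ P) :
    majorArcs d P Q ∩ Set.Icc 0 1 ⊆ ⋃ x ∈ centers I Q, arcBox d P Q x := by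
  rintro α ⟨⟨q, hq1, hqQ, hα⟩, hα0, hα1⟩
  choose a ha using hα
  have hqR : (1 : ℝ) ≤ q := by exact_mod_cast hq1
  have hPR : (1 : ℝ) ≤ P := by exact_mod_cast hq1.trans (hqQ.trans hQP)
  have hQPR : (Q : ℝ) ≤ P := by exact_mod_cast hQP
  have hqQR : (q : ℝ) ≤ Q := by exact_mod_cast hqQ
  simp only [Set.mem_iUnion]
  refine ⟨fun i => a i / q, mem_centers.2 ⟨q, hq1, hqQ, a, fun i => ?_, rfl⟩, ha⟩
  have h1 := abs_le_one_of_mul_pow_le (hd i) hPR hQPR (ha i)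
  have h2 : |(a i / q : ℝ)| ≤ 2 := by
    have h3 := hα0 i
    have h4 := hα1 i
    simp only [Pi.zero_apply, Pi.one_apply] at h3 h4
    rw [abs_le] at h1 ⊢
    constructor <;> linarith
  rw [abs_div, abs_of_pos (by linarith : (0 : ℝ) < q), div_le_iff₀ (by linarith)] at h2
  exact_mod_cast h2

lemma pairwiseDisjoint_arcBox {d : I → ℕ} (hd : ∀ i, 1 ≤ d i) {P Q : ℕ}
    (hQP : 2 * Q ^ 3 < P) :
    Set.PairwiseDisjoint (centers I Q : Set (I → ℝ)) (arcBox d P Q) := by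
  have hP : 1 ≤ P := by omega
  have hPR : (1 : ℝ) ≤ P := by exact_mod_cast hP
  intro x hx y hy hxy
  rw [Function.onFun, Set.disjoint_left]
  intro α h1 h2
  obtain ⟨q, hq, hqQ, a, -, rfl⟩ := mem_centers.1 (mem_coe.1 hx)
  obtain ⟨q', hq', hqQ', a', -, rfl⟩ := mem_centers.1 (mem_coe.1 hy)
  obtain ⟨i, hi⟩ : ∃ i, (a i : ℝ) / q ≠ a' i / q' := by
    by_contra! h
    exact hxy (funext h)
  have hqR : (1 : ℝ) ≤ q := by exact_mod_cast hq
  have hqR' : (1 : ℝ) ≤ q' := by exact_mod_cast hq'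
  have hqQR : (q : ℝ) ≤ Q := by exact_mod_cast hqQ
  have hqQR' : (q' : ℝ) ≤ Q := by exact_mod_cast hqQ'
  have h3 : |(a i : ℝ) / q - a' i / q'| * P ≤ 2 * Q := by
    have hp : (P : ℝ) ≤ (P : ℝ) ^ d i := le_self_pow₀ hPR (by have := hd i; omega)
    have h4 : |(a i : ℝ) / q - a' i / q'| ≤ |α i - a i / q| + |α i - a' i / q'| := by
      have := abs_sub (α i - a' i / q') (α i - a i / q)
      have e : α i - a' i / q' - (α i - a i / q) = (a i : ℝ) / q - a' i / q' := by ring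
      rw [e] at this
      linarith
    calc |(a i : ℝ) / q - a' i / q'| * P
        ≤ (|α i - a i / q| + |α i - a' i / q'|) * (P : ℝ) ^ d i := by gcongr
      _ ≤ 2 * Q := by linarith [h1 i, h2 i]
  have h4 : 1 ≤ |(a i : ℝ) / q - a' i / q'| * (q * q') := by
    have h5 : (a i : ℝ) / q - a' i / q' = ((a i * q' - q * a' i : ℤ) : ℝ) / (q * q') := by
      push_cast
      rw [div_sub_div _ _ (by positivity) (by positivity)]
    have h6 : (a i * q' - q * a' i : ℤ) ≠ 0 := by
      intro h6
      rw [h6] at h5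
      simp only [Int.cast_zero, zero_div] at h5
      exact hi (sub_eq_zero.1 h5)
    rw [h5, abs_div, abs_of_pos (by positivity : (0 : ℝ) < q * q'),
      div_mul_cancel₀ _ (by positivity)]
    exact_mod_cast Int.one_le_abs h6
  have h5 : (P : ℝ) ≤ 2 * Q ^ 3 := by
    calc (P : ℝ) ≤ |(a i : ℝ) / q - a' i / q'| * (q * q') * P := le_mul_of_one_le_left (by positivity) h4
      _ = |(a i : ℝ) / q - a' i / q'| * P * (q * q') := by ring
      _ ≤ 2 * Q * (Q * Q) := by gcongr
      _ = 2 * Q ^ 3 := by ring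
  have h6 : P ≤ 2 * Q ^ 3 := by exact_mod_cast h5
  omega

lemma arcBox_subset {d : I → ℕ} (hd : ∀ i, 1 ≤ d i) {P Q : ℕ} (hQP : Q ≤ P) {x : I → ℝ}
    (hx : x ∈ centers I Q) : arcBox d P Q x ⊆ Set.Icc (fun _ => -3) fun _ => 3 := by
  obtain ⟨q, hq, hqQ, a, ha, rfl⟩ := mem_centers.1 hx
  intro α hα
  have hqR : (1 : ℝ) ≤ q := by exact_mod_cast hq
  have hPR : (1 : ℝ) ≤ P := by exact_mod_cast hq.trans (hqQ.trans hQP)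
  have hQPR : (Q : ℝ) ≤ P := by exact_mod_cast hQP
  have key : ∀ i, |α i| ≤ 3 := by
    intro i
    have h1 := abs_le_one_of_mul_pow_le (hd i) hPR hQPR (hα i)
    have h2 : |(a i / q : ℝ)| ≤ 2 := by
      rw [abs_div, abs_of_pos (by linarith : (0 : ℝ) < q), div_le_iff₀ (by linarith)]
      exact_mod_cast ha i
    rw [abs_le] at h1 h2 ⊢
    constructor <;> linarith
  exact ⟨fun i => (abs_le.1 (key i)).1, fun i => (abs_le.1 (key i)).2⟩

/-- Pruning: the mean value restricted to the major arcs of height `Q` loses only `Q ^ ε`. -/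
theorem lintegral_majorArcs_normProd_le {d : I → ℕ} (hd : ∀ i, 1 ≤ d i) {s : ℕ}
    {A : I → Fin s → ℤ} {J : Finset (Fin s)}
    (hJ : ∀ ε : ℝ, 0 < ε → ∃ C : ℝ, 0 < C ∧ ∀ P : ℕ, 1 ≤ P →
      ENNReal.ofReal ((P : ℝ) ^ ∑ i, d i) *
        ∫⁻ α in Set.Icc 0 1, ENNReal.ofReal (normProd d A J P α) ≤
        ENNReal.ofReal (C * (P : ℝ) ^ ε))
    {ε : ℝ} (hε : 0 < ε) : ∃ C : ℝ, 0 < C ∧ ∀ P Q : ℕ, 1 ≤ P → 1 ≤ Q →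
      ENNReal.ofReal ((P : ℝ) ^ ∑ i, d i) *
        ∫⁻ α in majorArcs d P Q ∩ Set.Icc 0 1, ENNReal.ofReal (normProd d A J P α) ≤
        ENNReal.ofReal (C * (Q : ℝ) ^ ε) := by
  set r := Fintype.card I with hr
  have hm : ∀ P, Measurable fun α => ENNReal.ofReal (normProd d A J P α) := fun P =>
    continuous_normProd.measurable.ennreal_ofReal
  set N : ℕ := 2 * r + 3 with hN
  obtain ⟨C₀, hC₀, h0⟩ := hJ (ε / N) (by positivity)
  obtain ⟨C₁, hC₁, h1⟩ := abs_normProd_sub_le d A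
  refine ⟨7 ^ r * C₀ * 2 ^ ε + C₁ * 5 ^ r, by positivity, fun P Q hP hQ => ?_⟩
  have hQR : (1 : ℝ) ≤ Q := by exact_mod_cast hQ
  have hPR : (1 : ℝ) ≤ P := by exact_mod_cast hP
  set P' : ℕ := (2 * Q) ^ N with hP'
  have hP'1 : 1 ≤ P' := Nat.one_le_pow _ _ (by omega)
  have hP'ε : (P' : ℝ) ^ (ε / N) = 2 ^ ε * (Q : ℝ) ^ ε := by
    rw [hP']
    push_cast
    rw [← Real.rpow_natCast, ← Real.rpow_mul (by positivity),
      ← Real.mul_rpow (by positivity) (by positivity)]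
    congr 1
    have hN0 : (N : ℝ) ≠ 0 := by positivity
    field_simp
  have hQε : 1 ≤ (Q : ℝ) ^ ε := Real.one_le_rpow hQR hε.le
  have hbig : 7 ^ r * (C₀ * (P' : ℝ) ^ (ε / N)) + C₁ * 5 ^ r ≤
      (7 ^ r * C₀ * 2 ^ ε + C₁ * 5 ^ r) * (Q : ℝ) ^ ε := by
    rw [hP'ε, add_mul]
    have : C₁ * 5 ^ r ≤ C₁ * 5 ^ r * (Q : ℝ) ^ ε := le_mul_of_one_le_right (by positivity) hQε
    linarith
  refine le_trans ?_ (ENNReal.ofReal_le_ofReal hbig)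
  rcases lt_or_ge P P' with hlt | hle
  · have hPP : (P : ℝ) ≤ P' := by exact_mod_cast hlt.le
    calc _ ≤ ENNReal.ofReal ((P : ℝ) ^ ∑ i, d i) *
          ∫⁻ α in Set.Icc 0 1, ENNReal.ofReal (normProd d A J P α) := by
          gcongr
          exact Set.inter_subset_right
      _ ≤ ENNReal.ofReal (C₀ * (P : ℝ) ^ (ε / N)) := h0 P hP
      _ ≤ _ := by
          refine ENNReal.ofReal_le_ofReal ?_
          have e1 : (P : ℝ) ^ (ε / N) ≤ (P' : ℝ) ^ (ε / N) := by gcongr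
          have e2 : (1 : ℝ) ≤ 7 ^ r := one_le_pow₀ (by norm_num)
          have e3 : C₀ * (P : ℝ) ^ (ε / N) ≤ C₀ * (P' : ℝ) ^ (ε / N) := by gcongr
          have e4 : 0 ≤ C₀ * (P' : ℝ) ^ (ε / N) := by positivity
          have e5 : 0 < C₁ * 5 ^ r := by positivity
          nlinarith
  have hQP' : 2 * Q ^ 3 < P' := by
    calc 2 * Q ^ 3 < (2 * Q) ^ 3 := by
          have : 0 < Q ^ 3 := by positivity
          rw [mul_pow]
          omega
      _ ≤ P' := Nat.pow_le_pow_right (by omega) (by omega)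
  have hQle : Q ≤ P' := by
    have : Q ≤ Q ^ 3 := Nat.le_self_pow (by norm_num) Q
    omega
  set S : Set (I → ℝ) := {β : I → ℝ | ∀ i, |β i| ≤ Q} with hS
  have hSv : volume S = ENNReal.ofReal ((2 * Q) ^ r) := by
    have : S = Set.Icc (fun _ => -(Q : ℝ)) fun _ => Q := by
      ext β
      simp [hS, Set.mem_Icc, Pi.le_def, abs_le, forall_and]
    rw [this, Real.volume_Icc_pi, prod_const, card_univ, ENNReal.ofReal_pow (by positivity)]
    congr 2
    ring
  have hloc : ∀ x ∈ centers I Q, ENNReal.ofReal ((P : ℝ) ^ ∑ i, d i) *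
      ∫⁻ α in arcBox d P Q x, ENNReal.ofReal (normProd d A J P α) ≤
      ENNReal.ofReal ((P' : ℝ) ^ ∑ i, d i) *
        (∫⁻ α in arcBox d P' Q x, ENNReal.ofReal (normProd d A J P' α)) +
        ENNReal.ofReal (C₁ * Q ^ 2 / P' * (2 * Q) ^ r) := by
    intro x hx
    obtain ⟨q, hq, hqQ, a, ha, rfl⟩ := mem_centers.1 hx
    rw [← lintegral_arcBox d hP Q (hm P), ← lintegral_arcBox d hP'1 Q (hm P')]
    calc _ ≤ ∫⁻ β in S, (ENNReal.ofReal (normProd d A J P' fun i => a i / q + β i / (P' : ℝ) ^ d i) +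
            ENNReal.ofReal (C₁ * Q ^ 2 / P')) := by
          refine setLIntegral_mono ?_ fun β hβ => ?_
          · refine Measurable.add_const ?_ _
            exact (hm P').comp (by fun_prop)
          · rw [← ENNReal.ofReal_add (normProd_nonneg _) (by positivity)]
            refine ENNReal.ofReal_le_ofReal ?_
            have := (abs_le.1 (h1 J Q P P' hQ hP'1 hle q hq hqQ a β hβ)).2
            linarith
      _ = _ := by
          rw [lintegral_add_right _ measurable_const, setLIntegral_const, hSv,
            ← ENNReal.ofReal_mul (by positivity)]
  calc _ ≤ ENNReal.ofReal ((P : ℝ) ^ ∑ i, d i) * ∑ x ∈ centers I Q,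
        ∫⁻ α in arcBox d P Q x, ENNReal.ofReal (normProd d A J P α) := by
        gcongr
        exact (lintegral_mono_set (majorArcs_inter_subset hd (hQle.trans hle))).trans
          (lintegral_biUnion_finset_le _ _ _)
    _ ≤ ∑ x ∈ centers I Q, (ENNReal.ofReal ((P' : ℝ) ^ ∑ i, d i) *
        (∫⁻ α in arcBox d P' Q x, ENNReal.ofReal (normProd d A J P' α)) +
        ENNReal.ofReal (C₁ * Q ^ 2 / P' * (2 * Q) ^ r)) := by
        rw [mul_sum]
        exact sum_le_sum hloc
    _ = ENNReal.ofReal ((P' : ℝ) ^ ∑ i, d i) *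
        (∫⁻ α in ⋃ x ∈ centers I Q, arcBox d P' Q x, ENNReal.ofReal (normProd d A J P' α)) +
        #(centers I Q) * ENNReal.ofReal (C₁ * Q ^ 2 / P' * (2 * Q) ^ r) := by
        rw [sum_add_distrib, ← mul_sum, sum_const, nsmul_eq_mul,
          lintegral_biUnion_finset (pairwiseDisjoint_arcBox hd hQP')
            fun x _ => measurableSet_arcBox d P' Q x]
    _ ≤ 7 ^ r * ENNReal.ofReal (C₀ * (P' : ℝ) ^ (ε / N)) +
        ENNReal.ofReal (C₁ * 5 ^ r) := by
        refine add_le_add ?_ ?_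
        · calc _ ≤ ENNReal.ofReal ((P' : ℝ) ^ ∑ i, d i) *
                ∫⁻ α in Set.Icc (fun _ => -3) fun _ => 3, ENNReal.ofReal (normProd d A J P' α) := by
                gcongr
                exact Set.iUnion₂_subset fun x hx => arcBox_subset hd hQle hx
            _ ≤ ENNReal.ofReal ((P' : ℝ) ^ ∑ i, d i) *
                (7 ^ r * ∫⁻ α in Set.Icc 0 1, ENNReal.ofReal (normProd d A J P' α)) := by
                gcongr
                exact lintegral_le_of_periodic fun α v => by rw [normProd_add_intCast]
            _ ≤ _ := by
                rw [mul_left_comm]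
                gcongr
                exact h0 P' hP'1
        · rw [← ENNReal.ofReal_natCast, ← ENNReal.ofReal_mul (by positivity)]
          refine ENNReal.ofReal_le_ofReal ?_
          have e1 : (#(centers I Q) : ℝ) ≤ Q * (5 * Q) ^ r := by
            exact_mod_cast card_centers_le hQ
          have e2 : (P' : ℝ) = (2 * Q) ^ r * (2 * Q) ^ r * (2 * Q) ^ 3 := by
            rw [hP', hN]
            push_cast
            ring
          calc (#(centers I Q) : ℝ) * (C₁ * Q ^ 2 / P' * (2 * Q) ^ r)
              ≤ Q * (5 * Q) ^ r * (C₁ * Q ^ 2 / P' * (2 * Q) ^ r) := by gcongr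
            _ = C₁ * 5 ^ r * (1 / (8 * 2 ^ r)) := by
                rw [e2, mul_pow, mul_pow]
                field_simp
                ring
            _ ≤ C₁ * 5 ^ r := by
                refine mul_le_of_le_one_right (by positivity) ?_
                rw [div_le_one (by positivity)]
                have : (1 : ℝ) ≤ 2 ^ r := one_le_pow₀ (by norm_num)
                linarith
    _ = _ := by
        rw [ENNReal.ofReal_add (by positivity) (by positivity),
          ENNReal.ofReal_mul (by positivity : (0 : ℝ) ≤ 7 ^ r)]
        congr 2
        rw [ENNReal.ofReal_pow (by norm_num)]
        norm_num

end

end DiagonalSystems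

namespace DiagonalSystems

noncomputable section

open MeasureTheory

variable {I : Type} [Fintype I]

lemma measurableSet_majorArcs (d : I → ℕ) (P Q : ℕ) : MeasurableSet (majorArcs d P Q) := by
  have : majorArcs d P Q = ⋃ q ∈ {q : ℕ | 1 ≤ q ∧ q ≤ Q}, ⋂ i, ⋃ a : ℤ,
      {α : I → ℝ | |α i - a / q| * (P : ℝ) ^ d i ≤ Q} := by
    ext α
    simp [majorArcs, and_assoc]
  rw [this]
  exact MeasurableSet.biUnion (Set.to_countable _) fun q _ => MeasurableSet.iInter fun i =>
    MeasurableSet.iUnion fun a => (isClosed_le (by fun_prop) (by fun_prop)).measurableSet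

/-- Away from the first dyadic major arcs the product of all exponential sums is small in mean. -/
lemma exists_lintegral_normProd_le {d : I → ℕ} (hd : ∀ i, 1 ≤ d i) {s : ℕ} (hs : 1 ≤ s)
    {A : I → Fin s → ℤ}
    (hJ : ∀ j : Fin s, ∀ ε : ℝ, 0 < ε → ∃ C : ℝ, 0 < C ∧ ∀ P : ℕ, 1 ≤ P →
      ENNReal.ofReal ((P : ℝ) ^ ∑ i, d i) *
        ∫⁻ α in Set.Icc 0 1, ENNReal.ofReal (normProd d A (univ.erase j) P α) ≤
        ENNReal.ofReal (C * (P : ℝ) ^ ε))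
    {K : ℕ} (hK : 1 ≤ K) (hW : ∀ P R : ℕ, 1 ≤ P → 1 ≤ R → ∀ α : I → ℝ,
      (∀ j, (P : ℝ) ≤ R * ‖expSum d P fun i => α i * A i j‖) → α ∈ majorArcs d P (K * R ^ K)) :
    ∃ C ρ : ℝ, 0 < C ∧ 0 < ρ ∧ ρ < 1 ∧ ∀ (P i₀ : ℕ) (S : Set (I → ℝ)), 1 ≤ P →
      S ⊆ Set.Icc 0 1 → MeasurableSet S →
      (∀ i < i₀, ∀ α ∈ S, α ∉ majorArcs d P (K * (2 ^ (i + 1)) ^ K)) →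
      ENNReal.ofReal ((P : ℝ) ^ ∑ i, d i) *
        ∫⁻ α in S, ENNReal.ofReal (normProd d A univ P α) ≤ ENNReal.ofReal (C * ρ ^ i₀) := by
  have hKR : (1 : ℝ) ≤ K := by exact_mod_cast hK
  set ε : ℝ := 1 / (2 * K) with hε
  have hε0 : 0 < ε := by positivity
  choose C hC0 hC using fun j => lintegral_majorArcs_normProd_le hd (hJ j) hε0
  set l : ℝ := (2 : ℝ) ^ (1 / 2 : ℝ) with hl
  have hl0 : 0 < l := by positivity
  have hl2 : l < 2 := by
    calc l < (2 : ℝ) ^ (1 : ℝ) := Real.rpow_lt_rpow_of_exponent_lt (by norm_num) (by norm_num)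
      _ = 2 := by norm_num
  set ρ : ℝ := l / 2 with hρ
  have hρ0 : 0 < ρ := by positivity
  have hρ1 : ρ < 1 := by rw [hρ]; linarith
  have hsumC : 0 < ∑ j, C j := sum_pos (fun j _ => hC0 j) ⟨⟨0, hs⟩, mem_univ _⟩
  have hQε : ∀ n : ℕ, ((K * (2 ^ (n + 1)) ^ K : ℕ) : ℝ) ^ ε ≤ K * 2 * l ^ n := by
    intro n
    push_cast
    rw [Real.mul_rpow (by positivity) (by positivity)]
    have h1 : (((2 : ℝ) ^ (n + 1)) ^ K) ^ ε = l ^ (n + 1) := by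
      rw [← pow_mul, ← Real.rpow_natCast, ← Real.rpow_mul (by norm_num), hl,
        ← Real.rpow_natCast, ← Real.rpow_mul (by norm_num)]
      congr 1
      rw [hε]
      push_cast
      field_simp
    have h2 : (K : ℝ) ^ ε ≤ K := by
      calc (K : ℝ) ^ ε ≤ (K : ℝ) ^ (1 : ℝ) := by
            refine Real.rpow_le_rpow_of_exponent_le hKR ?_
            rw [hε, div_le_one (by positivity)]
            linarith
        _ = K := Real.rpow_one _
    rw [h1, pow_succ']
    calc (K : ℝ) ^ ε * (l * l ^ n) ≤ K * (2 * l ^ n) := by gcongr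
      _ = _ := by ring
  refine ⟨K * 2 * (∑ j, C j) * (1 - ρ)⁻¹, ρ, ?_, hρ0, hρ1, fun P i₀ S hP hS hSm hdis => ?_⟩
  · have : 0 < 1 - ρ := by linarith
    positivity
  set M : ℕ → Set (I → ℝ) := fun n => majorArcs d P (K * (2 ^ (n + 1)) ^ K) ∩ Set.Icc 0 1 with hM
  have hMm : ∀ n, MeasurableSet (M n) := fun n =>
    (measurableSet_majorArcs _ _ _).inter measurableSet_Icc
  have hPR : (0 : ℝ) < P := by exact_mod_cast hP
  have hpt : ∀ α ∈ S, ENNReal.ofReal (normProd d A univ P α) ≤ ∑' i, ∑ j,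
      ENNReal.ofReal ((1 / 2) ^ (i + i₀)) * (M (i + i₀)).indicator
        (fun α => ENNReal.ofReal (normProd d A (univ.erase j) P α)) α := by
    intro α hα
    by_cases h0 : normProd d A univ P α = 0
    · rw [h0]
      simp
    obtain ⟨j₁, -, hj₁⟩ := exists_min_image univ
      (fun j => ‖expSum d P fun i => α i * A i j‖ / P) ⟨⟨0, hs⟩, mem_univ _⟩
    have hmem := norm_expSum_div_mem d P fun i => α i * A i j₁
    have hpos : 0 < ‖expSum d P fun i => α i * A i j₁‖ / P := by
      refine lt_of_le_of_ne hmem.1 fun h => h0 ?_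
      exact prod_eq_zero (mem_univ j₁) h.symm
    obtain ⟨n, hn1, hn2⟩ := exists_nat_pow_near_of_lt_one hpos hmem.2
      (by norm_num : (0 : ℝ) < 1 / 2) (by norm_num)
    have hmaj : α ∈ majorArcs d P (K * (2 ^ (n + 1)) ^ K) := by
      refine hW P (2 ^ (n + 1)) hP Nat.one_le_two_pow α fun j => ?_
      have h1 := hn1.le.trans (hj₁ j (mem_univ _))
      rw [le_div_iff₀ hPR, one_div, inv_pow, inv_mul_le_iff₀ (by positivity)] at h1
      exact_mod_cast h1
    have hni : i₀ ≤ n := by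
      by_contra! h
      exact hdis n h α hα hmaj
    refine le_trans ?_ (ENNReal.le_tsum (n - i₀))
    refine le_trans ?_ (single_le_sum (fun _ _ => zero_le) (mem_univ j₁))
    rw [Nat.sub_add_cancel hni, Set.indicator_of_mem (show α ∈ M n from ⟨hmaj, hS hα⟩),
      ← ENNReal.ofReal_mul (by positivity)]
    refine ENNReal.ofReal_le_ofReal ?_
    rw [normProd, ← mul_prod_erase _ _ (mem_univ j₁)]
    exact mul_le_mul_of_nonneg_right hn2 (normProd_nonneg α)
  have hmeas : ∀ i j, Measurable fun α => ENNReal.ofReal ((1 / 2) ^ (i + i₀)) *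
      (M (i + i₀)).indicator
        (fun α => ENNReal.ofReal (normProd d A (univ.erase j) P α)) α := fun i j =>
    (continuous_normProd.measurable.ennreal_ofReal.indicator (hMm _)).const_mul _
  calc ENNReal.ofReal ((P : ℝ) ^ ∑ i, d i) * ∫⁻ α in S, ENNReal.ofReal (normProd d A univ P α)
      ≤ ENNReal.ofReal ((P : ℝ) ^ ∑ i, d i) * ∫⁻ α, ∑' i, ∑ j,
        ENNReal.ofReal ((1 / 2) ^ (i + i₀)) * (M (i + i₀)).indicator
        (fun α => ENNReal.ofReal (normProd d A (univ.erase j) P α)) α := by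
        refine mul_le_mul' le_rfl ?_
        exact (setLIntegral_mono' hSm hpt).trans (setLIntegral_le_lintegral _ _)
    _ = ∑' i, ∑ j, ENNReal.ofReal ((1 / 2) ^ (i + i₀)) * (ENNReal.ofReal ((P : ℝ) ^ ∑ i, d i) *
        ∫⁻ α in M (i + i₀), ENNReal.ofReal (normProd d A (univ.erase j) P α)) := by
        rw [lintegral_tsum fun i => (Finset.measurable_sum _ fun j _ => hmeas i j).aemeasurable,
          ← ENNReal.tsum_mul_left]
        refine tsum_congr fun i => ?_
        rw [lintegral_finsetSum _ fun j _ => hmeas i j, mul_sum]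
        refine sum_congr rfl fun j _ => ?_
        rw [lintegral_const_mul _ (continuous_normProd.measurable.ennreal_ofReal.indicator (hMm _)),
          lintegral_indicator (hMm _), mul_left_comm]
    _ ≤ ∑' i, ENNReal.ofReal (K * 2 * (∑ j, C j) * ρ ^ i₀ * ρ ^ i) := by
        refine ENNReal.tsum_le_tsum fun i => ?_
        calc _ ≤ ∑ j, ENNReal.ofReal (C j * (K * 2 * ρ ^ (i + i₀))) := by
              refine sum_le_sum fun j _ => ?_
              calc _ ≤ ENNReal.ofReal ((1 / 2) ^ (i + i₀)) * ENNReal.ofReal (C j *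
                    ((K * (2 ^ (i + i₀ + 1)) ^ K : ℕ) : ℝ) ^ ε) := by
                    gcongr
                    exact hC j P _ hP (Nat.one_le_iff_ne_zero.2 (by positivity))
                _ ≤ _ := by
                    rw [← ENNReal.ofReal_mul (by positivity)]
                    refine ENNReal.ofReal_le_ofReal ?_
                    have := hC0 j
                    calc (1 / 2) ^ (i + i₀) * (C j * ((K * (2 ^ (i + i₀ + 1)) ^ K : ℕ) : ℝ) ^ ε)
                        ≤ (1 / 2) ^ (i + i₀) * (C j * (K * 2 * l ^ (i + i₀))) := by
                          gcongr
                          exact hQε _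
                      _ = C j * (K * 2 * ρ ^ (i + i₀)) := by
                          rw [hρ, div_pow, div_pow]
                          ring
          _ = ENNReal.ofReal (K * 2 * (∑ j, C j) * ρ ^ i₀ * ρ ^ i) := by
              rw [← ENNReal.ofReal_sum_of_nonneg fun j _ => by have := hC0 j; positivity,
                ← sum_mul]
              congr 1
              ring
    _ = ENNReal.ofReal (K * 2 * (∑ j, C j) * (1 - ρ)⁻¹ * ρ ^ i₀) := by
        rw [← ENNReal.ofReal_tsum_of_nonneg (fun i => by positivity)
          ((summable_geometric_of_lt_one hρ0.le hρ1).mul_left _), tsum_mul_left,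
          tsum_geometric_of_lt_one hρ0.le hρ1]
        congr 1
        ring

omit [Fintype I] in
lemma majorArcs_mono (d : I → ℕ) (P : ℕ) {Q Q' : ℕ} (h : Q ≤ Q') :
    majorArcs d P Q ⊆ majorArcs d P Q' := by
  rintro α ⟨q, hq, hqQ, hα⟩
  refine ⟨q, hq, hqQ.trans h, fun i => ?_⟩
  obtain ⟨a, ha⟩ := hα i
  exact ⟨a, ha.trans (by exact_mod_cast h)⟩

/-- The total mean value is bounded, and uniformly concentrated on the major arcs. -/
def Concentrated (d : I → ℕ) {s : ℕ} (A : I → Fin s → ℤ) : Prop :=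
  (∃ C : ℝ, 0 < C ∧ ∀ P : ℕ, 1 ≤ P → ENNReal.ofReal ((P : ℝ) ^ ∑ i, d i) *
    ∫⁻ α in Set.Icc 0 1, ENNReal.ofReal (normProd d A univ P α) ≤ ENNReal.ofReal C) ∧
  ∀ η : ℝ, 0 < η → ∃ Q : ℕ, 1 ≤ Q ∧ ∀ P : ℕ, 1 ≤ P → ENNReal.ofReal ((P : ℝ) ^ ∑ i, d i) *
    ∫⁻ α in Set.Icc 0 1 \ majorArcs d P Q, ENNReal.ofReal (normProd d A univ P α) ≤
      ENNReal.ofReal η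

theorem concentrated {d : I → ℕ} (hd : ∀ i, 1 ≤ d i) {s : ℕ} (hs : 1 ≤ s)
    {A : I → Fin s → ℤ}
    (hJ : ∀ j : Fin s, ∀ ε : ℝ, 0 < ε → ∃ C : ℝ, 0 < C ∧ ∀ P : ℕ, 1 ≤ P →
      ENNReal.ofReal ((P : ℝ) ^ ∑ i, d i) *
        ∫⁻ α in Set.Icc 0 1, ENNReal.ofReal (normProd d A (univ.erase j) P α) ≤
        ENNReal.ofReal (C * (P : ℝ) ^ ε))
    {K : ℕ} (hK : 1 ≤ K) (hW : ∀ P R : ℕ, 1 ≤ P → 1 ≤ R → ∀ α : I → ℝ,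
      (∀ j, (P : ℝ) ≤ R * ‖expSum d P fun i => α i * A i j‖) → α ∈ majorArcs d P (K * R ^ K)) :
    Concentrated d A := by
  obtain ⟨C, ρ, hC, hρ0, hρ1, h⟩ := exists_lintegral_normProd_le hd hs hJ hK hW
  refine ⟨⟨C, hC, fun P hP => ?_⟩, fun η hη => ?_⟩
  · simpa using h P 0 (Set.Icc 0 1) hP le_rfl measurableSet_Icc (by simp)
  · obtain ⟨i₀, hi₀⟩ := exists_pow_lt_of_lt_one (div_pos hη hC) hρ1
    refine ⟨K * (2 ^ i₀) ^ K, Nat.one_le_iff_ne_zero.2 (by positivity), fun P hP => ?_⟩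
    refine (h P i₀ _ hP Set.sdiff_subset (measurableSet_Icc.diff (measurableSet_majorArcs _ _ _))
      fun i hi α hα hα' => hα.2 (majorArcs_mono d P ?_ hα')).trans (ENNReal.ofReal_le_ofReal ?_)
    · gcongr
      · norm_num
      · exact hi
    · rw [lt_div_iff₀ hC] at hi₀
      linarith

end

end DiagonalSystems

namespace DiagonalSystems

noncomputable section

open MeasureTheory

variable {I : Type} [Fintype I]

/-- The `i`-th diagonal form of degree `d i` with coefficients `A i j`. -/
def form {R : Type} [CommRing R] (d : I → ℕ) {s : ℕ} (A : I → Fin s → ℤ) (i : I)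
    (x : Fin s → R) : R :=
  ∑ j, (A i j : R) * x j ^ d i

/-- The form `form d A i` at a tuple of natural numbers. -/
def natForm (d : I → ℕ) {s : ℕ} (A : I → Fin s → ℤ) (i : I) (x : Fin s → ℕ) : ℤ :=
  form d A i fun j => (x j : ℤ)

omit [Fintype I] in
lemma natForm_cast {R : Type} [CommRing R] (d : I → ℕ) {s : ℕ} (A : I → Fin s → ℤ) (i : I)
    (x : Fin s → ℕ) : (natForm d A i x : R) = form d A i fun j => (x j : R) := by
  simp [natForm, form]

/-- The number of zeros of the system in the box `[1, P]ˢ`. -/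
def countZeros (d : I → ℕ) {s : ℕ} (A : I → Fin s → ℤ) (P : ℕ) : ℕ :=
  #{x ∈ Fintype.piFinset fun _ : Fin s => Icc 1 P | ∀ i, natForm d A i x = 0}

lemma prod_expSum_eq (d : I → ℕ) {s : ℕ} (A : I → Fin s → ℤ) (P : ℕ) (α : I → ℝ) :
    ∏ j, expSum d P (fun i => α i * A i j) =
      ∑ x ∈ Fintype.piFinset fun _ : Fin s => Icc 1 P, ∏ i, e (α i * (natForm d A i x)) := by
  simp only [expSum]
  rw [prod_univ_sum]
  refine sum_congr rfl fun x _ => ?_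
  rw [← e_sum, ← e_sum, sum_comm]
  congr 1
  refine sum_congr rfl fun i _ => ?_
  rw [natForm_cast, form, mul_sum]
  exact sum_congr rfl fun j _ => by ring

lemma setIntegral_prod_expSum (d : I → ℕ) {s : ℕ} (A : I → Fin s → ℤ) (P : ℕ) :
    ∫ α in Set.Icc (0 : I → ℝ) 1, ∏ j, expSum d P (fun i => α i * A i j) =
      countZeros d A P := by
  simp_rw [prod_expSum_eq, ← e_sum]
  rw [integral_finsetSum]
  · simp_rw [setIntegral_e_sum_mul_int]
    rw [sum_boole, countZeros]
    simp only [funext_iff, Pi.zero_apply]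
  · exact fun x _ => Continuous.integrableOn_Icc (by fun_prop)

/-- The Fejér type kernel that detects small multiples of `W`. -/
def fejer (W H : ℕ) (t : ℝ) : ℝ := ‖∑ y ∈ range H, e (t * (W * y))‖ ^ 2 / (H : ℝ) ^ 2

/-- The Fourier coefficients of `fejer`. -/
def fejerCoeff (W H : ℕ) (m : ℤ) : ℝ :=
  #{y ∈ range H ×ˢ range H | m + W * ((y.1 : ℤ) - y.2) = 0} / (H : ℝ) ^ 2

lemma fejer_eq (W H : ℕ) (t : ℝ) : (fejer W H t : ℂ) =
    (∑ y ∈ range H ×ˢ range H, e (t * (W * ((y.1 : ℤ) - y.2) : ℤ))) / (H : ℂ) ^ 2 := by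
  rw [fejer]
  push_cast
  rw [← Complex.mul_conj', map_sum, sum_mul_sum, ← sum_product']
  congr 1
  refine sum_congr rfl fun y _ => ?_
  rw [← e_neg, ← e_add]
  congr 1
  ring

@[fun_prop] lemma continuous_fejer (W H : ℕ) : Continuous (fejer W H) := by
  unfold fejer
  fun_prop

lemma fejer_nonneg (W H : ℕ) (t : ℝ) : 0 ≤ fejer W H t := by
  unfold fejer
  positivity

lemma fejer_le_one (W H : ℕ) (t : ℝ) : fejer W H t ≤ 1 := by
  rw [fejer]
  refine div_le_one_of_le₀ ?_ (by positivity)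
  gcongr
  refine (norm_sum_le _ _).trans ?_
  simp

lemma setIntegral_e_mul_fejer (W H : ℕ) (m : ℤ) :
    ∫ t in Set.Icc (0 : ℝ) 1, e (t * m) * (fejer W H t : ℂ) = fejerCoeff W H m := by
  simp_rw [fejer_eq, mul_div_assoc', mul_sum, ← e_add, ← mul_add, ← Int.cast_add]
  rw [integral_div, integral_finsetSum]
  · simp_rw [setIntegral_e_mul_int]
    rw [sum_boole, fejerCoeff]
    push_cast
    rfl
  · exact fun x _ => Continuous.integrableOn_Icc (by fun_prop)

lemma setIntegral_prod_expSum_mul_fejer (d : I → ℕ) {s : ℕ} (A : I → Fin s → ℤ) (P W : ℕ)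
    (H : I → ℕ) :
    ∫ α in Set.Icc (0 : I → ℝ) 1, (∏ j, expSum d P (fun i => α i * A i j)) *
      ((∏ i, fejer W (H i) (α i) : ℝ) : ℂ) =
      ((∑ x ∈ Fintype.piFinset fun _ : Fin s => Icc 1 P,
        ∏ i, fejerCoeff W (H i) (natForm d A i x) : ℝ) : ℂ) := by
  simp_rw [prod_expSum_eq, sum_mul]
  push_cast
  simp_rw [← prod_mul_distrib]
  rw [integral_finsetSum]
  · refine sum_congr rfl fun x _ => ?_
    rw [volume_restrict_unitCube, integral_fintype_prod_eq_prod (𝕜 := ℂ)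
      (f := fun i t => e (t * (natForm d A i x)) * (fejer W (H i) t : ℂ))]
    simp_rw [setIntegral_e_mul_fejer]
  · exact fun x _ => Continuous.integrableOn_Icc (by fun_prop)

lemma card_filter_sub_eq (H : ℕ) (z : ℤ) :
    (#{y ∈ range H ×ˢ range H | (y.2 : ℤ) - y.1 = z} : ℤ) = max 0 (H - |z|) := by
  rcases le_total 0 z with hz | hz
  · lift z to ℕ using hz
    have : {y ∈ range H ×ˢ range H | (y.2 : ℤ) - y.1 = z} =
        (range (H - z)).image fun a => (a, a + z) := by
      ext ⟨a, b⟩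
      simp only [mem_filter, mem_product, mem_range, mem_image, Prod.mk.injEq]
      constructor
      · intro h
        exact ⟨a, by omega, rfl, by omega⟩
      · rintro ⟨a, h1, rfl, rfl⟩
        omega
    rw [this, card_image_of_injective _ fun a b h => (Prod.mk.inj h).1, card_range, Nat.abs_cast]
    omega
  · obtain ⟨z, rfl⟩ : ∃ w : ℕ, z = -w := ⟨z.natAbs, by omega⟩
    have : {y ∈ range H ×ˢ range H | (y.2 : ℤ) - y.1 = -z} =
        (range (H - z)).image fun a => (a + z, a) := by
      ext ⟨a, b⟩
      simp only [mem_filter, mem_product, mem_range, mem_image, Prod.mk.injEq]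
      constructor
      · intro h
        exact ⟨b, by omega, by omega, rfl⟩
      · rintro ⟨a, h1, rfl, rfl⟩
        omega
    rw [this, card_image_of_injective _ fun a b h => (Prod.mk.inj h).2, card_range, abs_neg,
      Nat.abs_cast]
    omega

lemma fejerCoeff_eq {W H : ℕ} (hW : 1 ≤ W) (hH : 1 ≤ H) (m : ℤ) : fejerCoeff W H m =
    if (W : ℤ) ∣ m then max 0 (1 - |(m : ℝ)| / (W * H)) / H else 0 := by
  have hWR : (0 : ℝ) < W := by exact_mod_cast hW
  have hHR : (0 : ℝ) < H := by exact_mod_cast hH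
  split_ifs with h
  · obtain ⟨z, rfl⟩ := h
    have h1 : {y ∈ range H ×ˢ range H | (W : ℤ) * z + W * ((y.1 : ℤ) - y.2) = 0} =
        {y ∈ range H ×ˢ range H | (y.2 : ℤ) - y.1 = z} := by
      refine filter_congr fun y _ => ?_
      rw [← mul_add, mul_eq_zero_iff_left (by omega)]
      omega
    have h2 : ((#{y ∈ range H ×ˢ range H | (y.2 : ℤ) - y.1 = z} : ℤ) : ℝ) =
        ((max 0 (H - |z|) : ℤ) : ℝ) := by rw [card_filter_sub_eq]
    rw [fejerCoeff, h1]
    push_cast at h2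
    rw [h2]
    push_cast
    rw [abs_mul, Nat.abs_cast, mul_div_mul_left _ _ hWR.ne', div_eq_div_iff (by positivity)
      (by positivity), pow_two, ← mul_assoc, max_mul_of_nonneg _ _ hHR.le,
      max_mul_of_nonneg _ _ hHR.le, max_mul_of_nonneg _ _ hHR.le]
    congr 2
    · ring
    · field_simp
  · rw [fejerCoeff, div_eq_zero_iff]
    left
    rw [Nat.cast_eq_zero, card_eq_zero, filter_eq_empty_iff]
    intro y _ h2
    exact h ⟨y.2 - y.1, by linear_combination h2⟩

end

end DiagonalSystems

namespace DiagonalSystems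

noncomputable section

open MeasureTheory

variable {I : Type} [Fintype I]

lemma norm_setIntegral_mul_le {d : I → ℕ} {s : ℕ} {A : I → Fin s → ℤ} {P Q : ℕ} (hP : 1 ≤ P)
    {C η δ : ℝ} (hη : 0 ≤ η) (hδ : 0 ≤ δ) (hC : 0 ≤ C)
    (h1 : ENNReal.ofReal ((P : ℝ) ^ ∑ i, d i) *
      ∫⁻ α in Set.Icc 0 1, ENNReal.ofReal (normProd d A univ P α) ≤ ENNReal.ofReal C)
    (h2 : ENNReal.ofReal ((P : ℝ) ^ ∑ i, d i) * ∫⁻ α in Set.Icc 0 1 \ majorArcs d P Q,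
      ENNReal.ofReal (normProd d A univ P α) ≤ ENNReal.ofReal η)
    {κ : (I → ℝ) → ℝ} (hκ : ∀ α, |κ α| ≤ 1)
    (hκ' : ∀ α ∈ Set.Icc 0 1 ∩ majorArcs d P Q, |κ α| ≤ δ) :
    (P : ℝ) ^ (∑ i, d i) * (‖∫ α in Set.Icc (0 : I → ℝ) 1,
      (∏ j, expSum d P (fun i => α i * A i j)) * (κ α : ℂ)‖ / (P : ℝ) ^ s) ≤ η + δ * C := by
  have hPR : (0 : ℝ) < P := by exact_mod_cast hP
  rw [← ENNReal.ofReal_le_ofReal_iff (by positivity), ENNReal.ofReal_mul (by positivity)]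
  have h3 : ENNReal.ofReal (‖∫ α in Set.Icc (0 : I → ℝ) 1,
      (∏ j, expSum d P (fun i => α i * A i j)) * (κ α : ℂ)‖ / (P : ℝ) ^ s) ≤
      (∫⁻ α in Set.Icc 0 1 \ majorArcs d P Q, ENNReal.ofReal (normProd d A univ P α)) +
        ENNReal.ofReal δ * ∫⁻ α in Set.Icc 0 1, ENNReal.ofReal (normProd d A univ P α) := by
    have h4 : ‖∫ α in Set.Icc (0 : I → ℝ) 1,
        (∏ j, expSum d P (fun i => α i * A i j)) * (κ α : ℂ)‖ / (P : ℝ) ^ s =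
        ‖∫ α in Set.Icc (0 : I → ℝ) 1,
          (∏ j, expSum d P (fun i => α i * A i j)) * (κ α : ℂ) / (P : ℂ) ^ s‖ := by
      rw [integral_div, norm_div, norm_pow, Complex.norm_natCast]
    have h5 : ∀ α : I → ℝ, ‖(∏ j, expSum d P (fun i => α i * A i j)) * (κ α : ℂ) /
        (P : ℂ) ^ s‖ = normProd d A univ P α * |κ α| := by
      intro α
      rw [norm_div, norm_mul, norm_prod, norm_pow, Complex.norm_natCast, normProd,
        prod_div_distrib, Complex.norm_real, Real.norm_eq_abs, prod_const, card_univ,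
        Fintype.card_fin]
      ring
    rw [h4, ofReal_norm]
    refine (enorm_integral_le_lintegral_enorm _).trans ?_
    simp_rw [← ofReal_norm, h5]
    rw [← lintegral_inter_add_sdiff _ _ (measurableSet_majorArcs d P Q), add_comm]
    refine add_le_add ?_ ?_
    · refine lintegral_mono fun α => ENNReal.ofReal_le_ofReal ?_
      exact mul_le_of_le_one_right (normProd_nonneg _) (hκ α)
    · rw [← lintegral_const_mul' _ _ ENNReal.ofReal_ne_top]
      refine (setLIntegral_mono' (measurableSet_Icc.inter (measurableSet_majorArcs d P Q))
        fun α hα => ?_).trans (lintegral_mono_set Set.inter_subset_left)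
      rw [← ENNReal.ofReal_mul hδ, mul_comm δ]
      exact ENNReal.ofReal_le_ofReal (mul_le_mul_of_nonneg_left (hκ' α hα) (normProd_nonneg _))
  refine (mul_le_mul' le_rfl h3).trans ?_
  rw [mul_add, ENNReal.ofReal_add hη (by positivity), ENNReal.ofReal_mul hδ]
  refine add_le_add h2 ?_
  rw [mul_left_comm]
  exact mul_le_mul' le_rfl h1

lemma one_sub_fejer_le {W H : ℕ} (hH : 1 ≤ H) {t ρ : ℝ} (z : ℤ) (h : |t * W - z| ≤ ρ) :
    1 - fejer W H t ≤ 4 * Real.pi * (H * ρ) := by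
  have hHR : (0 : ℝ) < H := by exact_mod_cast hH
  have h1 : ∀ y ∈ range H, ‖e (t * (W * y)) - 1‖ ≤ 2 * Real.pi * (H * ρ) := by
    intro y hy
    have h2 : e (t * (W * y)) = e ((t * W - z) * y) := by
      rw [← e_add_intCast ((t * W - z) * y) (z * y)]
      congr 1
      push_cast
      ring
    rw [h2]
    refine (norm_e_sub_one_le _).trans ?_
    have hy' : (y : ℝ) ≤ H := by exact_mod_cast (mem_range.1 hy).le
    rw [abs_mul, Nat.abs_cast, mul_comm (|_|)]
    gcongr
  have h3 : ‖(∑ y ∈ range H, e (t * (W * y))) - H‖ ≤ H * (2 * Real.pi * (H * ρ)) := by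
    have : (∑ y ∈ range H, e (t * (W * y))) - H = ∑ y ∈ range H, (e (t * (W * y)) - 1) := by
      simp
    rw [this]
    refine (norm_sum_le_of_le _ h1).trans ?_
    simp
  have h4 : (H : ℝ) ≤ ‖∑ y ∈ range H, e (t * (W * y))‖ + H * (2 * Real.pi * (H * ρ)) := by
    calc (H : ℝ) = ‖(H : ℂ)‖ := by simp
      _ = ‖(∑ y ∈ range H, e (t * (W * y))) - ((∑ y ∈ range H, e (t * (W * y))) - H)‖ := by
        congr 1
        ring
      _ ≤ _ := (norm_sub_le _ _).trans (by gcongr)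
  have h5 : ‖∑ y ∈ range H, e (t * (W * y))‖ ≤ H := by
    refine (norm_sum_le _ _).trans ?_
    simp
  have h6 := norm_nonneg (∑ y ∈ range H, e (t * (W * y)))
  rw [fejer]
  set S := ‖∑ y ∈ range H, e (t * (W * y))‖
  rw [sub_le_iff_le_add, ← sub_le_iff_le_add', le_div_iff₀ (by positivity)]
  nlinarith [mul_le_mul_of_nonneg_left h4 hHR.le, mul_nonneg (sub_nonneg.2 h5) (sub_nonneg.2 h5)]

lemma fejer_le {W H : ℕ} (hH : 1 ≤ H) {t κ : ℝ} (hκ : 0 < κ)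
    (h : κ ≤ |t * W - round (t * W)|) : fejer W H t ≤ 1 / (κ * H) ^ 2 := by
  have hHR : (0 : ℝ) < H := by exact_mod_cast hH
  have h1 := abs_sub_round_mul_norm_sum_le (t * W) 0 H
  simp only [add_zero] at h1
  have h2 : ‖∑ y ∈ range H, e (t * (W * y))‖ ≤ 1 / κ := by
    rw [le_div_iff₀ hκ]
    simp only [← mul_assoc t]
    nlinarith [norm_nonneg (∑ y ∈ range H, e (t * W * y))]
  rw [fejer, mul_pow, ← div_div]
  gcongr
  rw [← one_div_pow]
  gcongr

lemma abs_one_sub_prod_fejer_le {W : ℕ} {H : I → ℕ} {t : I → ℝ} {ρ : ℝ}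
    (h : ∀ i, 1 - fejer W (H i) (t i) ≤ ρ) :
    |1 - ∏ i, fejer W (H i) (t i)| ≤ Fintype.card I * ρ := by
  have h1 := abs_prod_sub_prod_le (univ : Finset I) (a := fun _ => (1 : ℝ))
    (b := fun i => fejer W (H i) (t i)) (fun _ => by simp)
    (fun _ => ⟨fejer_nonneg _ _ _, fejer_le_one _ _ _⟩)
  rw [prod_const_one] at h1
  refine h1.trans ((sum_le_card_nsmul _ _ ρ fun i _ => ?_).trans_eq ?_)
  · rw [abs_of_nonneg (sub_nonneg.2 (fejer_le_one _ _ _))]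
    exact h i
  · rw [card_univ, nsmul_eq_mul]

lemma prod_fejer_mem (W : ℕ) (H : I → ℕ) (t : I → ℝ) :
    ∏ i, fejer W (H i) (t i) ∈ Set.Icc (0 : ℝ) 1 :=
  ⟨prod_nonneg fun _ _ => fejer_nonneg _ _ _,
    prod_le_one (fun _ _ => fejer_nonneg _ _ _) fun _ _ => fejer_le_one _ _ _⟩

lemma prod_fejer_le (W : ℕ) (H : I → ℕ) (t : I → ℝ) (i : I) :
    ∏ i, fejer W (H i) (t i) ≤ fejer W (H i) (t i) := by
  classical
  rw [← mul_prod_erase univ _ (mem_univ i)]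
  exact mul_le_of_le_one_right (fejer_nonneg _ _ _)
    (prod_le_one (fun _ _ => fejer_nonneg _ _ _) fun _ _ => fejer_le_one _ _ _)

end

end DiagonalSystems

namespace DiagonalSystems

noncomputable section

open MeasureTheory Filter Topology Pointwise

lemma tendsto_sum_grid {s : ℕ} {φ : (Fin s → ℝ) → ℝ} (hφ : Continuous φ) :
    Tendsto (fun n : ℕ => (∑ u ∈ Fintype.piFinset fun _ : Fin s => range n,
      φ fun j => (u j : ℝ) / n) / (n : ℝ) ^ s) atTop (𝓝 (∫ x in Set.Icc 0 1, φ x)) := by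
  classical
  obtain ⟨S, hS⟩ : ∃ S : Set (Fin s → ℝ), S = Set.univ.pi fun _ => Set.Ico (0 : ℝ) 1 := ⟨_, rfl⟩
  have h1 : Bornology.IsBounded S := by
    rw [hS]
    exact (Metric.isBounded_Icc (0 : Fin s → ℝ) 1).subset fun x hx =>
      ⟨fun j => (hx j trivial).1, fun j => (hx j trivial).2.le⟩
  have h2 : MeasurableSet S := by
    rw [hS]
    exact MeasurableSet.univ_pi fun _ => measurableSet_Ico
  have h3 : volume (frontier S) = 0 := by
    refine Convex.addHaar_frontier _ ?_
    rw [hS]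
    exact convex_pi fun _ _ => convex_Ico _ _
  have h4 : ∫ x in Set.Icc 0 1, φ x = ∫ x in S, φ x := by
    rw [hS]
    refine (setIntegral_congr_set ?_).symm
    exact Measure.univ_pi_Ico_ae_eq_Icc (μ := fun _ : Fin s => (volume : Measure ℝ))
      (f := fun _ => 0) (g := fun _ => 1)
  rw [h4]
  have h5 := tendsto_tsum_div_pow_atTop_integral S φ hφ h1 h2 h3
  refine h5.congr' ?_
  filter_upwards [eventually_gt_atTop 0] with n hn
  have : NeZero n := ⟨hn.ne'⟩
  have hnR : (0 : ℝ) < n := by exact_mod_cast hn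
  rw [Fintype.card_fin]
  congr 1
  have h6 : S ∩ (n : ℝ)⁻¹ • (Submodule.span ℤ (Set.range (Pi.basisFun ℝ (Fin s))) :
      Set (Fin s → ℝ)) = ((Fintype.piFinset fun _ : Fin s => range n).image
        fun u j => (u j : ℝ) / n : Finset (Fin s → ℝ)) := by
    ext x
    have : x ∈ (n : ℝ)⁻¹ • (Submodule.span ℤ (Set.range (Pi.basisFun ℝ (Fin s))) :
      Set (Fin s → ℝ)) ↔ _ := BoxIntegral.unitPartition.mem_smul_span_iff (n := n)
    rw [Set.mem_inter_iff, this, hS, coe_image]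
    simp only [Set.mem_pi, Set.mem_univ, true_implies, Set.mem_Ico, Set.mem_image, mem_coe,
      Fintype.mem_piFinset, mem_range]
    constructor
    · rintro ⟨hx, hz⟩
      choose z hz using hz
      refine ⟨fun j => (z j).toNat, fun j => ?_, ?_⟩
      · have h7 := hz j
        have h8 : ((z j : ℤ) : ℝ) < n := by
          rw [show ((z j : ℤ) : ℝ) = n * x j from h7]
          nlinarith [(hx j).2]
        have h9 : z j < n := by exact_mod_cast h8
        change (z j).toNat < n
        omega
      · funext j
        have h7 : ((z j : ℤ) : ℝ) = n * x j := hz j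
        have h8 : (0 : ℝ) ≤ z j := by
          rw [h7]
          exact mul_nonneg hnR.le (hx j).1
        have h9 : 0 ≤ z j := by exact_mod_cast h8
        have h10 : (((z j).toNat : ℕ) : ℝ) = z j := by
          exact_mod_cast Int.toNat_of_nonneg h9
        rw [h10, h7]
        field_simp
    · rintro ⟨u, hu, rfl⟩
      refine ⟨fun j => ⟨by positivity, ?_⟩, fun j => ⟨u j, ?_⟩⟩
      · rw [div_lt_one hnR]
        exact_mod_cast hu j
      · simp
        field_simp
  rw [h6, Finset.tsum_subtype' _ φ, sum_image]
  intro u _ v _ huv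
  funext j
  have := congrFun huv j
  simp only at this
  rw [div_left_inj' hnR.ne'] at this
  exact_mod_cast this

end

end DiagonalSystems

namespace DiagonalSystems

noncomputable section

open MeasureTheory Filter Topology

lemma sum_piFinset_Icc_mul {s : ℕ} {W : ℕ} (hW : 1 ≤ W) (n : ℕ) (f : (Fin s → ℕ) → ℝ) :
    ∑ x ∈ Fintype.piFinset fun _ : Fin s => Icc 1 (n * W), f x =
      ∑ ρ ∈ Fintype.piFinset fun _ : Fin s => Icc 1 W,
        ∑ u ∈ Fintype.piFinset fun _ : Fin s => range n, f fun j => W * u j + ρ j := by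
  rw [← sum_product']
  refine sum_bij' (fun x _ => (fun j => (x j - 1) % W + 1, fun j => (x j - 1) / W))
    (fun v _ j => W * v.2 j + v.1 j) ?_ ?_ ?_ ?_ ?_
  · intro x hx
    simp only [Fintype.mem_piFinset, mem_Icc, mem_product, mem_range] at hx ⊢
    refine ⟨fun j => ⟨by omega, Nat.mod_lt _ hW⟩, fun j => ?_⟩
    rw [Nat.div_lt_iff_lt_mul hW]
    have := hx j
    omega
  · rintro ⟨ρ, u⟩ hv
    simp only [Fintype.mem_piFinset, mem_Icc, mem_product, mem_range] at hv ⊢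
    intro j
    have h1 := hv.1 j
    have h2 : W * (u j + 1) ≤ W * n := Nat.mul_le_mul_left W (hv.2 j)
    constructor
    · omega
    · rw [mul_comm n]
      linarith
  · intro x hx
    simp only [Fintype.mem_piFinset, mem_Icc] at hx
    funext j
    simp only
    have h1 := Nat.div_add_mod (x j - 1) W
    have h2 := hx j
    omega
  · rintro ⟨ρ, u⟩ hv
    simp only [Fintype.mem_piFinset, mem_Icc, mem_product, mem_range] at hv
    have h1 : ∀ j, W * u j + ρ j - 1 = (ρ j - 1) + W * u j := fun j => by
      have := hv.1 j
      omega
    have h2 : ∀ j, (W * u j + ρ j - 1) % W + 1 = ρ j := fun j => by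
      have := hv.1 j
      rw [h1, Nat.add_mul_mod_self_left, Nat.mod_eq_of_lt (by omega)]
      omega
    have h3 : ∀ j, (W * u j + ρ j - 1) / W = u j := fun j => by
      have := hv.1 j
      rw [h1, Nat.add_mul_div_left _ _ hW, Nat.div_eq_of_lt (by omega), zero_add]
    simp only [h2, h3]
  · intro x hx
    simp only [Fintype.mem_piFinset, mem_Icc] at hx
    congr 1
    funext j
    simp only
    have h1 := Nat.div_add_mod (x j - 1) W
    have h2 := hx j
    omega

lemma abs_grid_sub_le {W P u ρ : ℕ} (hn : 0 < P / W) (hW : 1 ≤ W)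
    (hu : u < P / W) (hρ : 1 ≤ ρ ∧ ρ ≤ W) :
    |((W * u + ρ : ℕ) : ℝ) / P - (u : ℝ) / (P / W : ℕ)| ≤ W / P := by
  obtain ⟨n, hn'⟩ : ∃ n, n = P / W := ⟨_, rfl⟩
  rw [← hn'] at hn hu ⊢
  have h1 : n * W ≤ P := by rw [hn']; exact Nat.div_mul_le_self P W
  have h2 : P < n * W + W := by
    rw [hn']
    have := Nat.lt_div_mul_add (a := P) hW
    exact this
  have hP : 0 < P := lt_of_lt_of_le (Nat.mul_pos hn hW) h1
  have h1R : (n : ℝ) * W ≤ P := by exact_mod_cast h1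
  have h2R : (P : ℝ) ≤ n * W + W := by exact_mod_cast h2.le
  have hPR : (0 : ℝ) < P := by exact_mod_cast hP
  have hnR : (0 : ℝ) < n := by exact_mod_cast hn
  have huR : (u : ℝ) ≤ n := by exact_mod_cast hu.le
  have hρR : (ρ : ℝ) ≤ W := by exact_mod_cast hρ.2
  have hρ0 : (0 : ℝ) ≤ ρ := by positivity
  have hu0 : (0 : ℝ) ≤ u := by positivity
  have h3 : ((W * u + ρ : ℕ) : ℝ) / P - (u : ℝ) / n = (ρ - u / n * (P - n * W)) / P := by
    push_cast
    field_simp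
    ring
  have h4 : (u : ℝ) / n ≤ 1 := by rw [div_le_one hnR]; exact huR
  have h5 : (0 : ℝ) ≤ (u : ℝ) / n := by positivity
  rw [h3, abs_div, abs_of_pos hPR]
  gcongr
  rw [abs_le]
  constructor <;> nlinarith

lemma tendsto_div_mul_div (W : ℕ) (hW : 1 ≤ W) :
    Tendsto (fun P : ℕ => ((P / W : ℕ) : ℝ) / P) atTop (𝓝 (1 / W)) := by
  have h1 := tendsto_nat_floor_mul_div_atTop (R := ℝ) (a := 1 / W) (by positivity)
  refine (h1.comp tendsto_natCast_atTop_atTop).congr fun P => ?_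
  simp only [Function.comp]
  rw [one_div_mul_eq_div, Nat.floor_div_natCast, Nat.floor_natCast]

/-- Riemann sums weighted by a periodic function. -/
lemma tendsto_sum_periodic {s W : ℕ} (hW : 1 ≤ W) {g : (Fin s → ℕ) → ℝ} (hg : ∀ x, |g x| ≤ 1)
    (hper : ∀ u ρ : Fin s → ℕ, (g fun j => W * u j + ρ j) = g ρ) {φ : (Fin s → ℝ) → ℝ}
    (hφ : Continuous φ) {w : ℕ → (Fin s → ℕ) → ℝ}
    (hw : ∀ ε > 0, ∀ᶠ P : ℕ in atTop, ∀ x ∈ Fintype.piFinset fun _ : Fin s => Icc 1 P,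
      |w P x - φ fun j => (x j : ℝ) / P| ≤ ε) :
    Tendsto (fun P : ℕ => (∑ x ∈ Fintype.piFinset fun _ : Fin s => Icc 1 P, g x * w P x) /
      (P : ℝ) ^ s) atTop
      (𝓝 ((∑ ρ ∈ Fintype.piFinset fun _ : Fin s => Icc 1 W, g ρ) / (W : ℝ) ^ s *
        ∫ x in Set.Icc 0 1, φ x)) := by
  have hWR : (0 : ℝ) < W := by exact_mod_cast hW
  obtain ⟨G, hG⟩ : ∃ G : ℝ, G = ∑ ρ ∈ Fintype.piFinset fun _ : Fin s => Icc 1 W, g ρ := ⟨_, rfl⟩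
  obtain ⟨S, hS⟩ : ∃ S : ℕ → ℝ, S = fun P => G * ∑ u ∈ Fintype.piFinset fun _ : Fin s =>
    range (P / W), φ fun j => (u j : ℝ) / (P / W : ℕ) := ⟨_, rfl⟩
  have hdiv : Tendsto (fun P : ℕ => P / W) atTop atTop :=
    Nat.tendsto_div_const_atTop (by omega)
  have hmain : Tendsto (fun P : ℕ => S P / (P : ℝ) ^ s) atTop
      (𝓝 (G / (W : ℝ) ^ s * ∫ x in Set.Icc 0 1, φ x)) := by
    have h1 := ((tendsto_div_mul_div W hW).pow s).mul ((tendsto_sum_grid hφ).comp hdiv)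
    have h2 := h1.const_mul G
    rw [one_div_pow, ← mul_assoc, mul_one_div] at h2
    refine h2.congr' ?_
    filter_upwards [hdiv.eventually_gt_atTop 0] with P hP
    have hn : ((P / W : ℕ) : ℝ) ≠ 0 := by
      have : (0 : ℝ) < (P / W : ℕ) := by exact_mod_cast hP
      exact this.ne'
    rw [hS]
    simp only [Function.comp]
    rw [div_pow]
    field_simp
  suffices hD : Tendsto (fun P : ℕ => (∑ x ∈ Fintype.piFinset fun _ : Fin s => Icc 1 P,
      g x * w P x) / (P : ℝ) ^ s - S P / (P : ℝ) ^ s) atTop (𝓝 0) by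
    have := hD.add hmain
    simpa only [sub_add_cancel, zero_add, hG] using this
  obtain ⟨B, hB⟩ := (isCompact_Icc (a := (0 : Fin s → ℝ)) (b := 1)).exists_bound_of_continuousOn
    hφ.continuousOn
  have huc := (isCompact_Icc (a := (0 : Fin s → ℝ)) (b := 1)).uniformContinuousOn_of_continuous
    hφ.continuousOn
  rw [Metric.uniformContinuousOn_iff] at huc
  have hB0 : 0 ≤ B := (norm_nonneg _).trans (hB 0 ⟨le_rfl, zero_le_one⟩)
  have hrest : Tendsto (fun P : ℕ => B * (1 - (W * (((P / W : ℕ) : ℝ) / P)) ^ s)) atTop (𝓝 0) := by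
    have h1 := ((((tendsto_div_mul_div W hW).const_mul (W : ℝ)).pow s).const_sub 1).const_mul B
    rwa [mul_one_div_cancel hWR.ne', one_pow, sub_self, mul_zero] at h1
  rw [Metric.tendsto_atTop'] at hrest ⊢
  intro ε hε
  obtain ⟨δ, hδ, huc⟩ := huc (ε / 4) (by positivity)
  obtain ⟨N₁, hrest⟩ := hrest (ε / 4) (by positivity)
  obtain ⟨N₂, hw⟩ := eventually_atTop.1 (hw (ε / 4) (by positivity))
  have hWP : Tendsto (fun P : ℕ => (W : ℝ) / P) atTop (𝓝 0) :=
    tendsto_const_div_atTop_nhds_zero_nat _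
  obtain ⟨N₃, hN₃⟩ := eventually_atTop.1 ((hWP.eventually_lt_const hδ).and
    (hdiv.eventually_gt_atTop 0))
  refine ⟨max N₁ (max N₂ N₃), fun P hP => ?_⟩
  simp only [max_lt_iff] at hP
  have hr := hrest P hP.1
  have hw := hw P hP.2.1.le
  obtain ⟨hPδ, hn⟩ := hN₃ P hP.2.2.le
  have hnW : P / W * W ≤ P := Nat.div_mul_le_self P W
  have hP0 : 0 < P := lt_of_lt_of_le (Nat.mul_pos hn hW) hnW
  have hPR : (0 : ℝ) < P := by exact_mod_cast hP0
  have hunit : ∀ x ∈ Fintype.piFinset fun _ : Fin s => Icc 1 P,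
      (fun j => (x j : ℝ) / P) ∈ Set.Icc (0 : Fin s → ℝ) 1 := by
    intro x hx
    simp only [Fintype.mem_piFinset, mem_Icc] at hx
    refine ⟨fun j => ?_, fun j => ?_⟩
    · simp only [Pi.zero_apply]
      positivity
    · simp only [Pi.one_apply]
      rw [div_le_one hPR]
      exact_mod_cast (hx j).2
  have hsub : (Fintype.piFinset fun _ : Fin s => Icc 1 (P / W * W)) ⊆
      Fintype.piFinset fun _ : Fin s => Icc 1 P :=
    Fintype.piFinset_subset _ _ fun _ => Icc_subset_Icc_right hnW
  obtain ⟨X, hX⟩ : ∃ X : Finset (Fin s → ℕ), X = Fintype.piFinset fun _ : Fin s => Icc 1 P :=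
    ⟨_, rfl⟩
  obtain ⟨Y, hY⟩ : ∃ Y : Finset (Fin s → ℕ), Y = Fintype.piFinset fun _ : Fin s =>
    Icc 1 (P / W * W) := ⟨_, rfl⟩
  have hXc : (#X : ℝ) = (P : ℝ) ^ s := by rw [hX]; simp
  have hYc : (#Y : ℝ) = ((P / W : ℕ) * W : ℝ) ^ s := by rw [hY]; simp
  rw [← hX] at hw hunit hsub ⊢
  rw [← hY] at hsub
  have e1 : |∑ x ∈ X, g x * w P x - ∑ x ∈ X, g x * φ fun j => (x j : ℝ) / P| ≤
      (P : ℝ) ^ s * (ε / 4) := by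
    rw [← sum_sub_distrib, ← hXc, ← nsmul_eq_mul]
    refine (abs_sum_le_sum_abs _ _).trans (sum_le_card_nsmul _ _ _ fun x hx => ?_)
    rw [← mul_sub, abs_mul]
    exact (mul_le_of_le_one_left (abs_nonneg _) (hg x)).trans (hw x hx)
  have e2 : |∑ x ∈ X, (g x * φ fun j => (x j : ℝ) / P) -
      ∑ x ∈ Y, g x * φ fun j => (x j : ℝ) / P| ≤
      (P : ℝ) ^ s * (B * (1 - (W * (((P / W : ℕ) : ℝ) / P)) ^ s)) := by
    rw [← sum_sdiff hsub, add_sub_cancel_right]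
    have hc : (#(X \ Y) : ℝ) = (P : ℝ) ^ s * (1 - (W * (((P / W : ℕ) : ℝ) / P)) ^ s) := by
      rw [card_sdiff_of_subset hsub, Nat.cast_sub (card_le_card hsub), hXc, hYc, mul_pow,
        mul_pow, div_pow]
      field_simp
    rw [mul_left_comm, ← hc, mul_comm, ← nsmul_eq_mul]
    refine (abs_sum_le_sum_abs _ _).trans (sum_le_card_nsmul _ _ _ fun x hx => ?_)
    rw [abs_mul]
    exact (mul_le_of_le_one_left (abs_nonneg _) (hg x)).trans
      (hB _ (hunit x (mem_sdiff.1 hx).1))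
  have e3 : |(∑ x ∈ Y, g x * φ fun j => (x j : ℝ) / P) - S P| ≤ (P : ℝ) ^ s * (ε / 4) := by
    have hYX : (#Y : ℝ) ≤ (P : ℝ) ^ s := by
      rw [← hXc]
      exact_mod_cast card_le_card hsub
    refine le_trans ?_ (mul_le_mul_of_nonneg_right hYX (by positivity))
    have hcc : (#Y : ℝ) = #(Fintype.piFinset fun _ : Fin s => Icc 1 W) *
        #(Fintype.piFinset fun _ : Fin s => range (P / W)) := by
      rw [hYc]
      simp [mul_pow]
      ring
    rw [hY, sum_piFinset_Icc_mul hW, hS, ← hY]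
    simp only
    rw [hG, sum_mul, ← sum_sub_distrib, hcc, mul_assoc, ← nsmul_eq_mul]
    refine (abs_sum_le_sum_abs _ _).trans (sum_le_card_nsmul _ _ _ fun ρ hρ => ?_)
    rw [mul_sum, ← sum_sub_distrib, ← nsmul_eq_mul]
    refine (abs_sum_le_sum_abs _ _).trans (sum_le_card_nsmul _ _ _ fun u hu => ?_)
    rw [hper, ← mul_sub, abs_mul]
    refine (mul_le_of_le_one_left (abs_nonneg _) (hg ρ)).trans ?_
    rw [← Real.dist_eq]
    simp only [Fintype.mem_piFinset, mem_Icc, mem_range] at hu hρ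
    refine (huc _ (hunit (fun j => W * u j + ρ j) ?_) _ ?_ ?_).le
    · rw [hX]
      simp only [Fintype.mem_piFinset, mem_Icc]
      intro j
      have h2 : W * (u j + 1) ≤ W * (P / W) := Nat.mul_le_mul_left W (hu j)
      have := hρ j
      constructor
      · omega
      · linarith
    · have hnR : (0 : ℝ) < (P / W : ℕ) := by exact_mod_cast hn
      refine ⟨fun j => ?_, fun j => ?_⟩
      · simp only [Pi.zero_apply]
        positivity
      · simp only [Pi.one_apply]
        rw [div_le_one hnR]
        exact_mod_cast (hu j).le
    · rw [dist_pi_lt_iff hδ]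
      intro j
      rw [Real.dist_eq]
      exact (abs_grid_sub_le hn hW (hu j) (hρ j)).trans_lt hPδ
  rw [Real.dist_eq, sub_zero] at hr ⊢
  have hr' := (le_abs_self _).trans_lt hr
  rw [← sub_div, abs_div, abs_of_pos (pow_pos hPR s), div_lt_iff₀ (by positivity)]
  have hPs : 0 < (P : ℝ) ^ s := by positivity
  calc _ ≤ (P : ℝ) ^ s * (ε / 4) + (P : ℝ) ^ s * (B * (1 - (W * (((P / W : ℕ) : ℝ) / P)) ^ s)) +
        (P : ℝ) ^ s * (ε / 4) := by
        refine (abs_sub_le _ (∑ x ∈ Y, g x * φ fun j => (x j : ℝ) / P) _).trans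
          (add_le_add ((abs_sub_le _ _ _).trans (add_le_add e1 e2)) e3)
    _ < ε * (P : ℝ) ^ s := by nlinarith

end

end DiagonalSystems

namespace DiagonalSystems

noncomputable section

open MeasureTheory Filter Topology

variable {I : Type} [Fintype I]

/-- The number of solutions of the system modulo `W`. -/
def zerosMod (d : I → ℕ) {s : ℕ} (A : I → Fin s → ℤ) (W : ℕ) : ℕ :=
  #{x ∈ Fintype.piFinset fun _ : Fin s => Icc 1 W | ∀ i, (W : ℤ) ∣ natForm d A i x}

/-- The normalised number of solutions of the system modulo `W`. -/
def localDensity (d : I → ℕ) {s : ℕ} (A : I → Fin s → ℤ) (W : ℕ) : ℝ :=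
  (zerosMod d A W : ℝ) / (W : ℝ) ^ s * (W : ℝ) ^ Fintype.card I

/-- The smoothed real density of the system. -/
def realDensity (d : I → ℕ) {s : ℕ} (A : I → Fin s → ℤ) (T : ℕ) : ℝ :=
  ∫ t in Set.Icc (0 : Fin s → ℝ) 1, ∏ i, ((T : ℝ) * max 0 (1 - T * |form d A i t|))

/-- The smoothed count of near zeros modulo `W`. -/
def smoothCount (d : I → ℕ) {s : ℕ} (A : I → Fin s → ℤ) (W T P : ℕ) : ℝ :=
  ∑ x ∈ Fintype.piFinset fun _ : Fin s => Icc 1 P,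
    ∏ i, fejerCoeff W (P ^ d i / (T * W)) (natForm d A i x)

omit [Fintype I] in
@[fun_prop] lemma continuous_form (d : I → ℕ) {s : ℕ} (A : I → Fin s → ℤ) (i : I) :
    Continuous (form d A i : (Fin s → ℝ) → ℝ) := by
  unfold form
  fun_prop

omit [Fintype I] in
lemma form_div (d : I → ℕ) {s : ℕ} (A : I → Fin s → ℤ) (i : I) (x : Fin s → ℝ) (c : ℝ) :
    form d A i (fun j => x j / c) = form d A i x / c ^ d i := by
  rw [form, form, sum_div]
  exact sum_congr rfl fun j _ => by rw [div_pow, mul_div_assoc]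

lemma tendsto_smoothCount {d : I → ℕ} (hd : ∀ i, 1 ≤ d i) {s : ℕ} (A : I → Fin s → ℤ) {W T : ℕ}
    (hW : 1 ≤ W) (hT : 1 ≤ T) :
    Tendsto (fun P : ℕ => (P : ℝ) ^ (∑ i, d i) * (smoothCount d A W T P / (P : ℝ) ^ s)) atTop
      (𝓝 (localDensity d A W * realDensity d A T)) := by
  classical
  have hWR : (0 : ℝ) < W := by exact_mod_cast hW
  have hTR : (0 : ℝ) < T := by exact_mod_cast hT
  have hTW : 1 ≤ T * W := Nat.mul_pos hT hW
  obtain ⟨Ψ, hΨ⟩ : ∃ Ψ : (I → ℝ) → (Fin s → ℝ) → ℝ, Ψ = fun (h : I → ℝ) (t : Fin s → ℝ) =>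
    ∏ i, (W * (h i * max 0 (1 - h i * |form d A i t|))) := ⟨_, rfl⟩
  obtain ⟨h, hh⟩ : ∃ h : ℕ → I → ℝ, h = fun (P : ℕ) (i : I) =>
    (W * (((P ^ d i / (T * W) : ℕ) : ℝ) / (P ^ d i : ℕ)))⁻¹ := ⟨_, rfl⟩
  have hlim : Tendsto h atTop (𝓝 fun _ => (T : ℝ)) := by
    rw [tendsto_pi_nhds, hh]
    intro i
    have h1 := (tendsto_div_mul_div (T * W) hTW).comp
      (tendsto_pow_atTop (show d i ≠ 0 from (Nat.one_le_iff_ne_zero.1 (hd i))))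
    have h2 := (h1.const_mul (W : ℝ)).inv₀ (by positivity)
    have h3 : ((W : ℝ) * (1 / (T * W : ℕ)))⁻¹ = T := by
      push_cast
      field_simp
    rw [h3] at h2
    exact h2
  have hunif : ∀ ε > 0, ∀ᶠ P : ℕ in atTop, ∀ t ∈ Set.Icc (0 : Fin s → ℝ) 1,
      |Ψ (h P) t - Ψ (fun _ => T) t| ≤ ε := by
    intro ε hε
    have hc : Continuous (Function.uncurry Ψ) := by
      rw [hΨ]
      unfold Function.uncurry
      fun_prop
    have h1 := (isCompact_Icc (a := (0 : Fin s → ℝ)) (b := 1)).mem_uniformity_of_prod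
      (f := Ψ) (s := Set.univ) (q := fun _ => (T : ℝ)) hc.continuousOn (Set.mem_univ _)
      (Metric.dist_mem_uniformity hε)
    obtain ⟨v, hv, hv'⟩ := h1
    rw [nhdsWithin_univ] at hv
    filter_upwards [hlim hv] with P hP t ht
    have h3 := hv' (h P) hP t ht
    simpa [Real.dist_eq] using le_of_lt h3
  have key := tendsto_sum_periodic hW
    (g := fun x => if ∀ i, (W : ℤ) ∣ natForm d A i x then 1 else 0)
    (fun x => by split_ifs <;> simp) (fun u ρ => ?_) (φ := Ψ fun _ => T)
    (by rw [hΨ]; fun_prop) (w := fun P x => Ψ (h P) fun j => (x j : ℝ) / P) ?_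
  · rw [sum_boole] at key
    have h1 : localDensity d A W * realDensity d A T = (#{x ∈ Fintype.piFinset fun _ : Fin s =>
        Icc 1 W | ∀ i, (W : ℤ) ∣ natForm d A i x} : ℝ) / (W : ℝ) ^ s *
          ∫ x in Set.Icc 0 1, Ψ (fun _ => T) x := by
      rw [hΨ, localDensity, realDensity, zerosMod, mul_assoc, ← integral_const_mul]
      simp only [prod_mul_distrib, prod_const, card_univ]
    rw [h1]
    refine key.congr' ?_
    have h2 : ∀ᶠ P : ℕ in atTop, ∀ i, 1 ≤ P ^ d i / (T * W) := by
      filter_upwards [eventually_ge_atTop (T * W)] with P hP i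
      rw [Nat.one_le_div_iff hTW]
      exact hP.trans (Nat.le_self_pow (Nat.one_le_iff_ne_zero.1 (hd i)) P)
    filter_upwards [h2, eventually_gt_atTop 0] with P hP hP0
    have hPR : (0 : ℝ) < P := by exact_mod_cast hP0
    rw [smoothCount, mul_div_assoc', mul_sum]
    congr 1
    refine sum_congr rfl fun x _ => ?_
    rw [← prod_pow_eq_pow_sum, ← prod_mul_distrib]
    split_ifs with hdvd
    · rw [one_mul, hΨ]
      refine prod_congr rfl fun i _ => ?_
      have hHR : (0 : ℝ) < (P ^ d i / (T * W) : ℕ) := by exact_mod_cast hP i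
      rw [fejerCoeff_eq hW (hP i), if_pos (hdvd i), form_div, natForm_cast, hh, abs_div,
        abs_of_pos (pow_pos hPR _)]
      simp only
      push_cast
      generalize ((P ^ d i / (T * W) : ℕ) : ℝ) = H at *
      have : |form d A i fun j => (x j : ℝ)| / (W * H) =
          (W * (H / (P : ℝ) ^ d i))⁻¹ * (|form d A i fun j => (x j : ℝ)| / (P : ℝ) ^ d i) := by
        field_simp
      rw [this]
      field_simp
    · rw [zero_mul]
      push Not at hdvd
      obtain ⟨i, hi⟩ := hdvd
      refine (prod_eq_zero (mem_univ i) ?_).symm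
      rw [fejerCoeff_eq hW (hP i), if_neg hi, mul_zero]
  · have : (∀ i, (W : ℤ) ∣ natForm d A i fun j => W * u j + ρ j) ↔
        ∀ i, (W : ℤ) ∣ natForm d A i ρ := by
      refine forall_congr' fun i => ?_
      rw [← ZMod.intCast_zmod_eq_zero_iff_dvd, ← ZMod.intCast_zmod_eq_zero_iff_dvd,
        natForm_cast, natForm_cast]
      simp
    simp only [this]
  · intro ε hε
    filter_upwards [hunif ε hε, eventually_gt_atTop 0] with P hP hP0 x hx
    refine hP _ ?_
    have hPR : (0 : ℝ) < P := by exact_mod_cast hP0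
    simp only [Fintype.mem_piFinset, mem_Icc] at hx
    refine ⟨fun j => ?_, fun j => ?_⟩
    · simp only [Pi.zero_apply]
      positivity
    · simp only [Pi.one_apply]
      rw [div_le_one hPR]
      exact_mod_cast (hx j).2

end

end DiagonalSystems

namespace DiagonalSystems

noncomputable section

open MeasureTheory Filter Topology

variable {I : Type} [Fintype I]

lemma one_sub_fejer_cutoff_le {W T P m q Q : ℕ} (hT : 1 ≤ T) (hP : 1 ≤ P) (hq : 1 ≤ q)
    (hH : 1 ≤ P ^ m / (T * W)) {t : ℝ} {a : ℤ} (ht : |t - a / q| * (P : ℝ) ^ m ≤ Q)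
    (hdvd : (q : ℤ) ∣ a * W) :
    1 - fejer W (P ^ m / (T * W)) t ≤ 4 * Real.pi * (Q / T) := by
  obtain ⟨z, hz⟩ := hdvd
  have hqR : (0 : ℝ) < q := by exact_mod_cast hq
  have hTR : (0 : ℝ) < T := by exact_mod_cast hT
  have hPR : (0 : ℝ) < (P : ℝ) ^ m := pow_pos (by exact_mod_cast hP) m
  have hzR : (a : ℝ) * W = q * z := by exact_mod_cast hz
  have h1 : t * W - z = (t - a / q) * W := by
    have : (z : ℝ) = a * W / q := by rw [hzR]; field_simp
    rw [this]
    ring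
  have h2 : |t * W - z| ≤ Q / (P : ℝ) ^ m * W := by
    rw [h1, abs_mul, Nat.abs_cast]
    gcongr
    rwa [le_div_iff₀ hPR]
  refine (one_sub_fejer_le hH z h2).trans ?_
  have h3 : ((P ^ m / (T * W) : ℕ) : ℝ) * (T * W) ≤ (P : ℝ) ^ m := by
    exact_mod_cast Nat.div_mul_le_self (P ^ m) (T * W)
  gcongr
  rw [le_div_iff₀ hTR]
  calc ((P ^ m / (T * W) : ℕ) : ℝ) * (Q / (P : ℝ) ^ m * W) * T =
      (((P ^ m / (T * W) : ℕ) : ℝ) * (T * W)) / (P : ℝ) ^ m * Q := by ring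
    _ ≤ 1 * Q := by
      gcongr
      rwa [div_le_one hPR]
    _ = Q := one_mul _

lemma fejer_cutoff_le {W H P m q Q : ℕ} (hP : 1 ≤ P) (hq : 1 ≤ q) (hqQ : q ≤ Q)
    (hH : 1 ≤ H) (hPm : 2 * Q ^ 2 * W ≤ P ^ m) {t : ℝ} {a : ℤ}
    (ht : |t - a / q| * (P : ℝ) ^ m ≤ Q) (hdvd : ¬(q : ℤ) ∣ a * W) :
    fejer W H t ≤ 1 / (1 / (2 * Q) * H) ^ 2 := by
  have hqR : (0 : ℝ) < q := by exact_mod_cast hq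
  have hqQR : (q : ℝ) ≤ Q := by exact_mod_cast hqQ
  have hQR : (0 : ℝ) < Q := hqR.trans_le hqQR
  have hPR : (0 : ℝ) < (P : ℝ) ^ m := pow_pos (by exact_mod_cast hP) m
  refine fejer_le hH (by positivity) ?_
  obtain ⟨z, hz⟩ : ∃ z : ℤ, z = round (t * W) := ⟨_, rfl⟩
  rw [← hz]
  have h1 : (1 : ℝ) / q ≤ |(a : ℝ) * W / q - z| := by
    have h2 : (a : ℝ) * W / q - z = ((a * W - q * z : ℤ) : ℝ) / q := by
      push_cast
      field_simp
    have h3 : (1 : ℝ) ≤ |((a * W - q * z : ℤ) : ℝ)| := by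
      have : a * W - q * z ≠ 0 := fun h => hdvd ⟨z, by linarith⟩
      exact_mod_cast Int.one_le_abs this
    rw [h2, abs_div, Nat.abs_cast]
    gcongr
  have h4 : |t * W - a * W / q| ≤ 1 / (2 * Q) := by
    have h5 : t * W - a * W / q = (t - a / q) * W := by ring
    have h6 : (2 * (Q : ℝ) ^ 2 * W) ≤ (P : ℝ) ^ m := by exact_mod_cast hPm
    rw [h5, abs_mul, Nat.abs_cast, le_div_iff₀ (by positivity)]
    have h7 := abs_nonneg (t - a / q)
    have h8 : |t - a / q| * (2 * (Q : ℝ) ^ 2 * W) ≤ Q :=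
      (mul_le_mul_of_nonneg_left h6 h7).trans ht
    have h9 : (|t - a / q| * W * (2 * Q)) * Q ≤ 1 * Q := by nlinarith
    exact le_of_mul_le_mul_right h9 hQR
  have h10 : (1 : ℝ) / Q ≤ 1 / q := by gcongr
  have h11 : |(a : ℝ) * W / q - z| ≤ |t * W - a * W / q| + |t * W - z| := by
    rw [abs_sub_comm (t * W) (a * W / q)]
    exact abs_sub_le _ _ _
  have h12 : (1 : ℝ) / Q = 1 / (2 * Q) + 1 / (2 * Q) := by field_simp; norm_num
  linarith

lemma abs_countZeros_sub_smoothCount_le {d : I → ℕ} {s : ℕ} {A : I → Fin s → ℤ}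
    {P Q W T : ℕ} (hP : 1 ≤ P) (hT : 1 ≤ T) {C η : ℝ} (hη : 0 ≤ η) (hC : 0 ≤ C)
    (h1 : ENNReal.ofReal ((P : ℝ) ^ ∑ i, d i) *
      ∫⁻ α in Set.Icc 0 1, ENNReal.ofReal (normProd d A univ P α) ≤ ENNReal.ofReal C)
    (h2 : ENNReal.ofReal ((P : ℝ) ^ ∑ i, d i) * ∫⁻ α in Set.Icc 0 1 \ majorArcs d P Q,
      ENNReal.ofReal (normProd d A univ P α) ≤ ENNReal.ofReal η)
    (hQW : ∀ q, 1 ≤ q → q ≤ Q → q ∣ W) (hH : ∀ i, 1 ≤ P ^ d i / (T * W)) :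
    (P : ℝ) ^ (∑ i, d i) * (|(countZeros d A P : ℝ) - smoothCount d A W T P| / (P : ℝ) ^ s) ≤
      η + Fintype.card I * (4 * Real.pi * (Q / T)) * C := by
  obtain ⟨κ, hκ⟩ : ∃ κ : (I → ℝ) → ℝ, κ = fun α => 1 - ∏ i, fejer W (P ^ d i / (T * W)) (α i) :=
    ⟨_, rfl⟩
  have h3 : ((countZeros d A P : ℝ) - smoothCount d A W T P : ℂ) =
      ∫ α in Set.Icc (0 : I → ℝ) 1, (∏ j, expSum d P (fun i => α i * A i j)) * (κ α : ℂ) := by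
    rw [smoothCount, ← setIntegral_prod_expSum_mul_fejer, Complex.ofReal_natCast,
      ← setIntegral_prod_expSum, ← integral_sub]
    · refine integral_congr_ae (ae_of_all _ fun α => ?_)
      simp only [hκ]
      push_cast
      ring
    · exact Continuous.integrableOn_Icc (by fun_prop)
    · exact Continuous.integrableOn_Icc (by fun_prop)
  rw [← Complex.ofReal_sub] at h3
  rw [← Real.norm_eq_abs, ← Complex.norm_real, h3]
  refine norm_setIntegral_mul_le hP hη (by positivity) hC h1 h2 (fun α => ?_) fun α hα => ?_
  · have := prod_fejer_mem W (fun i => P ^ d i / (T * W)) α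
    rw [hκ, abs_le]
    constructor <;> linarith [this.1, this.2]
  · obtain ⟨-, q, hq1, hqQ, ha⟩ := hα
    rw [hκ]
    refine abs_one_sub_prod_fejer_le fun i => ?_
    obtain ⟨a, ha⟩ := ha i
    refine one_sub_fejer_cutoff_le hT hP hq1 (hH i) ha ?_
    exact Dvd.dvd.mul_left (by exact_mod_cast hQW q hq1 hqQ) a

lemma abs_smoothCount_sub_smoothCount_le {d : I → ℕ} {s : ℕ} {A : I → Fin s → ℤ}
    {P Q W T : ℕ} (hP : 1 ≤ P) (hT : 1 ≤ T) {C η : ℝ} (hη : 0 ≤ η) (hC : 0 ≤ C)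
    (h1 : ENNReal.ofReal ((P : ℝ) ^ ∑ i, d i) *
      ∫⁻ α in Set.Icc 0 1, ENNReal.ofReal (normProd d A univ P α) ≤ ENNReal.ofReal C)
    (h2 : ENNReal.ofReal ((P : ℝ) ^ ∑ i, d i) * ∫⁻ α in Set.Icc 0 1 \ majorArcs d P Q,
      ENNReal.ofReal (normProd d A univ P α) ≤ ENNReal.ofReal η)
    (hW : 1 ≤ W) (hQW : ∀ q, 1 ≤ q → q ≤ Q → Nat.Coprime q W)
    (hH : ∀ i, 1 ≤ P ^ d i / (T * W)) (hPW : ∀ i, 2 * Q ^ 2 * W ≤ P ^ d i)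
    {δ : ℝ} (hδ : Fintype.card I * (4 * Real.pi * (Q / T)) ≤ δ)
    (hHδ : ∀ i, 1 / (1 / (2 * Q) * ((P ^ d i / (T * W) : ℕ) : ℝ)) ^ 2 ≤ δ) :
    (P : ℝ) ^ (∑ i, d i) * (|smoothCount d A W T P - smoothCount d A 1 T P| / (P : ℝ) ^ s) ≤
      η + δ * C := by
  obtain ⟨κ, hκ⟩ : ∃ κ : (I → ℝ) → ℝ, κ = fun α => ∏ i, fejer W (P ^ d i / (T * W)) (α i) -
    ∏ i, fejer 1 (P ^ d i / (T * 1)) (α i) := ⟨_, rfl⟩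
  have h3 : (smoothCount d A W T P - smoothCount d A 1 T P : ℂ) =
      ∫ α in Set.Icc (0 : I → ℝ) 1, (∏ j, expSum d P (fun i => α i * A i j)) * (κ α : ℂ) := by
    rw [smoothCount, ← setIntegral_prod_expSum_mul_fejer, smoothCount,
      ← setIntegral_prod_expSum_mul_fejer, ← integral_sub]
    · refine integral_congr_ae (ae_of_all _ fun α => ?_)
      simp only [hκ]
      push_cast
      ring
    · exact Continuous.integrableOn_Icc (by fun_prop)
    · exact Continuous.integrableOn_Icc (by fun_prop)
  have hδ0 : 0 ≤ δ := le_trans (by positivity) hδ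
  rw [← Complex.ofReal_sub] at h3
  rw [← Real.norm_eq_abs, ← Complex.norm_real, h3]
  have hmono : ∀ i, P ^ d i / (T * W) ≤ P ^ d i / (T * 1) := fun i =>
    Nat.div_le_div_left (Nat.mul_le_mul_left T hW) (by omega)
  have hH1 : ∀ i, 1 ≤ P ^ d i / (T * 1) := fun i => (hH i).trans (hmono i)
  refine norm_setIntegral_mul_le hP hη hδ0 hC h1 h2 (fun α => ?_) fun α hα => ?_
  · have h4 := prod_fejer_mem W (fun i => P ^ d i / (T * W)) α
    have h5 := prod_fejer_mem 1 (fun i => P ^ d i / (T * 1)) α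
    rw [hκ, abs_le]
    constructor <;> linarith [h4.1, h4.2, h5.1, h5.2]
  · obtain ⟨-, q, hq1, hqQ, ha⟩ := hα
    choose a ha using ha
    have h4 := prod_fejer_mem W (fun i => P ^ d i / (T * W)) α
    have h5 := prod_fejer_mem 1 (fun i => P ^ d i / (T * 1)) α
    rw [hκ]
    by_cases hall : ∀ i, (q : ℤ) ∣ a i
    · have h6 := abs_one_sub_prod_fejer_le (W := W) (H := fun i => P ^ d i / (T * W)) (t := α)
        fun i => one_sub_fejer_cutoff_le hT hP hq1 (hH i) (ha i) ((hall i).mul_right _)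
      have h7 := abs_one_sub_prod_fejer_le (W := 1) (H := fun i => P ^ d i / (T * 1)) (t := α)
        fun i => one_sub_fejer_cutoff_le hT hP hq1 (hH1 i) (ha i) ((hall i).mul_right _)
      rw [abs_le] at h6 h7 ⊢
      constructor <;> linarith [h4.1, h4.2, h5.1, h5.2, h6.1, h6.2, h7.1, h7.2]
    · push Not at hall
      obtain ⟨i, hi⟩ := hall
      have hi' : ¬(q : ℤ) ∣ a i * W := fun h =>
        hi ((Nat.isCoprime_iff_coprime.2 (hQW q hq1 hqQ)).dvd_of_dvd_mul_right h)
      have hPW1 : 2 * Q ^ 2 * 1 ≤ P ^ d i := le_trans (Nat.mul_le_mul_left _ hW) (hPW i)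
      have h6 := (prod_fejer_le W (fun i => P ^ d i / (T * W)) α i).trans
        (fejer_cutoff_le hP hq1 hqQ (hH i) (hPW i) (ha i) hi')
      have h7 := (prod_fejer_le 1 (fun i => P ^ d i / (T * 1)) α i).trans
        (fejer_cutoff_le hP hq1 hqQ (hH1 i) hPW1 (ha i) (by simpa using hi))
      have hQR : (0 : ℝ) < Q := by exact_mod_cast hq1.trans hqQ
      have hHR : (0 : ℝ) < (P ^ d i / (T * W) : ℕ) := by exact_mod_cast hH i
      have h8 : (1 : ℝ) / (1 / (2 * Q) * ((P ^ d i / (T * 1) : ℕ) : ℝ)) ^ 2 ≤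
          1 / (1 / (2 * Q) * ((P ^ d i / (T * W) : ℕ) : ℝ)) ^ 2 := by
        have : ((P ^ d i / (T * W) : ℕ) : ℝ) ≤ (P ^ d i / (T * 1) : ℕ) := by
          exact_mod_cast hmono i
        gcongr
      rw [abs_le]
      constructor <;> linarith [h4.1, h4.2, h5.1, h5.2, h6, h7, h8, hHδ i]

end

end DiagonalSystems

namespace DiagonalSystems

noncomputable section

open MeasureTheory Filter Topology

variable {I : Type} [Fintype I]

lemma tendsto_pow_div_atTop {m W : ℕ} (hm : 1 ≤ m) (hW : 1 ≤ W) :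
    Tendsto (fun P : ℕ => P ^ m / W) atTop atTop :=
  (Nat.tendsto_div_const_atTop (by omega)).comp (tendsto_pow_atTop (by omega))

lemma exists_tendsto_of_forall_exists_eventually {a : ℕ → ℝ} {c : ℝ}
    (h : ∀ ε > 0, ∃ L : ℝ, c ≤ L ∧ ∀ᶠ P in atTop, |a P - L| ≤ ε) :
    ∃ C : ℝ, c ≤ C ∧ Tendsto a atTop (𝓝 C) := by
  have hcau : CauchySeq a := by
    rw [Metric.cauchySeq_iff']
    intro ε hε
    obtain ⟨L, -, hL⟩ := h (ε / 3) (by positivity)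
    obtain ⟨N, hN⟩ := eventually_atTop.1 hL
    refine ⟨N, fun n hn => ?_⟩
    rw [Real.dist_eq]
    have h1 := abs_le.1 (hN n hn)
    have h2 := abs_le.1 (hN N le_rfl)
    rw [abs_lt]
    constructor <;> linarith [h1.1, h1.2, h2.1, h2.2]
  obtain ⟨C, hC⟩ := cauchySeq_tendsto_of_complete hcau
  refine ⟨C, le_of_forall_pos_le_add fun ε hε => ?_, hC⟩
  obtain ⟨L, hcL, hL⟩ := h ε hε
  have h1 : L - ε ≤ C := by
    refine ge_of_tendsto hC ?_
    filter_upwards [hL] with P hP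
    linarith [(abs_le.1 hP).1]
  linarith

/-- The asymptotic formula, given a lower bound for the product of local densities. -/
lemma exists_tendsto_countZeros {d : I → ℕ} (hd : ∀ i, 1 ≤ d i) {s : ℕ} {A : I → Fin s → ℤ}
    (hA : Concentrated d A) {c : ℝ} {T₀ : ℕ}
    (hc : ∀ W T : ℕ, 1 ≤ W → 1 ≤ T → T₀ ≤ T → c ≤ localDensity d A W * realDensity d A T) :
    ∃ C : ℝ, c ≤ C ∧ Tendsto (fun P : ℕ => (P : ℝ) ^ (∑ i, d i) *
      ((countZeros d A P : ℝ) / (P : ℝ) ^ s)) atTop (𝓝 C) := by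
  refine exists_tendsto_of_forall_exists_eventually fun ε hε => ?_
  obtain ⟨⟨C, hC, hC'⟩, hη⟩ := hA
  obtain ⟨Q, -, hQ⟩ := hη (ε / 3) (by positivity)
  have h1 : Tendsto (fun T : ℕ => Fintype.card I * (4 * Real.pi * ((Q : ℝ) / T)) * C) atTop
      (𝓝 0) := by
    have := (((tendsto_const_div_atTop_nhds_zero_nat (Q : ℝ)).const_mul
      (4 * Real.pi)).const_mul (Fintype.card I : ℝ)).mul_const C
    simpa using this
  obtain ⟨T, hT1, hT2, hT3⟩ := ((h1.eventually_le_const (show 0 < ε / 3 by positivity)).and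
    ((eventually_ge_atTop 1).and (eventually_ge_atTop T₀))).exists
  have hW : 1 ≤ Q.factorial := Q.factorial_pos
  refine ⟨_, hc _ T hW hT2 hT3, ?_⟩
  have hH : ∀ᶠ P : ℕ in atTop, ∀ i, 1 ≤ P ^ d i / (T * Q.factorial) :=
    eventually_all.2 fun i => (tendsto_pow_div_atTop (hd i) (Nat.mul_pos hT2 hW)).eventually_ge_atTop 1
  have hlim := tendsto_smoothCount hd A hW hT2
  have hlim' := (tendsto_order.1 (tendsto_iff_dist_tendsto_zero.1 hlim)).2 (ε / 3) (by positivity)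
  filter_upwards [hH, eventually_ge_atTop 1, hlim'] with P hP1 hP2 hP3
  have h2 := abs_countZeros_sub_smoothCount_le hP2 hT2 (by positivity) hC.le (hC' P hP2) (hQ P hP2)
    (fun q hq1 hqQ => Nat.dvd_factorial hq1 hqQ) hP1
  have hPR : (0 : ℝ) < P := by exact_mod_cast hP2
  have h3 : |(P : ℝ) ^ (∑ i, d i) * ((countZeros d A P : ℝ) / (P : ℝ) ^ s) -
      (P : ℝ) ^ (∑ i, d i) * (smoothCount d A Q.factorial T P / (P : ℝ) ^ s)| =
      (P : ℝ) ^ (∑ i, d i) *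
        (|(countZeros d A P : ℝ) - smoothCount d A Q.factorial T P| / (P : ℝ) ^ s) := by
    rw [← mul_sub, ← sub_div, abs_mul, abs_div, abs_of_pos (pow_pos hPR _),
      abs_of_pos (pow_pos hPR _)]
  rw [← h3] at h2
  rw [Real.dist_eq] at hP3
  refine (abs_sub_le _ _ _).trans ((add_le_add h2 hP3.le).trans ?_)
  linarith

lemma localDensity_one (d : I → ℕ) {s : ℕ} (A : I → Fin s → ℤ) : localDensity d A 1 = 1 := by
  have : zerosMod d A 1 = 1 := by
    rw [zerosMod, filter_true_of_mem fun x _ i => by simp]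
    simp
  simp [localDensity, this]

lemma one_half_le_localDensity {d : I → ℕ} (hd : ∀ i, 1 ≤ d i) {s : ℕ} {A : I → Fin s → ℤ}
    (hA : Concentrated d A) {c : ℝ} (hc : 0 < c) {T₀ : ℕ}
    (hT₀ : ∀ T : ℕ, T₀ ≤ T → c ≤ realDensity d A T) :
    ∃ Q : ℕ, ∀ W : ℕ, 1 ≤ W → (∀ q, 1 ≤ q → q ≤ Q → Nat.Coprime q W) →
      1 / 2 ≤ localDensity d A W := by
  obtain ⟨⟨C, hC, hC'⟩, hη⟩ := hA
  obtain ⟨Q, hQ1, hQ⟩ := hη (c / 4) (by positivity)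
  refine ⟨Q, fun W hW hQW => ?_⟩
  obtain ⟨δ, hδ⟩ : ∃ δ : ℕ → ℝ, δ = fun T : ℕ => (Fintype.card I + 1) * (4 * Real.pi * ((Q : ℝ) / T)) :=
    ⟨_, rfl⟩
  have h1 : Tendsto (fun T : ℕ => δ T * C) atTop (𝓝 0) := by
    rw [hδ]
    have := (((tendsto_const_div_atTop_nhds_zero_nat (Q : ℝ)).const_mul
      (4 * Real.pi)).const_mul (Fintype.card I + 1 : ℝ)).mul_const C
    simpa using this
  obtain ⟨T, hT1, hT2, hT3⟩ := ((h1.eventually_le_const (show 0 < c / 4 by positivity)).and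
    ((eventually_ge_atTop 1).and (eventually_ge_atTop T₀))).exists
  have hTR : (0 : ℝ) < T := by exact_mod_cast hT2
  have hQR : (0 : ℝ) < Q := by exact_mod_cast hQ1
  have hδ0 : 0 < δ T := by
    rw [hδ]
    have := Real.pi_pos
    positivity
  have hHlim : ∀ i, Tendsto (fun P : ℕ => P ^ d i / (T * W)) atTop atTop := fun i =>
    tendsto_pow_div_atTop (hd i) (Nat.mul_pos hT2 hW)
  have hH : ∀ᶠ P : ℕ in atTop, ∀ i, 1 ≤ P ^ d i / (T * W) :=
    eventually_all.2 fun i => (hHlim i).eventually_ge_atTop 1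
  have hPW : ∀ᶠ P : ℕ in atTop, ∀ i, 2 * Q ^ 2 * W ≤ P ^ d i :=
    eventually_all.2 fun i => (tendsto_pow_atTop (Nat.one_le_iff_ne_zero.1 (hd i))
      ).eventually_ge_atTop _
  have hHδ : ∀ᶠ P : ℕ in atTop, ∀ i,
      1 / (1 / (2 * Q) * ((P ^ d i / (T * W) : ℕ) : ℝ)) ^ 2 ≤ δ T := by
    refine eventually_all.2 fun i => ?_
    have h2 : Tendsto (fun P : ℕ => 1 / (1 / (2 * (Q : ℝ)) * ((P ^ d i / (T * W) : ℕ) : ℝ)) ^ 2)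
        atTop (𝓝 0) := by
      simp only [one_div (_ ^ 2)]
      refine Tendsto.inv_tendsto_atTop ?_
      refine (tendsto_pow_atTop two_ne_zero).comp ?_
      exact Tendsto.const_mul_atTop (by positivity)
        (tendsto_natCast_atTop_atTop.comp (hHlim i))
    exact h2.eventually_le_const hδ0
  have hlimW := tendsto_smoothCount hd A hW hT2
  have hlim1 := tendsto_smoothCount hd A le_rfl hT2
  have hle := le_of_tendsto (hlimW.sub hlim1).abs (b := c / 4 + δ T * C) (by
    filter_upwards [hH, hPW, hHδ, eventually_ge_atTop 1] with P hP1 hP2 hP3 hP4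
    have hPR : (0 : ℝ) < P := by exact_mod_cast hP4
    rw [← mul_sub, ← sub_div, abs_mul, abs_div, abs_of_pos (pow_pos hPR _),
      abs_of_pos (pow_pos hPR _)]
    refine abs_smoothCount_sub_smoothCount_le hP4 hT2 (by positivity) hC.le (hC' P hP4) (hQ P hP4)
      hW hQW hP1 hP2 ?_ hP3
    rw [hδ]
    have := Real.pi_pos
    simp only
    gcongr
    linarith)
  have hI := hT₀ T hT3
  rw [localDensity_one, one_mul] at hle
  have h3 := (abs_le.1 hle).1
  have hI0 : 0 < realDensity d A T := hc.trans_le hI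
  by_contra hlt
  push Not at hlt
  nlinarith

/-- Multiplicativity and positivity at each prime give a uniform lower bound for the density. -/
lemma exists_le_localDensity {d : I → ℕ} (hd : ∀ i, 1 ≤ d i) {s : ℕ} {A : I → Fin s → ℤ}
    (hA : Concentrated d A) {c : ℝ} (hc : 0 < c) {T₀ : ℕ}
    (hT₀ : ∀ T : ℕ, T₀ ≤ T → c ≤ realDensity d A T)
    (hmul : ∀ m n : ℕ, 1 ≤ m → 1 ≤ n → Nat.Coprime m n →
      localDensity d A (m * n) = localDensity d A m * localDensity d A n)
    (hp : ∀ p : ℕ, p.Prime → ∃ c : ℝ, 0 < c ∧ ∀ h : ℕ, c ≤ localDensity d A (p ^ h)) :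
    ∃ c : ℝ, 0 < c ∧ ∀ W : ℕ, 1 ≤ W → c ≤ localDensity d A W := by
  obtain ⟨Q, hQ⟩ := one_half_le_localDensity hd hA hc hT₀
  have key : ∀ S : Finset ℕ, (∀ p ∈ S, p.Prime) → ∃ c : ℝ, 0 < c ∧ ∀ W : ℕ, 1 ≤ W →
      (∀ p, p.Prime → p ≤ Q → p ∉ S → ¬p ∣ W) → c ≤ localDensity d A W := by
    intro S
    induction S using Finset.induction_on with
    | empty =>
      intro _
      refine ⟨1 / 2, by norm_num, fun W hW h => hQ W hW fun q hq1 hqQ => ?_⟩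
      refine Nat.Coprime.symm (Nat.coprime_of_dvd fun p hp hpW hpq => ?_)
      exact h p hp ((Nat.le_of_dvd hq1 hpq).trans hqQ) (notMem_empty _) hpW
    | insert p S hpS ih =>
      intro hS
      obtain ⟨c₁, hc₁, h₁⟩ := ih fun q hq => hS q (mem_insert_of_mem hq)
      have hpp := hS p (mem_insert_self _ _)
      obtain ⟨c₂, hc₂, h₂⟩ := hp p hpp
      refine ⟨c₂ * c₁, by positivity, fun W hW h => ?_⟩
      obtain ⟨v, W', hW', rfl⟩ := Nat.exists_eq_pow_mul_and_not_dvd (by omega : W ≠ 0) p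
        hpp.ne_one
      have hW'0 : 1 ≤ W' := Nat.pos_of_ne_zero fun h0 => hW' (h0 ▸ dvd_zero p)
      rw [hmul _ _ (Nat.pow_pos hpp.pos) hW'0
        (((Nat.Prime.coprime_iff_not_dvd hpp).2 hW').pow_left v)]
      refine mul_le_mul (h₂ v) (h₁ W' hW'0 fun q hq hqQ hqS hqW => ?_) hc₁.le
        (hc₂.le.trans (h₂ v))
      rcases eq_or_ne q p with rfl | hqp
      · exact hW' hqW
      · exact h q hq hqQ (by simp [hqp, hqS]) (hqW.mul_left _)
  obtain ⟨c, hc, h⟩ := key ((range (Q + 1)).filter Nat.Prime) fun p hp => (mem_filter.1 hp).2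
  refine ⟨c, hc, fun W hW => h W hW fun p hp hpQ hpS _ => hpS ?_⟩
  exact mem_filter.2 ⟨mem_range.2 (by omega), hp⟩

end

end DiagonalSystems

namespace DiagonalSystems

noncomputable section

variable {I : Type}

/-- The zero set of the system over a commutative ring. -/
def zeroSet (d : I → ℕ) {s : ℕ} (A : I → Fin s → ℤ) (R : Type) [CommRing R] : Set (Fin s → R) :=
  {x | ∀ i, form d A i x = 0}

lemma map_form {R S : Type} [CommRing R] [CommRing S] (f : R →+* S) (d : I → ℕ) {s : ℕ}
    (A : I → Fin s → ℤ) (i : I) (x : Fin s → R) :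
    f (form d A i x) = form d A i fun j => f (x j) := by
  simp [form]

lemma zerosMod_eq_card [Fintype I] (d : I → ℕ) {s : ℕ} (A : I → Fin s → ℤ) {W : ℕ} (hW : 1 ≤ W) :
    zerosMod d A W = Nat.card (zeroSet d A (ZMod W)) := by
  classical
  have : NeZero W := ⟨by omega⟩
  have h1 : Nat.card (zeroSet d A (ZMod W)) =
      #{x : Fin s → ZMod W | ∀ i, form d A i x = 0} := by
    rw [Nat.card_eq_fintype_card, Fintype.card_subtype]
    congr 1
    ext
    simp only [mem_filter, mem_univ, true_and]
    exact Iff.rfl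
  have hdvd : ∀ (x : Fin s → ℕ) i, (W : ℤ) ∣ natForm d A i x ↔
      form d A i (fun j => (x j : ZMod W)) = 0 := fun x i => by
    rw [← ZMod.intCast_zmod_eq_zero_iff_dvd, natForm_cast]
  rw [h1, zerosMod]
  refine card_nbij (fun x j => (x j : ZMod W)) ?_ ?_ ?_
  · intro x hx
    rw [mem_coe, mem_filter] at hx
    exact mem_coe.2 (mem_filter.2 ⟨mem_univ _, fun i => (hdvd x i).1 (hx.2 i)⟩)
  · intro x hx y hy hxy
    simp only [coe_filter, Fintype.mem_piFinset, mem_Icc, Set.mem_ofPred_eq] at hx hy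
    funext j
    have h2 : ((x j : ℕ) : ZMod W) = (y j : ℕ) := congrFun hxy j
    rw [ZMod.natCast_eq_natCast_iff] at h2
    have h3 := hx.1 j
    have h4 := hy.1 j
    have h5 : x j - 1 ≡ y j - 1 [MOD W] := by
      refine Nat.ModEq.add_right_cancel' 1 ?_
      rwa [Nat.sub_add_cancel h3.1, Nat.sub_add_cancel h4.1]
    have := Nat.ModEq.eq_of_lt_of_lt h5 (by omega) (by omega)
    omega
  · intro z hz
    simp only [coe_filter, mem_univ, true_and, Set.mem_ofPred_eq] at hz
    have h2 : (fun j => (((z j - 1).val + 1 : ℕ) : ZMod W)) = z := by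
      funext j
      simp
    refine ⟨fun j => (z j - 1).val + 1, ?_, h2⟩
    simp only [coe_filter, Fintype.mem_piFinset, mem_Icc, Set.mem_ofPred_eq]
    refine ⟨fun j => ⟨by omega, ZMod.val_lt _⟩, fun i => (hdvd _ i).2 ?_⟩
    rw [h2]
    exact hz i

lemma card_zeroSet_congr (d : I → ℕ) {s : ℕ} (A : I → Fin s → ℤ) {R S : Type} [CommRing R]
    [CommRing S] (f : R ≃+* S) : Nat.card (zeroSet d A R) = Nat.card (zeroSet d A S) := by
  refine Nat.card_congr ((Equiv.piCongrRight fun _ => f.toEquiv).subtypeEquiv fun x => ?_)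
  refine forall_congr' fun i => ?_
  have h1 := map_form f.toRingHom d A i x
  have h2 : form d A i ((Equiv.piCongrRight fun _ => f.toEquiv) x) = f (form d A i x) := h1.symm
  rw [h2, map_eq_zero_iff _ f.injective]

lemma card_zeroSet_prod (d : I → ℕ) {s : ℕ} (A : I → Fin s → ℤ) (R S : Type) [CommRing R]
    [CommRing S] : Nat.card (zeroSet d A (R × S)) =
      Nat.card (zeroSet d A R) * Nat.card (zeroSet d A S) := by
  rw [← Nat.card_prod]
  refine Nat.card_congr ⟨fun x => (⟨fun j => (x.1 j).1, fun i => ?_⟩, ⟨fun j => (x.1 j).2,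
    fun i => ?_⟩), fun y => ⟨fun j => (y.1.1 j, y.2.1 j), fun i => ?_⟩, fun x => rfl, fun y => rfl⟩
  · exact (map_form (RingHom.fst R S) d A i _).symm.trans (by rw [x.2 i, map_zero])
  · exact (map_form (RingHom.snd R S) d A i _).symm.trans (by rw [x.2 i, map_zero])
  · refine Prod.ext ?_ ?_
    · exact (map_form (RingHom.fst R S) d A i _).trans (y.1.2 i)
    · exact (map_form (RingHom.snd R S) d A i _).trans (y.2.2 i)

lemma localDensity_mul [Fintype I] (d : I → ℕ) {s : ℕ} (A : I → Fin s → ℤ) {m n : ℕ} (hm : 1 ≤ m)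
    (hn : 1 ≤ n) (h : Nat.Coprime m n) :
    localDensity d A (m * n) = localDensity d A m * localDensity d A n := by
  rw [localDensity, localDensity, localDensity, zerosMod_eq_card d A (Nat.mul_pos hm hn),
    zerosMod_eq_card d A hm, zerosMod_eq_card d A hn,
    card_zeroSet_congr d A (ZMod.chineseRemainder h), card_zeroSet_prod]
  push_cast
  rw [mul_pow, mul_pow]
  have hm0 : (m : ℝ) ≠ 0 := by positivity
  have hn0 : (n : ℝ) ≠ 0 := by positivity
  field_simp

end

end DiagonalSystems

namespace DiagonalSystems

noncomputable section

open Filter Topology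

variable {I : Type} [Fintype I]

/-- The rows of the Jacobian matrix of the system at `x` are linearly independent. -/
def Nonsingular {R : Type} [CommRing R] (d : I → ℕ) {s : ℕ} (A : I → Fin s → ℤ)
    (x : Fin s → R) : Prop :=
  ∀ μ : I → R, (∀ j, ∑ i, μ i * ((d i : R) * (A i j : R) * x j ^ (d i - 1)) = 0) → μ = 0

lemma nonsingular_of_rank {𝕜 : Type} [Field 𝕜] (d : I → ℕ) {s : ℕ} (A : I → Fin s → ℤ)
    (x : Fin s → 𝕜)
    (h : (Matrix.of fun (i : I) (j : Fin s) =>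
      (d i : 𝕜) * (A i j : 𝕜) * x j ^ (d i - 1)).rank = Fintype.card I) :
    Nonsingular d A x := by
  intro μ hμ
  rw [Matrix.rank_eq_finrank_span_row] at h
  have hli := linearIndependent_iff_card_eq_finrank_span.2 h.symm
  refine funext fun i => Fintype.linearIndependent_iff.1 hli μ ?_ i
  funext j
  simpa [Matrix.row] using hμ j

lemma Nonsingular.smul {𝕜 : Type} [Field 𝕜] {d : I → ℕ} {s : ℕ} {A : I → Fin s → ℤ}
    {x : Fin s → 𝕜} (h : Nonsingular d A x) {c : 𝕜} (hc : c ≠ 0) :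
    Nonsingular d A fun j => c * x j := by
  intro μ hμ
  have h1 := h (fun i => μ i * c ^ (d i - 1)) fun j => by
    rw [← hμ j]
    exact sum_congr rfl fun i _ => by ring
  funext i
  have h2 := congrFun h1 i
  exact (mul_eq_zero.1 h2).resolve_right (pow_ne_zero _ hc)

omit [Fintype I] in
lemma form_smul {R : Type} [CommRing R] (d : I → ℕ) {s : ℕ} (A : I → Fin s → ℤ) (i : I)
    (x : Fin s → R) (c : R) : form d A i (fun j => c * x j) = c ^ d i * form d A i x := by
  rw [form, form, mul_sum]
  exact sum_congr rfl fun j _ => by ring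

/-- The derivative of a diagonal form. -/
def formDeriv {𝕜 : Type} [NontriviallyNormedField 𝕜] (d : I → ℕ) {s : ℕ} (A : I → Fin s → ℤ)
    (x : Fin s → 𝕜) (i : I) : (Fin s → 𝕜) →L[𝕜] 𝕜 :=
  ∑ j, ((d i : 𝕜) * (A i j : 𝕜) * x j ^ (d i - 1)) • ContinuousLinearMap.proj (R := 𝕜) j

omit [Fintype I] in
lemma hasStrictFDerivAt_form {𝕜 : Type} [NontriviallyNormedField 𝕜] (d : I → ℕ) {s : ℕ}
    (A : I → Fin s → ℤ) (x : Fin s → 𝕜) (i : I) :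
    HasStrictFDerivAt (fun y : Fin s → 𝕜 => form d A i y) (formDeriv d A x i) x := by
  refine HasStrictFDerivAt.fun_sum fun j _ => ?_
  refine (((hasStrictFDerivAt_apply j x).pow (d i)).const_mul (A i j : 𝕜)).congr_fderiv ?_
  ext v
  simp
  ring

/-- At a nonsingular point, the system together with suitable coordinate functions is an
open map. -/
lemma Nonsingular.exists_hasStrictFDerivAt {𝕜 : Type} [NontriviallyNormedField 𝕜] {d : I → ℕ}
    {s : ℕ} {A : I → Fin s → ℤ} {x : Fin s → 𝕜} (h : Nonsingular d A x) :
    ∃ σ : I → Fin s, Function.Injective σ ∧ ∃ L : (Fin s → 𝕜) →L[𝕜] (Fin s → 𝕜),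
      HasStrictFDerivAt
        (fun y : Fin s → 𝕜 => Function.extend σ (fun i => form d A i y) y) L x ∧
      L.range = ⊤ := by
  classical
  obtain ⟨M, hM⟩ : ∃ M : Matrix I (Fin s) 𝕜, M = Matrix.of fun (i : I) (j : Fin s) =>
    (d i : 𝕜) * (A i j : 𝕜) * x j ^ (d i - 1) := ⟨_, rfl⟩
  have hrow : LinearIndependent 𝕜 M.row := by
    refine Fintype.linearIndependent_iff.2 fun μ hμ i => congrFun (h μ fun j => ?_) i
    simpa [hM, Matrix.row] using congrFun hμ j
  have hrank : M.rank = Fintype.card I := hrow.rank_matrix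
  rw [Matrix.rank_eq_finrank_span_cols] at hrank
  obtain ⟨κ, a, ha, hsp, hli⟩ := exists_linearIndependent' 𝕜 M.col
  have : Fintype κ := Fintype.ofInjective a ha
  have hκ : Fintype.card I = Fintype.card κ := by
    rw [← hrank, ← hsp, finrank_span_eq_card hli]
  let eq : I ≃ κ := Fintype.equivOfCardEq hκ
  have hσ : Function.Injective fun i => a (eq i) := ha.comp eq.injective
  have hli' : LinearIndependent 𝕜 fun i => M.col (a (eq i)) := hli.comp _ eq.injective
  obtain ⟨σ, hσe⟩ : ∃ σ : I → Fin s, σ = fun i => a (eq i) := ⟨_, rfl⟩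
  rw [← hσe] at hσ
  have hli2 : LinearIndependent 𝕜 fun i => M.col (σ i) := by rw [hσe]; exact hli'
  refine ⟨σ, hσ, ContinuousLinearMap.pi (Function.extend σ (fun i => formDeriv d A x i)
    fun j => ContinuousLinearMap.proj j), ?_, ?_⟩
  · refine hasStrictFDerivAt_pi'' fun j => ?_
    by_cases hj : ∃ i, σ i = j
    · obtain ⟨i, rfl⟩ := hj
      simp only [hσ.extend_apply]
      refine (hasStrictFDerivAt_form d A x i).congr_fderiv ?_
      ext v
      simp [hσ.extend_apply]
    · simp only [Function.extend_apply' _ _ _ hj]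
      refine (hasStrictFDerivAt_apply j x).congr_fderiv ?_
      ext v
      simp [Function.extend_apply' _ _ _ hj]
  · refine LinearMap.range_eq_top.2 (LinearMap.injective_iff_surjective.1 ?_)
    refine (injective_iff_map_eq_zero _).2 fun v hv => ?_
    have hv1 : ∀ j, (¬ ∃ i, σ i = j) → v j = 0 := fun j hj => by
      simpa [Function.extend_apply' _ _ _ hj] using congrFun hv j
    have hv2 : ∀ i, formDeriv d A x i v = 0 := fun i => by
      simpa [hσ.extend_apply] using congrFun hv (σ i)
    have hv3 := Fintype.linearIndependent_iff.1 hli2 (fun i => v (σ i)) ?_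
    · funext j
      by_cases hj : ∃ i, σ i = j
      · obtain ⟨i, rfl⟩ := hj
        exact hv3 i
      · exact hv1 j hj
    · funext i
      have h4 := hv2 i
      simp only [formDeriv, _root_.sum_apply, _root_.smul_apply,
        ContinuousLinearMap.proj_apply, smul_eq_mul] at h4
      simp only [Finset.sum_apply, Pi.smul_apply, smul_eq_mul, Pi.zero_apply]
      rw [← h4, hM]
      simp only [Matrix.col, Matrix.transpose_apply, Matrix.of_apply]
      rw [← sum_image (s := univ) (g := σ) (f := fun j =>
        v j * ((d i : 𝕜) * (A i j : 𝕜) * x j ^ (d i - 1))) (fun _ _ _ _ hh => hσ hh)]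
      rw [← sum_subset (subset_univ (univ.image σ))]
      · exact sum_congr rfl fun j _ => mul_comm _ _
      · intro j _ hj
        rw [hv1 j fun ⟨i, hi⟩ => hj (mem_image.2 ⟨i, mem_univ _, hi⟩), mul_zero]

/-- Local solvability near a nonsingular zero, with prescribed values outside a set of
coordinates. -/
lemma Nonsingular.exists_image_mem_nhds {𝕜 : Type} [NontriviallyNormedField 𝕜] [CompleteSpace 𝕜]
    {d : I → ℕ} {s : ℕ} {A : I → Fin s → ℤ} {x : Fin s → 𝕜} (h : Nonsingular d A x)
    (hx : ∀ i, form d A i x = 0) :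
    ∃ σ : I → Fin s, Function.Injective σ ∧
      (∃ K : NNReal, ∃ U ∈ 𝓝 x, LipschitzOnWith K
        (fun y : Fin s → 𝕜 => Function.extend σ (fun i => form d A i y) y) U) ∧
      ∀ U ∈ 𝓝 x, (fun y : Fin s → 𝕜 => Function.extend σ (fun i => form d A i y) y) '' U ∈
        𝓝 (Function.extend σ (fun _ => 0) x) := by
  obtain ⟨σ, hσ, L, hL, hr⟩ := h.exists_hasStrictFDerivAt
  refine ⟨σ, hσ, hL.exists_lipschitzOnWith, fun U hU => ?_⟩
  have h1 := image_mem_map (m := fun y : Fin s → 𝕜 =>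
    Function.extend σ (fun i => form d A i y) y) hU
  rw [hL.map_nhds_eq_of_surj hr] at h1
  simpa only [hx] using h1

end

end DiagonalSystems

namespace DiagonalSystems

noncomputable section

open MeasureTheory Filter Topology

variable {I : Type} [Fintype I]

/-- Near a nonsingular real zero inside the unit cube, the set of near zeros has the expected
volume. -/
lemma exists_le_volume_near_zeros (d : I → ℕ) {s : ℕ} (A : I → Fin s → ℤ) {x : Fin s → ℝ}
    (hx : ∀ i, form d A i x = 0) (hns : Nonsingular d A x) (h01 : ∀ j, 0 < x j ∧ x j < 1) :
    ∃ c : ℝ, 0 < c ∧ ∃ ρ : ℝ, 0 < ρ ∧ ∀ δ, 0 < δ → δ ≤ ρ →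
      c * (2 * δ) ^ Fintype.card I ≤
        (volume {t : Fin s → ℝ | t ∈ Set.Icc (0 : Fin s → ℝ) 1 ∧
          ∀ i, |form d A i t| ≤ δ}).toReal := by
  classical
  obtain ⟨σ, hσ, ⟨K, U, hU, hLip⟩, himg⟩ := hns.exists_image_mem_nhds hx
  have hV : {t : Fin s → ℝ | ∀ j, 0 < t j ∧ t j < 1} ∈ 𝓝 x := by
    simp only [Set.ofPred_forall]
    refine (iInter_mem).2 fun j => ?_
    have hc : Continuous fun t : Fin s → ℝ => t j := continuous_apply j
    exact ((isOpen_lt continuous_const hc).inter (isOpen_lt hc continuous_const)).mem_nhds (h01 j)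
  obtain ⟨ρ, hρ, hball⟩ := Metric.nhds_basis_closedBall.mem_iff.1 (himg _ (inter_mem hU hV))
  refine ⟨(2 * ρ) ^ #{j : Fin s | ¬ ∃ i, σ i = j} / ((K : ℝ) + 1) ^ s, by positivity, ρ, hρ,
    fun δ hδ hδρ => ?_⟩
  obtain ⟨G, hG⟩ : ∃ G : Set (Fin s → ℝ), G = {t : Fin s → ℝ | t ∈ Set.Icc (0 : Fin s → ℝ) 1 ∧
    ∀ i, |form d A i t| ≤ δ} := ⟨_, rfl⟩
  rw [← hG]
  have hGfin : volume G ≠ ⊤ := by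
    refine ne_top_of_le_ne_top ?_ (measure_mono (t := Set.Icc (0 : Fin s → ℝ) 1) ?_)
    · exact isCompact_Icc.measure_lt_top.ne
    · rw [hG]
      exact fun t ht => ht.1
  obtain ⟨w, hw⟩ : ∃ w : Fin s → ℝ, w = fun j => if ∃ i, σ i = j then δ else ρ := ⟨_, rfl⟩
  have hw0 : ∀ j, 0 < w j := fun j => by rw [hw]; dsimp only; split_ifs <;> assumption
  have hwρ : ∀ j, w j ≤ ρ := fun j => by
    rw [hw]
    dsimp only
    split_ifs
    · exact hδρ
    · exact le_rfl
  obtain ⟨z, hz⟩ : ∃ z : Fin s → ℝ, z = Function.extend σ (fun _ => 0) x := ⟨_, rfl⟩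
  rw [← hz] at hball
  obtain ⟨Φ, hΦ⟩ : ∃ Φ : (Fin s → ℝ) → Fin s → ℝ, Φ = fun y : Fin s → ℝ =>
    Function.extend σ (fun i => form d A i y) y := ⟨_, rfl⟩
  rw [← hΦ] at hLip hball
  have hE : Set.Icc (fun j => z j - w j) (fun j => z j + w j) ⊆ Φ '' (U ∩ G) := by
    intro y hy
    have hy' : ∀ j, |y j - z j| ≤ w j := fun j => by
      rw [abs_le]
      have h1 := hy.1 j
      have h2 := hy.2 j
      dsimp only at h1 h2
      exact ⟨by linarith, by linarith⟩
    obtain ⟨t, ht, rfl⟩ := hball (by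
      rw [Metric.mem_closedBall, dist_pi_le_iff hρ.le]
      exact fun j => (hy' j).trans (hwρ j))
    refine ⟨t, ⟨ht.1, ?_⟩, rfl⟩
    rw [hG]
    refine ⟨⟨fun j => (ht.2 j).1.le, fun j => (ht.2 j).2.le⟩, fun i => ?_⟩
    have h3 := hy' (σ i)
    rw [hΦ, hz, hw] at h3
    dsimp only at h3
    rwa [hσ.extend_apply, hσ.extend_apply, if_pos ⟨i, rfl⟩, sub_zero] at h3
  have h1 : volume (Set.Icc (fun j => z j - w j) (fun j => z j + w j)) ≤
      (K : ENNReal) ^ s * volume G := by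
    refine (measure_mono hE).trans ?_
    have h2 := (hLip.mono (Set.inter_subset_left (t := G))).hausdorffMeasure_image_le
      (d := (Fintype.card (Fin s) : ℝ)) (by positivity)
    rw [hausdorffMeasure_pi_real, Fintype.card_fin, ENNReal.rpow_natCast] at h2
    exact h2.trans (mul_le_mul_right (measure_mono Set.inter_subset_right) _)
  have h2 : (volume (Set.Icc (fun j => z j - w j) (fun j => z j + w j))).toReal =
      (2 * ρ) ^ #{j : Fin s | ¬ ∃ i, σ i = j} * (2 * δ) ^ Fintype.card I := by
    rw [Real.volume_Icc_pi_toReal fun j => by linarith [hw0 j]]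
    have : ∀ j, z j + w j - (z j - w j) = if ∃ i, σ i = j then 2 * δ else 2 * ρ := fun j => by
      rw [hw]
      dsimp only
      split_ifs <;> ring
    simp only [this]
    rw [prod_ite, prod_const, prod_const, mul_comm]
    congr 2
    have : ({j : Fin s | ∃ i, σ i = j} : Finset (Fin s)) = univ.image σ := by
      ext j
      simp
    rw [this, card_image_of_injective _ hσ, card_univ]
  have h3 := ENNReal.toReal_mono (ENNReal.mul_ne_top (by finiteness) hGfin) h1
  rw [h2, ENNReal.toReal_mul, ENNReal.toReal_pow, ENNReal.coe_toReal] at h3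
  rw [div_mul_eq_mul_div, div_le_iff₀ (by positivity), mul_comm (volume G).toReal]
  refine h3.trans (mul_le_mul_of_nonneg_right ?_ ENNReal.toReal_nonneg)
  exact pow_le_pow_left₀ K.coe_nonneg (by linarith) _

/-- The real density of a system with a nonsingular positive zero is bounded below. -/
theorem exists_le_realDensity (d : I → ℕ) {s : ℕ} (A : I → Fin s → ℤ) {x : Fin s → ℝ}
    (hpos : ∀ j, 0 < x j) (hx : ∀ i, form d A i x = 0) (hns : Nonsingular d A x) :
    ∃ c : ℝ, 0 < c ∧ ∃ T₀ : ℕ, ∀ T, T₀ ≤ T → c ≤ realDensity d A T := by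
  have hM : 0 < 1 + ∑ j, x j := by
    have := sum_nonneg fun j (_ : j ∈ univ) => (hpos j).le
    linarith
  obtain ⟨c, hc, ρ, hρ, hvol⟩ := exists_le_volume_near_zeros d A
    (x := fun j => (1 + ∑ j, x j)⁻¹ * x j) (fun i => by rw [form_smul, hx, mul_zero])
    (hns.smul (inv_ne_zero hM.ne')) fun j => ⟨mul_pos (inv_pos.2 hM) (hpos j), by
      rw [inv_mul_lt_iff₀ hM, mul_one]
      have := single_le_sum (fun j _ => (hpos j).le) (mem_univ j)
      linarith⟩
  refine ⟨c / 2 ^ Fintype.card I, by positivity, ⌈1 / ρ⌉₊ + 1, fun T hT => ?_⟩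
  have hT1 : (1 : ℝ) ≤ T := by exact_mod_cast (show 1 ≤ T by omega)
  have hTρ : 1 / ρ ≤ T := (Nat.le_ceil _).trans (by exact_mod_cast (show ⌈1 / ρ⌉₊ ≤ T by omega))
  have hδ : 1 / (2 * (T : ℝ)) ≤ ρ := by
    rw [div_le_iff₀ hρ] at hTρ
    rw [div_le_iff₀ (by positivity)]
    nlinarith
  have h1 := hvol (1 / (2 * (T : ℝ))) (by positivity) hδ
  obtain ⟨G, hG⟩ : ∃ G : Set (Fin s → ℝ), G = {t : Fin s → ℝ | t ∈ Set.Icc (0 : Fin s → ℝ) 1 ∧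
    ∀ i, |form d A i t| ≤ 1 / (2 * (T : ℝ))} := ⟨_, rfl⟩
  rw [← hG] at h1
  have hGsub : G ⊆ Set.Icc 0 1 := by
    rw [hG]
    exact fun t ht => ht.1
  have hGm : MeasurableSet G := by
    rw [hG]
    refine (isClosed_Icc.inter (s₂ := {t | ∀ i, |form d A i t| ≤ 1 / (2 * (T : ℝ))}) ?_).measurableSet
    rw [Set.ofPred_forall]
    exact isClosed_iInter fun i => isClosed_le (by fun_prop) continuous_const
  have hcont : Continuous fun t : Fin s → ℝ =>
      ∏ i, ((T : ℝ) * max 0 (1 - T * |form d A i t|)) := by fun_prop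
  have h2 : ((T : ℝ) / 2) ^ Fintype.card I * (volume G).toReal ≤ realDensity d A T := by
    calc ((T : ℝ) / 2) ^ Fintype.card I * (volume G).toReal
        = ∫ _ in G, ((T : ℝ) / 2) ^ Fintype.card I := by
          rw [setIntegral_const, smul_eq_mul, mul_comm]
          rfl
      _ ≤ ∫ t in G, ∏ i, ((T : ℝ) * max 0 (1 - T * |form d A i t|)) := by
          refine setIntegral_mono_on ?_ (hcont.integrableOn_Icc.mono_set hGsub) hGm
            fun t ht => ?_
          · refine integrableOn_const (ne_top_of_le_ne_top ?_ (measure_mono hGsub))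
            exact isCompact_Icc.measure_lt_top.ne
          · rw [← card_univ, ← prod_const]
            refine prod_le_prod (fun i _ => by positivity) fun i _ => ?_
            rw [div_eq_mul_inv]
            refine mul_le_mul_of_nonneg_left (le_max_of_le_right ?_) (by positivity)
            rw [hG] at ht
            have h3 := ht.2 i
            rw [le_div_iff₀ (by positivity)] at h3
            linarith
      _ ≤ realDensity d A T := by
          refine setIntegral_mono_set hcont.integrableOn_Icc (ae_of_all _ fun t => ?_)
            (LE.le.eventuallyLE hGsub)
          exact prod_nonneg fun i _ => by positivity
  refine le_trans ?_ h2
  calc c / 2 ^ Fintype.card I = ((T : ℝ) / 2) ^ Fintype.card I *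
        (c * (2 * (1 / (2 * (T : ℝ)))) ^ Fintype.card I) := by
        rw [mul_left_comm, ← mul_pow]
        have : (T : ℝ) / 2 * (2 * (1 / (2 * (T : ℝ)))) = 1 / 2 := by
          field_simp
        rw [this, one_div, inv_pow, div_eq_mul_inv]
    _ ≤ _ := mul_le_mul_of_nonneg_left h1 (by positivity)

end

end DiagonalSystems

namespace DiagonalSystems

noncomputable section

open Filter Topology

variable {I : Type} [Fintype I]

/-- An integral nonsingular `p`-adic zero can be perturbed to a `p`-adic zero with prescribed
coordinates outside the range of an injection from the set of equations. -/
lemma exists_integral_zeros (d : I → ℕ) {s : ℕ} (A : I → Fin s → ℤ) {p : ℕ} [Fact p.Prime]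
    {x : Fin s → ℚ_[p]} (hx : ∀ i, form d A i x = 0) (hns : Nonsingular d A x)
    (h1 : ∀ j, ‖x j‖ ≤ 1) :
    ∃ σ : I → Fin s, Function.Injective σ ∧ ∃ h₀ : ℕ, ∀ w : Fin s → ℕ,
      ∃ t : Fin s → ℤ_[p], (∀ i, form d A i t = 0) ∧
        ∀ j, (¬ ∃ i, σ i = j) → (t j : ℚ_[p]) = x j + ((p ^ h₀ * w j : ℕ) : ℚ_[p]) := by
  classical
  obtain ⟨σ, hσ, -, himg⟩ := hns.exists_image_mem_nhds hx
  have hU : {y : Fin s → ℚ_[p] | ∀ j, ‖y j‖ ≤ 1} ∈ 𝓝 x := by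
    refine mem_of_superset (Metric.ball_mem_nhds x one_pos) fun y hy j => ?_
    rw [Metric.mem_ball, dist_pi_lt_iff one_pos] at hy
    have h2 := hy j
    rw [dist_eq_norm] at h2
    have h3 := IsUltrametricDist.norm_add_le_max (y j - x j) (x j)
    rw [sub_add_cancel] at h3
    exact h3.trans (max_le h2.le (h1 j))
  obtain ⟨ρ, hρ, hball⟩ := Metric.nhds_basis_closedBall.mem_iff.1 (himg _ hU)
  have hp1 : (1 : ℝ) < p := by exact_mod_cast (Fact.out : p.Prime).one_lt
  obtain ⟨h₀, hh₀⟩ := exists_pow_lt_of_lt_one hρ (inv_lt_one_of_one_lt₀ hp1)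
  refine ⟨σ, hσ, h₀, fun w => ?_⟩
  obtain ⟨t, ht, hty⟩ := hball (a := fun j => Function.extend σ (fun _ => 0) x j +
      if ∃ i, σ i = j then 0 else ((p ^ h₀ * w j : ℕ) : ℚ_[p])) (by
    rw [Metric.mem_closedBall, dist_pi_le_iff hρ.le]
    intro j
    rw [dist_eq_norm, add_sub_cancel_left]
    split_ifs
    · simpa using hρ.le
    · push_cast
      rw [norm_mul, norm_pow, Padic.norm_p]
      refine le_trans (mul_le_of_le_one_right (by positivity) ?_) hh₀.le
      exact_mod_cast Padic.norm_int_le_one (p := p) (w j : ℤ))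
  refine ⟨fun j => ⟨t j, ht j⟩, fun i => ?_, fun j hj => ?_⟩
  · have h2 := congrFun hty (σ i)
    dsimp only at h2
    rw [hσ.extend_apply, hσ.extend_apply, if_pos ⟨i, rfl⟩, add_zero] at h2
    have h3 := map_form (PadicInt.Coe.ringHom (p := p)) d A i (fun j => ⟨t j, ht j⟩)
    refine PadicInt.ext ?_
    exact h3.trans h2
  · have h2 := congrFun hty j
    dsimp only at h2
    rwa [Function.extend_apply' _ _ _ hj, Function.extend_apply' _ _ _ hj, if_neg hj] at h2

/-- The local densities at powers of `p` are bounded below if there is a nonsingular `p`-adic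
zero. -/
theorem exists_le_localDensity_pow (d : I → ℕ) {s : ℕ} (A : I → Fin s → ℤ) {p : ℕ}
    [Fact p.Prime] {x : Fin s → ℚ_[p]} (hx : ∀ i, form d A i x = 0) (hns : Nonsingular d A x) :
    ∃ c : ℝ, 0 < c ∧ ∀ h, c ≤ localDensity d A (p ^ h) := by
  classical
  have hp : p.Prime := Fact.out
  have hp1 : (1 : ℝ) < p := by exact_mod_cast hp.one_lt
  have hp0 : (p : ℚ_[p]) ≠ 0 := by exact_mod_cast hp.ne_zero
  obtain ⟨m, hm⟩ := pow_unbounded_of_one_lt (∑ j, ‖x j‖) hp1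
  obtain ⟨σ, hσ, h₀, hz⟩ := exists_integral_zeros d A (x := fun j => (p : ℚ_[p]) ^ m * x j)
    (fun i => by rw [form_smul, hx, mul_zero]) (hns.smul (pow_ne_zero m hp0)) fun j => by
      rw [norm_mul, norm_pow, Padic.norm_p, inv_pow, inv_mul_le_iff₀ (by positivity),
        mul_one]
      exact (single_le_sum (fun j _ => norm_nonneg (x j)) (mem_univ j)).trans hm.le
  obtain ⟨r, hr⟩ : ∃ r, r = Fintype.card {j : Fin s // ¬ ∃ i, σ i = j} := ⟨_, rfl⟩
  have hrs : s = r + Fintype.card I := by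
    have h1 : Fintype.card {j : Fin s // ∃ i, σ i = j} = Fintype.card I :=
      Fintype.card_congr (Equiv.ofInjective σ hσ).symm
    have h2 := Fintype.card_subtype_compl fun j : Fin s => ∃ i, σ i = j
    have h3 := Fintype.card_subtype_le fun j : Fin s => ∃ i, σ i = j
    rw [Fintype.card_fin] at h2 h3
    omega
  refine ⟨1 / ((p : ℝ) ^ h₀) ^ r, by positivity, fun h => ?_⟩
  have : NeZero (p ^ h) := ⟨pow_ne_zero _ hp.ne_zero⟩
  have hcard : (p ^ (h - h₀)) ^ r ≤ zerosMod d A (p ^ h) := by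
    rw [zerosMod_eq_card d A (Nat.one_le_pow _ _ hp.pos)]
    choose t ht htj using hz
    obtain ⟨ext, hext⟩ : ∃ ext : ({j : Fin s // ¬ ∃ i, σ i = j} → Fin (p ^ (h - h₀))) →
        Fin s → ℕ, ext = fun w j => if hj : ¬ ∃ i, σ i = j then (w ⟨j, hj⟩ : ℕ) else 0 :=
      ⟨_, rfl⟩
    have hcd : (p ^ (h - h₀)) ^ r =
        Nat.card ({j : Fin s // ¬ ∃ i, σ i = j} → Fin (p ^ (h - h₀))) := by
      rw [Nat.card_eq_fintype_card, Fintype.card_fun, Fintype.card_fin, hr]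
    rw [hcd]
    have : Finite (zeroSet d A (ZMod (p ^ h))) := Subtype.finite
    refine Nat.card_le_card_of_injective (fun w => ⟨fun j => PadicInt.toZModPow h (t (ext w) j),
      fun i => ?_⟩) ?_
    · rw [← map_form, ht, map_zero]
    · intro w w' hww
      funext ⟨j, hj⟩
      have h2 : PadicInt.toZModPow h (t (ext w) j) = PadicInt.toZModPow h (t (ext w') j) :=
        congrFun (congrArg Subtype.val hww) j
      have h3 : t (ext w) j + ((p ^ h₀ * ext w' j : ℕ) : ℤ_[p]) =
          t (ext w') j + ((p ^ h₀ * ext w j : ℕ) : ℤ_[p]) := by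
        refine PadicInt.ext ?_
        rw [PadicInt.coe_add, PadicInt.coe_add, PadicInt.coe_natCast, PadicInt.coe_natCast,
          htj _ j hj, htj _ j hj]
        ring
      have h4 := congrArg (PadicInt.toZModPow h) h3
      rw [map_add, map_add, h2, map_natCast, map_natCast] at h4
      have h5 := (ZMod.natCast_eq_natCast_iff' _ _ _).1 (add_left_cancel h4)
      have hlt : ∀ v : {j : Fin s // ¬ ∃ i, σ i = j} → Fin (p ^ (h - h₀)),
          ext v j = v ⟨j, hj⟩ := fun v => by rw [hext]; exact dif_pos hj
      rw [hlt, hlt] at h5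
      refine Fin.ext ?_
      rcases le_total h₀ h with hle | hle
      · have hb : ∀ v : Fin (p ^ (h - h₀)), p ^ h₀ * (v : ℕ) < p ^ h := fun v => by
          calc p ^ h₀ * (v : ℕ) < p ^ h₀ * p ^ (h - h₀) :=
                Nat.mul_lt_mul_of_pos_left v.2 (pow_pos hp.pos _)
            _ = p ^ h := by rw [← pow_add, Nat.add_sub_cancel' hle]
        rw [Nat.mod_eq_of_lt (hb _), Nat.mod_eq_of_lt (hb _)] at h5
        exact (Nat.eq_of_mul_eq_mul_left (pow_pos hp.pos _) h5).symm
      · have hb : ∀ v : Fin (p ^ (h - h₀)), (v : ℕ) = 0 := fun v => by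
          have h6 : p ^ (h - h₀) = 1 := by rw [Nat.sub_eq_zero_of_le hle, pow_zero]
          have := v.2
          omega
        rw [hb, hb]
  rw [localDensity]
  have hpp : (0 : ℝ) < p := by linarith
  have h6 : (((p : ℝ) ^ (h - h₀)) ^ r) ≤ (zerosMod d A (p ^ h) : ℝ) := by exact_mod_cast hcard
  have h7 : ((p : ℝ) ^ h) ^ r ≤ ((p : ℝ) ^ (h - h₀)) ^ r * ((p : ℝ) ^ h₀) ^ r := by
    rw [← mul_pow, ← pow_add]
    refine pow_le_pow_left₀ (by positivity) (pow_le_pow_right₀ hp1.le (by omega)) _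
  have h8 : ((zerosMod d A (p ^ h) : ℝ)) / ((p ^ h : ℕ) : ℝ) ^ s *
      ((p ^ h : ℕ) : ℝ) ^ Fintype.card I = (zerosMod d A (p ^ h) : ℝ) / ((p : ℝ) ^ h) ^ r := by
    obtain ⟨q, hq⟩ : ∃ q, q = Fintype.card I := ⟨_, rfl⟩
    rw [← hq] at hrs ⊢
    subst hrs
    push_cast
    rw [pow_add]
    field_simp
  rw [h8, div_le_div_iff₀ (by positivity) (by positivity), one_mul]
  exact h7.trans (mul_le_mul_of_nonneg_right h6 (by positivity))

end

end DiagonalSystems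

namespace DiagonalSystems

noncomputable section

open MeasureTheory Filter Topology

variable {I : Type} [Fintype I]

lemma lintegral_normProd_erase_le (d : I → ℕ) {s : ℕ} (A : I → Fin s → ℤ) (j : Fin s) {C ε : ℝ}
    {P : ℕ} (hP : 1 ≤ P)
    (h : ∫ α in Set.Icc (0 : I → ℝ) 1, ∏ j' ∈ univ.erase j, ‖expSum d P fun i => α i * A i j'‖ ≤
      C * (P : ℝ) ^ ((s : ℝ) - 1 - (∑ i, d i : ℕ) + ε)) :
    ENNReal.ofReal ((P : ℝ) ^ ∑ i, d i) *
      ∫⁻ α in Set.Icc 0 1, ENNReal.ofReal (normProd d A (univ.erase j) P α) ≤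
      ENNReal.ofReal (C * (P : ℝ) ^ ε) := by
  have hP0 : (0 : ℝ) < P := by exact_mod_cast hP
  have hs : 1 ≤ s := by have := j.2; omega
  rw [← ofReal_integral_eq_lintegral_ofReal
      continuous_normProd.integrableOn_Icc
      (ae_of_all _ fun α => normProd_nonneg α), ← ENNReal.ofReal_mul (by positivity)]
  refine ENNReal.ofReal_le_ofReal ?_
  have h1 : ∀ α : I → ℝ, normProd d A (univ.erase j) P α =
      (∏ j' ∈ univ.erase j, ‖expSum d P fun i => α i * A i j'‖) / (P : ℝ) ^ (s - 1) := fun α => by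
    rw [normProd, prod_div_distrib, prod_const, card_erase_of_mem (mem_univ j), card_univ,
      Fintype.card_fin]
  simp only [h1]
  rw [integral_div]
  calc ((P : ℝ) ^ ∑ i, d i) * ((∫ α in Set.Icc (0 : I → ℝ) 1,
        ∏ j' ∈ univ.erase j, ‖expSum d P fun i => α i * A i j'‖) / (P : ℝ) ^ (s - 1))
      ≤ ((P : ℝ) ^ ∑ i, d i) * ((C * (P : ℝ) ^ ((s : ℝ) - 1 - (∑ i, d i : ℕ) + ε)) /
          (P : ℝ) ^ (s - 1)) := by gcongr
    _ = C * (P : ℝ) ^ ε := by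
        rw [Real.rpow_add hP0, Real.rpow_sub hP0, Real.rpow_natCast,
          show (s : ℝ) - 1 = ((s - 1 : ℕ) : ℝ) by rw [Nat.cast_sub hs, Nat.cast_one],
          Real.rpow_natCast]
        field_simp

/-- The asymptotic formula with positive constant for systems of diagonal forms of two degrees
whose coefficients are in general position. -/
theorem exists_tendsto_countZeros_div {k n s : ℕ} (hkn : n < k) (hn : 2 ≤ n)
    (hs : 4 * k * (k - 1) + 1 ≤ s) {d : I → ℕ} (hd : ∀ i, d i = k ∨ d i = n)
    {A : I → Fin s → ℤ} (hA : Recoverable d A) {T T' : Finset ℕ} (hT : T ⊆ Icc 1 k)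
    (hT' : T' ⊆ Icc 1 k) (hTd : ∑ j ∈ T, j + ∑ j ∈ T', j = ∑ i, d i)
    (hsep : ∀ j j', j ≠ j' → Separates d (fun i => A i j) (fun i => A i j') T T')
    {x : Fin s → ℝ} (hpos : ∀ j, 0 < x j) (hx : ∀ i, form d A i x = 0)
    (hns : Nonsingular d A x)
    (hp : ∀ (p : ℕ) [Fact p.Prime], ∃ y : Fin s → ℚ_[p], (∀ i, form d A i y = 0) ∧
      Nonsingular d A y) :
    ∃ C : ℝ, 0 < C ∧ Tendsto (fun P : ℕ =>
      (countZeros d A P : ℝ) / (P : ℝ) ^ ((s : ℝ) - (∑ i, d i : ℕ))) atTop (𝓝 C) := by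
  have hd1 : ∀ i, 1 ≤ d i := fun i => by rcases hd i with h | h <;> omega
  obtain ⟨K, hK, hW⟩ := mem_majorArcs_of_le_norm_expSum (by omega) hkn hd hA
  have hσ : k * (k + 1) ≤ 2 * (k * (k - 1)) := by
    obtain ⟨m, rfl⟩ : ∃ m, k = m + 3 := ⟨k - 3, by omega⟩
    rw [show m + 3 - 1 = m + 2 by omega]
    nlinarith
  have hconc : Concentrated d A := by
    refine concentrated hd1 (by omega) (fun j ε hε => ?_) hK hW
    obtain ⟨C, hC, h⟩ := setIntegral_prod_expSum_le d A j (by omega) hσ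
      (by rwa [← mul_assoc]) hT hT' hsep hε
    rw [hTd] at h
    exact ⟨C, hC, fun P hP => lintegral_normProd_erase_le d A j hP (h P hP)⟩
  obtain ⟨c₁, hc₁, T₀, hreal⟩ := exists_le_realDensity d A hpos hx hns
  obtain ⟨c₂, hc₂, hloc⟩ := exists_le_localDensity hd1 hconc hc₁ hreal
    (fun m n hm hn h => localDensity_mul d A hm hn h) fun p hp' => by
      have : Fact p.Prime := ⟨hp'⟩
      obtain ⟨y, hy, hyn⟩ := hp p
      exact exists_le_localDensity_pow d A hy hyn
  obtain ⟨C, hC, hlim⟩ := exists_tendsto_countZeros hd1 hconc (c := c₂ * c₁) (T₀ := T₀)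
    fun W T hW _ hT => mul_le_mul (hloc W hW) (hreal T hT) hc₁.le (hc₂.le.trans (hloc W hW))
  refine ⟨C, (mul_pos hc₂ hc₁).trans_le hC, hlim.congr' ?_⟩
  filter_upwards [eventually_ge_atTop 1] with P hP
  have hP0 : (0 : ℝ) < P := by exact_mod_cast hP
  rw [Real.rpow_sub hP0, Real.rpow_natCast, Real.rpow_natCast]
  field_simp

lemma recoverable_of_two_columns {d : I → ℕ} {s : ℕ} {A : I → Fin s → ℤ}
    (h : ∀ i, ∃ (D a b : ℤ) (j₁ j₂ : Fin s), D ≠ 0 ∧ ∀ α : I → ℝ,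
      D * α i = a * ∑ i' with d i' = d i, α i' * A i' j₁ +
        b * ∑ i' with d i' = d i, α i' * A i' j₂) : Recoverable d A := by
  classical
  choose D a b j₁ j₂ hD h using h
  have hprod : (((∏ i, D i ^ 2).natAbs : ℕ) : ℤ) = ∏ i, D i ^ 2 :=
    Int.natAbs_of_nonneg (prod_nonneg fun i _ => sq_nonneg _)
  refine ⟨(∏ i, D i ^ 2).natAbs, Int.natAbs_pos.2 (prod_ne_zero_iff.2 fun i _ =>
    pow_ne_zero 2 (hD i)), fun i j => (D i * ∏ i' ∈ univ.erase i, D i' ^ 2) *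
      ((Pi.single (j₁ i) (a i) : Fin s → ℤ) j + (Pi.single (j₂ i) (b i) : Fin s → ℤ) j),
    fun α i => ?_⟩
  have h1 : (((∏ i, D i ^ 2).natAbs : ℕ) : ℝ) = ((∏ i, D i ^ 2 : ℤ) : ℝ) :=
    (Int.cast_natCast _).symm.trans (congrArg Int.cast hprod)
  rw [h1, ← mul_prod_erase univ _ (mem_univ i)]
  push_cast
  have h2 : ∀ (L : Fin s → ℝ) (j₀ : Fin s) (v : ℤ),
      ∑ j, (((Pi.single j₀ v : Fin s → ℤ) j : ℤ) : ℝ) * L j = v * L j₀ := fun L j₀ v => by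
    rw [sum_eq_single j₀ (fun j _ hj => by rw [Pi.single_eq_of_ne hj, Int.cast_zero, zero_mul])
      (fun hj => absurd (mem_univ _) hj), Pi.single_eq_same]
  simp only [mul_assoc, add_mul]
  rw [← mul_sum, ← mul_sum, sum_add_distrib, h2 (fun j => ∑ i' with d i' = d i, α i' * A i' j),
    h2 (fun j => ∑ i' with d i' = d i, α i' * A i' j), ← h]
  ring

end

end DiagonalSystems

namespace DiagonalSystems

noncomputable section

open Filter Topology

variable {J : Type} [Fintype J]

/-- The asymptotic formula for a system of two forms of degree `k` and further forms of
degree `n`. -/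
theorem exists_tendsto_card_zeros {k n s : ℕ} (hkn : n < k) (hn : 2 ≤ n)
    (hs : 4 * k * (k - 1) + 1 ≤ s) (c : Fin 2 → Fin s → ℤ) (b : J → Fin s → ℤ)
    (hA : Recoverable (Sum.elim (fun _ => k) (fun _ => n)) (Sum.elim c b))
    {T T' : Finset ℕ} (hT : T ⊆ Icc 1 k) (hT' : T' ⊆ Icc 1 k) {K : ℕ}
    (hK : 2 * k + Fintype.card J * n = K) (hTK : ∑ j ∈ T, j + ∑ j ∈ T', j = K)
    (hsep : ∀ j j', j ≠ j' → Separates (Sum.elim (fun _ => k) (fun _ => n))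
      (fun i => Sum.elim c b i j) (fun i => Sum.elim c b i j') T T')
    (hreal : ∃ x : Fin s → ℝ, (∀ j, 0 < x j) ∧ (∀ i, ∑ j, (c i j : ℝ) * x j ^ k = 0) ∧
      (∀ i, ∑ j, (b i j : ℝ) * x j ^ n = 0) ∧
      (Matrix.of fun (i : Fin 2 ⊕ J) (j : Fin s) =>
        Sum.elim (fun i₁ : Fin 2 => (k : ℝ) * (c i₁ j : ℝ) * x j ^ (k - 1))
          (fun i₂ : J => (n : ℝ) * (b i₂ j : ℝ) * x j ^ (n - 1)) i).rank =
        Fintype.card (Fin 2 ⊕ J))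
    (hpadic : ∀ (p : ℕ) [Fact p.Prime], ∃ x : Fin s → ℚ_[p],
      (∀ i, ∑ j, (c i j : ℚ_[p]) * x j ^ k = 0) ∧ (∀ i, ∑ j, (b i j : ℚ_[p]) * x j ^ n = 0) ∧
      (Matrix.of fun (i : Fin 2 ⊕ J) (j : Fin s) =>
        Sum.elim (fun i₁ : Fin 2 => (k : ℚ_[p]) * (c i₁ j : ℚ_[p]) * x j ^ (k - 1))
          (fun i₂ : J => (n : ℚ_[p]) * (b i₂ j : ℚ_[p]) * x j ^ (n - 1)) i).rank =
        Fintype.card (Fin 2 ⊕ J)) :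
    ∃ C : ℝ, 0 < C ∧ Tendsto
      (fun P : ℕ => ((Nat.card {x : Fin s → ℕ // (∀ j, 1 ≤ x j ∧ x j ≤ P) ∧
          (∀ i, ∑ j, c i j * (x j : ℤ) ^ k = 0) ∧ (∀ i, ∑ j, b i j * (x j : ℤ) ^ n = 0)}) : ℝ) /
        (P : ℝ) ^ ((s : ℝ) - (K : ℕ))) atTop (𝓝 C) := by
  obtain ⟨d, hd⟩ : ∃ d : Fin 2 ⊕ J → ℕ, d = Sum.elim (fun _ => k) (fun _ => n) := ⟨_, rfl⟩
  have hsum : ∑ i, d i = K := by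
    rw [← hK, hd, Fintype.sum_sum_type]
    simp
  have hzero : ∀ {R : Type} [CommRing R] (x : Fin s → R),
      (∀ i, form d (Sum.elim c b) i x = 0) ↔ (∀ i, ∑ j, (c i j : R) * x j ^ k = 0) ∧
        (∀ i, ∑ j, (b i j : R) * x j ^ n = 0) := fun x => by
    rw [Sum.forall, hd]
    rfl
  have hjac : ∀ {F : Type} [Field F] (x : Fin s → F),
      (Matrix.of fun (i : Fin 2 ⊕ J) (j : Fin s) =>
        Sum.elim (fun i₁ : Fin 2 => (k : F) * (c i₁ j : F) * x j ^ (k - 1))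
          (fun i₂ : J => (n : F) * (b i₂ j : F) * x j ^ (n - 1)) i).rank =
        Fintype.card (Fin 2 ⊕ J) → Nonsingular d (Sum.elim c b) x := fun x h => by
    refine nonsingular_of_rank d (Sum.elim c b) x ?_
    rw [← h]
    congr 2
    funext i j
    rw [hd]
    rcases i with i | i <;> rfl
  obtain ⟨x, hpos, hx, hx', hrank⟩ := hreal
  have hcount : ∀ P : ℕ, Nat.card {x : Fin s → ℕ // (∀ j, 1 ≤ x j ∧ x j ≤ P) ∧
      (∀ i, ∑ j, c i j * (x j : ℤ) ^ k = 0) ∧ (∀ i, ∑ j, b i j * (x j : ℤ) ^ n = 0)} =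
      countZeros d (Sum.elim c b) P := fun P => by
    refine Nat.subtype_card _ fun y => ?_
    rw [mem_filter, Fintype.mem_piFinset]
    refine and_congr (forall_congr' fun j => mem_Icc) ?_
    exact (hzero fun j => (y j : ℤ)).trans (by simp only [Int.cast_id])
  simp only [hcount]
  rw [← hsum]
  subst hd
  refine exists_tendsto_countZeros_div hkn hn hs ?_ hA hT hT' (hTK.trans hsum.symm) hsep hpos
    ((hzero x).2 ⟨hx, hx'⟩) (hjac x hrank) fun p _ => ?_
  · rintro (i | i)
    · exact Or.inl rfl
    · exact Or.inr rfl
  · obtain ⟨y, hy, hy', hyr⟩ := hpadic p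
    exact ⟨y, (hzero y).2 ⟨hy, hy'⟩, hjac y hyr⟩

lemma sum_filter_elim_inl {k n : ℕ} (hkn : n < k) (f : Fin 2 ⊕ J → ℝ) :
    ∑ i' with Sum.elim (fun _ => k) (fun _ => n) i' = k, f i' =
      f (Sum.inl 0) + f (Sum.inl 1) := by
  rw [sum_filter, Fintype.sum_sum_type, Fin.sum_univ_two]
  simp [hkn.ne]

lemma sum_filter_elim_inr {k n : ℕ} (hkn : n < k) (f : Fin 2 ⊕ J → ℝ) :
    ∑ i' with Sum.elim (fun _ => k) (fun _ => n) i' = n, f i' = ∑ i, f (Sum.inr i) := by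
  rw [sum_filter, Fintype.sum_sum_type]
  simp [hkn.ne']

/-- Two linear forms in two variables with nonzero determinant determine the variables. -/
lemma eq_combination_of_minor (c : Fin 2 → ℤ × ℤ) (i : Fin 2) : ∃ a b : ℤ, ∀ x : Fin 2 → ℝ,
    (((c 0).1 * (c 1).2 - (c 0).2 * (c 1).1 : ℤ) : ℝ) * x i =
      a * (x 0 * (c 0).1 + x 1 * (c 1).1) + b * (x 0 * (c 0).2 + x 1 * (c 1).2) := by
  fin_cases i
  · refine ⟨(c 1).2, -(c 1).1, fun x => ?_⟩
    push_cast
    ring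
  · refine ⟨-(c 0).2, (c 0).1, fun x => ?_⟩
    push_cast
    ring

/-- A two by two homogeneous linear system with nonzero determinant has only the trivial
solution. -/
lemma eq_zero_of_minor {a b a' b' u w : ℤ} (h : a * b' - b * a' ≠ 0) (h1 : a * u + b * w = 0)
    (h2 : a' * u + b' * w = 0) : u = 0 ∧ w = 0 := by
  constructor
  · refine (mul_eq_zero.1 ?_).resolve_left h
    linear_combination b' * h1 - b * h2
  · refine (mul_eq_zero.1 ?_).resolve_left h
    linear_combination a * h2 - a' * h1

lemma separates_two_one {k n : ℕ} (hkn : n < k) {a a' : Fin 2 → ℤ} {b b' : ℤ}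
    (h : a 0 * a' 1 - a' 0 * a 1 ≠ 0) (hb : b ≠ 0) :
    Separates (Sum.elim (fun _ : Fin 2 => k) (fun _ : Fin 1 => n))
      (Sum.elim a fun _ => b) (Sum.elim a' fun _ => b') {k, n} {k} := by
  refine ⟨fun w m => if m = k then 0 else -(b' * w n) / b, fun u w huw => ?_⟩
  have hz := eq_zero_of_minor h (huw (Sum.inl 0)) (huw (Sum.inl 1))
  simp only [Sum.elim_inl] at hz
  refine ⟨by simpa using hz.2, fun j hj => ?_⟩
  rw [mem_insert, mem_singleton] at hj
  rcases hj with rfl | rfl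
  · simpa using hz.1
  · refine Eq.trans ?_ (if_neg hkn.ne).symm
    have h3 := huw (Sum.inr 0)
    simp only [Sum.elim_inr] at h3
    exact Int.eq_ediv_of_mul_eq_right hb (by linarith)

lemma separates_two_two {k n : ℕ} {a a' b b' : Fin 2 → ℤ}
    (h : a 0 * a' 1 - a' 0 * a 1 ≠ 0) (hb : b 0 * b' 1 - b' 0 * b 1 ≠ 0) :
    Separates (Sum.elim (fun _ : Fin 2 => k) (fun _ : Fin 2 => n))
      (Sum.elim a b) (Sum.elim a' b') {k, n} {k, n} := by
  refine ⟨fun _ _ => 0, fun u w huw => ?_⟩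
  have hz := eq_zero_of_minor h (huw (Sum.inl 0)) (huw (Sum.inl 1))
  have hz' := eq_zero_of_minor hb (huw (Sum.inr 0)) (huw (Sum.inr 1))
  simp only [Sum.elim_inl, Sum.elim_inr] at hz hz'
  constructor
  · simp [hz.2, hz'.2]
  · simp [hz.1, hz'.1]

lemma recoverable_elim {k n s : ℕ} (hkn : n < k) {c : Fin 2 → Fin s → ℤ} {b : J → Fin s → ℤ}
    {j₁ j₂ : Fin s} (h : c 0 j₁ * c 1 j₂ - c 0 j₂ * c 1 j₁ ≠ 0)
    (hb : ∀ i, ∃ D a a' : ℤ, D ≠ 0 ∧ ∀ x : J → ℝ, D * x i =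
      a * ∑ i', x i' * b i' j₁ + a' * ∑ i', x i' * b i' j₂) :
    Recoverable (Sum.elim (fun _ => k) (fun _ => n)) (Sum.elim c b) := by
  refine recoverable_of_two_columns ?_
  rintro (i | i)
  · obtain ⟨a, a', haa⟩ := eq_combination_of_minor (fun i => (c i j₁, c i j₂)) i
    refine ⟨_, a, a', j₁, j₂, h, fun α => ?_⟩
    have e := fun j => sum_filter_elim_inl hkn fun i' => α i' * (Sum.elim c b i' j : ℝ)
    exact (haa fun i => α (Sum.inl i)).trans
      (congrArg₂ (· + ·) (congrArg _ (e j₁).symm) (congrArg _ (e j₂).symm))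
  · obtain ⟨D, a, a', hD, haa⟩ := hb i
    refine ⟨D, a, a', j₁, j₂, hD, fun α => ?_⟩
    have e := fun j => sum_filter_elim_inr hkn fun i' => α i' * (Sum.elim c b i' j : ℝ)
    exact (haa fun i => α (Sum.inr i)).trans
      (congrArg₂ (· + ·) (congrArg _ (e j₁).symm) (congrArg _ (e j₂).symm))

end

end DiagonalSystems

/-- Corollary 1.3 of Brandes–Parsell, the bounds
`G̃*(k,k,n) ≤ 4k(k-1)+1` and `G̃*(k,k,n,n) ≤ 4k(k-1)+1`: for `k > n ≥ 2` and
`s ≥ 4k(k-1)+1`, both for systems of two degree-`k` forms and one degree-`n` form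
(case (i)) and for systems of two degree-`k` forms and two degree-`n` forms
(case (ii)), highly non-singular systems with non-singular positive real
solutions and non-singular `p`-adic solutions satisfy `N(P) = (C+o(1))P^{s-K}`. -/
theorem statement3 (k n s : ℕ) (hkn : n < k) (hn : 2 ≤ n)
    (hs : 4 * k * (k - 1) + 1 ≤ s) :
    -- case (i): two degree-k equations and one degree-n equation, K = 2k + n
    ((∀ (c : Fin 2 → Fin s → ℤ) (b : Fin s → ℤ),
      (∀ i j, c i j ≠ 0) → (∀ j, b j ≠ 0) →
      (∀ j₁ j₂ : Fin s, j₁ ≠ j₂ → c 0 j₁ * c 1 j₂ - c 0 j₂ * c 1 j₁ ≠ 0) →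
      (∃ x : Fin s → ℝ, (∀ j, 0 < x j) ∧
        (∀ i : Fin 2, ∑ j, (c i j : ℝ) * x j ^ k = 0) ∧ (∑ j, (b j : ℝ) * x j ^ n = 0) ∧
        (Matrix.of fun (i : Fin 2 ⊕ Fin 1) (j : Fin s) =>
          Sum.elim (fun i₁ : Fin 2 => (k : ℝ) * (c i₁ j : ℝ) * x j ^ (k - 1))
            (fun _ : Fin 1 => (n : ℝ) * (b j : ℝ) * x j ^ (n - 1)) i).rank = 3) →
      (∀ (p : ℕ) [Fact p.Prime], ∃ x : Fin s → ℚ_[p],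
        (∀ i : Fin 2, ∑ j, (c i j : ℚ_[p]) * x j ^ k = 0) ∧
        (∑ j, (b j : ℚ_[p]) * x j ^ n = 0) ∧
        (Matrix.of fun (i : Fin 2 ⊕ Fin 1) (j : Fin s) =>
          Sum.elim (fun i₁ : Fin 2 => (k : ℚ_[p]) * (c i₁ j : ℚ_[p]) * x j ^ (k - 1))
            (fun _ : Fin 1 => (n : ℚ_[p]) * (b j : ℚ_[p]) * x j ^ (n - 1)) i).rank = 3) →
      ∃ C : ℝ, 0 < C ∧ Filter.Tendsto
        (fun P : ℕ => ((Nat.card {x : Fin s → ℕ // (∀ j, 1 ≤ x j ∧ x j ≤ P) ∧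
            (∀ i : Fin 2, ∑ j, c i j * (x j : ℤ) ^ k = 0) ∧
            (∑ j, b j * (x j : ℤ) ^ n = 0)}) : ℝ) /
          (P : ℝ) ^ ((s : ℝ) - (2 * k + n : ℕ)))
        Filter.atTop (nhds C)))
    ∧
    -- case (ii): two degree-k equations and two degree-n equations, K = 2k + 2n
    (∀ (c : Fin 2 → Fin s → ℤ) (b : Fin 2 → Fin s → ℤ),
      (∀ i j, c i j ≠ 0) → (∀ i j, b i j ≠ 0) →
      (∀ j₁ j₂ : Fin s, j₁ ≠ j₂ → c 0 j₁ * c 1 j₂ - c 0 j₂ * c 1 j₁ ≠ 0) →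
      (∀ j₁ j₂ : Fin s, j₁ ≠ j₂ → b 0 j₁ * b 1 j₂ - b 0 j₂ * b 1 j₁ ≠ 0) →
      (∃ x : Fin s → ℝ, (∀ j, 0 < x j) ∧
        (∀ i : Fin 2, ∑ j, (c i j : ℝ) * x j ^ k = 0) ∧
        (∀ i : Fin 2, ∑ j, (b i j : ℝ) * x j ^ n = 0) ∧
        (Matrix.of fun (i : Fin 2 ⊕ Fin 2) (j : Fin s) =>
          Sum.elim (fun i₁ : Fin 2 => (k : ℝ) * (c i₁ j : ℝ) * x j ^ (k - 1))
            (fun i₂ : Fin 2 => (n : ℝ) * (b i₂ j : ℝ) * x j ^ (n - 1)) i).rank = 4) →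
      (∀ (p : ℕ) [Fact p.Prime], ∃ x : Fin s → ℚ_[p],
        (∀ i : Fin 2, ∑ j, (c i j : ℚ_[p]) * x j ^ k = 0) ∧
        (∀ i : Fin 2, ∑ j, (b i j : ℚ_[p]) * x j ^ n = 0) ∧
        (Matrix.of fun (i : Fin 2 ⊕ Fin 2) (j : Fin s) =>
          Sum.elim (fun i₁ : Fin 2 => (k : ℚ_[p]) * (c i₁ j : ℚ_[p]) * x j ^ (k - 1))
            (fun i₂ : Fin 2 => (n : ℚ_[p]) * (b i₂ j : ℚ_[p]) * x j ^ (n - 1)) i).rank = 4) →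
      ∃ C : ℝ, 0 < C ∧ Filter.Tendsto
        (fun P : ℕ => ((Nat.card {x : Fin s → ℕ // (∀ j, 1 ≤ x j ∧ x j ≤ P) ∧
            (∀ i : Fin 2, ∑ j, c i j * (x j : ℤ) ^ k = 0) ∧
            (∀ i : Fin 2, ∑ j, b i j * (x j : ℤ) ^ n = 0)}) : ℝ) /
          (P : ℝ) ^ ((s : ℝ) - (2 * k + 2 * n : ℕ)))
        Filter.atTop (nhds C)) := by
  have hs2 : 1 < s := by
    have : 1 ≤ k * (k - 1) := Nat.mul_pos (by omega) (by omega)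
    rw [mul_assoc] at hs
    omega
  have hj : (⟨0, by omega⟩ : Fin s) ≠ ⟨1, hs2⟩ := by simp
  have hT : ({k, n} : Finset ℕ) ⊆ Icc 1 k := by
    intro j hj
    rw [mem_insert, mem_singleton] at hj
    rw [mem_Icc]
    omega
  have hT' : ({k} : Finset ℕ) ⊆ Icc 1 k := (singleton_subset_iff.2 (mem_insert_self _ _)).trans hT
  have hsumT : ∑ j ∈ ({k, n} : Finset ℕ), j = k + n := sum_pair hkn.ne'
  refine ⟨fun c b _ hb hminor hreal hpadic => ?_, fun c b _ _ hminor hminor' hreal hpadic => ?_⟩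
  · have key := DiagonalSystems.exists_tendsto_card_zeros hkn hn hs c (fun _ : Fin 1 => b)
      (DiagonalSystems.recoverable_elim hkn (hminor _ _ hj) fun i =>
        ⟨b ⟨0, by omega⟩, 1, 0, hb _, fun x => by
          rw [Subsingleton.elim i 0]
          simp [mul_comm]⟩) hT hT' (K := 2 * k + n) (by simp)
      (by rw [hsumT, sum_singleton]; omega)
      (fun j j' hjj => ?_) ?_ ?_
    · simpa only [forall_const] using key
    · have := DiagonalSystems.separates_two_one hkn (a := fun i => c i j) (a' := fun i => c i j')
        (b := b j) (b' := b j') (hminor j j' hjj) (hb j)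
      convert this using 1 <;> (funext i; rcases i with i | i <;> rfl)
    · obtain ⟨x, h0, h1, h2, h3⟩ := hreal
      exact ⟨x, h0, h1, fun _ => h2, h3.trans (by simp)⟩
    · intro p _
      obtain ⟨x, h1, h2, h3⟩ := hpadic p
      exact ⟨x, h1, fun _ => h2, h3.trans (by simp)⟩
  · refine DiagonalSystems.exists_tendsto_card_zeros hkn hn hs c b
      (DiagonalSystems.recoverable_elim hkn (hminor _ _ hj) fun i => ?_) hT hT
      (K := 2 * k + 2 * n) (by simp) (by rw [hsumT]; omega) (fun j j' hjj => ?_) ?_ ?_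
    · obtain ⟨a, a', haa⟩ := DiagonalSystems.eq_combination_of_minor
        (fun i => (b i ⟨0, by omega⟩, b i ⟨1, hs2⟩)) i
      refine ⟨_, a, a', hminor' _ _ hj, fun x => ?_⟩
      rw [Fin.sum_univ_two, Fin.sum_univ_two]
      exact haa x
    · have := DiagonalSystems.separates_two_two (k := k) (n := n) (a := fun i => c i j)
        (a' := fun i => c i j') (b := fun i => b i j) (b' := fun i => b i j') (hminor j j' hjj)
        (hminor' j j' hjj)
      convert this using 1 <;> (funext i; rcases i with i | i <;> rfl)
    · obtain ⟨x, h0, h1, h2, h3⟩ := hreal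
      exact ⟨x, h0, h1, h2, h3.trans (by simp)⟩
    · intro p _
      obtain ⟨x, h1, h2, h3⟩ := hpadic p
      exact ⟨x, h1, h2, h3.trans (by simp)⟩
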